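/- Short-time existence and uniqueness for fully nonlinear parabolic systems in parabolic Hölder spaces on the torus (Theorem 1.2 for M = 𝕋^n with the trivial bundle): Let T > 0, R₀ > 0, and let u₀ ∈ C^{r+α}(ℝ^n,ℝ^l) be ℤ^n-periodic. Let B = { (x,t,z) ∈ ℝ^n × [0,T] × ℝ^N : |z − j_r u₀(x)| ≤ R₀ } and let F : B → ℝ^l be twice continuously differentiable with F(x+k,t,z) = F(x,t,z) for all k ∈ ℤ^n. Assume the equation ∂u/∂t = F(x,t,j_r u(x,t)) is strongly parabolic at u₀ with some constant λ > 0. Then there exists δ ∈ (0,T] such that there is one and only one function u ∈ C^{r+α,1+α/r}(ℝ^n×[0,δ],ℝ^l), ℤ^n-periodic in x and with (x,t,j_r u(x,t)) ∈ B for all (x,t), satisfying ∂u/∂t = F(x,t,j_r u(x,t)) on ℝ^n×[0,δ] and u(·,0) = u₀. -/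

import Mathlib

open scoped BigOperators
noncomputable section

/-- Euclidean space `ℝ^n`. -/
abbrev Vec (n : ℕ) := EuclideanSpace ℝ (Fin n)

/-- Iterated spatial partial derivative (within `D`) in the directions `I = (i_1, …, i_k)`. -/
def pderivW {n l : ℕ} (D : Set (Vec n)) (k : ℕ) (I : Fin k → Fin n)
    (w : Vec n → Vec l) : Vec n → Vec l :=
  fun x => iteratedFDerivWithin ℝ k w D x (fun j => EuclideanSpace.single (I j) 1)

/-- Spatial partial derivative `∂_I u(⋅,t)` of a space-time function (within `D`). -/
def spDerivW {n l : ℕ} (D : Set (Vec n)) (k : ℕ) (I : Fin k → Fin n)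
    (u : Vec n → ℝ → Vec l) : Vec n → ℝ → Vec l :=
  fun x t => pderivW D k I (fun y => u y t) x

/-- Time derivative `∂_t u` within the time interval `J`. -/
def tDerivW {n l : ℕ} (J : Set ℝ) (u : Vec n → ℝ → Vec l) : Vec n → ℝ → Vec l :=
  fun x t => derivWithin (fun s => u x s) J t

/-- Supremum norm `|w|_{0;Q}`. -/
def supQ {n l : ℕ} (Q : Set (Vec n × ℝ)) (w : Vec n → ℝ → Vec l) : ℝ :=
  sSup {c | ∃ p ∈ Q, c = ‖w p.1 p.2‖}

/-- The set of parabolic Hölder difference quotients of exponent `α` (parabolic order `r`). -/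
def holQuot {n l : ℕ} (r : ℕ) (α : ℝ) (Q : Set (Vec n × ℝ))
    (w : Vec n → ℝ → Vec l) : Set ℝ :=
  {c | ∃ p ∈ Q, ∃ q ∈ Q, p ≠ q ∧
    c = ‖w p.1 p.2 - w q.1 q.2‖ / (‖p.1 - q.1‖ ^ α + |p.2 - q.2| ^ (α / r))}

/-- Parabolic Hölder seminorm `[w]_{α;Q}`. -/
def parSemi {n l : ℕ} (r : ℕ) (α : ℝ) (Q : Set (Vec n × ℝ))
    (w : Vec n → ℝ → Vec l) : ℝ :=
  sSup (holQuot r α Q w)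

/-- Parabolic Hölder norm `‖u‖_{C^{r+α,1+α/r}(D × J)}`. -/
def parNorm {n l : ℕ} (r : ℕ) (α : ℝ) (D : Set (Vec n)) (J : Set ℝ)
    (u : Vec n → ℝ → Vec l) : ℝ :=
  (∑ k ∈ Finset.range (r + 1), ∑ I : Fin k → Fin n, supQ (D ×ˢ J) (spDerivW D k I u))
    + supQ (D ×ˢ J) (tDerivW J u)
    + (∑ I : Fin r → Fin n, parSemi r α (D ×ˢ J) (spDerivW D r I u))
    + parSemi r α (D ×ˢ J) (tDerivW J u)

/-- Membership in the parabolic Hölder space `C^{r+α,1+α/r}(D × J, ℝ^l)`. -/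
def MemPar {n l : ℕ} (r : ℕ) (α : ℝ) (D : Set (Vec n)) (J : Set ℝ)
    (u : Vec n → ℝ → Vec l) : Prop :=
  ContinuousOn (fun p : Vec n × ℝ => u p.1 p.2) (D ×ˢ J) ∧
  (∀ t ∈ J, ContDiffOn ℝ r (fun x => u x t) D) ∧
  (∀ x ∈ D, DifferentiableOn ℝ (fun s => u x s) J) ∧
  (∀ k, k ≤ r → ∀ I : Fin k → Fin n,
    ContinuousOn (fun p : Vec n × ℝ => spDerivW D k I u p.1 p.2) (D ×ˢ J)) ∧
  ContinuousOn (fun p : Vec n × ℝ => tDerivW J u p.1 p.2) (D ×ˢ J) ∧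
  (∀ I : Fin r → Fin n, BddAbove (holQuot r α (D ×ˢ J) (spDerivW D r I u))) ∧
  BddAbove (holQuot r α (D ×ˢ J) (tDerivW J u))

/-- The norm of `C^{α,α/r}(Q)`. -/
def lowNorm {n l : ℕ} (r : ℕ) (α : ℝ) (Q : Set (Vec n × ℝ))
    (f : Vec n → ℝ → Vec l) : ℝ :=
  supQ Q f + parSemi r α Q f

/-- Membership in `C^{α,α/r}(Q, ℝ^l)`. -/
def MemLow {n l : ℕ} (r : ℕ) (α : ℝ) (Q : Set (Vec n × ℝ))
    (f : Vec n → ℝ → Vec l) : Prop :=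
  ContinuousOn (fun p : Vec n × ℝ => f p.1 p.2) Q ∧ BddAbove (holQuot r α Q f)

/-- Spatial Hölder quotient set. -/
def spHolQuot {n l : ℕ} (D : Set (Vec n)) (α : ℝ) (w : Vec n → Vec l) : Set ℝ :=
  {c | ∃ x ∈ D, ∃ y ∈ D, x ≠ y ∧ c = ‖w x - w y‖ / ‖x - y‖ ^ α}

/-- The elliptic Hölder norm `‖u₀‖_{C^{r+α}(D)}`. -/
def spNorm {n l : ℕ} (r : ℕ) (α : ℝ) (D : Set (Vec n)) (u₀ : Vec n → Vec l) : ℝ :=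
  (∑ k ∈ Finset.range (r + 1), ∑ I : Fin k → Fin n,
    sSup {c | ∃ x ∈ D, c = ‖pderivW D k I u₀ x‖})
    + ∑ I : Fin r → Fin n, sSup (spHolQuot D α (pderivW D r I u₀))

/-- Membership in `C^{r+α}(D, ℝ^l)`. -/
def MemSp {n l : ℕ} (r : ℕ) (α : ℝ) (D : Set (Vec n)) (u₀ : Vec n → Vec l) : Prop :=
  ContDiffOn ℝ r u₀ D ∧ ∀ I : Fin r → Fin n, BddAbove (spHolQuot D α (pderivW D r I u₀))

/-- Action `(L_t u)(x)` of the time-dependent linear differential operator of order `r` with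
coefficients `A k I a b` (`k = |I| ≤ r`). -/
def applyL {n l : ℕ} (r : ℕ) (D : Set (Vec n))
    (A : (k : ℕ) → (Fin k → Fin n) → Fin l → Fin l → Vec n → ℝ → ℝ)
    (u : Vec n → ℝ → Vec l) : Vec n → ℝ → Vec l :=
  fun x t => (EuclideanSpace.equiv (Fin l) ℝ).symm fun a =>
    ∑ k ∈ Finset.range (r + 1), ∑ I : Fin k → Fin n, ∑ b : Fin l,
      A k I a b x t * spDerivW D k I u x t b

/-- Legendre–Hadamard strong ellipticity with constant `lam` on `Q`. -/
def StrongEllip {n l : ℕ} (r : ℕ)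
    (A : (k : ℕ) → (Fin k → Fin n) → Fin l → Fin l → Vec n → ℝ → ℝ)
    (Q : Set (Vec n × ℝ)) (lam : ℝ) : Prop :=
  ∀ p ∈ Q, ∀ ξ : Vec n, ∀ v : Vec l,
    lam * ‖ξ‖ ^ r * ‖v‖ ^ 2 ≤
      (-1 : ℝ) ^ (r / 2 - 1) *
        ∑ I : Fin r → Fin n, ∑ a : Fin l, ∑ b : Fin l,
          A r I a b p.1 p.2 * (∏ j, ξ (I j)) * v a * v b

/-- `ℤ^n`-periodicity. -/
def PerZ {n : ℕ} {β : Type*} (g : Vec n → β) : Prop :=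
  ∀ x : Vec n, ∀ m : Fin n → ℤ,
    g (x + (EuclideanSpace.equiv (Fin n) ℝ).symm fun i => (m i : ℝ)) = g x

/-- Real-valued functions viewed as `ℝ^1`-valued. -/
def toV1 {n : ℕ} (g : Vec n → ℝ → ℝ) : Vec n → ℝ → Vec 1 :=
  fun x t => (EuclideanSpace.equiv (Fin 1) ℝ).symm fun _ => g x t

/-- The `r`-jet space: components indexed by the derivative order `k ≤ r`,
a tuple of `k` spatial directions, and the component index `b`. -/
abbrev Jet (n l r : ℕ) := (k : Fin (r + 1)) → ((Fin (k : ℕ) → Fin n) → Fin l → ℝ)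

/-- The `r`-jet `j_r w(x) = (w(x), Dw(x), …, D^r w(x))` (derivatives within `D`). -/
def jetOf {n l : ℕ} (D : Set (Vec n)) (r : ℕ) (w : Vec n → Vec l) (x : Vec n) :
    Jet n l r :=
  fun k I b => pderivW D (k : ℕ) I w x b

/-- The basis jet vector corresponding to the jet component `(k, I, b)`;
differentiating in this direction gives `∂F/∂z^b_I`. -/
def jetBasisG {n l : ℕ} (r k : ℕ) (I : Fin k → Fin n) (b : Fin l) : Jet n l r :=
  fun k' I' b' => if h : (k' : ℕ) = k then
    (if (I' ∘ Fin.cast h.symm) = I ∧ b' = b then (1 : ℝ) else 0) else 0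

section ParabolicSystems

set_option linter.unusedSectionVars false
open Filter Topology MeasureTheory Set

section Kernel

variable {n r : ℕ} {H : Type*} [NormedAddCommGroup H] [InnerProductSpace ℂ H] [CompleteSpace H]

/-- Symbol of the differential operator `∂_I`. -/
def monoSym (I : List (Fin n)) (ζ : Fin n → ℂ) : ℂ :=
  (I.map fun i => 2 * (Real.pi : ℂ) * Complex.I * ζ i).prod

/-- Symbol of the homogeneous operator `∑_J a_J ∂_J`. -/
def opSym (a : (Fin r → Fin n) → (H →L[ℂ] H)) (ζ : Fin n → ℂ) : H →L[ℂ] H :=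
  ∑ J, monoSym (List.ofFn J) ζ • a J

/-- A real covector as a complex one. -/
def toC (ξ : Vec n) : Fin n → ℂ := fun i => (ξ i : ℂ)

/-- Uniformly strongly elliptic coefficient families. -/
structure EllCls (lam Lam : ℝ) (a : (Fin r → Fin n) → (H →L[ℂ] H)) : Prop where
  ell : ∀ (ξ : Vec n) (v : H),
    (inner ℂ v (opSym a (toC ξ) v)).re ≤ -lam * ‖ξ‖ ^ r * ‖v‖ ^ 2
  bd : ∀ J, ‖a J‖ ≤ Lam

lemma norm_exp_le_of_re_inner_le (Q : H →L[ℂ] H) (μ : ℝ)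
    (hQ : ∀ v, (inner ℂ v (Q v)).re ≤ μ * ‖v‖ ^ 2) :
    ‖NormedSpace.exp Q‖ ≤ Real.exp μ := by
  refine ContinuousLinearMap.opNorm_le_bound _ (Real.exp_pos _).le fun v => ?_
  let y : ℝ → H := fun t => NormedSpace.exp (t • Q) v
  have hy : ∀ t, HasDerivAt y (Q (y t)) t := by
    intro t
    have h1 : HasDerivAt (fun u : ℝ => NormedSpace.exp (u • Q)) (Q * NormedSpace.exp (t • Q)) t :=
      hasDerivAt_exp_smul_const' Q t
    have h2 := ((ContinuousLinearMap.apply ℝ H v).restrictScalars ℝ).hasFDerivAt.comp_hasDerivAt t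
      (f := fun u : ℝ => (ContinuousLinearMap.restrictScalarsL ℂ H H ℝ ℝ)
        (NormedSpace.exp (u • Q)))
      ((ContinuousLinearMap.restrictScalarsL ℂ H H ℝ ℝ).hasFDerivAt.comp_hasDerivAt t h1)
    exact h2
  let φ : ℝ → ℝ := fun t => ‖y t‖ ^ 2 * Real.exp (-(2 * μ) * t)
  have hφ : ∀ t, HasDerivAt φ ((2 * (inner ℂ (y t) (Q (y t))).re) * Real.exp (-(2 * μ) * t)
      + ‖y t‖ ^ 2 * (Real.exp (-(2 * μ) * t) * (-(2 * μ)))) t := by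
    intro t
    have h1 : HasDerivAt (fun t => ‖y t‖ ^ 2) (2 * (inner ℂ (y t) (Q (y t))).re) t := by
      let _ : InnerProductSpace ℝ H := InnerProductSpace.rclikeToReal ℂ H
      have := (hy t).norm_sq
      exact this
    have h2 : HasDerivAt (fun t => Real.exp (-(2 * μ) * t))
        (Real.exp (-(2 * μ) * t) * (-(2 * μ))) t := by
      have := ((hasDerivAt_id t).const_mul (-(2 * μ))).exp
      simpa using this
    exact h1.mul h2
  have hanti : Antitone φ := by
    refine antitone_of_deriv_nonpos (fun t => (hφ t).differentiableAt) fun t => ?_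
    rw [(hφ t).deriv]
    have := hQ (y t)
    have he := Real.exp_pos (-(2 * μ) * t)
    nlinarith
  have h01 := hanti (zero_le_one (α := ℝ))
  simp only [φ, y, zero_smul, one_smul, NormedSpace.exp_zero, one_apply_eq_self,
    mul_zero, Real.exp_zero, mul_one] at h01
  have h3 : ‖(NormedSpace.exp Q) v‖ ^ 2 ≤ (Real.exp μ * ‖v‖) ^ 2 := by
    have h4 : Real.exp (-(2 * μ)) * Real.exp μ ^ 2 = 1 := by
      rw [pow_two, ← Real.exp_add, ← Real.exp_add]; simp; ring
    have h5 : 0 < Real.exp μ ^ 2 := by positivity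
    rw [mul_pow]
    calc ‖(NormedSpace.exp Q) v‖ ^ 2 = ‖(NormedSpace.exp Q) v‖ ^ 2 * (Real.exp (-(2 * μ)) * Real.exp μ ^ 2) := by
          rw [h4, mul_one]
      _ ≤ _ := by nlinarith
  exact (sq_le_sq₀ (norm_nonneg _) (by positivity)).1 h3

end Kernel

section KernelBound

variable {n r : ℕ} {H : Type*} [NormedAddCommGroup H] [InnerProductSpace ℂ H] [CompleteSpace H]

/-- Complex shift of a real covector in direction `e_i`. -/
def shiftC (i : Fin n) (s : ℂ) (ξ : Vec n) : Fin n → ℂ := toC ξ + s • Pi.single i 1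

lemma monoSym_nil (ζ : Fin n → ℂ) : monoSym [] ζ = 1 := by simp [monoSym]

lemma monoSym_cons (i : Fin n) (I : List (Fin n)) (ζ : Fin n → ℂ) :
    monoSym (i :: I) ζ = 2 * (Real.pi : ℂ) * Complex.I * ζ i * monoSym I ζ := by simp [monoSym]

lemma monoSym_append (I I' : List (Fin n)) (ζ : Fin n → ℂ) :
    monoSym (I ++ I') ζ = monoSym I ζ * monoSym I' ζ := by simp [monoSym]

lemma norm_shiftC_apply_le (i j : Fin n) (s : ℂ) (hs : ‖s‖ ≤ 3) (ξ : Vec n) :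
    ‖shiftC i s ξ j‖ ≤ 3 * (1 + ‖ξ‖) := by
  have h1 : ‖(ξ j : ℂ)‖ ≤ ‖ξ‖ := by
    rw [Complex.norm_real]; exact PiLp.norm_apply_le ξ j
  have h2 : ‖(s • Pi.single i (1 : ℂ) : Fin n → ℂ) j‖ ≤ 3 := by
    rcases eq_or_ne j i with rfl | h
    · simpa using hs
    · simp [Pi.single_eq_of_ne h]
  calc ‖shiftC i s ξ j‖ ≤ ‖(ξ j : ℂ)‖ + ‖(s • Pi.single i (1 : ℂ) : Fin n → ℂ) j‖ := norm_add_le _ _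
    _ ≤ _ := by have := norm_nonneg ξ; linarith

lemma norm_shiftC_sub_le (i j : Fin n) (s : ℂ) (hs : ‖s‖ ≤ 3) (ξ : Vec n) :
    ‖shiftC i s ξ j - toC ξ j‖ ≤ 3 := by
  have h2 : ‖(s • Pi.single i (1 : ℂ) : Fin n → ℂ) j‖ ≤ 3 := by
    rcases eq_or_ne j i with rfl | h
    · simpa using hs
    · simp [Pi.single_eq_of_ne h]
  simpa [shiftC] using h2

lemma norm_monoSym_shiftC_le (I : List (Fin n)) (i : Fin n) (s : ℂ) (hs : ‖s‖ ≤ 3) (ξ : Vec n) :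
    ‖monoSym I (shiftC i s ξ)‖ ≤ (2 * Real.pi * 3 * (1 + ‖ξ‖)) ^ I.length := by
  induction I with
  | nil => simp [monoSym_nil]
  | cons j I ih =>
    rw [monoSym_cons, norm_mul, List.length_cons, pow_succ']
    have := norm_shiftC_apply_le i j s hs ξ
    have hp := Real.pi_pos
    gcongr
    simp only [norm_mul, Complex.norm_I, Complex.norm_real, Complex.norm_ofNat, mul_one,
      Real.norm_eq_abs, abs_of_pos hp]
    nlinarith

lemma shiftC_zero (i : Fin n) (ξ : Vec n) : shiftC i 0 ξ = toC ξ := by simp [shiftC]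

lemma norm_monoSym_sub_le (I : List (Fin n)) (i : Fin n) (s : ℂ) (hs : ‖s‖ ≤ 3) (ξ : Vec n) :
    ‖monoSym I (shiftC i s ξ) - monoSym I (toC ξ)‖
      ≤ I.length * (2 * Real.pi * 3 * (1 + ‖ξ‖)) ^ (I.length - 1) * (2 * Real.pi * 3) := by
  induction I with
  | nil => simp [monoSym_nil]
  | cons j I ih =>
    rw [monoSym_cons, monoSym_cons]
    have hp := Real.pi_pos
    set c : ℂ := 2 * (Real.pi : ℂ) * Complex.I
    have hc : ‖c‖ = 2 * Real.pi := by
      simp only [c, norm_mul, Complex.norm_I, Complex.norm_real, Complex.norm_ofNat, mul_one,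
        Real.norm_eq_abs, abs_of_pos hp]
    have e : c * shiftC i s ξ j * monoSym I (shiftC i s ξ) - c * toC ξ j * monoSym I (toC ξ)
      = c * (shiftC i s ξ j - toC ξ j) * monoSym I (shiftC i s ξ)
        + c * toC ξ j * (monoSym I (shiftC i s ξ) - monoSym I (toC ξ)) := by ring
    rw [e]
    refine (norm_add_le _ _).trans ?_
    simp only [norm_mul, hc, List.length_cons, Nat.add_sub_cancel]
    set M := 2 * Real.pi * 3 * (1 + ‖ξ‖) with hM
    have h1 := norm_shiftC_sub_le i j s hs ξ
    have h2 := norm_monoSym_shiftC_le I i s hs ξ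
    have h3 := norm_shiftC_apply_le i j 0 (by simp) ξ
    rw [shiftC_zero] at h3
    have hM0 : 0 ≤ M := by positivity
    have t1 : 2 * Real.pi * ‖shiftC i s ξ j - toC ξ j‖ * ‖monoSym I (shiftC i s ξ)‖
        ≤ 2 * Real.pi * 3 * M ^ I.length := by gcongr
    have t2 : 2 * Real.pi * ‖toC ξ j‖ * ‖monoSym I (shiftC i s ξ) - monoSym I (toC ξ)‖
        ≤ M * (I.length * M ^ (I.length - 1) * (2 * Real.pi * 3)) := by
      gcongr
      rw [hM]; nlinarith
    have t3 : M * (I.length * M ^ (I.length - 1) * (2 * Real.pi * 3))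
        = I.length * M ^ I.length * (2 * Real.pi * 3) := by
      rcases Nat.eq_zero_or_pos I.length with h | h
      · simp [h]
      · conv_rhs => rw [← Nat.succ_pred_eq_of_pos h, pow_succ]
        simp only [Nat.pred_eq_sub_one, Nat.succ_eq_add_one]
        rw [Nat.sub_add_cancel h]; ring
    push_cast
    nlinarith

lemma norm_opSym_sub_le {a : (Fin r → Fin n) → (H →L[ℂ] H)} {Lam : ℝ} (ha : ∀ J, ‖a J‖ ≤ Lam)
    (i : Fin n) (s : ℂ) (hs : ‖s‖ ≤ 3) (ξ : Vec n) :
    ‖opSym a (shiftC i s ξ) - opSym a (toC ξ)‖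
      ≤ ((n : ℝ) ^ r * (r * (2 * Real.pi * 3) ^ (r - 1) * (2 * Real.pi * 3)) * Lam)
        * (1 + ‖ξ‖) ^ (r - 1) := by
  unfold opSym
  rw [← Finset.sum_sub_distrib]
  refine (norm_sum_le _ _).trans ?_
  have : ∀ J ∈ (Finset.univ : Finset (Fin r → Fin n)),
      ‖monoSym (List.ofFn J) (shiftC i s ξ) • a J - monoSym (List.ofFn J) (toC ξ) • a J‖
      ≤ (r * (2 * Real.pi * 3) ^ (r - 1) * (2 * Real.pi * 3)) * (1 + ‖ξ‖) ^ (r - 1) * Lam := by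
    intro J _
    rw [← sub_smul, norm_smul]
    have h := norm_monoSym_sub_le (List.ofFn J) i s hs ξ
    rw [List.length_ofFn, mul_pow] at h
    have hp := Real.pi_pos
    gcongr
    · linarith
    · exact ha J
  refine (Finset.sum_le_sum this).trans (le_of_eq ?_)
  simp only [Finset.sum_const, Finset.card_univ, Fintype.card_fun, Fintype.card_fin,
    nsmul_eq_mul, Nat.cast_pow]
  ring

/-- Boundedness of polynomial times Gaussian-type weights. -/
lemma exists_exp_poly_bound (hr : 2 ≤ r) (lam C : ℝ) (hlam : 0 < lam) (hC : 0 ≤ C) (m : ℕ) :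
    ∃ B : ℝ, 0 ≤ B ∧ ∀ ρ : ℝ, 0 ≤ ρ →
      (1 + ρ) ^ m * Real.exp (-lam * ρ ^ r + C * (1 + ρ) ^ (r - 1)) ≤ B := by
  obtain ⟨k, rfl⟩ : ∃ k, r = k + 1 := ⟨r - 1, by omega⟩
  have hk : 1 ≤ k := by omega
  set D := (C + 1) * 2 ^ k
  have hD : 0 ≤ D := by positivity
  set E : ℝ := D + D * (D / lam) ^ k
  refine ⟨m.factorial * Real.exp E, by positivity, fun ρ hρ => ?_⟩
  have h1 : (1 + ρ) ^ m ≤ m.factorial * Real.exp (1 + ρ) := by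
    have := Real.pow_div_factorial_le_exp (1 + ρ) (by linarith) m
    rwa [div_le_iff₀' (by positivity)] at this
  have h2 : (1 + ρ) ≤ (1 + ρ) ^ k := le_self_pow₀ (by linarith) (by omega)
  have h3 : -lam * ρ ^ (k + 1) + (C + 1) * (1 + ρ) ^ k ≤ E := by
    rcases le_total ρ 1 with h | h
    · have : (1 + ρ) ^ k ≤ 2 ^ k := by gcongr; linarith
      have h5 : 0 ≤ lam * ρ ^ (k + 1) := by positivity
      have h6 : (C + 1) * (1 + ρ) ^ k ≤ D := by simp only [D]; gcongr
      have h7 : 0 ≤ D * (D / lam) ^ k := by positivity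
      simp only [E]; linarith
    · have : (1 + ρ) ^ k ≤ 2 ^ k * ρ ^ k := by rw [← mul_pow]; gcongr; linarith
      have h6 : (C + 1) * (1 + ρ) ^ k ≤ D * ρ ^ k := by
        simp only [D]; rw [mul_assoc]; gcongr
      rcases le_total ρ (D / lam) with h' | h'
      · have : ρ ^ k ≤ (D / lam) ^ k := by gcongr
        have h7 : D * ρ ^ k ≤ D * (D / lam) ^ k := by gcongr
        have h5 : 0 ≤ lam * ρ ^ (k + 1) := by positivity
        simp only [E]; linarith
      · rw [div_le_iff₀ hlam] at h'
        have : D * ρ ^ k ≤ lam * ρ ^ (k + 1) := by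
          rw [pow_succ]
          have : 0 ≤ ρ ^ k := by positivity
          nlinarith
        have : 0 ≤ E := by positivity
        linarith
  simp only [Nat.add_sub_cancel]
  calc _ ≤ m.factorial * Real.exp (1 + ρ) * Real.exp (-lam * ρ ^ (k + 1) + C * (1 + ρ) ^ k) := by
        gcongr
    _ = m.factorial * Real.exp (1 + ρ + (-lam * ρ ^ (k + 1) + C * (1 + ρ) ^ k)) := by
        rw [mul_assoc, ← Real.exp_add]
    _ ≤ _ := by gcongr; linarith

lemma one_add_rpow_neg_natCast {x : ℝ} (hx : 0 ≤ x) (m : ℕ) :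
    (1 + x) ^ (-(m : ℝ)) = ((1 + x) ^ m)⁻¹ := by
  rw [Real.rpow_neg (by linarith), Real.rpow_natCast]

lemma exists_norm_symbol_bound (H : Type*) [NormedAddCommGroup H] [InnerProductSpace ℂ H]
    [CompleteSpace H] (hr : 2 ≤ r) (lam Lam : ℝ) (hlam : 0 < lam) (hLam : 0 ≤ Lam)
    (I : List (Fin n)) (m : ℕ) :
    ∃ B : ℝ, 0 ≤ B ∧ ∀ a : (Fin r → Fin n) → (H →L[ℂ] H), EllCls lam Lam a →
      ∀ (ξ : Vec n) (i : Fin n) (s : ℂ), ‖s‖ ≤ 3 →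
      ‖monoSym I (shiftC i s ξ) • NormedSpace.exp (opSym a (shiftC i s ξ))‖
        ≤ B * (1 + ‖ξ‖) ^ (-(m : ℝ)) := by
  have hp := Real.pi_pos
  set C := ((n : ℝ) ^ r * (r * (2 * Real.pi * 3) ^ (r - 1) * (2 * Real.pi * 3)) * Lam)
  obtain ⟨B, hB, hB'⟩ := exists_exp_poly_bound hr lam C hlam (by positivity) (I.length + m)
  refine ⟨(2 * Real.pi * 3) ^ I.length * B, by positivity, fun a ha ξ i s hs => ?_⟩
  rw [norm_smul, one_add_rpow_neg_natCast (norm_nonneg _), ← div_eq_mul_inv,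
    le_div_iff₀ (by positivity)]
  have h1 : ‖NormedSpace.exp (opSym a (shiftC i s ξ))‖
      ≤ Real.exp (-lam * ‖ξ‖ ^ r + C * (1 + ‖ξ‖) ^ (r - 1)) := by
    apply norm_exp_le_of_re_inner_le
    intro v
    have e : opSym a (shiftC i s ξ) v = opSym a (toC ξ) v
        + (opSym a (shiftC i s ξ) - opSym a (toC ξ)) v := by simp
    rw [e, inner_add_right, Complex.add_re]
    have h2 := ha.ell ξ v
    have h3 : (inner ℂ v ((opSym a (shiftC i s ξ) - opSym a (toC ξ)) v)).re
        ≤ C * (1 + ‖ξ‖) ^ (r - 1) * ‖v‖ ^ 2 := by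
      refine (Complex.re_le_norm _).trans ((norm_inner_le_norm _ _).trans ?_)
      have := (opSym a (shiftC i s ξ) - opSym a (toC ξ)).le_of_opNorm_le
        (norm_opSym_sub_le ha.bd i s hs ξ) v
      calc _ ≤ ‖v‖ * (C * (1 + ‖ξ‖) ^ (r - 1) * ‖v‖) := by gcongr
        _ = _ := by ring
    linarith
  have h2 := norm_monoSym_shiftC_le I i s hs ξ
  calc _ ≤ (2 * Real.pi * 3 * (1 + ‖ξ‖)) ^ I.length
        * Real.exp (-lam * ‖ξ‖ ^ r + C * (1 + ‖ξ‖) ^ (r - 1)) * (1 + ‖ξ‖) ^ m := by gcongr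
    _ = (2 * Real.pi * 3) ^ I.length * ((1 + ‖ξ‖) ^ (I.length + m)
        * Real.exp (-lam * ‖ξ‖ ^ r + C * (1 + ‖ξ‖) ^ (r - 1))) := by
        rw [mul_pow, pow_add]; ring
    _ ≤ _ := by gcongr; exact hB' _ (norm_nonneg _)

end KernelBound

section KernelDecay

variable {n r : ℕ} {H : Type*} [NormedAddCommGroup H] [InnerProductSpace ℂ H] [CompleteSpace H]

/-- The plane wave with complex frequency `ζ`. -/
def planeWave (z : Vec n) (ζ : Fin n → ℂ) : ℂ :=
  Complex.exp (2 * (Real.pi : ℂ) * Complex.I * ∑ j, (z j : ℂ) * ζ j)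

/-- Integrand of the kernel `∂_I e^{-tL}`. -/
def kerG (a : (Fin r → Fin n) → (H →L[ℂ] H)) (I : List (Fin n)) (z : Vec n) (ζ : Fin n → ℂ) :
    H →L[ℂ] H :=
  planeWave z ζ • monoSym I ζ • NormedSpace.exp (opSym a ζ)

/-- The `I`-th derivative of the fundamental solution at time one for coefficients `a`. -/
def kerK (a : (Fin r → Fin n) → (H →L[ℂ] H)) (I : List (Fin n)) (z : Vec n) : H →L[ℂ] H :=
  ∫ ξ : Vec n, kerG a I z (toC ξ)

lemma differentiable_monoSym (I : List (Fin n)) : Differentiable ℂ (monoSym I) := by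
  induction I with
  | nil => simp only [funext monoSym_nil]; fun_prop
  | cons i I ih => simp only [funext (monoSym_cons i I)]; fun_prop

lemma differentiable_opSym (a : (Fin r → Fin n) → (H →L[ℂ] H)) :
    Differentiable ℂ (opSym a) := by
  have := fun J : Fin r → Fin n => differentiable_monoSym (List.ofFn J)
  unfold opSym
  fun_prop

lemma differentiable_exp_op : Differentiable ℂ (NormedSpace.exp : (H →L[ℂ] H) → (H →L[ℂ] H)) :=
  fun x => (NormedSpace.exp_analytic (𝕂 := ℂ) x).differentiableAt

lemma differentiable_kerG (a : (Fin r → Fin n) → (H →L[ℂ] H)) (I : List (Fin n)) (z : Vec n) :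
    Differentiable ℂ (kerG a I z) := by
  have h1 := differentiable_monoSym I
  have h2 : Differentiable ℂ fun ζ => NormedSpace.exp (opSym a ζ) :=
    differentiable_exp_op.comp (differentiable_opSym a)
  unfold kerG planeWave
  fun_prop

lemma continuous_kerG_uncurry (a : (Fin r → Fin n) → (H →L[ℂ] H)) (I : List (Fin n)) :
    Continuous fun p : Vec n × (Fin n → ℂ) => kerG a I p.1 p.2 := by
  have h1 := (differentiable_monoSym I).continuous
  have h2 : Continuous fun ζ => NormedSpace.exp (opSym a ζ) :=
    (differentiable_exp_op.comp (differentiable_opSym a)).continuous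
  have h3 : Continuous fun p : Vec n × (Fin n → ℂ) => planeWave p.1 p.2 := by
    unfold planeWave
    fun_prop
  exact h3.smul ((h1.comp continuous_snd).smul (h2.comp continuous_snd))

lemma continuous_toC : Continuous (toC : Vec n → Fin n → ℂ) := by unfold toC; fun_prop

lemma norm_planeWave_shiftC (z : Vec n) (i : Fin n) (s : ℂ) (ξ : Vec n) :
    ‖planeWave z (shiftC i s ξ)‖ = Real.exp (-(2 * Real.pi * z i * s.im)) := by
  unfold planeWave
  rw [Complex.norm_exp]
  congr 1
  have : ∑ j, (z j : ℂ) * shiftC i s ξ j = ((∑ j, z j * ξ j : ℝ) : ℂ) + z i * s := by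
    simp only [shiftC, toC, Pi.add_apply, Pi.smul_apply, smul_eq_mul, mul_add,
      Finset.sum_add_distrib, Complex.ofReal_sum, Complex.ofReal_mul]
    congr 1
    rw [Finset.sum_eq_single i] <;> simp +contextual
  rw [this]
  have e : (2 * (Real.pi : ℂ) * Complex.I * (((∑ j, z j * ξ j : ℝ) : ℂ) + z i * s))
    = ((2 * Real.pi * (∑ j, z j * ξ j) : ℝ) : ℂ) * Complex.I
      + ((2 * Real.pi * z i : ℝ) : ℂ) * (s * Complex.I) := by push_cast; ring
  rw [e, Complex.add_re, Complex.re_ofReal_mul, Complex.re_ofReal_mul, Complex.I_re,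
    Complex.mul_I_re]
  ring

lemma norm_planeWave_toC (z ξ : Vec n) : ‖planeWave z (toC ξ)‖ = 1 := by
  unfold planeWave
  rw [Complex.norm_exp]
  have e : (2 * (Real.pi : ℂ) * Complex.I * ∑ j, (z j : ℂ) * toC ξ j)
    = ((2 * Real.pi * (∑ j, z j * ξ j) : ℝ) : ℂ) * Complex.I := by
    simp only [toC]; push_cast; ring
  rw [e, Complex.re_ofReal_mul, Complex.I_re]; simp

lemma integrable_one_add_norm_vec (m : ℕ) (hm : n < m) :
    Integrable fun ξ : Vec n => (1 + ‖ξ‖) ^ (-(m : ℝ)) := by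
  apply integrable_one_add_norm
  simpa using hm

lemma shiftC_real (i : Fin n) (s : ℝ) (ξ : Vec n) :
    shiftC i s ξ = toC (ξ + EuclideanSpace.single i s) := by
  ext j
  simp only [shiftC, toC, Pi.add_apply, Pi.smul_apply, smul_eq_mul, PiLp.add_apply,
    PiLp.single_apply, Complex.ofReal_add, Pi.single_apply]
  split_ifs <;> simp

/-- Moving the contour of integration by an imaginary amount. -/
lemma integral_kerG_shift (hr : 2 ≤ r) {lam Lam : ℝ} (hlam : 0 < lam) (hLam : 0 ≤ Lam)
    {a : (Fin r → Fin n) → (H →L[ℂ] H)} (ha : EllCls lam Lam a) (I : List (Fin n)) (z : Vec n)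
    (i : Fin n) (s : ℂ) (hs : ‖s‖ < 2) :
    ∫ ξ : Vec n, kerG a I z (shiftC i s ξ) = kerK a I z := by
  obtain ⟨B, hB, hb⟩ := exists_norm_symbol_bound H hr lam Lam hlam hLam I (n + 1)
  obtain ⟨g, hg⟩ : ∃ g : Vec n → ℂ → (H →L[ℂ] H), ∀ ξ s, g ξ s = kerG a I z (shiftC i s ξ) :=
    ⟨_, fun _ _ => rfl⟩
  have hshift : ∀ ξ : Vec n, Differentiable ℂ fun s => shiftC i s ξ := by
    intro ξ; unfold shiftC; fun_prop
  have hd : ∀ ξ, Differentiable ℂ (g ξ) := fun ξ => by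
    rw [show g ξ = fun s => kerG a I z (shiftC i s ξ) from funext (hg ξ)]
    exact (differentiable_kerG a I z).comp (hshift ξ)
  have hgc : Continuous fun p : Vec n × ℂ => g p.1 p.2 := by
    have : Continuous fun p : Vec n × ℂ => shiftC i p.2 p.1 := by
      have := continuous_toC (n := n)
      unfold shiftC; fun_prop
    have h2 : Continuous fun p : Vec n × ℂ => ((z, shiftC i p.2 p.1) : Vec n × (Fin n → ℂ)) :=
      continuous_const.prodMk this
    have h3 : Continuous fun p : Vec n × ℂ => kerG a I z (shiftC i p.2 p.1) :=
      Continuous.comp (g := fun p : Vec n × (Fin n → ℂ) => kerG a I p.1 p.2)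
        (f := fun p : Vec n × ℂ => ((z, shiftC i p.2 p.1) : Vec n × (Fin n → ℂ)))
        (continuous_kerG_uncurry a I) h2
    exact h3.congr fun p => (hg p.1 p.2).symm
  set E := Real.exp (2 * Real.pi * |z i| * 3)
  have hgb : ∀ ξ s, ‖s‖ ≤ 3 → ‖g ξ s‖ ≤ E * (B * (1 + ‖ξ‖) ^ (-((n + 1 : ℕ) : ℝ))) := by
    intro ξ s hs
    have h1 := hb a ha ξ i s hs
    simp only [hg, kerG]
    rw [norm_smul, norm_planeWave_shiftC]
    have h2 : -(2 * Real.pi * z i * s.im) ≤ 2 * Real.pi * |z i| * 3 := by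
      have h3 : |z i * s.im| ≤ |z i| * 3 := by
        rw [abs_mul]; gcongr; exact (Complex.abs_im_le_norm s).trans hs
      have h4 := (abs_le.1 h3).1
      nlinarith [Real.pi_pos]
    gcongr
    exact Real.exp_le_exp.2 h2
  have hbi : Integrable fun ξ : Vec n => E * (B * (1 + ‖ξ‖) ^ (-((n + 1 : ℕ) : ℝ))) :=
    ((integrable_one_add_norm_vec (n + 1) (by omega)).const_mul B).const_mul E
  have hintg : ∀ s, ‖s‖ ≤ 3 → Integrable fun ξ => g ξ s := fun s hs =>
    hbi.mono' (hgc.comp (continuous_id.prodMk continuous_const)).aestronglyMeasurable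
      (Eventually.of_forall fun ξ => hgb ξ s hs)
  let Ψ : ℂ → (H →L[ℂ] H) := fun s => ∫ ξ, g ξ s
  have hΨ : DifferentiableOn ℂ Ψ (Metric.ball 0 2) := by
    intro s₀ hs₀
    have hs₀' : ‖s₀‖ < 2 := by simpa using hs₀
    have := hasDerivAt_integral_of_dominated_loc_of_deriv_le (μ := volume) (F := fun s ξ => g ξ s)
      (F' := fun s ξ => deriv (g ξ) s) (s := Metric.ball 0 2) (x₀ := s₀)
      (bound := fun ξ => E * (B * (1 + ‖ξ‖) ^ (-((n + 1 : ℕ) : ℝ))))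
      (Metric.isOpen_ball.mem_nhds hs₀)
      (Eventually.of_forall fun s =>
        (hgc.comp (continuous_id.prodMk continuous_const)).aestronglyMeasurable)
      (hintg s₀ (by linarith))
      (((stronglyMeasurable_deriv_with_param hgc).comp_measurable
        (measurable_id.prodMk measurable_const)).aestronglyMeasurable)
      (Eventually.of_forall fun ξ s hs => by
        have hs' : ‖s‖ < 2 := by simpa using hs
        have := Complex.norm_deriv_le_of_forall_mem_sphere_norm_le (c := s) (R := 1) one_pos
          (hd ξ).diffContOnCl (C := E * (B * (1 + ‖ξ‖) ^ (-((n + 1 : ℕ) : ℝ)))) (by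
            intro w hw
            refine hgb ξ w ?_
            have : ‖w - s‖ = 1 := by simpa [dist_eq_norm] using hw
            calc ‖w‖ = ‖(w - s) + s‖ := by simp
              _ ≤ ‖w - s‖ + ‖s‖ := norm_add_le _ _
              _ ≤ 3 := by linarith)
        simpa using this)
      hbi
      (Eventually.of_forall fun ξ s _ => (hd ξ s).hasDerivAt)
    exact this.2.differentiableAt.differentiableWithinAt
  have hreal : ∀ s : ℝ, Ψ s = kerK a I z := by
    intro s
    simp only [Ψ, hg, kerK, shiftC_real]
    exact integral_add_right_eq_self (fun ξ : Vec n => kerG a I z (toC ξ)) _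
  have han : AnalyticOnNhd ℂ Ψ (Metric.ball 0 2) := hΨ.analyticOnNhd Metric.isOpen_ball
  have := AnalyticOnNhd.eqOn_of_preconnected_of_frequently_eq (g := fun _ => kerK a I z)
    han analyticOnNhd_const
    (convex_ball (0 : ℂ) 2).isPreconnected (Metric.mem_ball_self (by norm_num : (0 : ℝ) < 2)) (by
      have ht : Tendsto (fun t : ℝ => (t : ℂ)) (𝓝[≠] 0) (𝓝[≠] 0) := by
        refine tendsto_nhdsWithin_of_tendsto_nhds_of_eventually_within _ ?_ ?_
        · exact (Complex.continuous_ofReal.tendsto' 0 0 (by simp)).mono_left nhdsWithin_le_nhds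
        · filter_upwards [self_mem_nhdsWithin] with t ht
          simpa using ht
      exact ht.frequently (Eventually.frequently (Eventually.of_forall hreal)))
  simpa only [Ψ, hg] using this (by simpa using hs : s ∈ Metric.ball (0 : ℂ) 2)

lemma kerG_integrable (hn : 1 ≤ n) (hr : 2 ≤ r) {lam Lam : ℝ} (hlam : 0 < lam) (hLam : 0 ≤ Lam)
    {a : (Fin r → Fin n) → (H →L[ℂ] H)} (ha : EllCls lam Lam a) (I : List (Fin n)) (z : Vec n) :
    Integrable fun ξ : Vec n => kerG a I z (toC ξ) := by
  obtain ⟨B, hB, hb⟩ := exists_norm_symbol_bound H hr lam Lam hlam hLam I (n + 1)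
  refine ((integrable_one_add_norm_vec (n + 1) (by omega)).const_mul B).mono'
    (((continuous_kerG_uncurry a I).comp
      (continuous_const.prodMk continuous_toC)).aestronglyMeasurable)
    (Eventually.of_forall fun ξ => ?_)
  have := hb a ha ξ ⟨0, hn⟩ 0 (by simp)
  rw [shiftC_zero] at this
  rwa [kerG, norm_smul, norm_planeWave_toC, one_mul]

lemma exists_kerK_bound (H : Type*) [NormedAddCommGroup H] [InnerProductSpace ℂ H]
    [CompleteSpace H] (hn : 1 ≤ n) (hr : 2 ≤ r) (lam Lam : ℝ) (hlam : 0 < lam) (hLam : 0 ≤ Lam)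
    (I : List (Fin n)) (m : ℕ) :
    ∃ C : ℝ, 0 ≤ C ∧ ∀ a : (Fin r → Fin n) → (H →L[ℂ] H), EllCls lam Lam a →
      ∀ z, ‖kerK a I z‖ ≤ C * (1 + ‖z‖) ^ (-(m : ℝ)) := by
  obtain ⟨B, hB, hb⟩ := exists_norm_symbol_bound H hr lam Lam hlam hLam I (n + 1)
  set D := ∫ ξ : Vec n, B * (1 + ‖ξ‖) ^ (-((n + 1 : ℕ) : ℝ))
  have hD : 0 ≤ D := integral_nonneg fun ξ => by positivity
  have key : ∀ a : (Fin r → Fin n) → (H →L[ℂ] H), EllCls lam Lam a → ∀ z i,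
      ‖kerK a I z‖ ≤ Real.exp (-(2 * Real.pi * |z i|)) * D := by
    intro a ha z i
    obtain ⟨s, hs, hs2⟩ : ∃ s : ℂ, ‖s‖ = 1 ∧ z i * s.im = |z i| := by
      rcases le_total 0 (z i) with h | h
      · exact ⟨Complex.I, by simp, by simp [abs_of_nonneg h]⟩
      · exact ⟨-Complex.I, by simp, by simp [abs_of_nonpos h]⟩
    rw [← integral_kerG_shift hr hlam hLam ha I z i s (by linarith), ← integral_const_mul]
    refine norm_integral_le_of_norm_le
      (((integrable_one_add_norm_vec (n + 1) (by omega)).const_mul B).const_mul _)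
      (Eventually.of_forall fun ξ => ?_)
    rw [kerG, norm_smul, norm_planeWave_shiftC, mul_assoc, hs2]
    have := hb a ha ξ i s (by linarith)
    gcongr
  set E : ℝ := 2 ^ m + n ^ m * m.factorial
  refine ⟨2 ^ m * E * D, by positivity, fun a ha z => ?_⟩
  rw [one_add_rpow_neg_natCast (norm_nonneg _), ← div_eq_mul_inv, le_div_iff₀ (by positivity)]
  obtain ⟨i, hi⟩ : ∃ i, ‖z‖ ≤ n * |z i| := by
    have : Nonempty (Fin n) := ⟨⟨0, hn⟩⟩
    obtain ⟨i, hi⟩ := Finite.exists_max fun i => |z i|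
    refine ⟨i, ?_⟩
    have h1 : ‖z‖ ≤ ∑ j, |z j| := by
      rw [EuclideanSpace.norm_eq]
      refine Real.sqrt_le_iff.2 ⟨Finset.sum_nonneg fun j _ => abs_nonneg _, ?_⟩
      simpa using Finset.sum_sq_le_sq_sum_of_nonneg (s := Finset.univ) (f := fun j => |z j|)
        (fun j _ => abs_nonneg _)
    calc ‖z‖ ≤ ∑ j, |z j| := h1
      _ ≤ ∑ _j : Fin n, |z i| := Finset.sum_le_sum fun j _ => hi j
      _ = _ := by simp
  have h1 := key a ha z i
  have h2 : (1 + ‖z‖) ^ m * Real.exp (-(2 * Real.pi * |z i|)) ≤ 2 ^ m * E := by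
    have hx : 0 ≤ |z i| := abs_nonneg _
    have hn' : (1 : ℝ) ≤ n := by exact_mod_cast hn
    have h3 : (1 + ‖z‖) ^ m ≤ (2 ^ m) * (1 + (n : ℝ) ^ m * |z i| ^ m) := by
      have : (1 + n * |z i|) ^ m ≤ 2 ^ m * (1 ^ m + (n * |z i|) ^ m) := by
        refine (add_pow_le zero_le_one (by positivity) m).trans ?_
        gcongr
        · norm_num
        · omega
      calc (1 + ‖z‖) ^ m ≤ (1 + n * |z i|) ^ m := by gcongr
        _ ≤ _ := this
        _ = _ := by rw [one_pow, mul_pow]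
    have h4 : |z i| ^ m ≤ m.factorial * Real.exp (2 * Real.pi * |z i|) := by
      have := Real.pow_div_factorial_le_exp (|z i|) hx m
      rw [div_le_iff₀' (by positivity)] at this
      refine this.trans ?_
      gcongr
      nlinarith [Real.pi_gt_three]
    have h5 : (1 : ℝ) ≤ Real.exp (2 * Real.pi * |z i|) := Real.one_le_exp (by positivity)
    rw [Real.exp_neg, ← div_eq_mul_inv, div_le_iff₀ (Real.exp_pos _)]
    refine h3.trans ?_
    rw [mul_assoc]
    gcongr
    simp only [E]
    have h6 : (n : ℝ) ^ m * |z i| ^ m ≤ n ^ m * (m.factorial * Real.exp (2 * Real.pi * |z i|)) := by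
      gcongr
    have h7 : (1 : ℝ) ≤ 2 ^ m := one_le_pow₀ (by norm_num)
    nlinarith
  calc _ ≤ Real.exp (-(2 * Real.pi * |z i|)) * D * (1 + ‖z‖) ^ m := by gcongr
    _ = ((1 + ‖z‖) ^ m * Real.exp (-(2 * Real.pi * |z i|))) * D := by ring
    _ ≤ _ := by gcongr

end KernelDecay

section KernelDeriv

variable {n r : ℕ} {H : Type*} [NormedAddCommGroup H] [InnerProductSpace ℂ H] [CompleteSpace H]

lemma norm_monoSym_toC_le (I : List (Fin n)) (ξ : Vec n) :
    ‖monoSym I (toC ξ)‖ ≤ (2 * Real.pi * ‖ξ‖) ^ I.length := by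
  induction I with
  | nil => simp [monoSym_nil]
  | cons j I ih =>
    rw [monoSym_cons, norm_mul, List.length_cons, pow_succ']
    have hp := Real.pi_pos
    have : ‖toC ξ j‖ ≤ ‖ξ‖ := by
      rw [toC, Complex.norm_real]; exact PiLp.norm_apply_le ξ j
    gcongr
    simp only [norm_mul, Complex.norm_I, Complex.norm_real, Complex.norm_ofNat, mul_one,
      Real.norm_eq_abs, abs_of_pos hp]
    gcongr

lemma norm_opSym_toC_le {a : (Fin r → Fin n) → (H →L[ℂ] H)} {M : ℝ} (ha : ∀ J, ‖a J‖ ≤ M)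
    (ξ : Vec n) : ‖opSym a (toC ξ)‖ ≤ ((n : ℝ) ^ r * (2 * Real.pi) ^ r * M) * ‖ξ‖ ^ r := by
  unfold opSym
  refine (norm_sum_le _ _).trans ?_
  have : ∀ J ∈ (Finset.univ : Finset (Fin r → Fin n)),
      ‖monoSym (List.ofFn J) (toC ξ) • a J‖ ≤ (2 * Real.pi * ‖ξ‖) ^ r * M := by
    intro J _
    rw [norm_smul]
    have h := norm_monoSym_toC_le (List.ofFn J) ξ
    rw [List.length_ofFn] at h
    have := Real.pi_pos
    gcongr
    exact ha J
  refine (Finset.sum_le_sum this).trans (le_of_eq ?_)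
  simp only [Finset.sum_const, Finset.card_univ, Fintype.card_fun, Fintype.card_fin,
    nsmul_eq_mul, Nat.cast_pow, mul_pow]
  ring

lemma opSym_add (a b : (Fin r → Fin n) → (H →L[ℂ] H)) (ζ : Fin n → ℂ) :
    opSym (a + b) ζ = opSym a ζ + opSym b ζ := by
  simp [opSym, smul_add, Finset.sum_add_distrib]

lemma opSym_smul (t : ℝ) (a : (Fin r → Fin n) → (H →L[ℂ] H)) (ζ : Fin n → ℂ) :
    opSym (t • a) ζ = t • opSym a ζ := by
  simp only [opSym, Pi.smul_apply, Finset.smul_sum]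
  exact Finset.sum_congr rfl fun J _ => smul_comm _ _ _

lemma EllCls.mono {lam Lam lam' Lam' : ℝ} {a : (Fin r → Fin n) → (H →L[ℂ] H)}
    (h : EllCls lam Lam a) (h1 : lam' ≤ lam) (h2 : Lam ≤ Lam') : EllCls lam' Lam' a where
  ell ξ v := (h.ell ξ v).trans (by
    have : 0 ≤ ‖ξ‖ ^ r * ‖v‖ ^ 2 := by positivity
    nlinarith)
  bd J := (h.bd J).trans h2

lemma EllCls.add {lam Lam lam' Lam' : ℝ} {a a' : (Fin r → Fin n) → (H →L[ℂ] H)}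
    (h : EllCls lam Lam a) (h' : EllCls lam' Lam' a') : EllCls (lam + lam') (Lam + Lam') (a + a') where
  ell ξ v := by
    rw [opSym_add, add_apply, inner_add_right, Complex.add_re]
    have := h.ell ξ v
    have := h'.ell ξ v
    linarith
  bd J := (norm_add_le _ _).trans (add_le_add (h.bd J) (h'.bd J))

lemma EllCls.smul {lam Lam t : ℝ} (ht : 0 ≤ t) {a : (Fin r → Fin n) → (H →L[ℂ] H)}
    (h : EllCls lam Lam a) : EllCls (t * lam) (t * Lam) (t • a) where
  ell ξ v := by
    have e : (t • opSym a (toC ξ)) v = (t : ℂ) • (opSym a (toC ξ) v) := by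
      simp
    rw [opSym_smul, e, inner_smul_right, Complex.re_ofReal_mul]
    have := mul_le_mul_of_nonneg_left (h.ell ξ v) ht
    linarith
  bd J := by
    rw [Pi.smul_apply, norm_smul, Real.norm_eq_abs, abs_of_nonneg ht]
    exact mul_le_mul_of_nonneg_left (h.bd J) ht

lemma EllCls.perturb {lam Lam M : ℝ} (hlam : 0 < lam) (hM : 0 ≤ M)
    {a b : (Fin r → Fin n) → (H →L[ℂ] H)} (h : EllCls lam Lam b) (ha : ∀ J, ‖a J‖ ≤ M) :
    ∃ ε : ℝ, 0 < ε ∧ ∀ t : ℝ, |t| ≤ ε → EllCls (lam / 2) (Lam + M) (b + t • a) := by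
  have hp := Real.pi_pos
  set C := (n : ℝ) ^ r * (2 * Real.pi) ^ r * M
  have hC : 0 ≤ C := by positivity
  refine ⟨min 1 (lam / (2 * (C + 1))), by positivity, fun t ht => ⟨fun ξ v => ?_, fun J => ?_⟩⟩
  · have ht2 : |t| * C ≤ lam / 2 := by
      have h1 := ht.trans (min_le_right _ _)
      rw [le_div_iff₀ (by positivity)] at h1
      nlinarith [abs_nonneg t]
    rw [opSym_add, add_apply, inner_add_right, Complex.add_re, opSym_smul]
    have h1 := h.ell ξ v
    have h2 : (inner ℂ v ((t • opSym a (toC ξ)) v)).re ≤ |t| * (C * ‖ξ‖ ^ r) * ‖v‖ ^ 2 := by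
      refine (Complex.re_le_norm _).trans ((norm_inner_le_norm _ _).trans ?_)
      have h3 : ‖t • opSym a (toC ξ)‖ ≤ |t| * (C * ‖ξ‖ ^ r) := by
        rw [norm_smul, Real.norm_eq_abs]
        gcongr
        exact norm_opSym_toC_le ha ξ
      have := (t • opSym a (toC ξ)).le_of_opNorm_le h3 v
      calc _ ≤ ‖v‖ * (|t| * (C * ‖ξ‖ ^ r) * ‖v‖) := by gcongr
        _ = _ := by ring
    have h4 : 0 ≤ ‖ξ‖ ^ r * ‖v‖ ^ 2 := by positivity
    nlinarith
  · refine (norm_add_le _ _).trans (add_le_add (h.bd J) ?_)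
    rw [Pi.smul_apply, norm_smul, Real.norm_eq_abs]
    have h1 := ht.trans (min_le_left _ _)
    calc |t| * ‖a J‖ ≤ 1 * M := by gcongr; exact ha J
      _ = M := one_mul M

lemma exists_kerG_bound (hn : 1 ≤ n) (H : Type*) [NormedAddCommGroup H] [InnerProductSpace ℂ H]
    [CompleteSpace H] (hr : 2 ≤ r) (lam Lam : ℝ) (hlam : 0 < lam) (hLam : 0 ≤ Lam)
    (I : List (Fin n)) :
    ∃ g : Vec n → ℝ, Integrable g ∧ ∀ a : (Fin r → Fin n) → (H →L[ℂ] H), EllCls lam Lam a →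
      ∀ z ξ : Vec n, ‖kerG a I z (toC ξ)‖ ≤ g ξ := by
  obtain ⟨B, hB, hb⟩ := exists_norm_symbol_bound H hr lam Lam hlam hLam I (n + 1)
  refine ⟨_, (integrable_one_add_norm_vec (n + 1) (by omega)).const_mul B, fun a ha z ξ => ?_⟩
  have := hb a ha ξ ⟨0, hn⟩ 0 (by simp)
  rw [shiftC_zero] at this
  rwa [kerG, norm_smul, norm_planeWave_toC, one_mul]

lemma continuous_kerG_toC (a : (Fin r → Fin n) → (H →L[ℂ] H)) (I : List (Fin n)) (z : Vec n) :
    Continuous fun ξ : Vec n => kerG a I z (toC ξ) :=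
  Continuous.comp (g := fun p : Vec n × (Fin n → ℂ) => kerG a I p.1 p.2)
    (f := fun ξ : Vec n => ((z, toC ξ) : Vec n × (Fin n → ℂ)))
    (continuous_kerG_uncurry a I) (continuous_const.prodMk continuous_toC)

lemma continuous_kerK (hn : 1 ≤ n) (hr : 2 ≤ r) {lam Lam : ℝ} (hlam : 0 < lam) (hLam : 0 ≤ Lam)
    {a : (Fin r → Fin n) → (H →L[ℂ] H)} (ha : EllCls lam Lam a) (I : List (Fin n)) :
    Continuous (kerK a I) := by
  obtain ⟨g, hg, hb⟩ := exists_kerG_bound hn H hr lam Lam hlam hLam I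
  refine continuous_of_dominated (bound := g)
    (fun z => (continuous_kerG_toC a I z).aestronglyMeasurable)
    (fun z => Eventually.of_forall fun ξ => hb a ha z ξ) hg
    (Eventually.of_forall fun ξ => ?_)
  exact Continuous.comp (g := fun p : Vec n × (Fin n → ℂ) => kerG a I p.1 p.2)
    (f := fun z : Vec n => ((z, toC ξ) : Vec n × (Fin n → ℂ)))
    (continuous_kerG_uncurry a I) (continuous_id.prodMk continuous_const)

lemma hasDerivAt_planeWave (z : Vec n) (i : Fin n) (ζ : Fin n → ℂ) (t : ℝ) :
    HasDerivAt (fun t : ℝ => planeWave (z + t • EuclideanSpace.single i (1 : ℝ)) ζ)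
      (planeWave (z + t • EuclideanSpace.single i (1 : ℝ)) ζ
        * (2 * (Real.pi : ℂ) * Complex.I * ζ i)) t := by
  unfold planeWave
  have e : ∀ t : ℝ, ∑ j, ((z + t • EuclideanSpace.single i (1 : ℝ) : Vec n) j : ℂ) * ζ j
      = ∑ j, (z j : ℂ) * ζ j + t * ζ i := by
    intro t
    simp only [PiLp.add_apply, PiLp.smul_apply, PiLp.single_apply, smul_eq_mul,
      Complex.ofReal_add, add_mul, Finset.sum_add_distrib]
    congr 1
    rw [Finset.sum_eq_single i] <;> simp +contextual
  simp only [e]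
  have h1 : HasDerivAt (fun t : ℝ => (t : ℂ)) 1 t := Complex.ofRealCLM.hasDerivAt
  have h2 := (((h1.mul_const (ζ i)).const_add (∑ j, (z j : ℂ) * ζ j)).const_mul
    (2 * (Real.pi : ℂ) * Complex.I)).cexp
  simpa [mul_assoc] using h2

lemma hasDerivAt_kerK_line (hn : 1 ≤ n) (hr : 2 ≤ r) {lam Lam : ℝ} (hlam : 0 < lam)
    (hLam : 0 ≤ Lam) {a : (Fin r → Fin n) → (H →L[ℂ] H)} (ha : EllCls lam Lam a)
    (I : List (Fin n)) (z : Vec n) (i : Fin n) :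
    HasLineDerivAt ℝ (kerK a I) (kerK a (i :: I) z) z (EuclideanSpace.single i (1 : ℝ)) := by
  obtain ⟨g, hg, hb⟩ := exists_kerG_bound hn H hr lam Lam hlam hLam (i :: I)
  have hd : ∀ (ξ : Vec n) (t : ℝ), HasDerivAt
      (fun t : ℝ => kerG a I (z + t • EuclideanSpace.single i (1 : ℝ)) (toC ξ))
      (kerG a (i :: I) (z + t • EuclideanSpace.single i (1 : ℝ)) (toC ξ)) t := by
    intro ξ t
    have := (hasDerivAt_planeWave z i (toC ξ) t).smul_const
      (monoSym I (toC ξ) • NormedSpace.exp (opSym a (toC ξ)))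
    have e : kerG a (i :: I) (z + t • EuclideanSpace.single i (1 : ℝ)) (toC ξ)
      = (planeWave (z + t • EuclideanSpace.single i (1 : ℝ)) (toC ξ)
        * (2 * (Real.pi : ℂ) * Complex.I * toC ξ i)) •
        (monoSym I (toC ξ) • NormedSpace.exp (opSym a (toC ξ))) := by
      rw [kerG, monoSym_cons]; simp only [smul_smul]; congr 1; ring
    rw [e]
    exact this
  have := hasDerivAt_integral_of_dominated_loc_of_deriv_le (μ := volume)
    (F := fun (t : ℝ) (ξ : Vec n) =>
      kerG a I (z + t • EuclideanSpace.single i (1 : ℝ)) (toC ξ))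
    (F' := fun (t : ℝ) (ξ : Vec n) =>
      kerG a (i :: I) (z + t • EuclideanSpace.single i (1 : ℝ)) (toC ξ))
    (s := univ) (x₀ := (0 : ℝ)) (bound := g) univ_mem
    (Eventually.of_forall fun t => (continuous_kerG_toC a I _).aestronglyMeasurable)
    (kerG_integrable hn hr hlam hLam ha I _)
    (continuous_kerG_toC a (i :: I) _).aestronglyMeasurable
    (Eventually.of_forall fun ξ t _ => hb a ha _ ξ) hg
    (Eventually.of_forall fun ξ t _ => hd ξ t)
  have h2 := this.2
  simp only [zero_smul, add_zero] at h2
  exact h2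

lemma hasDerivAt_exp_commute (Q P : H →L[ℂ] H) (h : Commute Q P) (t : ℝ) :
    HasDerivAt (fun t : ℝ => NormedSpace.exp (Q + t • P)) (NormedSpace.exp (Q + t • P) * P) t := by
  let _ : NormedAlgebra ℚ (H →L[ℂ] H) := NormedAlgebra.restrictScalars ℚ ℂ (H →L[ℂ] H)
  have e : ∀ t : ℝ, NormedSpace.exp (Q + t • P) = NormedSpace.exp Q * NormedSpace.exp (t • P) :=
    fun t => NormedSpace.exp_add_of_commute (h.smul_right t)
  simp only [e]
  have := (hasDerivAt_exp_smul_const P t).const_mul (NormedSpace.exp Q)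
  simpa [mul_assoc] using this

lemma hasDerivAt_kerK_coeff (hn : 1 ≤ n) (hr : 2 ≤ r) {lam Lam M : ℝ} (hlam : 0 < lam)
    (hLam : 0 ≤ Lam) {a b : (Fin r → Fin n) → (H →L[ℂ] H)} (hb : EllCls lam Lam b)
    (ha : ∀ J, ‖a J‖ ≤ M) (hM : 0 ≤ M)
    (hc : ∀ ξ : Vec n, Commute (opSym b (toC ξ)) (opSym a (toC ξ))) (I : List (Fin n))
    (z : Vec n) :
    HasDerivAt (fun t : ℝ => kerK (b + t • a) I z)
      (∑ J, kerK b (List.ofFn J ++ I) z * a J) 0 := by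
  obtain ⟨ε, hε, hell⟩ := hb.perturb hlam hM ha
  have hG : ∀ J : Fin r → Fin n, ∃ g : Vec n → ℝ, Integrable g ∧
      ∀ a : (Fin r → Fin n) → (H →L[ℂ] H), EllCls (lam / 2) (Lam + M) a →
      ∀ z ξ : Vec n, ‖kerG a (List.ofFn J ++ I) z (toC ξ)‖ ≤ g ξ := fun J =>
    exists_kerG_bound hn H hr (lam / 2) (Lam + M) (by positivity) (by positivity) _
  choose g hg hgb using hG
  have hd : ∀ (ξ : Vec n) (t : ℝ), HasDerivAt (fun t : ℝ => kerG (b + t • a) I z (toC ξ))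
      (∑ J, kerG (b + t • a) (List.ofFn J ++ I) z (toC ξ) * a J) t := by
    intro ξ t
    have h1 := ((hasDerivAt_exp_commute _ _ (hc ξ) t).const_smul (monoSym I (toC ξ))).const_smul
      (planeWave z (toC ξ))
    have e : ∑ J, kerG (b + t • a) (List.ofFn J ++ I) z (toC ξ) * a J
        = planeWave z (toC ξ) • monoSym I (toC ξ) •
          (NormedSpace.exp (opSym b (toC ξ) + t • opSym a (toC ξ)) * opSym a (toC ξ)) := by
      rw [← opSym_smul, ← opSym_add]
      conv_rhs => rw [opSym.eq_def a]
      simp only [kerG, Finset.mul_sum, Finset.smul_sum, monoSym_append, smul_mul_assoc,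
        mul_smul_comm, smul_smul]
      refine Finset.sum_congr rfl fun J _ => ?_
      congr 1; ring
    rw [e]
    refine h1.congr_of_eventuallyEq (Eventually.of_forall fun t => ?_)
    simp [kerG, opSym_add, opSym_smul]
  have hcont : ∀ t : ℝ, Continuous fun ξ : Vec n =>
      ∑ J, kerG (b + t • a) (List.ofFn J ++ I) z (toC ξ) * a J := fun t =>
    continuous_finsetSum _ fun J _ => (continuous_kerG_toC _ _ z).mul continuous_const
  have := hasDerivAt_integral_of_dominated_loc_of_deriv_le (μ := volume)
    (F := fun (t : ℝ) (ξ : Vec n) => kerG (b + t • a) I z (toC ξ))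
    (F' := fun (t : ℝ) (ξ : Vec n) => ∑ J, kerG (b + t • a) (List.ofFn J ++ I) z (toC ξ) * a J)
    (s := Metric.ball 0 ε) (x₀ := (0 : ℝ)) (bound := fun ξ => ∑ J, g J ξ * M)
    (Metric.ball_mem_nhds 0 hε)
    (Eventually.of_forall fun t => (continuous_kerG_toC _ I z).aestronglyMeasurable)
    (by simpa using kerG_integrable hn hr hlam hLam hb I z)
    (hcont 0).aestronglyMeasurable
    (Eventually.of_forall fun ξ t ht => by
      refine (norm_sum_le _ _).trans (Finset.sum_le_sum fun J _ => (norm_mul_le _ _).trans ?_)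
      have ht' : |t| ≤ ε := by simpa using (Metric.mem_ball.1 ht).le
      have h1 := hgb J _ (hell t ht') z ξ
      gcongr
      · exact (norm_nonneg _).trans h1
      · exact ha J)
    (integrable_finsetSum _ fun J _ => (hg J).mul_const M)
    (Eventually.of_forall fun ξ t _ => hd ξ t)
  have h2 := this.2
  simp only [zero_smul, add_zero] at h2
  have hI : ∀ J : Fin r → Fin n, Integrable fun ξ : Vec n => kerG b (List.ofFn J ++ I) z (toC ξ) :=
    fun J => kerG_integrable hn hr hlam hLam hb _ z
  have e : ∀ J, ∫ ξ : Vec n, kerG b (List.ofFn J ++ I) z (toC ξ) * a J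
      = kerK b (List.ofFn J ++ I) z * a J := fun J => integral_mul_const_of_integrable (hI J)
  rw [integral_finsetSum _ fun J _ => (hI J).mul_const (a J)] at h2
  simp only [e] at h2
  exact h2

end KernelDeriv

section KernelMoments

variable {n r : ℕ} {H : Type*} [NormedAddCommGroup H] [InnerProductSpace ℂ H] [CompleteSpace H]

lemma monoSym_smul (I : List (Fin n)) (c : ℂ) (ζ : Fin n → ℂ) :
    monoSym I (c • ζ) = c ^ I.length * monoSym I ζ := by
  induction I with
  | nil => simp [monoSym_nil]
  | cons i I ih => rw [monoSym_cons, monoSym_cons, ih, List.length_cons, pow_succ]; simp; ring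

lemma toC_smul (c : ℝ) (ξ : Vec n) : toC (c • ξ) = (c : ℂ) • toC ξ := by
  ext j; simp [toC]

lemma opSym_toC_smul (a : (Fin r → Fin n) → (H →L[ℂ] H)) (c : ℝ) (ξ : Vec n) :
    opSym a (toC (c • ξ)) = c ^ r • opSym a (toC ξ) := by
  simp only [opSym, toC_smul, monoSym_smul, List.length_ofFn, Finset.smul_sum]
  refine Finset.sum_congr rfl fun J _ => ?_
  rw [mul_smul]
  norm_cast

lemma kerK_scale (a : (Fin r → Fin n) → (H →L[ℂ] H)) (I : List (Fin n)) (z : Vec n) {c : ℝ}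
    (hc : 0 < c) :
    kerK ((c ^ r)⁻¹ • a) I z = c ^ (n + I.length) • kerK a I (c • z) := by
  have h1 := Measure.integral_comp_smul (volume : Measure (Vec n))
    (fun ξ => kerG ((c ^ r)⁻¹ • a) I z (toC ξ)) c
  have h2 : (fun ξ : Vec n => kerG ((c ^ r)⁻¹ • a) I z (toC (c • ξ)))
      = fun ξ => c ^ I.length • kerG a I (c • z) (toC ξ) := by
    ext1 ξ
    have e1 : planeWave z (toC (c • ξ)) = planeWave (c • z) (toC ξ) := by
      simp only [planeWave, toC]
      congr 2
      refine Finset.sum_congr rfl fun j _ => ?_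
      simp; ring
    rw [kerG, kerG, opSym_smul, opSym_toC_smul,
      inv_smul_smul₀ (pow_pos hc r).ne', e1, toC_smul, monoSym_smul, mul_smul, smul_comm (planeWave _ _)]
    norm_cast
  rw [h2, integral_smul, finrank_euclideanSpace_fin] at h1
  have h3 : |((c ^ n)⁻¹ : ℝ)| = (c ^ n)⁻¹ := abs_of_pos (by positivity)
  rw [h3, ← kerK, ← kerK] at h1
  rw [pow_add, mul_smul, h1, smul_smul, mul_inv_cancel₀ (by positivity), one_smul]

lemma exists_kerK_moment (H : Type*) [NormedAddCommGroup H] [InnerProductSpace ℂ H]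
    [CompleteSpace H] (hn : 1 ≤ n) (hr : 2 ≤ r) (lam Lam : ℝ) (hlam : 0 < lam) (hLam : 0 ≤ Lam)
    (I : List (Fin n)) :
    ∃ C : ℝ, 0 ≤ C ∧ ∀ (T : ℝ), 0 < T → ∀ b : (Fin r → Fin n) → (H →L[ℂ] H),
      EllCls (T * lam) (T * Lam) b → ∀ β : ℝ, 0 ≤ β → β ≤ 1 →
      Integrable (fun z : Vec n => ‖kerK b I z‖ * ‖z‖ ^ β) ∧
      ∫ z : Vec n, ‖kerK b I z‖ * ‖z‖ ^ β ≤ C * T ^ ((β - I.length) / r) := by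
  obtain ⟨C, hC, hb⟩ := exists_kerK_bound H hn hr lam Lam hlam hLam I (n + 2)
  have hgi := (integrable_one_add_norm_vec (n := n) (n + 1) (by omega)).const_mul C
  refine ⟨∫ ξ : Vec n, C * (1 + ‖ξ‖) ^ (-((n + 1 : ℕ) : ℝ)),
    integral_nonneg fun ξ => by positivity, fun T hT b hbc β hβ0 hβ1 => ?_⟩
  set c : ℝ := T ^ (-(1 / (r : ℝ))) with hcdef
  have hr0 : (r : ℝ) ≠ 0 := by positivity
  have hc : 0 < c := Real.rpow_pos_of_pos hT _
  have hcr : (c ^ r)⁻¹ = T := by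
    rw [← Real.rpow_natCast, hcdef, ← Real.rpow_mul hT.le]
    rw [show -(1 / (r : ℝ)) * r = -1 by field_simp, Real.rpow_neg_one, inv_inv]
  set a := T⁻¹ • b
  have hba : b = (c ^ r)⁻¹ • a := by rw [hcr, smul_smul, mul_inv_cancel₀ hT.ne', one_smul]
  have ha : EllCls lam Lam a := by
    have := hbc.smul (inv_nonneg.2 hT.le)
    rwa [← mul_assoc, ← mul_assoc, inv_mul_cancel₀ hT.ne', one_mul, one_mul] at this
  let φ : Vec n → ℝ := fun y => ‖kerK a I y‖ * ‖y‖ ^ β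
  have hφb : ∀ y, ‖φ y‖ ≤ C * (1 + ‖y‖) ^ (-((n + 1 : ℕ) : ℝ)) := by
    intro y
    have h1 := hb a ha y
    have hy := norm_nonneg y
    rw [Real.norm_eq_abs, abs_of_nonneg (by positivity)]
    have h2 : ‖y‖ ^ β ≤ 1 + ‖y‖ := by
      calc ‖y‖ ^ β ≤ (1 + ‖y‖) ^ β := by gcongr; linarith
        _ ≤ (1 + ‖y‖) ^ (1 : ℝ) := Real.rpow_le_rpow_of_exponent_le (by linarith) hβ1
        _ = _ := Real.rpow_one _
    calc φ y ≤ (C * (1 + ‖y‖) ^ (-((n + 2 : ℕ) : ℝ))) * (1 + ‖y‖) := by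
          simp only [φ]; gcongr
      _ = C * (1 + ‖y‖) ^ (-((n + 1 : ℕ) : ℝ)) := by
          rw [one_add_rpow_neg_natCast hy, one_add_rpow_neg_natCast hy]
          rw [pow_succ (1 + ‖y‖) (n + 1)]
          field_simp
  have hφc : Continuous φ := by
    have := continuous_kerK hn hr hlam hLam ha I
    have h2 : Continuous fun y : Vec n => ‖y‖ ^ β := continuous_norm.rpow_const fun _ => Or.inr hβ0
    exact this.norm.mul h2
  have hφi : Integrable φ := hgi.mono' hφc.aestronglyMeasurable (Eventually.of_forall hφb)
  have e : (fun z : Vec n => ‖kerK b I z‖ * ‖z‖ ^ β)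
      = fun z => (c ^ (n + I.length) * c ^ (-β)) * φ (c • z) := by
    ext1 z
    rw [hba, kerK_scale a I z hc]
    simp only [φ]
    rw [norm_smul, norm_smul, Real.norm_eq_abs, Real.norm_eq_abs, abs_of_pos hc,
      abs_of_pos (by positivity), Real.mul_rpow hc.le (norm_nonneg _), Real.rpow_neg hc.le]
    have : 0 < c ^ β := Real.rpow_pos_of_pos hc _
    field_simp
  rw [e]
  refine ⟨(hφi.comp_smul hc.ne').const_mul _, ?_⟩
  rw [integral_const_mul, Measure.integral_comp_smul, finrank_euclideanSpace_fin,
    abs_of_pos (by positivity), smul_eq_mul]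
  have h5 : ∫ z, φ z ≤ ∫ ξ : Vec n, C * (1 + ‖ξ‖) ^ (-((n + 1 : ℕ) : ℝ)) :=
    integral_mono hφi hgi fun y => (le_abs_self _).trans (hφb y)
  have h6 : c ^ (n + I.length) * c ^ (-β) * ((c ^ n)⁻¹ * ∫ z, φ z)
      = T ^ ((β - I.length) / r) * ∫ z, φ z := by
    have : c ^ (n + I.length) * c ^ (-β) * (c ^ n)⁻¹ = T ^ ((β - I.length) / r) := by
      rw [pow_add]
      have h7 : c ^ n ≠ 0 := by positivity
      have h8 : c ^ n * c ^ I.length * c ^ (-β) * (c ^ n)⁻¹ = c ^ I.length * c ^ (-β) := by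
        field_simp
      rw [h8, ← Real.rpow_natCast, ← Real.rpow_add hc, hcdef, ← Real.rpow_mul hT.le]
      congr 1
      field_simp
      ring
    rw [← this]; ring
  rw [h6, mul_comm]
  gcongr

lemma integral_kerK_nil (hn : 1 ≤ n) (hr : 2 ≤ r) {lam Lam : ℝ} (hlam : 0 < lam) (hLam : 0 ≤ Lam)
    {a : (Fin r → Fin n) → (H →L[ℂ] H)} (ha : EllCls lam Lam a) (hr0 : r ≠ 0) :
    ∫ z : Vec n, kerK a [] z = 1 := by
  open scoped FourierTransform in
  have hpw : ∀ (z ξ : Vec n), planeWave z (toC ξ)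
      = Complex.exp ((2 * Real.pi * inner ℝ ξ z : ℝ) * Complex.I) := by
    intro z ξ
    simp only [planeWave, toC, PiLp.inner_apply]
    congr 1
    push_cast
    have : ∑ j, (z j : ℂ) * ξ j = ∑ j, ((inner ℝ (ξ j) (z j) : ℝ) : ℂ) :=
      Finset.sum_congr rfl fun j _ => by simp
    rw [this]; ring
  let f : Vec n → (H →L[ℂ] H) := fun ξ => NormedSpace.exp (opSym a (toC ξ))
  have hK : kerK a [] = 𝓕⁻ f := by
    ext1 z
    rw [Real.fourierInv_eq']
    simp only [kerK, kerG, monoSym_nil, one_smul, hpw, f]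
  have hf : Continuous f :=
    (differentiable_exp_op.continuous).comp ((differentiable_opSym a).continuous.comp continuous_toC)
  have hfi : Integrable f := by
    have := kerG_integrable hn hr hlam hLam ha [] 0
    simpa [kerG, monoSym_nil, planeWave, f] using this
  have hki : Integrable (𝓕⁻ f) := by
    rw [← hK]
    obtain ⟨C, hC, hb⟩ := exists_kerK_bound H hn hr lam Lam hlam hLam ([] : List (Fin n)) (n + 1)
    exact ((integrable_one_add_norm_vec (n + 1) (by omega)).const_mul C).mono'
      (continuous_kerK hn hr hlam hLam ha []).aestronglyMeasurable
      (Eventually.of_forall fun z => hb a ha z)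
  have hki' : Integrable (𝓕 f) := by
    have := hki.comp_neg
    refine this.congr (Eventually.of_forall fun x => ?_)
    simp only [Real.fourierInv_eq_fourier_neg, neg_neg]
  have h1 := congrFun (hf.fourier_fourierInv_eq hfi hki') 0
  rw [Real.fourier_eq', ← hK] at h1
  have h0 : opSym a (toC (0 : Vec n)) = 0 := by
    have := opSym_toC_smul a 0 (0 : Vec n)
    simpa [hr0] using this
  simpa [f, h0] using h1

lemma kerK_integrable (hn : 1 ≤ n) (hr : 2 ≤ r) {lam Lam : ℝ} (hlam : 0 < lam) (hLam : 0 ≤ Lam)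
    {a : (Fin r → Fin n) → (H →L[ℂ] H)} (ha : EllCls lam Lam a) (I : List (Fin n)) :
    Integrable (kerK a I) := by
  obtain ⟨C, hC, hb⟩ := exists_kerK_bound H hn hr lam Lam hlam hLam I (n + 1)
  exact ((integrable_one_add_norm_vec (n + 1) (by omega)).const_mul C).mono'
    (continuous_kerK hn hr hlam hLam ha I).aestronglyMeasurable
    (Eventually.of_forall fun z => hb a ha z)

/-- The solution operator (with derivative `∂_I`) acting on functions. -/
def heatT (a : (Fin r → Fin n) → (H →L[ℂ] H)) (I : List (Fin n)) (f : Vec n → H) (x : Vec n) : H :=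
  ∫ z : Vec n, kerK a I z (f (x - z))

lemma heatT_integrable (hn : 1 ≤ n) (hr : 2 ≤ r) {lam Lam : ℝ} (hlam : 0 < lam) (hLam : 0 ≤ Lam)
    {a : (Fin r → Fin n) → (H →L[ℂ] H)} (ha : EllCls lam Lam a) (I : List (Fin n))
    {f : Vec n → H} (hf : Continuous f) {M : ℝ} (hM : ∀ x, ‖f x‖ ≤ M) (x : Vec n) :
    Integrable fun z : Vec n => kerK a I z (f (x - z)) := by
  refine ((kerK_integrable hn hr hlam hLam ha I).norm.mul_const M).mono' ?_
    (Eventually.of_forall fun z => ?_)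
  · exact ((continuous_kerK hn hr hlam hLam ha I).clm_apply
      (hf.comp (continuous_const.sub continuous_id))).aestronglyMeasurable
  · exact (ContinuousLinearMap.le_opNorm _ _).trans (by gcongr; exact hM _)

/-- Integration by parts. -/
lemma heatT_ibp (hn : 1 ≤ n) (hr : 2 ≤ r) {lam Lam : ℝ} (hlam : 0 < lam) (hLam : 0 ≤ Lam)
    {a : (Fin r → Fin n) → (H →L[ℂ] H)} (ha : EllCls lam Lam a) (I : List (Fin n)) (i : Fin n)
    {w w' : Vec n → H} (hw : Continuous w) {M : ℝ} (hM : ∀ x, ‖w x‖ ≤ M)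
    (hw' : Continuous w') {M' : ℝ} (hM' : ∀ x, ‖w' x‖ ≤ M')
    (hd : ∀ x, HasLineDerivAt ℝ w (w' x) x (EuclideanSpace.single i (1 : ℝ))) (x : Vec n) :
    heatT a I w' x = heatT a (i :: I) w x := by
  let B : (H →L[ℂ] H) →L[ℝ] H →L[ℝ] H :=
    (ContinuousLinearMap.restrictScalarsL ℂ H H ℝ ℝ)
  have hB : ∀ A v, B A v = A v := fun A v => rfl
  have h1 := heatT_integrable hn hr hlam hLam ha (i :: I) hw hM x
  have h2 := heatT_integrable hn hr hlam hLam ha I hw' hM' x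
  have h3 := heatT_integrable hn hr hlam hLam ha I hw hM x
  have := integral_bilinear_hasLineDerivAt_right_eq_neg_left_of_integrable (μ := volume)
    (f := kerK a I) (f' := kerK a (i :: I)) (g := fun z => w (x - z)) (g' := fun z => -w' (x - z))
    (v := EuclideanSpace.single i (1 : ℝ)) (B := B) h1
    (by simpa [hB] using h2.neg) h3
    (fun z _ => hasDerivAt_kerK_line hn hr hlam hLam ha I z i)
    (fun z _ => by
      have h := hd (x - z)
      unfold HasLineDerivAt at h ⊢
      have h5 := HasDerivAt.scomp_of_eq (0 : ℝ) (h := fun t : ℝ => -t) (h' := (-1 : ℝ)) h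
        (hasDerivAt_neg 0) (by simp)
      simp only [neg_smul, one_smul] at h5
      refine h5.congr_of_eventuallyEq (Eventually.of_forall fun t => ?_)
      simp only [Function.comp_apply]
      congr 1
      rw [neg_smul]
      abel)
  simp only [hB, map_neg, integral_neg, neg_inj] at this
  exact this

lemma heatT_const_cons (hn : 1 ≤ n) (hr : 2 ≤ r) {lam Lam : ℝ} (hlam : 0 < lam) (hLam : 0 ≤ Lam)
    {a : (Fin r → Fin n) → (H →L[ℂ] H)} (ha : EllCls lam Lam a) (I : List (Fin n)) (i : Fin n)
    (v : H) (x : Vec n) : heatT a (i :: I) (fun _ => v) x = 0 := by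
  rw [← heatT_ibp hn hr hlam hLam ha I i (w := fun _ => v) (w' := fun _ => 0) continuous_const
    (fun _ => le_rfl) continuous_const (fun _ => le_rfl)
    (fun x => by simpa [HasLineDerivAt] using hasDerivAt_const (0 : ℝ) v)]
  simp [heatT]

lemma heatT_const_nil (hn : 1 ≤ n) (hr : 2 ≤ r) {lam Lam : ℝ} (hlam : 0 < lam) (hLam : 0 ≤ Lam)
    {a : (Fin r → Fin n) → (H →L[ℂ] H)} (ha : EllCls lam Lam a)
    (v : H) (x : Vec n) : heatT a [] (fun _ => v) x = v := by
  rw [heatT, ← ContinuousLinearMap.integral_apply (kerK_integrable hn hr hlam hLam ha []),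
    integral_kerK_nil hn hr hlam hLam ha (by omega)]
  rfl

end KernelMoments

section HeatOp

variable {n r : ℕ} {H : Type*} [NormedAddCommGroup H] [InnerProductSpace ℂ H] [CompleteSpace H]

lemma monoSym_perm {I I' : List (Fin n)} (h : I.Perm I') (ζ : Fin n → ℂ) :
    monoSym I ζ = monoSym I' ζ := (h.map _).prod_eq

lemma kerK_perm (a : (Fin r → Fin n) → (H →L[ℂ] H)) {I I' : List (Fin n)} (h : I.Perm I') :
    kerK a I = kerK a I' := by
  ext1 z
  simp only [kerK, kerG, monoSym_perm h]

lemma heatT_perm (a : (Fin r → Fin n) → (H →L[ℂ] H)) {I I' : List (Fin n)} (h : I.Perm I') :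
    heatT a I = heatT a I' := by
  ext f x
  simp only [heatT, kerK_perm a h]

/-- Mean value inequality with a non-constant bound on the derivative. -/
lemma norm_sub_le_of_hasDerivAt_le {E : Type*} [NormedAddCommGroup E] [NormedSpace ℝ E]
    {f f' : ℝ → E} {B B' : ℝ → ℝ} {a b : ℝ} (hab : a ≤ b) (hf : ContinuousOn f (Icc a b))
    (hf' : ∀ s ∈ Ioo a b, HasDerivAt f (f' s) s) (hB : ContinuousOn B (Icc a b))
    (hB' : ∀ s ∈ Ioo a b, HasDerivAt B (B' s) s) (h : ∀ s ∈ Ioo a b, ‖f' s‖ ≤ B' s) :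
    ‖f b - f a‖ ≤ B b - B a := by
  rcases hab.eq_or_lt with rfl | hab
  · simp
  have key : ∀ a' ∈ Ioo a b, ‖f b - f a'‖ ≤ B b - B a' := by
    intro a' ha'
    have hsub : Icc a' b ⊆ Icc a b := Icc_subset_Icc_left ha'.1.le
    have hin : ∀ s ∈ Ico a' b, s ∈ Ioo a b := fun s hs => ⟨ha'.1.trans_le hs.1, hs.2⟩
    exact image_norm_le_of_norm_deriv_right_le_deriv_boundary' (f := fun s => f s - f a')
      (f' := f') (B := fun s => B s - B a') (B' := B') ((hf.mono hsub).sub continuousOn_const)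
      (fun s hs => ((hf' s (hin s hs)).sub_const _).hasDerivWithinAt) (by simp)
      ((hB.mono hsub).sub continuousOn_const)
      (fun s hs => ((hB' s (hin s hs)).sub_const _).hasDerivWithinAt)
      (fun s hs => h s (hin s hs)) (right_mem_Icc.2 ha'.2.le)
  have hne : (𝓝[Ioo a b] a).NeBot := by
    rw [← mem_closure_iff_nhdsWithin_neBot, closure_Ioo hab.ne]
    exact left_mem_Icc.2 hab.le
  have t1 : Tendsto f (𝓝[Ioo a b] a) (𝓝 (f a)) :=
    ((hf a (left_mem_Icc.2 hab.le)).mono Ioo_subset_Icc_self)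
  have t2 : Tendsto B (𝓝[Ioo a b] a) (𝓝 (B a)) :=
    ((hB a (left_mem_Icc.2 hab.le)).mono Ioo_subset_Icc_self)
  exact le_of_tendsto_of_tendsto (tendsto_const_nhds.sub t1).norm (tendsto_const_nhds.sub t2)
    (eventually_mem_nhdsWithin.mono key)

lemma exists_heatT_bound (H : Type*) [NormedAddCommGroup H] [InnerProductSpace ℂ H]
    [CompleteSpace H] (hn : 1 ≤ n) (hr : 2 ≤ r) (lam Lam : ℝ) (hlam : 0 < lam) (hLam : 0 ≤ Lam)
    (I : List (Fin n)) :
    ∃ C : ℝ, 0 ≤ C ∧ ∀ (T : ℝ), 0 < T → ∀ b : (Fin r → Fin n) → (H →L[ℂ] H),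
      EllCls (T * lam) (T * Lam) b → ∀ β : ℝ, 0 ≤ β → β ≤ 1 → ∀ (f : Vec n → H) (M : ℝ)
      (x : Vec n), (∀ y, ‖f y‖ ≤ M * ‖y - x‖ ^ β) →
      ‖heatT b I f x‖ ≤ C * T ^ ((β - I.length) / r) * M := by
  obtain ⟨C, hC, h⟩ := exists_kerK_moment H hn hr lam Lam hlam hLam I
  refine ⟨C, hC, fun T hT b hb β hβ0 hβ1 f M x hf => ?_⟩
  obtain ⟨h1, h2⟩ := h T hT b hb β hβ0 hβ1
  have hM : 0 ≤ M := by
    have h3 := (norm_nonneg _).trans (hf (x + EuclideanSpace.single ⟨0, hn⟩ 1))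
    simpa using h3
  calc ‖heatT b I f x‖ ≤ ∫ z : Vec n, (‖kerK b I z‖ * ‖z‖ ^ β) * M := by
        refine norm_integral_le_of_norm_le (h1.mul_const M) (Eventually.of_forall fun z => ?_)
        refine (ContinuousLinearMap.le_opNorm _ _).trans ?_
        have := hf (x - z)
        rw [sub_sub_cancel_left, norm_neg] at this
        calc _ ≤ ‖kerK b I z‖ * (M * ‖z‖ ^ β) := by gcongr
          _ = _ := by ring
    _ ≤ _ := by rw [integral_mul_const]; gcongr

lemma heatT_sub (hn : 1 ≤ n) (hr : 2 ≤ r) {lam Lam : ℝ} (hlam : 0 < lam) (hLam : 0 ≤ Lam)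
    {a : (Fin r → Fin n) → (H →L[ℂ] H)} (ha : EllCls lam Lam a) (I : List (Fin n))
    {f g : Vec n → H} (hf : Continuous f) {M : ℝ} (hM : ∀ x, ‖f x‖ ≤ M)
    (hg : Continuous g) {M' : ℝ} (hM' : ∀ x, ‖g x‖ ≤ M') (x : Vec n) :
    heatT a I (fun y => f y - g y) x = heatT a I f x - heatT a I g x := by
  simp only [heatT, map_sub]
  exact integral_sub (heatT_integrable hn hr hlam hLam ha I hf hM x)
    (heatT_integrable hn hr hlam hLam ha I hg hM' x)

lemma heatT_add (hn : 1 ≤ n) (hr : 2 ≤ r) {lam Lam : ℝ} (hlam : 0 < lam) (hLam : 0 ≤ Lam)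
    {a : (Fin r → Fin n) → (H →L[ℂ] H)} (ha : EllCls lam Lam a) (I : List (Fin n))
    {f g : Vec n → H} (hf : Continuous f) {M : ℝ} (hM : ∀ x, ‖f x‖ ≤ M)
    (hg : Continuous g) {M' : ℝ} (hM' : ∀ x, ‖g x‖ ≤ M') (x : Vec n) :
    heatT a I (fun y => f y + g y) x = heatT a I f x + heatT a I g x := by
  simp only [heatT, map_add]
  exact integral_add (heatT_integrable hn hr hlam hLam ha I hf hM x)
    (heatT_integrable hn hr hlam hLam ha I hg hM' x)

lemma heatT_sum (hn : 1 ≤ n) (hr : 2 ≤ r) {lam Lam : ℝ} (hlam : 0 < lam) (hLam : 0 ≤ Lam)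
    {a : (Fin r → Fin n) → (H →L[ℂ] H)} (ha : EllCls lam Lam a) (I : List (Fin n))
    {ι : Type*} (s : Finset ι)
    {f : ι → Vec n → H} (hf : ∀ j ∈ s, Continuous (f j)) {M : ι → ℝ}
    (hM : ∀ j ∈ s, ∀ x, ‖f j x‖ ≤ M j) (x : Vec n) :
    heatT a I (fun y => ∑ j ∈ s, f j y) x = ∑ j ∈ s, heatT a I (f j) x := by
  simp only [heatT, map_sum]
  exact integral_finsetSum _ fun j hj => heatT_integrable hn hr hlam hLam ha I (hf j hj) (hM j hj) x

/-- Hölder bounds for the derivatives of the heat operator. -/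
lemma exists_heatT_holder_bound (H : Type*) [NormedAddCommGroup H] [InnerProductSpace ℂ H]
    [CompleteSpace H] (hn : 1 ≤ n) (hr : 2 ≤ r) (lam Lam : ℝ) (hlam : 0 < lam) (hLam : 0 ≤ Lam)
    (I : List (Fin n)) (hI : I ≠ []) :
    ∃ C : ℝ, 0 ≤ C ∧ ∀ (T : ℝ), 0 < T → ∀ b : (Fin r → Fin n) → (H →L[ℂ] H),
      EllCls (T * lam) (T * Lam) b → ∀ β : ℝ, 0 ≤ β → β ≤ 1 → ∀ (f : Vec n → H), Continuous f →
      ∀ (R : ℝ), (∀ y, ‖f y‖ ≤ R) → ∀ (M : ℝ) (x : Vec n),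
      (∀ y, ‖f y - f x‖ ≤ M * ‖y - x‖ ^ β) →
      ‖heatT b I f x‖ ≤ C * T ^ ((β - I.length) / r) * M := by
  obtain ⟨C, hC, h⟩ := exists_heatT_bound H hn hr lam Lam hlam hLam I
  refine ⟨C, hC, fun T hT b hb β hβ0 hβ1 f hf R hR M x hM => ?_⟩
  have h1 := h T hT b hb β hβ0 hβ1 (fun y => f y - f x) M x hM
  rw [heatT_sub hn hr (by positivity : 0 < T * lam) (by positivity) hb I hf hR continuous_const
    (fun _ => hR x)] at h1
  obtain ⟨i, I', rfl⟩ := List.exists_cons_of_ne_nil hI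
  rwa [heatT_const_cons hn hr (by positivity : 0 < T * lam) (by positivity) hb, sub_zero] at h1

lemma exists_heatT_nil_sub_bound (H : Type*) [NormedAddCommGroup H] [InnerProductSpace ℂ H]
    [CompleteSpace H] (hn : 1 ≤ n) (hr : 2 ≤ r) (lam Lam : ℝ) (hlam : 0 < lam) (hLam : 0 ≤ Lam) :
    ∃ C : ℝ, 0 ≤ C ∧ ∀ (T : ℝ), 0 < T → ∀ b : (Fin r → Fin n) → (H →L[ℂ] H),
      EllCls (T * lam) (T * Lam) b → ∀ β : ℝ, 0 ≤ β → β ≤ 1 → ∀ (f : Vec n → H), Continuous f →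
      ∀ (R : ℝ), (∀ y, ‖f y‖ ≤ R) → ∀ (M : ℝ) (x : Vec n),
      (∀ y, ‖f y - f x‖ ≤ M * ‖y - x‖ ^ β) →
      ‖heatT b [] f x - f x‖ ≤ C * T ^ (β / r) * M := by
  obtain ⟨C, hC, h⟩ := exists_heatT_bound H hn hr lam Lam hlam hLam []
  refine ⟨C, hC, fun T hT b hb β hβ0 hβ1 f hf R hR M x hM => ?_⟩
  have h1 := h T hT b hb β hβ0 hβ1 (fun y => f y - f x) M x hM
  rw [heatT_sub hn hr (by positivity : 0 < T * lam) (by positivity) hb [] hf hR continuous_const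
    (fun _ => hR x)] at h1
  rw [heatT_const_nil hn hr (by positivity : 0 < T * lam) (by positivity) hb] at h1
  simpa using h1

lemma one_add_norm_shift_le (m : ℕ) (x h : Vec n) (hh : ‖h‖ ≤ 1) :
    (1 + ‖x + h‖) ^ (-(m : ℝ)) ≤ 2 ^ m * (1 + ‖x‖) ^ (-(m : ℝ)) := by
  rw [one_add_rpow_neg_natCast (norm_nonneg _), one_add_rpow_neg_natCast (norm_nonneg _),
    ← div_eq_mul_inv, inv_eq_one_div, div_le_div_iff₀ (by positivity) (by positivity), one_mul,
    ← mul_pow]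
  have : ‖x‖ ≤ ‖x + h‖ + ‖h‖ := by
    calc ‖x‖ = ‖(x + h) - h‖ := by simp
      _ ≤ _ := norm_sub_le _ _
  have h2 := norm_nonneg (x + h)
  gcongr
  linarith

lemma heatT_eq_conv (a : (Fin r → Fin n) → (H →L[ℂ] H)) (I : List (Fin n)) (f : Vec n → H)
    (x : Vec n) : heatT a I f x = ∫ y : Vec n, kerK a I (x - y) (f y) := by
  rw [heatT, ← integral_sub_left_eq_self _ volume x]
  simp

lemma HasLineDerivAt.hasDerivAt_add_smul {E E' : Type*} [NormedAddCommGroup E] [NormedSpace ℝ E]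
    [NormedAddCommGroup E'] [NormedSpace ℝ E'] {g : E → E'} {g' : E'} {x y e : E} {t : ℝ}
    (h : HasLineDerivAt ℝ g g' y e) (hy : y = x + t • e) :
    HasDerivAt (fun u : ℝ => g (x + u • e)) g' t := by
  unfold HasLineDerivAt at h
  have h2 := HasDerivAt.comp_sub_const (x := t) (a := t) (by simpa using h)
  refine h2.congr_of_eventuallyEq (Eventually.of_forall fun u => ?_)
  beta_reduce
  congr 1
  rw [hy]
  module

lemma hasDerivAt_clm_apply_vec {G : ℝ → H →L[ℂ] H} {G' : H →L[ℂ] H} {t : ℝ}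
    (h : HasDerivAt G G' t) (v : H) : HasDerivAt (fun u => G u v) (G' v) t := by
  have := (((ContinuousLinearMap.apply ℂ H v).restrictScalars ℝ).hasFDerivAt
    (x := G t)).comp_hasDerivAt t h
  exact this

lemma heatT_hasLineDerivAt (hn : 1 ≤ n) (hr : 2 ≤ r) {lam Lam : ℝ} (hlam : 0 < lam)
    (hLam : 0 ≤ Lam) {a : (Fin r → Fin n) → (H →L[ℂ] H)} (ha : EllCls lam Lam a)
    (I : List (Fin n)) (i : Fin n) {f : Vec n → H} (hf : Continuous f) {M : ℝ}
    (hM : ∀ x, ‖f x‖ ≤ M) (x : Vec n) :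
    HasLineDerivAt ℝ (heatT a I f) (heatT a (i :: I) f x) x (EuclideanSpace.single i (1 : ℝ)) := by
  obtain ⟨C, hC, hb⟩ := exists_kerK_bound H hn hr lam Lam hlam hLam (i :: I) (n + 1)
  have hM0 : 0 ≤ M := (norm_nonneg _).trans (hM 0)
  set e : Vec n := EuclideanSpace.single i (1 : ℝ)
  have he : ‖e‖ = 1 := by simp [e]
  have hKc := fun I => continuous_kerK hn hr hlam hLam ha I
  have hc : ∀ I (x : Vec n), Continuous fun y : Vec n => kerK a I (x - y) (f y) := fun I x =>
    ((hKc I).comp (continuous_const.sub continuous_id)).clm_apply hf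
  have hintg : Integrable fun y : Vec n => kerK a I (x - y) (f y) := by
    have := (heatT_integrable hn hr hlam hLam ha I hf hM x).comp_sub_left x
    simpa using this
  have := hasDerivAt_integral_of_dominated_loc_of_deriv_le (μ := volume)
    (F := fun (t : ℝ) (y : Vec n) => kerK a I (x + t • e - y) (f y))
    (F' := fun (t : ℝ) (y : Vec n) => kerK a (i :: I) (x + t • e - y) (f y))
    (s := Metric.ball 0 1) (x₀ := (0 : ℝ))
    (bound := fun y => C * (2 ^ (n + 1) * (1 + ‖x - y‖) ^ (-((n + 1 : ℕ) : ℝ))) * M)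
    (Metric.ball_mem_nhds 0 one_pos)
    (Eventually.of_forall fun t => (hc I _).aestronglyMeasurable)
    (by simpa using hintg)
    (hc (i :: I) _).aestronglyMeasurable
    (Eventually.of_forall fun y t ht => by
      refine (ContinuousLinearMap.le_opNorm _ _).trans ?_
      have h1 := hb a ha (x + t • e - y)
      have h2 := one_add_norm_shift_le (n + 1) (x - y) (t • e) (by
        rw [norm_smul, he, mul_one]; simpa using (Metric.mem_ball.1 ht).le)
      rw [show x + t • e - y = x - y + t • e by abel] at h1 ⊢
      gcongr
      · exact h1.trans (by gcongr)
      · exact hM y)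
    (by
      have := ((integrable_one_add_norm_vec (n := n) (n + 1) (by omega)).comp_sub_left x)
      exact ((this.const_mul _).const_mul _).mul_const _)
    (Eventually.of_forall fun y t _ => by
      have h1 := hasDerivAt_kerK_line hn hr hlam hLam ha I (x + t • e - y) i
      rw [add_sub_right_comm] at h1
      have h3 := h1.hasDerivAt_add_smul (x := x - y) (t := t) rfl
      have h4 := hasDerivAt_clm_apply_vec h3 (f y)
      simp only [add_sub_right_comm]
      exact h4)
  have h2 := this.2
  unfold HasLineDerivAt
  simp only [heatT_eq_conv]
  simpa using h2

end HeatOp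

section HeatOpParam

variable {n r : ℕ} {H : Type*} [NormedAddCommGroup H] [InnerProductSpace ℂ H] [CompleteSpace H]

lemma tendsto_integral_kerK (hn : 1 ≤ n) (hr : 2 ≤ r) {lam Lam M R : ℝ} (hlam : 0 < lam)
    (hLam : 0 ≤ Lam) {b a : (Fin r → Fin n) → (H →L[ℂ] H)} (hb : EllCls lam Lam b)
    (ha : ∀ J, ‖a J‖ ≤ M)
    (hc : ∀ ξ : Vec n, Commute (opSym b (toC ξ)) (opSym a (toC ξ))) (I : List (Fin n))
    {X : Type*} {l : Filter X} [l.IsCountablyGenerated] {τ : X → ℝ} (hτ : Tendsto τ l (𝓝 0))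
    {f : X → Vec n → H} {f₀ : Vec n → H} (hf : ∀ᶠ p in l, Continuous (f p))
    (hR : ∀ᶠ p in l, ∀ z, ‖f p z‖ ≤ R) (hlim : ∀ z, Tendsto (fun p => f p z) l (𝓝 (f₀ z))) :
    Tendsto (fun p => ∫ z : Vec n, kerK (b + τ p • a) I z (f p z)) l
      (𝓝 (∫ z : Vec n, kerK b I z (f₀ z))) := by
  have hM0 : 0 ≤ M := (norm_nonneg _).trans (ha (fun _ => ⟨0, hn⟩))
  obtain ⟨ε, hε, hp⟩ := EllCls.perturb hlam hM0 hb ha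
  obtain ⟨C, hC, hbd⟩ := exists_kerK_bound H hn hr (lam / 2) (Lam + M) (by positivity)
    (by positivity) I (n + 1)
  have hτε : ∀ᶠ p in l, |τ p| ≤ ε := by
    filter_upwards [hτ.eventually (Metric.ball_mem_nhds (0 : ℝ) hε)] with p hp
    simpa using (Metric.mem_ball.1 hp).le
  have hcK : ∀ z, Tendsto (fun p => kerK (b + τ p • a) I z) l (𝓝 (kerK b I z)) := by
    intro z
    have h1 := (hasDerivAt_kerK_coeff hn hr hlam hLam hb ha hM0 hc I z).continuousAt
    have h2 := h1.tendsto.comp hτ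
    simpa [Function.comp_def] using h2
  refine tendsto_integral_filter_of_dominated_convergence
    (fun z => C * (1 + ‖z‖) ^ (-((n + 1 : ℕ) : ℝ)) * R) ?_ ?_ ?_ ?_
  · filter_upwards [hf, hτε] with p h1 h2
    exact ((continuous_kerK hn hr (by positivity) (by positivity) (hp _ h2) I).clm_apply
      h1).aestronglyMeasurable
  · filter_upwards [hR, hτε] with p h1 h2
    refine Eventually.of_forall fun z => (ContinuousLinearMap.le_opNorm _ _).trans ?_
    have h3 := hbd _ (hp _ h2) z
    gcongr
    exact h1 z
  · exact ((integrable_one_add_norm_vec (n := n) (n + 1) (by omega)).const_mul _).mul_const _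
  · exact Eventually.of_forall fun z =>
      ((isBoundedBilinearMap_apply (𝕜 := ℂ) (E := H) (F := H)).continuous.tendsto
        (kerK b I z, f₀ z)).comp ((hcK z).prodMk_nhds (hlim z))

lemma hasDerivAt_clm_apply_real {G : ℝ → H →L[ℂ] H} {G' : H →L[ℂ] H} {v : ℝ → H} {v' : H} {t : ℝ}
    (h : HasDerivAt G G' t) (hv : HasDerivAt v v' t) :
    HasDerivAt (fun u => G u (v u)) (G' (v t) + G t v') t := by
  have h1 : HasDerivAt (fun u => ContinuousLinearMap.restrictScalarsL ℂ H H ℝ ℝ (G u))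
      (ContinuousLinearMap.restrictScalarsL ℂ H H ℝ ℝ G') t :=
    (ContinuousLinearMap.restrictScalarsL ℂ H H ℝ ℝ).hasFDerivAt.comp_hasDerivAt t (f := G) h
  exact h1.clm_apply hv

lemma hasDerivAt_heatT_param (hn : 1 ≤ n) (hr : 2 ≤ r) {lam Lam M R ε₀ s₀ : ℝ} (hlam : 0 < lam)
    (hLam : 0 ≤ Lam) {b a : (Fin r → Fin n) → (H →L[ℂ] H)} (hb : EllCls lam Lam b)
    (ha : ∀ J, ‖a J‖ ≤ M)
    (hc : ∀ (t : ℝ) (ξ : Vec n), Commute (opSym (b + t • a) (toC ξ)) (opSym a (toC ξ)))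
    (I : List (Fin n)) (hε₀ : 0 < ε₀) {w wt : Vec n → ℝ → H}
    (hw : ∀ s ∈ Metric.ball s₀ ε₀, Continuous fun y => w y s)
    (hwR : ∀ s ∈ Metric.ball s₀ ε₀, ∀ y, ‖w y s‖ ≤ R)
    (hwt : Continuous fun y => wt y s₀)
    (hwtR : ∀ s ∈ Metric.ball s₀ ε₀, ∀ y, ‖wt y s‖ ≤ R)
    (hd : ∀ s ∈ Metric.ball s₀ ε₀, ∀ y, HasDerivAt (w y) (wt y s) s) (x : Vec n) :
    HasDerivAt (fun s => heatT (b + (s - s₀) • a) I (fun y => w y s) x)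
      (∑ J, heatT b (List.ofFn J ++ I) (fun y => a J (w y s₀)) x
        + heatT b I (fun y => wt y s₀) x) s₀ := by
  have hM0 : 0 ≤ M := (norm_nonneg _).trans (ha (fun _ => ⟨0, hn⟩))
  have hs₀ : s₀ ∈ Metric.ball s₀ ε₀ := Metric.mem_ball_self hε₀
  have hR0 : 0 ≤ R := (norm_nonneg _).trans (hwR s₀ hs₀ 0)
  obtain ⟨ε, hε, hp⟩ := EllCls.perturb hlam hM0 hb ha
  choose C hC hbd using fun I => exists_kerK_bound H hn hr (lam / 2) (Lam + M) (by positivity)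
    (by positivity) I (n + 1)
  set ε₁ := min ε ε₀
  have hε₁ : 0 < ε₁ := lt_min hε hε₀
  have hp' : ∀ s ∈ Metric.ball s₀ ε₁, EllCls (lam / 2) (Lam + M) (b + (s - s₀) • a) := by
    intro s hs
    refine hp _ ?_
    rw [Metric.mem_ball, Real.dist_eq] at hs
    exact hs.le.trans (min_le_left _ _)
  have hs' : ∀ s ∈ Metric.ball s₀ ε₁, s ∈ Metric.ball s₀ ε₀ := fun s hs =>
    Metric.ball_subset_ball (min_le_right _ _) hs
  have hs₁ : s₀ ∈ Metric.ball s₀ ε₁ := Metric.mem_ball_self hε₁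
  have hl2 : 0 < lam / 2 := by positivity
  have hL2 : 0 ≤ Lam + M := by positivity
  have hcw : ∀ s ∈ Metric.ball s₀ ε₀, Continuous fun z => w (x - z) s := fun s hs =>
    (hw s hs).comp (continuous_const.sub continuous_id)
  have hb' : EllCls (lam / 2) (Lam + M) b := by simpa using hp' s₀ hs₁
  set ρ : Vec n → ℝ := fun z => (1 + ‖z‖) ^ (-((n + 1 : ℕ) : ℝ))
  have hρ : Integrable ρ := integrable_one_add_norm_vec (n := n) (n + 1) (by omega)
  have key := hasDerivAt_integral_of_dominated_loc_of_deriv_le (μ := volume)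
    (F := fun (s : ℝ) (z : Vec n) => kerK (b + (s - s₀) • a) I z (w (x - z) s))
    (F' := fun (s : ℝ) (z : Vec n) =>
      (∑ J, kerK (b + (s - s₀) • a) (List.ofFn J ++ I) z * a J) (w (x - z) s)
        + kerK (b + (s - s₀) • a) I z (wt (x - z) s))
    (s := Metric.ball s₀ ε₁) (x₀ := s₀)
    (bound := fun z => (∑ J : Fin r → Fin n, C (List.ofFn J ++ I) * ρ z * M) * R + C I * ρ z * R)
    (Metric.ball_mem_nhds s₀ hε₁)
    (by
      filter_upwards [Metric.ball_mem_nhds s₀ hε₁] with s hs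
      exact ((continuous_kerK hn hr hl2 hL2 (hp' s hs) I).clm_apply
        (hcw s (hs' s hs))).aestronglyMeasurable)
    (by
      simp only [sub_self, zero_smul, add_zero]
      exact heatT_integrable hn hr hl2 hL2 hb' I (hw s₀ hs₀) (hwR s₀ hs₀) x)
    (by
      simp only [sub_self, zero_smul, add_zero]
      refine Continuous.aestronglyMeasurable (Continuous.add ?_ ?_)
      · refine Continuous.clm_apply (continuous_finsetSum _ fun J _ => ?_) (hcw s₀ hs₀)
        exact (continuous_kerK hn hr hl2 hL2 hb' _).mul continuous_const
      · exact (continuous_kerK hn hr hl2 hL2 hb' I).clm_apply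
          (hwt.comp (continuous_const.sub continuous_id)))
    (Eventually.of_forall fun z s hs => by
      refine (norm_add_le _ _).trans (add_le_add ?_ ?_)
      · refine (ContinuousLinearMap.le_opNorm _ _).trans ?_
        have h1 : ‖∑ J : Fin r → Fin n, kerK (b + (s - s₀) • a) (List.ofFn J ++ I) z * a J‖
            ≤ ∑ J : Fin r → Fin n, C (List.ofFn J ++ I) * ρ z * M := by
          refine norm_sum_le_of_le _ fun J _ => (norm_mul_le _ _).trans ?_
          have h2 := hbd (List.ofFn J ++ I) _ (hp' s hs) z
          have h3 := ha J
          gcongr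
          exact (norm_nonneg _).trans h2
        gcongr
        · exact (norm_nonneg _).trans h1
        · exact hwR s (hs' s hs) _
      · refine (ContinuousLinearMap.le_opNorm _ _).trans ?_
        have h2 := hbd I _ (hp' s hs) z
        gcongr
        · exact (norm_nonneg _).trans h2
        · exact hwtR s (hs' s hs) _)
    (by
      refine Integrable.add (Integrable.mul_const (integrable_finsetSum _ fun J _ => ?_) _) ?_
      · exact (hρ.const_mul _).mul_const _
      · exact (hρ.const_mul _).mul_const _)
    (Eventually.of_forall fun z s hs => by
      have h1 := hasDerivAt_kerK_coeff hn hr hl2 hL2 (hp' s hs) ha hM0 (hc (s - s₀)) I z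
      have h2 : HasDerivAt (fun u : ℝ => kerK (b + (u - s₀) • a) I z)
          (∑ J, kerK (b + (s - s₀) • a) (List.ofFn J ++ I) z * a J) s := by
        have h3 := HasDerivAt.comp_sub_const (x := s) (a := s) (by simpa using h1)
        refine h3.congr_of_eventuallyEq (Eventually.of_forall fun u => ?_)
        have e1 : b + (u - s₀) • a = b + (s - s₀) • a + (u - s) • a := by module
        beta_reduce
        rw [e1]
      exact hasDerivAt_clm_apply_real h2 (hd s (hs' s hs) (x - z)))
  have h2 := key.2
  have e : (∑ J, heatT b (List.ofFn J ++ I) (fun y => a J (w y s₀)) x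
        + heatT b I (fun y => wt y s₀) x) = ∫ z : Vec n,
      (∑ J, kerK (b + (s₀ - s₀) • a) (List.ofFn J ++ I) z * a J) (w (x - z) s₀)
        + kerK (b + (s₀ - s₀) • a) I z (wt (x - z) s₀) := by
    simp only [sub_self, zero_smul, add_zero]
    have i1 : ∀ J, Integrable fun z => kerK b (List.ofFn J ++ I) z (a J (w (x - z) s₀)) := fun J =>
      heatT_integrable hn hr hl2 hL2 hb' _ (f := fun y => a J (w y s₀)) (M := M * R)
        ((a J).continuous.comp (hw s₀ hs₀)) (fun y => (ContinuousLinearMap.le_opNorm _ _).trans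
          (mul_le_mul (ha J) (hwR s₀ hs₀ y) (norm_nonneg _) hM0)) x
    have i2 : Integrable fun z => kerK b I z (wt (x - z) s₀) :=
      heatT_integrable hn hr hl2 hL2 hb' _ hwt (hwtR s₀ hs₀) x
    simp only [heatT]
    rw [← integral_finsetSum _ fun J _ => i1 J, ← integral_add (integrable_finsetSum _ fun J _ =>
      i1 J) i2]
    congr 1
    ext1 z
    simp
  rw [e]
  exact h2

end HeatOpParam

section Partials

variable {n : ℕ} {E : Type*} [NormedAddCommGroup E] [NormedSpace ℝ E]

lemma norm_le_of_coord_le {x y : Vec n} (h : ∀ j, ‖x j‖ ≤ ‖y j‖) : ‖x‖ ≤ ‖y‖ := by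
  rw [EuclideanSpace.norm_eq, EuclideanSpace.norm_eq]
  gcongr
  exact h _

lemma norm_sub_sub_sum_partials_le {f : Vec n → E} {G : Fin n → Vec n → E}
    (hf : ∀ i y, HasLineDerivAt ℝ f (G i y) y (EuclideanSpace.single i (1 : ℝ)))
    (x : Vec n) (c : Fin n → E) (ε : ℝ) (h : Vec n)
    (hc : ∀ i y, ‖y - x‖ ≤ ‖h‖ → ‖G i y - c i‖ ≤ ε) :
    ‖f (x + h) - f x - ∑ i, h i • c i‖ ≤ n * ε * ‖h‖ := by
  have key : ∀ s : Finset (Fin n),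
      ‖f (x + ∑ i ∈ s, EuclideanSpace.single i (h i)) - f x - ∑ i ∈ s, h i • c i‖
        ≤ s.card * ε * ‖h‖ := by
    intro s
    induction s using Finset.induction_on with
    | empty => simp
    | insert i s hi ih =>
      rw [Finset.sum_insert hi, Finset.sum_insert hi, Finset.card_insert_of_notMem hi]
      set y := x + ∑ i ∈ s, EuclideanSpace.single i (h i) with hy
      have hcoord : ∀ θ : ℝ, |θ| ≤ |h i| →
          ‖y + θ • EuclideanSpace.single i (1 : ℝ) - x‖ ≤ ‖h‖ := by
        intro θ hθ
        refine norm_le_of_coord_le fun j => ?_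
        have e : (y + θ • EuclideanSpace.single i (1 : ℝ) - x) j
            = (∑ k ∈ s, if j = k then h k else 0) + if j = i then θ else 0 := by
          simp [hy, Pi.single_apply]
          ring
        rw [e]
        simp only [Finset.sum_ite_eq]
        by_cases hji : j = i
        · subst hji; simpa [hi] using hθ
        · by_cases hjs : j ∈ s <;> simp [hji, hjs]
      have hmv : ‖f (y + h i • EuclideanSpace.single i (1 : ℝ)) - f y - h i • c i‖
          ≤ ε * ‖h‖ := by
        have hder : ∀ θ ∈ Icc (0 : ℝ) 1, HasDerivWithinAt
            (fun θ : ℝ => f (y + (θ * h i) • EuclideanSpace.single i (1 : ℝ)) - (θ * h i) • c i)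
            (h i • (G i (y + (θ * h i) • EuclideanSpace.single i (1 : ℝ)) - c i)) (Icc 0 1) θ := by
          intro θ _
          have h1 := (hf i (y + (θ * h i) • EuclideanSpace.single i (1 : ℝ))).hasDerivAt_add_smul
            (x := y) (t := θ * h i) rfl
          have h0 : HasDerivAt (fun u : ℝ => u * h i) (h i) θ := by
            simpa using (hasDerivAt_id θ).mul_const (h i)
          have h2 := HasDerivAt.scomp (h := fun u : ℝ => u * h i) θ h1 h0
          have h3 := h0.smul_const (c i)
          have h4 := h2.sub h3
          rw [← smul_sub] at h4
          exact h4.hasDerivWithinAt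
        have hbound : ∀ θ ∈ Ico (0 : ℝ) 1,
            ‖h i • (G i (y + (θ * h i) • EuclideanSpace.single i (1 : ℝ)) - c i)‖ ≤ ε * ‖h‖ := by
          intro θ hθ
          rw [norm_smul, mul_comm]
          have h1 := hc i (y + (θ * h i) • EuclideanSpace.single i (1 : ℝ)) (hcoord _ (by
            rw [abs_mul, abs_of_nonneg hθ.1]
            exact mul_le_of_le_one_left (abs_nonneg _) hθ.2.le))
          have h2 : ‖h i‖ ≤ ‖h‖ := PiLp.norm_apply_le h i
          gcongr
          exact (norm_nonneg _).trans h1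
        have := norm_image_sub_le_of_norm_deriv_le_segment_01' hder hbound
        simpa [sub_right_comm] using this
      have e1 : x + (EuclideanSpace.single i (h i) + ∑ i ∈ s, EuclideanSpace.single i (h i))
          = y + h i • EuclideanSpace.single i (1 : ℝ) := by
        have e2 : EuclideanSpace.single i (h i) = h i • EuclideanSpace.single i (1 : ℝ) := by
          ext j
          simp
        rw [e2, hy]; abel
      rw [e1]
      calc _ = ‖(f (y + h i • EuclideanSpace.single i (1 : ℝ)) - f y - h i • c i)
            + (f y - f x - ∑ i ∈ s, h i • c i)‖ := by congr 1; abel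
        _ ≤ ε * ‖h‖ + s.card * ε * ‖h‖ := (norm_add_le _ _).trans (add_le_add hmv ih)
        _ = _ := by push_cast; ring
  have h1 := key Finset.univ
  have e : ∑ i, EuclideanSpace.single i (h i) = h := by
    ext j
    simp [Pi.single_apply]
  rw [e] at h1
  simpa using h1

end Partials

section LinearSolutions

variable {n r : ℕ} {H : Type*} [NormedAddCommGroup H] [InnerProductSpace ℂ H] [CompleteSpace H]

/-- A bounded family of iterated line derivatives up to order `r`. -/
structure Jets (r : ℕ) (e : List (Fin n) → Vec n → H) (R : ℝ) : Prop where
  cont : ∀ I, I.length ≤ r → Continuous (e I)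
  bd : ∀ I, I.length ≤ r → ∀ x, ‖e I x‖ ≤ R
  line : ∀ I i, I.length < r → ∀ x,
    HasLineDerivAt ℝ (e I) (e (i :: I) x) x (EuclideanSpace.single i (1 : ℝ))

/-- Coefficient families that are multiples of the identity. -/
def ScalarCoef (a : (Fin r → Fin n) → (H →L[ℂ] H)) : Prop := ∀ J, ∃ c : ℂ, a J = c • 1

/-- Hölder continuous uniformly elliptic coefficients. -/
structure HolCoef (lam Lam α Ha : ℝ) (a : Vec n → (Fin r → Fin n) → (H →L[ℂ] H)) : Prop where
  cls : ∀ x, EllCls lam Lam (a x)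
  hol : ∀ x y J, ‖a x J - a y J‖ ≤ Ha * ‖x - y‖ ^ α

/-- A solution on `[0,δ]` of the linear equation with leading coefficients `a`,
right-hand side `f` and zero initial value, together with its jets and time derivative. -/
structure LinSol (δ R : ℝ) (a : Vec n → (Fin r → Fin n) → (H →L[ℂ] H)) (f : Vec n → ℝ → H)
    (d : List (Fin n) → Vec n → ℝ → H) (wt : Vec n → ℝ → H) : Prop where
  jets : ∀ t ∈ Icc 0 δ, Jets r (fun I x => d I x t) R
  time : ∀ x, ∀ t ∈ Icc 0 δ, HasDerivWithinAt (d [] x) (wt x t) (Icc 0 δ) t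
  zero : ∀ x, d [] x 0 = 0
  wt_cont : ∀ t ∈ Icc 0 δ, Continuous fun x => wt x t
  wt_bd : ∀ t ∈ Icc 0 δ, ∀ x, ‖wt x t‖ ≤ R
  eq : ∀ t ∈ Icc 0 δ, ∀ x, wt x t = ∑ J, a x J (d (List.ofFn J) x t) + f x t

lemma Jets.map {e : List (Fin n) → Vec n → H} {R : ℝ} (h : Jets r e R) (A : H →L[ℂ] H) :
    Jets r (fun I x => A (e I x)) (‖A‖ * R) where
  cont I hI := A.continuous.comp (h.cont I hI)
  bd I hI x := (A.le_opNorm _).trans (by gcongr; exact h.bd I hI x)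
  line I i hI x := by
    have h1 := h.line I i hI x
    unfold HasLineDerivAt at h1 ⊢
    exact (A.restrictScalars ℝ).hasFDerivAt.comp_hasDerivAt (0 : ℝ) h1

lemma Jets.sub {e e' : List (Fin n) → Vec n → H} {R R' : ℝ} (h : Jets r e R) (h' : Jets r e' R') :
    Jets r (fun I x => e I x - e' I x) (R + R') where
  cont I hI := (h.cont I hI).sub (h'.cont I hI)
  bd I hI x := (norm_sub_le _ _).trans (add_le_add (h.bd I hI x) (h'.bd I hI x))
  line I i hI x := by
    have h1 := h.line I i hI x
    have h2 := h'.line I i hI x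
    unfold HasLineDerivAt at h1 h2 ⊢
    exact h1.sub h2

lemma Jets.heatT_eq (hn : 1 ≤ n) (hr : 2 ≤ r) {lam Lam : ℝ} (hlam : 0 < lam) (hLam : 0 ≤ Lam)
    {b : (Fin r → Fin n) → (H →L[ℂ] H)} (hb : EllCls lam Lam b)
    {e : List (Fin n) → Vec n → H} {R : ℝ} (h : Jets r e R) (J : List (Fin n)) :
    ∀ (I : List (Fin n)), J.length ≤ r → ∀ x,
      heatT b I (e J) x = heatT b (J ++ I) (e []) x := by
  induction J with
  | nil => intro I _ x; rfl
  | cons i J ih =>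
    intro I hJ x
    simp only [List.length_cons] at hJ
    rw [heatT_ibp hn hr hlam hLam hb I i (h.cont J (by omega)) (h.bd J (by omega))
      (h.cont (i :: J) (by simpa using hJ)) (h.bd (i :: J) (by simpa using hJ))
      (h.line J i (by omega)), ih (i :: I) (by omega) x]
    exact congrFun (congrFun (heatT_perm b (List.perm_middle)) _) _

lemma heatT_scale (a : (Fin r → Fin n) → (H →L[ℂ] H)) (I : List (Fin n)) (f : Vec n → H)
    (x : Vec n) {c : ℝ} (hc : 0 < c) :
    heatT ((c ^ r)⁻¹ • a) I f x = c ^ I.length • ∫ z : Vec n, kerK a I z (f (x - c⁻¹ • z)) := by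
  have h1 := Measure.integral_comp_smul (volume : Measure (Vec n))
    (fun z => kerK a I z (f (x - c⁻¹ • z))) c
  simp only [smul_smul, inv_mul_cancel₀ hc.ne', one_smul] at h1
  rw [heatT]
  simp only [kerK_scale a I _ hc]
  have e : ∀ z, (c ^ (n + I.length) • kerK a I (c • z)) (f (x - z))
      = c ^ (n + I.length) • (kerK a I (c • z) (f (x - z))) := fun z => rfl
  simp only [e, integral_smul, h1, smul_smul]
  congr 1
  have : |(c ^ Module.finrank ℝ (Vec n))⁻¹| = (c ^ n)⁻¹ := by
    rw [abs_of_pos (by positivity)]; simp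
  rw [this, pow_add]
  field_simp

lemma tendsto_heatT_nil (hn : 1 ≤ n) (hr : 2 ≤ r) {lam Lam : ℝ} (hlam : 0 < lam)
    (hLam : 0 ≤ Lam) {a : (Fin r → Fin n) → (H →L[ℂ] H)} (ha : EllCls lam Lam a)
    {f : Vec n → H} (hf : Continuous f) {R : ℝ} (hR : ∀ y, ‖f y‖ ≤ R) (x : Vec n) :
    Tendsto (fun σ : ℝ => heatT (σ • a) [] f x) (𝓝[>] 0) (𝓝 (f x)) := by
  have hr0 : (r : ℝ) ≠ 0 := by positivity
  have e : ∀ σ ∈ Ioi (0 : ℝ), ∫ z : Vec n, kerK a [] z (f (x - σ ^ (1 / (r : ℝ)) • z))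
      = heatT (σ • a) [] f x := by
    intro σ hσ
    have hσ' : (0 : ℝ) < σ := hσ
    have h1 := heatT_scale a [] f x (c := σ ^ (-(1 / (r : ℝ)))) (by positivity)
    have e1 : ((σ ^ (-(1 / (r : ℝ)))) ^ r)⁻¹ = σ := by
      rw [← Real.rpow_mul_natCast hσ'.le, ← Real.rpow_neg hσ'.le]
      simp [hr0]
    have e2 : (σ ^ (-(1 / (r : ℝ))))⁻¹ = σ ^ (1 / (r : ℝ)) := by
      rw [Real.rpow_neg hσ'.le, inv_inv]
    rw [e1, e2] at h1
    simpa using h1.symm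
  have hlim : Tendsto (fun σ : ℝ => ∫ z : Vec n, kerK a [] z (f (x - σ ^ (1 / (r : ℝ)) • z)))
      (𝓝[>] 0) (𝓝 (∫ z : Vec n, kerK a [] z (f x))) := by
    refine tendsto_integral_filter_of_dominated_convergence (fun z => ‖kerK a [] z‖ * R) ?_ ?_ ?_ ?_
    · refine Eventually.of_forall fun σ => Continuous.aestronglyMeasurable ?_
      exact (continuous_kerK hn hr hlam hLam ha []).clm_apply
        (hf.comp (by fun_prop))
    · refine Eventually.of_forall fun σ => Eventually.of_forall fun z =>
        (ContinuousLinearMap.le_opNorm _ _).trans ?_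
      gcongr
      exact hR _
    · exact (kerK_integrable hn hr hlam hLam ha []).norm.mul_const R
    · refine Eventually.of_forall fun z => ?_
      have h1 : Tendsto (fun σ : ℝ => σ ^ (1 / (r : ℝ))) (𝓝[>] 0) (𝓝 0) := by
        have h2 := (Real.continuousAt_rpow_const 0 (1 / (r : ℝ)) (Or.inr (by positivity))).tendsto
        rw [Real.zero_rpow (by positivity)] at h2
        exact h2.mono_left nhdsWithin_le_nhds
      have h3 : Tendsto (fun σ : ℝ => x - σ ^ (1 / (r : ℝ)) • z) (𝓝[>] 0) (𝓝 x) := by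
        simpa using tendsto_const_nhds.sub (h1.smul_const z)
      exact ((kerK a [] z).continuous.tendsto _).comp ((hf.tendsto x).comp h3)
  have h2 : ∫ z : Vec n, kerK a [] z (f x) = f x := heatT_const_nil hn hr hlam hLam ha (f x) x
  rw [h2] at hlim
  exact hlim.congr' (eventually_mem_nhdsWithin.mono e)

lemma ScalarCoef.commute {a : (Fin r → Fin n) → (H →L[ℂ] H)} (h : ScalarCoef a)
    (b : (Fin r → Fin n) → (H →L[ℂ] H)) (ζ : Fin n → ℂ) : Commute (opSym a ζ) (opSym b ζ) := by
  unfold opSym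
  refine Commute.sum_left _ _ _ fun J _ => ?_
  obtain ⟨c, hc⟩ := h J
  rw [hc]
  exact ((Commute.one_left _).smul_left c).smul_left _

end LinearSolutions

section LinearEstimates

variable {n r : ℕ} {H : Type*} [NormedAddCommGroup H] [InnerProductSpace ℂ H] [CompleteSpace H]

lemma LinSol.frozen_holder {δ R R' lam Lam Ha Mf α : ℝ}
    {a : Vec n → (Fin r → Fin n) → (H →L[ℂ] H)} {f : Vec n → ℝ → H}
    {d : List (Fin n) → Vec n → ℝ → H} {wt : Vec n → ℝ → H} (h : LinSol δ R a f d wt)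
    (ha : HolCoef lam Lam α Ha a) (hHa : 0 ≤ Ha) {t : ℝ} (ht : t ∈ Icc 0 δ)
    (hf : ∀ x y, ‖f x t - f y t‖ ≤ Mf * ‖x - y‖ ^ α)
    (hR' : ∀ (J : Fin r → Fin n) x, ‖d (List.ofFn J) x t‖ ≤ R') (x y : Vec n) :
    ‖(wt y t - ∑ J, a x J (d (List.ofFn J) y t)) - (wt x t - ∑ J, a x J (d (List.ofFn J) x t))‖
      ≤ (Mf + (n : ℝ) ^ r * Ha * R') * ‖y - x‖ ^ α := by
  have e : (wt y t - ∑ J, a x J (d (List.ofFn J) y t)) - (wt x t - ∑ J, a x J (d (List.ofFn J) x t))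
      = (f y t - f x t) + ∑ J, (a y J - a x J) (d (List.ofFn J) y t) := by
    rw [h.eq t ht y, h.eq t ht x]
    simp only [sub_apply, Finset.sum_sub_distrib]
    abel
  rw [e]
  refine (norm_add_le _ _).trans ?_
  have h1 : ‖∑ J, (a y J - a x J) (d (List.ofFn J) y t)‖
      ≤ ∑ _J : Fin r → Fin n, Ha * ‖y - x‖ ^ α * R' := by
    refine norm_sum_le_of_le _ fun J _ => (ContinuousLinearMap.le_opNorm _ _).trans ?_
    have h2 := ha.hol y x J
    have h3 := hR' J y
    gcongr
  have h2 : ∑ _J : Fin r → Fin n, Ha * ‖y - x‖ ^ α * R' = (n : ℝ) ^ r * Ha * R' * ‖y - x‖ ^ α := by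
    rw [Finset.sum_const, Finset.card_univ, Fintype.card_fun, Fintype.card_fin, Fintype.card_fin,
      nsmul_eq_mul]
    push_cast
    ring
  have h3 := hf y x
  linarith [h1.trans_eq h2]

lemma exists_heatT_linSol_bound (H : Type*) [NormedAddCommGroup H] [InnerProductSpace ℂ H]
    [CompleteSpace H] (hn : 1 ≤ n) (hr : 2 ≤ r) (lam Lam α : ℝ) (hlam : 0 < lam) (hLam : 0 ≤ Lam)
    (hα0 : 0 < α) (hα1 : α < 1) (K : List (Fin n)) (hK : r + 1 ≤ K.length) :
    ∃ C : ℝ, 0 ≤ C ∧ ∀ (a₀ : (Fin r → Fin n) → (H →L[ℂ] H)), EllCls lam Lam a₀ → ScalarCoef a₀ →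
      ∀ (δ R R' Ha Mf : ℝ) (a : Vec n → (Fin r → Fin n) → (H →L[ℂ] H)) (f : Vec n → ℝ → H)
        (d : List (Fin n) → Vec n → ℝ → H) (wt : Vec n → ℝ → H), LinSol δ R a f d wt →
        HolCoef lam Lam α Ha a → 0 ≤ Ha →
        (∀ t ∈ Icc 0 δ, ∀ x y, ‖f x t - f y t‖ ≤ Mf * ‖x - y‖ ^ α) →
        (∀ (J : Fin r → Fin n), ∀ t ∈ Icc 0 δ, ∀ x, ‖d (List.ofFn J) x t‖ ≤ R') →
        ∀ σ : ℝ, 0 < σ → ∀ t ∈ Icc 0 δ, ∀ x,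
          ‖heatT (σ • a₀) K (fun y => d [] y t) x‖
            ≤ C * (Mf + Ha * R') * σ ^ ((α - K.length) / r + 1) := by
  obtain ⟨C, hC, hb⟩ := exists_heatT_holder_bound H hn hr lam Lam hlam hLam K (by
    rintro rfl; simp at hK)
  have hrpos : (0 : ℝ) < r := by positivity
  set p : ℝ := (α - K.length) / r with hp
  have hp1 : p + 1 < 0 := by
    have : (r : ℝ) + 1 ≤ K.length := by exact_mod_cast hK
    have h2 : p < -1 := by
      rw [hp, div_lt_iff₀ hrpos]; linarith
    linarith
  refine ⟨C * (1 + (n : ℝ) ^ r) * (-(p + 1))⁻¹, by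
    have : 0 < -(p + 1) := by linarith
    positivity, ?_⟩
  intro a₀ ha₀ hsc δ R R' Ha Mf a f d wt h ha hHa hf hR' σ hσ t ht x
  have h0δ : (0 : ℝ) ∈ Icc 0 δ := ⟨le_rfl, ht.1.trans ht.2⟩
  have hMf : 0 ≤ Mf := by
    have h1 := (norm_nonneg _).trans (hf 0 h0δ (EuclideanSpace.single ⟨0, hn⟩ 1) 0)
    simpa using h1
  have hR'0 : 0 ≤ R' := (norm_nonneg _).trans (hR' (fun _ => ⟨0, hn⟩) 0 h0δ 0)
  have hR0 : 0 ≤ R := (norm_nonneg _).trans (h.wt_bd 0 h0δ 0)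
  set b : ℝ → (Fin r → Fin n) → (H →L[ℂ] H) := fun s => (t - s) • a x + σ • a₀ with hbdef
  have hbc : ∀ s ∈ Icc 0 t, EllCls ((t - s + σ) * lam) ((t - s + σ) * Lam) (b s) := by
    intro s hs
    have := ((ha.cls x).smul (t := t - s) (by linarith [hs.2])).add (ha₀.smul hσ.le)
    rwa [← add_mul, ← add_mul] at this
  have hpos : ∀ s ∈ Icc 0 t, 0 < t - s + σ := fun s hs => by linarith [hs.2]
  have hbs : ∀ s s₀ : ℝ, b s = b s₀ + (s - s₀) • (-(a x)) := by
    intro s s₀; simp only [hbdef]; module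
  have hcomm : ∀ (s u : ℝ) (ξ : Vec n),
      Commute (opSym (b s + u • (-(a x))) (toC ξ)) (opSym (-(a x)) (toC ξ)) := by
    intro s u ξ
    have e : b s + u • (-(a x)) = (t - s - u) • a x + σ • a₀ := by simp only [hbdef]; module
    have e2 : -(a x) = (-1 : ℝ) • a x := by module
    rw [e, e2, opSym_add, opSym_smul, opSym_smul, opSym_smul]
    refine Commute.add_left ?_ ?_
    · exact ((Commute.refl _).smul_left _).smul_right _
    · exact ((hsc.commute _ _).smul_left _).smul_right _
  have hLa : ∀ J, ‖(-(a x)) J‖ ≤ Lam := fun J => by simpa using (ha.cls x).bd J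
  set g : ℝ → Vec n → H := fun s y => wt y s - ∑ J, a x J (d (List.ofFn J) y s) with hg
  have hsub : ∀ s ∈ Icc 0 t, s ∈ Icc 0 δ := fun s hs => ⟨hs.1, hs.2.trans ht.2⟩
  have hgc : ∀ s ∈ Icc 0 δ, Continuous (g s) := by
    intro s hs
    refine (h.wt_cont s hs).sub (continuous_finsetSum _ fun J _ => ?_)
    exact (a x J).continuous.comp ((h.jets s hs).cont _ (by simp))
  have hgb : ∀ s ∈ Icc 0 δ, ∀ y, ‖g s y‖ ≤ R + ∑ _J : Fin r → Fin n, Lam * R := by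
    intro s hs y
    refine (norm_sub_le _ _).trans (add_le_add (h.wt_bd s hs y) (norm_sum_le_of_le _ fun J _ => ?_))
    refine (ContinuousLinearMap.le_opNorm _ _).trans ?_
    have h1 := (ha.cls x).bd J
    have h2 := (h.jets s hs).bd (List.ofFn J) (by simp) y
    gcongr
  set W : ℝ → H := fun s => heatT (b s) K (fun y => d [] y s) x with hW
  have hWd : ∀ s ∈ Ioo 0 t, HasDerivAt W (heatT (b s) K (g s) x) s := by
    intro s hs
    have hs' : s ∈ Icc 0 t := Ioo_subset_Icc_self hs
    obtain ⟨ε, hε, hball⟩ := Metric.isOpen_iff.1 isOpen_Ioo s hs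
    have hball' : ∀ u ∈ Metric.ball s ε, u ∈ Icc 0 δ := fun u hu =>
      hsub u (Ioo_subset_Icc_self (hball hu))
    have hl : 0 < (t - s + σ) * lam := mul_pos (hpos s hs') hlam
    have hL : 0 ≤ (t - s + σ) * Lam := mul_nonneg (hpos s hs').le hLam
    have h1 := hasDerivAt_heatT_param hn hr (s₀ := s) (R := R) hl hL
      (hbc s hs') hLa (fun u ξ => hcomm s u ξ) K hε
      (w := d []) (wt := wt)
      (fun u hu => (h.jets u (hball' u hu)).cont [] (by simp))
      (fun u hu => (h.jets u (hball' u hu)).bd [] (by simp))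
      (h.wt_cont s (hsub s hs'))
      (fun u hu => h.wt_bd u (hball' u hu))
      (fun u hu y => (h.time y u (hball' u hu)).hasDerivAt (Icc_mem_nhds
        (hball hu).1 ((hball hu).2.trans_le ht.2))) x
    have e1 : (∑ J, heatT (b s) (List.ofFn J ++ K) (fun y => (-(a x)) J (d [] y s)) x
        + heatT (b s) K (fun y => wt y s) x) = heatT (b s) K (g s) x := by
      have e2 : ∀ J : Fin r → Fin n, heatT (b s) (List.ofFn J ++ K)
          (fun y => (-(a x)) J (d [] y s)) x
          = heatT (b s) K (fun y => (-(a x)) J (d (List.ofFn J) y s)) x := fun J =>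
        (((h.jets s (hsub s hs')).map ((-(a x)) J)).heatT_eq hn hr hl hL (hbc s hs') (List.ofFn J) K
          (by simp) x).symm
      simp only [e2]
      have hcj : ∀ J ∈ (Finset.univ : Finset (Fin r → Fin n)),
          Continuous fun y => (-(a x)) J (d (List.ofFn J) y s) := fun J _ =>
        ((h.jets s (hsub s hs')).map ((-(a x)) J)).cont _ (by simp)
      have hbj : ∀ J ∈ (Finset.univ : Finset (Fin r → Fin n)), ∀ y,
          ‖(-(a x)) J (d (List.ofFn J) y s)‖ ≤ ‖(-(a x)) J‖ * R := fun J _ =>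
        ((h.jets s (hsub s hs')).map ((-(a x)) J)).bd _ (by simp)
      rw [← heatT_sum hn hr hl hL (hbc s hs') K Finset.univ hcj hbj,
        ← heatT_add hn hr hl hL (hbc s hs') K (continuous_finsetSum _ hcj)
          (M := ∑ J, ‖(-(a x)) J‖ * R) (fun y => norm_sum_le_of_le _ fun J hJ => hbj J hJ y)
          (h.wt_cont s (hsub s hs')) (h.wt_bd s (hsub s hs'))]
      congr 1
      ext1 y
      simp only [hg, Pi.neg_apply, neg_apply, Finset.sum_neg_distrib]
      abel
    rw [e1] at h1
    refine h1.congr_of_eventuallyEq (Eventually.of_forall fun u => ?_)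
    simp only [hW]
    rw [hbs u s]
  have hWc : ContinuousOn W (Icc 0 t) := by
    intro s hs
    have hl : 0 < (t - s + σ) * lam := mul_pos (hpos s hs) hlam
    have hL : 0 ≤ (t - s + σ) * Lam := mul_nonneg (hpos s hs).le hLam
    have h1 := tendsto_integral_kerK hn hr hl hL (hbc s hs) hLa
      (fun ξ => by simpa using hcomm s 0 ξ) K (l := 𝓝[Icc 0 t] s) (τ := fun u => u - s) (R := R)
      (by
        have : Tendsto (fun u : ℝ => u - s) (𝓝 s) (𝓝 (s - s)) :=
          (continuous_id.sub continuous_const).tendsto s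
        rw [sub_self] at this
        exact this.mono_left nhdsWithin_le_nhds)
      (f := fun u z => d [] (x - z) u) (f₀ := fun z => d [] (x - z) s)
      (eventually_mem_nhdsWithin.mono fun u hu =>
        ((h.jets u (hsub u hu)).cont [] (by simp)).comp (continuous_const.sub continuous_id))
      (eventually_mem_nhdsWithin.mono fun u hu z => (h.jets u (hsub u hu)).bd [] (by simp) _)
      (fun z => ((h.time (x - z) s (hsub s hs)).continuousWithinAt.mono
        (Icc_subset_Icc_right ht.2)).tendsto)
    refine h1.congr fun u => ?_
    simp only [hW, heatT]
    rw [hbs u s]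
  set M' := Mf + (n : ℝ) ^ r * Ha * R' with hM'
  have hWb : ∀ s ∈ Ioo 0 t, ‖heatT (b s) K (g s) x‖ ≤ C * (t - s + σ) ^ p * M' := by
    intro s hs
    have hs' : s ∈ Icc 0 t := Ioo_subset_Icc_self hs
    exact hb (t - s + σ) (hpos s hs') (b s) (hbc s hs') α hα0.le hα1.le (g s) (hgc s (hsub s hs')) _
      (hgb s (hsub s hs')) M' x fun y =>
        h.frozen_holder ha hHa (hsub s hs') (hf s (hsub s hs'))
          (fun J x => hR' J s (hsub s hs') x) x y
  have hB : ∀ s ∈ Icc 0 t, HasDerivAt (fun s => C * M' * (-(p + 1))⁻¹ * (t - s + σ) ^ (p + 1))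
      (C * (t - s + σ) ^ p * M') s := by
    intro s hs
    have h1 : HasDerivAt (fun s : ℝ => t - s + σ) (-1) s := by
      simpa using ((hasDerivAt_id s).const_sub t).add_const σ
    have h2 := (h1.rpow_const (p := p + 1) (Or.inl (hpos s hs).ne')).const_mul
      (C * M' * (-(p + 1))⁻¹)
    refine h2.congr_deriv ?_
    have : -(p + 1) ≠ 0 := by linarith
    rw [add_sub_cancel_right]
    have h3 : (-(p + 1))⁻¹ * (p + 1) = -1 := by
      rw [inv_mul_eq_div, div_eq_iff this]; ring
    linear_combination (- C * M' * (t - s + σ) ^ p) * h3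
  have key := norm_sub_le_of_hasDerivAt_le ht.1 hWc hWd
    (fun s hs => (hB s hs).continuousAt.continuousWithinAt)
    (fun s hs => hB s (Ioo_subset_Icc_self hs)) hWb
  have hW0 : W 0 = 0 := by
    simp only [hW, heatT, h.zero, map_zero, integral_zero]
  have hWt : W t = heatT (σ • a₀) K (fun y => d [] y t) x := by
    simp only [hW, hbdef, sub_self, zero_smul, zero_add]
  rw [hW0, sub_zero, hWt] at key
  refine key.trans ?_
  have hq : 0 < (-(p + 1))⁻¹ := inv_pos.2 (by linarith)
  have hM'0 : M' ≤ (1 + (n : ℝ) ^ r) * (Mf + Ha * R') := by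
    have h1 : 0 ≤ (n : ℝ) ^ r := by positivity
    have h2 : 0 ≤ Ha * R' := by positivity
    have : 0 ≤ (n : ℝ) ^ r * Mf := by positivity
    rw [hM']; nlinarith
  have hM'nn : 0 ≤ M' := by rw [hM']; positivity
  have h2 : 0 ≤ (t - 0 + σ) ^ (p + 1) := by
    have := ht.1
    positivity
  simp only [sub_self, zero_add]
  have h3 : C * M' * (-(p + 1))⁻¹ * σ ^ (p + 1)
      ≤ C * ((1 + (n : ℝ) ^ r) * (Mf + Ha * R')) * (-(p + 1))⁻¹ * σ ^ (p + 1) := by gcongr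
  have h4 : 0 ≤ C * M' * (-(p + 1))⁻¹ * (t - 0 + σ) ^ (p + 1) := by positivity
  calc _ ≤ C * M' * (-(p + 1))⁻¹ * σ ^ (p + 1) := by linarith
    _ ≤ _ := h3
    _ = _ := by ring

end LinearEstimates

section LinearEstimatesHolder

variable {n r : ℕ} {H : Type*} [NormedAddCommGroup H] [InnerProductSpace ℂ H] [CompleteSpace H]

lemma heatT_scalar (b : (Fin r → Fin n) → (H →L[ℂ] H)) (K : List (Fin n)) {A : H →L[ℂ] H}
    (hA : ∃ c : ℂ, A = c • 1) (w : Vec n → H) (x : Vec n) :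
    heatT b K (fun y => A (w y)) x = A (heatT b K w x) := by
  obtain ⟨c, rfl⟩ := hA
  simp [heatT, integral_smul]

/-- A Hölder criterion in terms of a smoothing by the heat operator. -/
lemma norm_sub_le_of_heat_smoothing (hn : 1 ≤ n) (hr : 2 ≤ r) {α A : ℝ} (hα0 : 0 < α)
    {v : Vec n → H} {V : ℝ → Vec n → H} {V' : ℝ → Vec n → H} {G : ℝ → Fin n → Vec n → H}
    (hlim : ∀ x, Tendsto (fun σ => V σ x) (𝓝[>] 0) (𝓝 (v x)))
    (hV : ∀ σ, 0 < σ → ∀ x, HasDerivAt (fun s => V s x) (V' σ x) σ)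
    (hV' : ∀ σ, 0 < σ → ∀ x, ‖V' σ x‖ ≤ A * σ ^ (α / r - 1))
    (hG : ∀ σ, 0 < σ → ∀ i x,
      HasLineDerivAt ℝ (V σ) (G σ i x) x (EuclideanSpace.single i (1 : ℝ)))
    (hG' : ∀ σ, 0 < σ → ∀ i x, ‖G σ i x‖ ≤ A * σ ^ ((α - 1) / r)) (x y : Vec n) :
    ‖v x - v y‖ ≤ (2 * (r / α) + n) * A * ‖x - y‖ ^ α := by
  have hrpos : (0 : ℝ) < r := by positivity
  have hA : 0 ≤ A := by
    have := (norm_nonneg _).trans (hV' 1 one_pos 0)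
    simpa using this
  rcases eq_or_ne x y with rfl | hxy
  · simp; positivity
  have key : ∀ σ, 0 < σ → ∀ x, ‖V σ x - v x‖ ≤ A * (r / α) * σ ^ (α / r) := by
    intro σ hσ x
    have h1 : ∀ s, 0 < s → HasDerivAt (fun s => A * (r / α) * s ^ (α / r))
        (A * s ^ (α / r - 1)) s := by
      intro s hs
      have := ((hasDerivAt_id s).rpow_const (p := α / r) (Or.inl hs.ne')).const_mul (A * (r / α))
      refine this.congr_deriv ?_
      simp only [id]
      field_simp
    have h2 : ∀ s ∈ Ioo 0 σ, ‖V σ x - V s x‖ ≤ A * (r / α) * σ ^ (α / r) := by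
      intro s hs
      have h3 := norm_sub_le_of_hasDerivAt_le (f := fun s => V s x) (f' := fun s => V' s x) hs.2.le
        (fun u hu => (hV u (hs.1.trans_le hu.1) x).continuousAt.continuousWithinAt)
        (fun u hu => hV u (hs.1.trans hu.1) x)
        (fun u hu => (h1 u (hs.1.trans_le hu.1)).continuousAt.continuousWithinAt)
        (fun u hu => h1 u (hs.1.trans hu.1)) (fun u hu => hV' u (hs.1.trans hu.1) x)
      have h4 : 0 ≤ A * (r / α) * s ^ (α / r) := by
        have := hs.1
        positivity
      linarith
    refine le_of_tendsto (tendsto_const_nhds.sub (hlim x)).norm ?_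
    filter_upwards [Ioo_mem_nhdsGT hσ] with s hs using h2 s hs
  set ρ := ‖x - y‖ with hρ
  have hρ0 : 0 < ρ := norm_pos_iff.2 (sub_ne_zero.2 hxy)
  have hσ : 0 < ρ ^ r := by positivity
  have e1 : (ρ ^ r) ^ (α / r) = ρ ^ α := by
    rw [← Real.rpow_natCast, ← Real.rpow_mul hρ0.le]
    congr 1
    field_simp
  have e2 : (ρ ^ r) ^ ((α - 1) / r) = ρ ^ (α - 1) := by
    rw [← Real.rpow_natCast, ← Real.rpow_mul hρ0.le]
    congr 1
    field_simp
  have h1 := key _ hσ x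
  have h2 := key _ hσ y
  have h3 := norm_sub_sub_sum_partials_le (hG _ hσ) y 0 _ (x - y)
    (fun i z _ => by simpa using hG' _ hσ i z)
  rw [add_sub_cancel] at h3
  simp only [Pi.zero_apply, smul_zero, Finset.sum_const_zero, sub_zero] at h3
  rw [e1] at h1 h2
  rw [e2, ← hρ] at h3
  have e3 : ρ ^ (α - 1) * ρ = ρ ^ α := by
    rw [← Real.rpow_add_one hρ0.ne', sub_add_cancel]
  have h4 : ‖v x - v y‖ ≤ ‖V (ρ ^ r) x - v x‖ + ‖V (ρ ^ r) x - V (ρ ^ r) y‖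
      + ‖V (ρ ^ r) y - v y‖ := by
    have e : v x - v y = -(V (ρ ^ r) x - v x) + (V (ρ ^ r) x - V (ρ ^ r) y)
      + (V (ρ ^ r) y - v y) := by abel
    rw [e]
    refine (norm_add₃_le).trans ?_
    rw [norm_neg]
  calc _ ≤ A * (r / α) * ρ ^ α + n * (A * ρ ^ (α - 1)) * ρ + A * (r / α) * ρ ^ α := by linarith
    _ = A * (r / α) * ρ ^ α + n * A * (ρ ^ (α - 1) * ρ) + A * (r / α) * ρ ^ α := by ring
    _ = _ := by rw [e3]; ring

lemma exists_linSol_holder_bound (H : Type*) [NormedAddCommGroup H] [InnerProductSpace ℂ H]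
    [CompleteSpace H] (hn : 1 ≤ n) (hr : 2 ≤ r) (lam Lam α : ℝ) (hlam : 0 < lam) (hLam : 0 ≤ Lam)
    (hα0 : 0 < α) (hα1 : α < 1) :
    ∃ C : ℝ, 0 ≤ C ∧ ∀ (a₀ : (Fin r → Fin n) → (H →L[ℂ] H)), EllCls lam Lam a₀ → ScalarCoef a₀ →
      ∀ (δ R R' Ha Mf : ℝ) (a : Vec n → (Fin r → Fin n) → (H →L[ℂ] H)) (f : Vec n → ℝ → H)
        (d : List (Fin n) → Vec n → ℝ → H) (wt : Vec n → ℝ → H), LinSol δ R a f d wt →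
        HolCoef lam Lam α Ha a → 0 ≤ Ha →
        (∀ t ∈ Icc 0 δ, ∀ x y, ‖f x t - f y t‖ ≤ Mf * ‖x - y‖ ^ α) →
        (∀ (J : Fin r → Fin n), ∀ t ∈ Icc 0 δ, ∀ x, ‖d (List.ofFn J) x t‖ ≤ R') →
        ∀ (J : Fin r → Fin n), ∀ t ∈ Icc 0 δ, ∀ x y,
          ‖d (List.ofFn J) x t - d (List.ofFn J) y t‖ ≤ C * (Mf + Ha * R') * ‖x - y‖ ^ α := by
  have hrpos : (0 : ℝ) < r := by positivity
  choose C₀ hC₀ hb using fun K : {K : List (Fin n) // r + 1 ≤ K.length} =>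
    exists_heatT_linSol_bound H hn hr lam Lam α hlam hLam hα0 hα1 K.1 K.2
  set C₁ := ∑ J : Fin r → Fin n, ∑ i : Fin n, C₀ ⟨List.ofFn J ++ [i], by simp⟩ with hC₁
  set C₂ := ∑ J : Fin r → Fin n, ∑ J' : Fin r → Fin n,
    C₀ ⟨List.ofFn J ++ List.ofFn J', by simp; omega⟩ with hC₂
  have hC₁0 : 0 ≤ C₁ := Finset.sum_nonneg fun _ _ => Finset.sum_nonneg fun _ _ => hC₀ _
  have hC₂0 : 0 ≤ C₂ := Finset.sum_nonneg fun _ _ => Finset.sum_nonneg fun _ _ => hC₀ _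
  refine ⟨(2 * (r / α) + n) * (C₁ + Lam * C₂), by positivity, ?_⟩
  intro a₀ ha₀ hsc δ R R' Ha Mf a f d wt h ha hHa hf hR' J t ht x y
  have h0δ : (0 : ℝ) ∈ Icc 0 δ := ⟨le_rfl, ht.1.trans ht.2⟩
  have hMf : 0 ≤ Mf := by
    have h1 := (norm_nonneg _).trans (hf 0 h0δ (EuclideanSpace.single ⟨0, hn⟩ 1) 0)
    simpa using h1
  have hR'0 : 0 ≤ R' := (norm_nonneg _).trans (hR' (fun _ => ⟨0, hn⟩) 0 h0δ 0)
  set Q := Mf + Ha * R' with hQ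
  have hQ0 : 0 ≤ Q := by positivity
  have hj := h.jets t ht
  have hcls : ∀ σ : ℝ, 0 < σ → EllCls (σ * lam) (σ * Lam) (σ • a₀) := fun σ hσ => ha₀.smul hσ.le
  have hlen : (List.ofFn J).length ≤ r := by simp
  have hvc := hj.cont (List.ofFn J) hlen
  have hvb := hj.bd (List.ofFn J) hlen
  have main := norm_sub_le_of_heat_smoothing hn hr (α := α) (A := (C₁ + Lam * C₂) * Q) hα0
    (v := fun x => d (List.ofFn J) x t)
    (V := fun σ => heatT (σ • a₀) [] (fun y => d (List.ofFn J) y t))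
    (V' := fun σ x => ∑ J', heatT (σ • a₀) (List.ofFn J' ++ [])
      (fun y => a₀ J' (d (List.ofFn J) y t)) x + heatT (σ • a₀) [] (fun _ => (0 : H)) x)
    (G := fun σ i => heatT (σ • a₀) [i] (fun y => d (List.ofFn J) y t))
    (fun x => tendsto_heatT_nil hn hr hlam hLam ha₀ hvc hvb x)
    (fun σ hσ x => by
      have h1 := hasDerivAt_heatT_param hn hr (s₀ := σ) (ε₀ := 1) (R := R) (mul_pos hσ hlam)
        (mul_nonneg hσ.le hLam) (hcls σ hσ) ha₀.bd
        (fun u ξ => by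
          rw [← add_smul, opSym_smul]
          exact (Commute.refl _).smul_left _) [] one_pos
        (w := fun y _ => d (List.ofFn J) y t) (wt := fun _ _ => 0)
        (fun _ _ => hvc) (fun _ _ => hvb) continuous_const
        (fun _ _ y => by simpa using (norm_nonneg _).trans (hvb 0))
        (fun s _ y => hasDerivAt_const s _) x
      refine h1.congr_of_eventuallyEq (Eventually.of_forall fun s => ?_)
      beta_reduce
      rw [← add_smul, add_sub_cancel])
    (fun σ hσ x => by
      have h0 : heatT (σ • a₀) [] (fun _ => (0 : H)) x = 0 := by simp [heatT]
      rw [h0, add_zero]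
      have h1 : ∀ J' : Fin r → Fin n, ‖heatT (σ • a₀) (List.ofFn J' ++ [])
          (fun y => a₀ J' (d (List.ofFn J) y t)) x‖
          ≤ Lam * (C₀ ⟨List.ofFn J ++ List.ofFn J', by simp; omega⟩ * Q * σ ^ (α / r - 1)) := by
        intro J'
        have h2 := hb ⟨List.ofFn J ++ List.ofFn J', by simp; omega⟩ a₀ ha₀ hsc δ R R' Ha Mf a f d wt
          h ha hHa hf hR' σ hσ t ht x
        have e : (α - (List.ofFn J ++ List.ofFn J').length) / r + 1 = α / r - 1 := by
          simp only [List.length_append, List.length_ofFn]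
          push_cast
          field_simp
          ring
        rw [e] at h2
        rw [List.append_nil, heatT_scalar _ _ (hsc J'),
          hj.heatT_eq hn hr (mul_pos hσ hlam) (mul_nonneg hσ.le hLam) (hcls σ hσ) _ _ hlen]
        refine (ContinuousLinearMap.le_opNorm _ _).trans ?_
        have h3 := ha₀.bd J'
        gcongr
      refine (norm_sum_le_of_le _ fun J' _ => h1 J').trans ?_
      rw [← Finset.mul_sum, ← Finset.sum_mul, ← Finset.sum_mul]
      have h3 : ∑ J' : Fin r → Fin n, C₀ ⟨List.ofFn J ++ List.ofFn J', by simp; omega⟩ ≤ C₂ :=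
        Finset.single_le_sum (f := fun J : Fin r → Fin n => ∑ J' : Fin r → Fin n,
          C₀ ⟨List.ofFn J ++ List.ofFn J', by simp; omega⟩)
          (fun _ _ => Finset.sum_nonneg fun _ _ => hC₀ _) (Finset.mem_univ J)
      calc _ ≤ Lam * (C₂ * Q * σ ^ (α / r - 1)) := by gcongr
        _ ≤ _ := by
          have : 0 ≤ C₁ * (Q * σ ^ (α / r - 1)) := by positivity
          linarith)
    (fun σ hσ i x => heatT_hasLineDerivAt hn hr (mul_pos hσ hlam) (mul_nonneg hσ.le hLam)
      (hcls σ hσ) [] i hvc hvb x)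
    (fun σ hσ i x => by
      have h2 := hb ⟨List.ofFn J ++ [i], by simp⟩ a₀ ha₀ hsc δ R R' Ha Mf a f d wt
          h ha hHa hf hR' σ hσ t ht x
      have e : (α - (List.ofFn J ++ [i]).length) / r + 1 = (α - 1) / r := by
        simp only [List.length_append, List.length_ofFn, List.length_singleton]
        push_cast
        field_simp
        ring
      rw [e] at h2
      rw [hj.heatT_eq hn hr (mul_pos hσ hlam) (mul_nonneg hσ.le hLam) (hcls σ hσ) _ _ hlen]
      refine h2.trans ?_
      have h3 : C₀ ⟨List.ofFn J ++ [i], by simp⟩ ≤ C₁ :=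
        (Finset.single_le_sum (f := fun i : Fin n => C₀ ⟨List.ofFn J ++ [i], by simp⟩)
          (fun _ _ => hC₀ _) (Finset.mem_univ i)).trans
        (Finset.single_le_sum (f := fun J : Fin r → Fin n => ∑ i : Fin n,
          C₀ ⟨List.ofFn J ++ [i], by simp⟩)
          (fun _ _ => Finset.sum_nonneg fun _ _ => hC₀ _) (Finset.mem_univ J))
      have h4 : 0 ≤ Lam * C₂ := by positivity
      have h5 : C₀ ⟨List.ofFn J ++ [i], by simp⟩ ≤ C₁ + Lam * C₂ := by linarith
      gcongr) x y
  refine main.trans_eq ?_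
  ring

end LinearEstimatesHolder

section Interpolation

variable {n r : ℕ} {H : Type*} [NormedAddCommGroup H] [InnerProductSpace ℂ H] [CompleteSpace H]

lemma exists_uniform_list_bound {P : List (Fin n) → ℝ → Prop} (h : ∀ I, ∃ C, 0 ≤ C ∧ P I C)
    (hmono : ∀ I C C', C ≤ C' → P I C → P I C') (k : ℕ) :
    ∃ C, 0 ≤ C ∧ ∀ I : List (Fin n), I.length ≤ k → P I C := by
  choose C hC hP using h
  refine ⟨∑ m ∈ Finset.range (k + 1), ∑ J : Fin m → Fin n, C (List.ofFn J),
    Finset.sum_nonneg fun _ _ => Finset.sum_nonneg fun _ _ => hC _, fun I hI => ?_⟩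
  refine hmono I _ _ ?_ (hP I)
  have h1 : C I ≤ ∑ J : Fin I.length → Fin n, C (List.ofFn J) := by
    have := Finset.single_le_sum (f := fun J : Fin I.length → Fin n => C (List.ofFn J))
      (fun _ _ => hC _) (Finset.mem_univ I.get)
    rwa [List.ofFn_get] at this
  exact h1.trans (Finset.single_le_sum
    (f := fun m => ∑ J : Fin m → Fin n, C (List.ofFn J))
    (fun _ _ => Finset.sum_nonneg fun _ _ => hC _)
    (Finset.mem_range.2 (Nat.lt_succ_of_le hI)))

lemma Jets.norm_sub_le {e : List (Fin n) → Vec n → H} {R S : ℝ} (h : Jets r e R)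
    {I : List (Fin n)} (hI : I.length < r) (hS : ∀ i x, ‖e (i :: I) x‖ ≤ S) (x y : Vec n) :
    ‖e I x - e I y‖ ≤ n * S * ‖x - y‖ := by
  have h1 := norm_sub_sub_sum_partials_le (G := fun i => e (i :: I)) (fun i x => h.line I i hI x) y 0
    S (x - y) (fun i z _ => by simpa using hS i z)
  simpa using h1

/-- Interpolation between the Hölder norms of a function and of its derivatives of order `r`. -/
lemma exists_jets_interpolation (H : Type*) [NormedAddCommGroup H] [InnerProductSpace ℂ H]
    [CompleteSpace H] (hn : 1 ≤ n) (hr : 2 ≤ r) (lam Lam α : ℝ) (hlam : 0 < lam) (hLam : 0 ≤ Lam)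
    (hα0 : 0 < α) (hα1 : α < 1) :
    ∃ C : ℝ, 0 ≤ C ∧ ∀ (a₀ : (Fin r → Fin n) → (H →L[ℂ] H)), EllCls lam Lam a₀ →
      ∀ (e : List (Fin n) → Vec n → H) (R Q ε : ℝ), Jets r e R → 0 ≤ Q → 0 < ε → ε ≤ 1 →
        (∀ x, ‖e [] x‖ ≤ Q * ε) → (∀ x y, ‖e [] x - e [] y‖ ≤ Q * ε * ‖x - y‖ ^ α) →
        (∀ (J : Fin r → Fin n) x y, ‖e (List.ofFn J) x - e (List.ofFn J) y‖ ≤ Q * ‖x - y‖ ^ α) →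
        ∀ I, I.length ≤ r → ∀ x, ‖e I x‖ ≤ C * Q * ε ^ (α / r) := by
  have hrpos : (0 : ℝ) < r := by positivity
  have hr1 : (1 : ℝ) ≤ r := by exact_mod_cast (by omega : 1 ≤ r)
  have hαr : α / r ≤ 1 := by rw [div_le_one hrpos]; linarith
  obtain ⟨C₁, hC₁, hb₁⟩ := exists_heatT_nil_sub_bound H hn hr lam Lam hlam hLam
  obtain ⟨C₂, hC₂, hb₂⟩ := exists_uniform_list_bound (n := n) (P := fun I C => I ≠ [] →
      ∀ (a₀ : (Fin r → Fin n) → (H →L[ℂ] H)), EllCls lam Lam a₀ → ∀ ε : ℝ, 0 < ε →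
      ∀ (f : Vec n → H), Continuous f → ∀ (R : ℝ), (∀ y, ‖f y‖ ≤ R) → ∀ (M : ℝ), 0 ≤ M →
      ∀ (x : Vec n), (∀ y, ‖f y - f x‖ ≤ M * ‖y - x‖ ^ α) →
      ‖heatT (ε • a₀) I f x‖ ≤ C * ε ^ ((α - I.length) / r) * M) (fun I => by
        by_cases hI : I = []
        · exact ⟨0, le_rfl, fun h => absurd hI h⟩
        · obtain ⟨C, hC, h⟩ := exists_heatT_holder_bound H hn hr lam Lam hlam hLam I hI
          exact ⟨C, hC, fun _ a₀ ha₀ ε hε f hf R hR M _ x hM =>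
            h ε hε _ (ha₀.smul hε.le) α hα0.le hα1.le f hf R hR M x hM⟩)
      (fun I C C' hCC h hI a₀ ha₀ ε hε f hf R hR M hM0 x hM => by
        refine (h hI a₀ ha₀ ε hε f hf R hR M hM0 x hM).trans ?_
        gcongr) r
  have key : ∀ m : ℕ, m ≤ r → ∃ C : ℝ, 0 ≤ C ∧ ∀ (a₀ : (Fin r → Fin n) → (H →L[ℂ] H)),
      EllCls lam Lam a₀ →
      ∀ (e : List (Fin n) → Vec n → H) (R Q ε : ℝ), Jets r e R → 0 ≤ Q → 0 < ε → ε ≤ 1 →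
        (∀ x, ‖e [] x‖ ≤ Q * ε) → (∀ x y, ‖e [] x - e [] y‖ ≤ Q * ε * ‖x - y‖ ^ α) →
        (∀ (J : Fin r → Fin n) x y, ‖e (List.ofFn J) x - e (List.ofFn J) y‖ ≤ Q * ‖x - y‖ ^ α) →
        ∀ I, I.length + m = r → ∀ x, ‖e I x‖ ≤ C * Q * ε ^ (α / r) := by
    have step : ∀ (a₀ : (Fin r → Fin n) → (H →L[ℂ] H)), EllCls lam Lam a₀ →
      ∀ (e : List (Fin n) → Vec n → H) (R Q ε : ℝ), Jets r e R → 0 ≤ Q → 0 < ε → ε ≤ 1 →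
        (∀ x, ‖e [] x‖ ≤ Q * ε) → (∀ x y, ‖e [] x - e [] y‖ ≤ Q * ε * ‖x - y‖ ^ α) →
        ∀ I, I.length ≤ r → ∀ x S, ‖heatT (ε • a₀) [] (e I) x - e I x‖ ≤ S →
          ‖e I x‖ ≤ (C₂ + 1) * Q * ε ^ (α / r) + S := by
      intro a₀ ha₀ e R Q ε hj hQ hε hε1 h0 h0' I hI x S hS
      have hεα : 0 ≤ ε ^ (α / r) := by positivity
      by_cases hIn : I = []
      · subst hIn
        have h1 : ε ≤ ε ^ (α / r) := by
          simpa using Real.rpow_le_rpow_of_exponent_ge hε hε1 hαr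
        have h2 := h0 x
        have h3 := (norm_nonneg _).trans hS
        have h4 : Q * ε ≤ Q * ε ^ (α / r) := by gcongr
        have h5 : 0 ≤ C₂ * Q * ε ^ (α / r) := by positivity
        linarith
      · have h1 := hb₂ I hI hIn a₀ ha₀ ε hε (e []) (hj.cont [] (by simp)) R (hj.bd [] (by simp))
          (Q * ε) (by positivity) x (fun y => h0' y x)
        rw [hj.heatT_eq hn hr (mul_pos hε hlam) (mul_nonneg hε.le hLam) (ha₀.smul hε.le) I [] hI,
          List.append_nil] at hS
        have h2 : ε ^ ((α - I.length) / r) * ε ≤ ε ^ (α / r) := by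
          rw [← Real.rpow_add_one hε.ne']
          refine Real.rpow_le_rpow_of_exponent_ge hε hε1 ?_
          have : (I.length : ℝ) ≤ r := by exact_mod_cast hI
          rw [sub_div]
          have h3 : (I.length : ℝ) / r ≤ 1 := by rwa [div_le_one hrpos]
          linarith
        have h3 : C₂ * ε ^ ((α - I.length) / r) * (Q * ε) ≤ C₂ * Q * ε ^ (α / r) := by
          calc _ = C₂ * Q * (ε ^ ((α - I.length) / r) * ε) := by ring
            _ ≤ _ := by gcongr
        have h4 : ‖e I x‖ ≤ ‖heatT (ε • a₀) I (e []) x‖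
            + ‖heatT (ε • a₀) I (e []) x - e I x‖ := by
          have := norm_sub_le (heatT (ε • a₀) I (e []) x) (heatT (ε • a₀) I (e []) x - e I x)
          simpa using this
        have h5 : 0 ≤ Q * ε ^ (α / r) := by positivity
        linarith
    intro m
    induction m with
    | zero =>
      intro _
      refine ⟨C₂ + 1 + C₁, by positivity, ?_⟩
      intro a₀ ha₀ e R Q ε hj hQ hε hε1 h0 h0' hJ I hI x
      have hI' : I.length = r := by omega
      have h1 : ∀ x y, ‖e I x - e I y‖ ≤ Q * ‖x - y‖ ^ α := by
        subst hI'
        have := hJ I.get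
        rwa [List.ofFn_get] at this
      have h2 := hb₁ ε hε _ (ha₀.smul hε.le) α hα0.le hα1.le (e I) (hj.cont I hI'.le) R
        (hj.bd I hI'.le) Q x (fun y => h1 y x)
      refine (step a₀ ha₀ e R Q ε hj hQ hε hε1 h0 h0' I hI'.le x _ h2).trans_eq ?_
      ring
    | succ m ih =>
      intro hm
      obtain ⟨C, hC, h⟩ := ih (by omega)
      refine ⟨C₂ + 1 + C₁ * (n * C), by positivity, ?_⟩
      intro a₀ ha₀ e R Q ε hj hQ hε hε1 h0 h0' hJ I hI x
      have h1 := h a₀ ha₀ e R Q ε hj hQ hε hε1 h0 h0' hJ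
      have h2 := hj.norm_sub_le (I := I) (by omega)
        (fun i x => h1 (i :: I) (by simp only [List.length_cons]; omega) x)
      have h3 := hb₁ ε hε _ (ha₀.smul hε.le) 1 zero_le_one le_rfl (e I) (hj.cont I (by omega)) R
        (hj.bd I (by omega)) _ x (fun y => by simpa using h2 y x)
      refine (step a₀ ha₀ e R Q ε hj hQ hε hε1 h0 h0' I (by omega) x _ h3).trans ?_
      have h4 : ε ^ (1 / (r : ℝ)) ≤ 1 := Real.rpow_le_one hε.le hε1 (by positivity)
      have h5 : C₁ * ε ^ (1 / (r : ℝ)) * (n * (C * Q * ε ^ (α / r)))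
          ≤ C₁ * 1 * (n * (C * Q * ε ^ (α / r))) := by gcongr
      calc _ ≤ (C₂ + 1) * Q * ε ^ (α / r) + C₁ * 1 * (n * (C * Q * ε ^ (α / r))) := by linarith
        _ = _ := by ring
  choose! C hC hk using key
  refine ⟨∑ m ∈ Finset.range (r + 1), C m, Finset.sum_nonneg fun m hm =>
    hC m (Nat.lt_succ_iff.1 (Finset.mem_range.1 hm)), ?_⟩
  intro a₀ ha₀ e R Q ε hj hQ hε hε1 h0 h0' hJ I hI x
  refine (hk (r - I.length) (by omega) a₀ ha₀ e R Q ε hj hQ hε hε1 h0 h0' hJ I (by omega) x).trans ?_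
  have := Finset.single_le_sum (f := C) (s := Finset.range (r + 1)) (fun m hm =>
    hC m (Nat.lt_succ_iff.1 (Finset.mem_range.1 hm))) (Finset.mem_range.2
      (by omega : r - I.length < r + 1))
  gcongr

end Interpolation

section LinearEstimate

variable {n r : ℕ} {H : Type*} [NormedAddCommGroup H] [InnerProductSpace ℂ H] [CompleteSpace H]

lemma Jets.eq_zero {e : List (Fin n) → Vec n → H} {R : ℝ} (h : Jets r e R)
    (h0 : ∀ x, e [] x = 0) : ∀ I, I.length ≤ r → ∀ x, e I x = 0 := by
  intro I
  induction I with
  | nil => exact fun _ => h0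
  | cons i I ih =>
    intro hI x
    simp only [List.length_cons] at hI
    have h1 := h.line I i (by omega) x
    have h2 : e I = fun _ => 0 := funext (ih (by omega))
    rw [h2] at h1
    unfold HasLineDerivAt at h1
    exact h1.unique (hasDerivAt_const _ _)

variable {δ R : ℝ} {a : Vec n → (Fin r → Fin n) → (H →L[ℂ] H)} {f : Vec n → ℝ → H}
  {d : List (Fin n) → Vec n → ℝ → H} {wt : Vec n → ℝ → H}

lemma norm_sum_clm_le {ι : Type*} [Fintype ι] (A : ι → H →L[ℂ] H) (v : ι → H) {p q : ℝ}
    (hp : 0 ≤ p) (hA : ∀ j, ‖A j‖ ≤ p) (hv : ∀ j, ‖v j‖ ≤ q) :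
    ‖∑ j, A j (v j)‖ ≤ Fintype.card ι * (p * q) := by
  refine (norm_sum_le _ _).trans ((Finset.sum_le_card_nsmul _ _ (p * q) fun j _ => ?_).trans_eq ?_)
  · exact ((A j).le_opNorm _).trans (mul_le_mul (hA j) (hv j) (norm_nonneg _) hp)
  · simp

lemma LinSol.norm_wt_le {lam Lam α Ha M Q : ℝ} (h : LinSol δ R a f d wt)
    (ha : HolCoef lam Lam α Ha a) (hLam : 0 ≤ Lam)
    (hf : ∀ t ∈ Icc 0 δ, ∀ x, ‖f x t‖ ≤ M)
    (hd : ∀ (J : Fin r → Fin n), ∀ t ∈ Icc 0 δ, ∀ x, ‖d (List.ofFn J) x t‖ ≤ Q) :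
    ∀ t ∈ Icc 0 δ, ∀ x, ‖wt x t‖ ≤ Fintype.card (Fin r → Fin n) * (Lam * Q) + M := by
  intro t ht x
  rw [h.eq t ht x]
  exact (norm_add_le _ _).trans (add_le_add (norm_sum_clm_le _ _ hLam
    (fun J => (ha.cls x).bd J) fun J => hd J t ht x) (hf t ht x))

lemma LinSol.norm_wt_sub_le {lam Lam α Ha M Q : ℝ} (h : LinSol δ R a f d wt)
    (ha : HolCoef lam Lam α Ha a) (hLam : 0 ≤ Lam) (hHa : 0 ≤ Ha)
    (hf : ∀ t ∈ Icc 0 δ, ∀ x y, ‖f x t - f y t‖ ≤ M * ‖x - y‖ ^ α)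
    (hd : ∀ (J : Fin r → Fin n), ∀ t ∈ Icc 0 δ, ∀ x, ‖d (List.ofFn J) x t‖ ≤ Q)
    (hd' : ∀ (J : Fin r → Fin n), ∀ t ∈ Icc 0 δ, ∀ x y,
      ‖d (List.ofFn J) x t - d (List.ofFn J) y t‖ ≤ Q * ‖x - y‖ ^ α) :
    ∀ t ∈ Icc 0 δ, ∀ x y, ‖wt x t - wt y t‖
      ≤ (Fintype.card (Fin r → Fin n) * ((Lam + Ha) * Q) + M) * ‖x - y‖ ^ α := by
  intro t ht x y
  have hxy : 0 ≤ ‖x - y‖ ^ α := by positivity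
  have e1 : wt x t - wt y t = ∑ J, a x J (d (List.ofFn J) x t - d (List.ofFn J) y t)
      + ∑ J, (a x J - a y J) (d (List.ofFn J) y t) + (f x t - f y t) := by
    rw [h.eq t ht x, h.eq t ht y]
    simp only [map_sub, sub_apply, Finset.sum_sub_distrib]
    abel
  rw [e1]
  have h1 := norm_sum_clm_le (fun J => a x J)
    (fun J => d (List.ofFn J) x t - d (List.ofFn J) y t) hLam (fun J => (ha.cls x).bd J)
    fun J => hd' J t ht x y
  have h2 := norm_sum_clm_le (fun J => a x J - a y J)
    (fun J => d (List.ofFn J) y t) (mul_nonneg hHa hxy) (fun J => ha.hol x y J)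
    fun J => hd J t ht y
  refine (norm_add₃_le).trans ((add_le_add (add_le_add h1 h2) (hf t ht x y)).trans_eq ?_)
  ring

/-- Time regularity of the jets of a solution whose spatial Hölder norms are under control. -/
lemma exists_linSol_time_holder (H : Type*) [NormedAddCommGroup H] [InnerProductSpace ℂ H]
    [CompleteSpace H] (hn : 1 ≤ n) (hr : 2 ≤ r) (lam Lam α Ha : ℝ) (hlam : 0 < lam)
    (hLam : 0 ≤ Lam) (hα0 : 0 < α) (hα1 : α < 1) (hHa : 0 ≤ Ha) :
    ∃ C : ℝ, 0 ≤ C ∧ ∀ (a₀ : (Fin r → Fin n) → (H →L[ℂ] H)), EllCls lam Lam a₀ →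
      ∀ (δ R : ℝ) (a : Vec n → (Fin r → Fin n) → (H →L[ℂ] H)) (f : Vec n → ℝ → H)
        (d : List (Fin n) → Vec n → ℝ → H) (wt : Vec n → ℝ → H) (M Q : ℝ), δ ≤ 1 →
        LinSol δ R a f d wt → HolCoef lam Lam α Ha a → 0 ≤ M → 0 ≤ Q →
        (∀ t ∈ Icc 0 δ, ∀ x, ‖f x t‖ ≤ M) →
        (∀ t ∈ Icc 0 δ, ∀ x y, ‖f x t - f y t‖ ≤ M * ‖x - y‖ ^ α) →
        (∀ (J : Fin r → Fin n), ∀ t ∈ Icc 0 δ, ∀ x, ‖d (List.ofFn J) x t‖ ≤ Q) →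
        (∀ (J : Fin r → Fin n), ∀ t ∈ Icc 0 δ, ∀ x y,
          ‖d (List.ofFn J) x t - d (List.ofFn J) y t‖ ≤ Q * ‖x - y‖ ^ α) →
        ∀ I, I.length ≤ r → ∀ t ∈ Icc 0 δ, ∀ s ∈ Icc 0 δ, ∀ x,
          ‖d I x t - d I x s‖ ≤ C * (Q + M) * |t - s| ^ (α / r) := by
  obtain ⟨C, hC, hi⟩ := exists_jets_interpolation H hn hr lam Lam α hlam hLam hα0 hα1
  set m : ℝ := ((Fintype.card (Fin r → Fin n) : ℕ) : ℝ) with hm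
  have hm0 : 0 ≤ m := by positivity
  refine ⟨C * (2 + m * (Lam + Ha)), by positivity, ?_⟩
  intro a₀ ha₀ δ R a f d wt M Q hδ h ha hM hQ hf hf' hd hd' I hI t ht s hs x
  rcases eq_or_ne t s with rfl | hts
  · simp only [sub_self, norm_zero]; positivity
  have hε : 0 < |t - s| := abs_pos.2 (sub_ne_zero.2 hts)
  have hε1 : |t - s| ≤ 1 := by
    rw [abs_le]; exact ⟨by linarith [ht.1, hs.2], by linarith [ht.2, hs.1]⟩
  set P : ℝ := (2 + m * (Lam + Ha)) * (Q + M) with hP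
  have hP0 : 0 ≤ P := by positivity
  have hw := h.norm_wt_le ha hLam hf hd
  have hw' := h.norm_wt_sub_le ha hLam hHa hf' hd hd'
  have hx1 : m * (Lam * Q) + M ≤ P := by
    have : P - (m * (Lam * Q) + M) = 2 * Q + M + m * Ha * Q + m * (Lam + Ha) * M := by
      rw [hP]; ring
    have h2 : 0 ≤ 2 * Q + M + m * Ha * Q + m * (Lam + Ha) * M := by positivity
    linarith
  have hx2 : m * ((Lam + Ha) * Q) + M ≤ P := by
    have : P - (m * ((Lam + Ha) * Q) + M) = 2 * Q + M + m * (Lam + Ha) * M := by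
      rw [hP]; ring
    have h2 : 0 ≤ 2 * Q + M + m * (Lam + Ha) * M := by positivity
    linarith
  have hx3 : Q + Q ≤ P := by
    have : P - (Q + Q) = 2 * M + m * (Lam + Ha) * (Q + M) := by
      rw [hP]; ring
    have h2 : 0 ≤ 2 * M + m * (Lam + Ha) * (Q + M) := by positivity
    linarith
  refine (hi a₀ ha₀ (fun I x => d I x t - d I x s) (R + R) P |t - s|
    ((h.jets t ht).sub (h.jets s hs)) hP0 hε hε1 ?_ ?_ ?_ I hI x).trans_eq ?_
  · intro y
    have := (convex_Icc 0 δ).norm_image_sub_le_of_norm_hasDerivWithin_le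
      (fun τ hτ => h.time y τ hτ) (fun τ hτ => (hw τ hτ y).trans hx1) hs ht
    simpa using this
  · intro y z
    have := (convex_Icc 0 δ).norm_image_sub_le_of_norm_hasDerivWithin_le
      (fun τ hτ => (h.time y τ hτ).sub (h.time z τ hτ))
      (fun τ hτ => (hw' τ hτ y z).trans (mul_le_mul_of_nonneg_right hx2 (by positivity))) hs ht
    refine (le_of_eq ?_).trans (this.trans_eq ?_)
    · congr 1; simp only [Pi.sub_apply]; abel
    · rw [Real.norm_eq_abs]; ring
  · intro J y z
    have h1 := hd' J t ht y z
    have h2 := hd' J s hs y z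
    calc ‖d (List.ofFn J) y t - d (List.ofFn J) y s
          - (d (List.ofFn J) z t - d (List.ofFn J) z s)‖
        = ‖d (List.ofFn J) y t - d (List.ofFn J) z t
          - (d (List.ofFn J) y s - d (List.ofFn J) z s)‖ := by congr 1; abel
      _ ≤ Q * ‖y - z‖ ^ α + Q * ‖y - z‖ ^ α := (norm_sub_le _ _).trans (add_le_add h1 h2)
      _ = (Q + Q) * ‖y - z‖ ^ α := by ring
      _ ≤ _ := by gcongr
  · rw [hP]; ring

/-- Short-time Schauder estimate for the linear problem with zero initial value. -/
lemma exists_linSol_estimate (H : Type*) [NormedAddCommGroup H] [InnerProductSpace ℂ H]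
    [CompleteSpace H] (hn : 1 ≤ n) (hr : 2 ≤ r) (lam Lam α Ha : ℝ) (hlam : 0 < lam)
    (hLam : 0 ≤ Lam) (hα0 : 0 < α) (hα1 : α < 1) (hHa : 0 ≤ Ha) :
    ∃ δ₀ C : ℝ, 0 < δ₀ ∧ δ₀ ≤ 1 ∧ 0 ≤ C ∧
      ∀ (a₀ : (Fin r → Fin n) → (H →L[ℂ] H)), EllCls lam Lam a₀ → ScalarCoef a₀ →
      ∀ (δ R : ℝ) (a : Vec n → (Fin r → Fin n) → (H →L[ℂ] H)) (f : Vec n → ℝ → H)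
        (d : List (Fin n) → Vec n → ℝ → H) (wt : Vec n → ℝ → H) (M : ℝ), 0 ≤ δ → δ ≤ δ₀ →
        LinSol δ R a f d wt → HolCoef lam Lam α Ha a → 0 ≤ M →
        (∀ t ∈ Icc 0 δ, ∀ x, ‖f x t‖ ≤ M) →
        (∀ t ∈ Icc 0 δ, ∀ x y, ‖f x t - f y t‖ ≤ M * ‖x - y‖ ^ α) →
        (∀ I, I.length ≤ r → ∀ t ∈ Icc 0 δ, ∀ x, ‖d I x t‖ ≤ C * M * δ ^ (α / r)) ∧
        (∀ (J : Fin r → Fin n), ∀ t ∈ Icc 0 δ, ∀ x y,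
          ‖d (List.ofFn J) x t - d (List.ofFn J) y t‖ ≤ C * M * ‖x - y‖ ^ α) ∧
        (∀ I, I.length ≤ r → ∀ t ∈ Icc 0 δ, ∀ s ∈ Icc 0 δ, ∀ x,
          ‖d I x t - d I x s‖ ≤ C * M * |t - s| ^ (α / r)) ∧
        (∀ t ∈ Icc 0 δ, ∀ x, ‖wt x t‖ ≤ C * M) ∧
        (∀ t ∈ Icc 0 δ, ∀ x y, ‖wt x t - wt y t‖ ≤ C * M * ‖x - y‖ ^ α) := by
  obtain ⟨C₁, hC₁, hh⟩ := exists_linSol_holder_bound H hn hr lam Lam α hlam hLam hα0 hα1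
  obtain ⟨C₂, hC₂, hi⟩ := exists_linSol_time_holder H hn hr lam Lam α Ha hlam hLam hα0 hα1 hHa
  set m : ℝ := ((Fintype.card (Fin r → Fin n) : ℕ) : ℝ) with hm
  have hm0 : 0 ≤ m := by positivity
  have hrpos : (0 : ℝ) < r := by positivity
  have hexp : 0 < α / r := by positivity
  -- a time for which the small factor is absorbed
  set A : ℝ := (1 + C₁ * Ha) * C₂ + C₁ with hA
  have hA0 : 0 ≤ A := by positivity
  obtain ⟨δ₀, hδ₀, hδ₀1, hδ₀A⟩ : ∃ δ₀ : ℝ, 0 < δ₀ ∧ δ₀ ≤ 1 ∧ A * δ₀ ^ (α / r) ≤ 1 / 2 := by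
    refine ⟨(1 / (2 * (A + 1))) ^ (r / α), by positivity,
      Real.rpow_le_one (by positivity) ?_ (by positivity), ?_⟩
    · rw [div_le_one (by positivity)]; linarith
    · rw [← Real.rpow_mul (by positivity), show (r : ℝ) / α * (α / r) = 1 by field_simp,
        Real.rpow_one, mul_one_div, div_le_div_iff₀ (by positivity) (by norm_num)]
      linarith
  set E : ℝ := 2 * (A + C₁) with hE
  have hE0 : 0 ≤ E := by positivity
  set C : ℝ := E + C₂ * (E + 1) + (m * ((Lam + Ha) * E) + 1) with hCd
  refine ⟨δ₀, C, hδ₀, hδ₀1, by positivity, ?_⟩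
  intro a₀ ha₀ hs₀ δ R a f d wt M hδ hδδ h ha hM hf hf'
  have hδ1 : δ ≤ 1 := hδδ.trans hδ₀1
  have hδA : A * δ ^ (α / r) ≤ 1 / 2 := le_trans (by gcongr) hδ₀A
  have hδp : 0 ≤ δ ^ (α / r) := by positivity
  have h0mem : (0 : ℝ) ∈ Icc 0 δ := ⟨le_rfl, hδ⟩
  have hz : ∀ I, I.length ≤ r → ∀ x, d I x 0 = 0 := (h.jets 0 h0mem).eq_zero h.zero
  -- validity of a bound
  let Val : ℝ → Prop := fun Q =>
    (∀ (J : Fin r → Fin n), ∀ t ∈ Icc 0 δ, ∀ x, ‖d (List.ofFn J) x t‖ ≤ Q) ∧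
    (∀ (J : Fin r → Fin n), ∀ t ∈ Icc 0 δ, ∀ x y,
          ‖d (List.ofFn J) x t - d (List.ofFn J) y t‖ ≤ Q * ‖x - y‖ ^ α)
  have hmono : ∀ Q Q', Q ≤ Q' → Val Q → Val Q' := fun Q Q' hQ hv =>
    ⟨fun J t ht x => (hv.1 J t ht x).trans hQ, fun J t ht x y => (hv.2 J t ht x y).trans
      (by gcongr)⟩
  have htime : ∀ Q, 0 ≤ Q → Val Q → ∀ I, I.length ≤ r → ∀ t ∈ Icc 0 δ, ∀ s ∈ Icc 0 δ, ∀ x,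
      ‖d I x t - d I x s‖ ≤ C₂ * (Q + M) * |t - s| ^ (α / r) := fun Q hQ hv =>
    hi a₀ ha₀ δ R a f d wt M Q hδ1 h ha hM hQ hf hf' hv.1 hv.2
  have hsup : ∀ Q, 0 ≤ Q → Val Q → ∀ I, I.length ≤ r → ∀ t ∈ Icc 0 δ, ∀ x,
      ‖d I x t‖ ≤ C₂ * (Q + M) * δ ^ (α / r) := by
    intro Q hQ hv I hI t ht x
    have h1 := htime Q hQ hv I hI t ht 0 h0mem x
    rw [hz I hI x, sub_zero, sub_zero, abs_of_nonneg ht.1] at h1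
    refine h1.trans ?_
    have := ht.1
    have := ht.2
    gcongr
  have hstep : ∀ Q, 0 ≤ Q → Val Q → Val ((A + C₁) * M + Q / 2) := by
    intro Q hQ hv
    set q : ℝ := C₂ * (Q + M) * δ ^ (α / r) with hq
    have hq0 : 0 ≤ q := by positivity
    have h1 : ∀ (J : Fin r → Fin n), ∀ t ∈ Icc 0 δ, ∀ x, ‖d (List.ofFn J) x t‖ ≤ q :=
      fun J t ht x => hsup Q hQ hv _ (by simp) t ht x
    have h2 := hh a₀ ha₀ hs₀ δ R q Ha M a f d wt h ha hHa hf' h1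
    have h3 : q + C₁ * (M + Ha * q) ≤ (A + C₁) * M + Q / 2 := by
      have e1 : q + C₁ * (M + Ha * q) = ((1 + C₁ * Ha) * C₂) * (δ ^ (α / r)) * (Q + M) + C₁ * M := by
        rw [hq]; ring
      have e2 : ((1 + C₁ * Ha) * C₂) * (δ ^ (α / r)) ≤ A * δ ^ (α / r) := by
        gcongr; rw [hA]; linarith
      have e3 : A * δ ^ (α / r) ≤ A := by
        have : δ ^ (α / r) ≤ 1 := Real.rpow_le_one hδ hδ1 hexp.le
        exact mul_le_of_le_one_right hA0 this
      rw [e1]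
      have e4 := e2.trans hδA
      have e5 := e2.trans e3
      have e6 := mul_le_mul_of_nonneg_right e4 hQ
      have e7 := mul_le_mul_of_nonneg_right e5 hM
      nlinarith
    have h4 : 0 ≤ C₁ * (M + Ha * q) := by positivity
    refine ⟨fun J t ht x => (h1 J t ht x).trans (by linarith), fun J t ht x y =>
      (h2 J t ht x y).trans ?_⟩
    gcongr
    linarith
  have hR : 0 ≤ R := (norm_nonneg _).trans (h.wt_bd 0 h0mem 0)
  have hinit : ∃ Q, 0 ≤ Q ∧ Val Q := by
    have h1 : ∀ (J : Fin r → Fin n), ∀ t ∈ Icc 0 δ, ∀ x, ‖d (List.ofFn J) x t‖ ≤ R :=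
      fun J t ht x => (h.jets t ht).bd _ (by simp) x
    have h2 := hh a₀ ha₀ hs₀ δ R R Ha M a f d wt h ha hHa hf' h1
    have h3 : 0 ≤ C₁ * (M + Ha * R) := by positivity
    refine ⟨R + C₁ * (M + Ha * R), by positivity, fun J t ht x => (h1 J t ht x).trans (by linarith),
      fun J t ht x y => (h2 J t ht x y).trans ?_⟩
    gcongr
    linarith
  obtain ⟨Q₀, hQ₀, hv₀⟩ := hinit
  have hiter : ∀ k : ℕ, Val (E * M + Q₀ / 2 ^ k) := by
    intro k
    induction k with
    | zero => exact hmono _ _ (by simp; positivity) hv₀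
    | succ k ih =>
      refine hmono _ _ (le_of_eq ?_) (hstep _ (by positivity) ih)
      rw [hE, pow_succ]; field_simp; ring
  have hlim : Tendsto (fun k : ℕ => E * M + Q₀ / 2 ^ k) atTop (𝓝 (E * M)) := by
    have h1 : Tendsto (fun k : ℕ => Q₀ * (1 / 2 : ℝ) ^ k) atTop (𝓝 (Q₀ * 0)) :=
      (tendsto_pow_atTop_nhds_zero_of_lt_one (by norm_num) (by norm_num)).const_mul _
    have h2 := h1.const_add (E * M)
    simpa [div_eq_mul_inv] using h2
  have hvE : Val (E * M) :=
    ⟨fun J t ht x => ge_of_tendsto' hlim fun k => (hiter k).1 J t ht x,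
     fun J t ht x y => ge_of_tendsto' (hlim.mul_const _) fun k => (hiter k).2 J t ht x y⟩
  have hEM : 0 ≤ E * M := by positivity
  have hCC : C₂ * (E * M + M) ≤ C * M := by
    have : C * M - C₂ * (E * M + M) = E * M + (m * ((Lam + Ha) * E) + 1) * M := by rw [hCd]; ring
    have h2 : 0 ≤ E * M + (m * ((Lam + Ha) * E) + 1) * M := by positivity
    linarith
  have hCE : E * M ≤ C * M := by
    have : C * M - E * M = C₂ * (E * M + M) + (m * ((Lam + Ha) * E) + 1) * M := by rw [hCd]; ring
    have h2 : 0 ≤ C₂ * (E * M + M) + (m * ((Lam + Ha) * E) + 1) * M := by positivity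
    linarith
  have hCw : m * ((Lam + Ha) * (E * M)) + M ≤ C * M := by
    have : C * M - (m * ((Lam + Ha) * (E * M)) + M) = C₂ * (E * M + M) + E * M := by rw [hCd]; ring
    have h2 : 0 ≤ C₂ * (E * M + M) + E * M := by positivity
    linarith
  refine ⟨fun I hI t ht x => (hsup _ hEM hvE I hI t ht x).trans (by gcongr),
    fun J t ht x y => (hvE.2 J t ht x y).trans (by gcongr),
    fun I hI t ht s hs x => (htime _ hEM hvE I hI t ht s hs x).trans (by gcongr),
    fun t ht x => (h.norm_wt_le ha hLam hf hvE.1 t ht x).trans (le_trans ?_ hCw),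
    fun t ht x y => (h.norm_wt_sub_le ha hLam hHa hf' hvE.1 hvE.2 t ht x y).trans (by gcongr)⟩
  rw [← hm]
  gcongr
  linarith

end LinearEstimate

section BaseOperator

variable {n r : ℕ} {H : Type*} [NormedAddCommGroup H] [InnerProductSpace ℂ H] [CompleteSpace H]

lemma monoSym_replicate (i : Fin n) (k : ℕ) (ζ : Fin n → ℂ) :
    monoSym (List.replicate k i) ζ = (2 * Real.pi * Complex.I * ζ i) ^ k := by
  induction k with
  | zero => simp [monoSym_nil]
  | succ k ih => rw [List.replicate_succ, monoSym_cons, ih, pow_succ']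

/-- A multiple of the coefficients of the operator `(-1)^(r/2-1) ∑ᵢ ∂ᵢ^r`. -/
def baseCoef (n r : ℕ) (H : Type*) [NormedAddCommGroup H] [InnerProductSpace ℂ H] (c : ℝ) :
    (Fin r → Fin n) → (H →L[ℂ] H) :=
  fun J => ∑ i : Fin n, if J = fun _ => i then (((-1) ^ (r / 2 - 1) * c : ℝ) : ℂ) • 1 else 0

lemma baseCoef_scalar (c : ℝ) : ScalarCoef (baseCoef n r H c) := by
  intro J
  refine ⟨∑ i : Fin n, if J = fun _ => i then (((-1) ^ (r / 2 - 1) * c : ℝ) : ℂ) else 0, ?_⟩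
  rw [baseCoef, Finset.sum_smul]
  refine Finset.sum_congr rfl fun i _ => ?_
  split_ifs <;> simp

lemma opSym_baseCoef (c : ℝ) (ζ : Fin n → ℂ) : opSym (baseCoef n r H c) ζ
    = ∑ i : Fin n, ((2 * Real.pi * Complex.I * ζ i) ^ r * (((-1) ^ (r / 2 - 1) * c : ℝ) : ℂ)) •
      (1 : H →L[ℂ] H) := by
  unfold opSym baseCoef
  simp only [Finset.smul_sum]
  rw [Finset.sum_comm]
  refine Finset.sum_congr rfl fun i _ => ?_
  rw [Finset.sum_eq_single (fun _ => i)]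
  · rw [if_pos rfl, smul_smul, ← monoSym_replicate, List.ofFn_const]
  · intro J _ hJ
    rw [if_neg hJ, smul_zero]
  · simp

lemma norm_pow_le_sum_pow (hrev : Even r) (hn : 1 ≤ n) (ξ : Vec n) :
    ‖ξ‖ ^ r ≤ (n : ℝ) ^ (r / 2) * ∑ i, ξ i ^ r := by
  obtain ⟨m, rfl⟩ := hrev
  rw [← two_mul, Nat.mul_div_cancel_left _ two_pos, pow_mul, EuclideanSpace.real_norm_sq_eq]
  have : Nonempty (Fin n) := ⟨⟨0, hn⟩⟩
  obtain ⟨i, -, hi⟩ := Finset.exists_max_image Finset.univ (fun i => ξ i ^ 2) Finset.univ_nonempty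
  have h1 : ∑ j, ξ j ^ 2 ≤ n * ξ i ^ 2 := by
    refine (Finset.sum_le_card_nsmul _ _ _ fun j hj => hi j hj).trans_eq ?_
    simp
  calc (∑ j, ξ j ^ 2) ^ m ≤ (n * ξ i ^ 2) ^ m := by
        gcongr
    _ = (n : ℝ) ^ m * ξ i ^ (2 * m) := by rw [mul_pow, pow_mul]
    _ ≤ _ := by
        gcongr
        exact Finset.single_le_sum (f := fun j => ξ j ^ (2 * m))
          (fun j _ => by rw [pow_mul]; positivity) (Finset.mem_univ i)

lemma exists_baseCoef_ellCls (hn : 1 ≤ n) (hr : 2 ≤ r) (hrev : Even r) (lam : ℝ) (hlam : 0 < lam) :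
    ∃ c Lam : ℝ, 0 ≤ Lam ∧ ∀ (H : Type) [NormedAddCommGroup H] [InnerProductSpace ℂ H]
      [CompleteSpace H], EllCls lam Lam (baseCoef n r H c) := by
  have hpi : 0 < (2 * Real.pi) ^ r := by positivity
  set c : ℝ := (n : ℝ) ^ (r / 2) * lam / (2 * Real.pi) ^ r with hc
  have hc0 : 0 ≤ c := by positivity
  refine ⟨c, n * c, by positivity, fun H _ _ _ => ⟨?_, ?_⟩⟩
  · intro ξ v
    have key : ∀ i, (2 * Real.pi * Complex.I * toC ξ i) ^ r * (((-1) ^ (r / 2 - 1) * c : ℝ) : ℂ)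
        = ((-(c * (2 * Real.pi) ^ r * ξ i ^ r) : ℝ) : ℂ) := by
      intro i
      obtain ⟨m, hm⟩ := hrev
      have hm' : r = 2 * m := by omega
      obtain ⟨k, rfl⟩ : ∃ k, m = k + 1 := ⟨m - 1, by omega⟩
      have h2 : r / 2 - 1 = k := by omega
      rw [h2]
      have h3 : (2 * Real.pi * Complex.I * toC ξ i) ^ r
          = (2 * Real.pi) ^ r * (ξ i : ℂ) ^ r * (-1) ^ (k + 1) := by
        have : toC ξ i = (ξ i : ℂ) := rfl
        rw [this, mul_pow, mul_pow, hm', pow_mul Complex.I, Complex.I_sq]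
        ring
      rw [h3]
      push_cast
      have h4 : ((-1 : ℂ)) ^ k * (-1) ^ k = 1 := by rw [← mul_pow]; simp
      calc _ = -(c * (2 * Real.pi) ^ r * (ξ i : ℂ) ^ r) * ((-1 : ℂ) ^ k * (-1) ^ k) := by ring
        _ = _ := by rw [h4, mul_one]
    have h1 : opSym (baseCoef n r H c) (toC ξ) v
        = ((-(c * (2 * Real.pi) ^ r * ∑ i, ξ i ^ r) : ℝ) : ℂ) • v := by
      rw [opSym_baseCoef]
      simp only [key]
      rw [← Finset.sum_smul, smul_apply, one_apply_eq_self]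
      congr 1
      rw [← Complex.ofReal_sum, Finset.sum_neg_distrib, Finset.mul_sum]
    rw [h1, inner_smul_right, Complex.re_ofReal_mul]
    have h2 : (inner ℂ v v : ℂ).re = ‖v‖ ^ 2 := by
      have := inner_self_eq_norm_sq (𝕜 := ℂ) v
      simpa using this
    rw [h2]
    have h3 := norm_pow_le_sum_pow hrev hn ξ
    have h4 : c * (2 * Real.pi) ^ r = (n : ℝ) ^ (r / 2) * lam := by
      rw [hc]; field_simp
    rw [h4]
    have h5 : lam * ‖ξ‖ ^ r ≤ (n : ℝ) ^ (r / 2) * lam * ∑ i, ξ i ^ r := by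
      calc _ ≤ lam * ((n : ℝ) ^ (r / 2) * ∑ i, ξ i ^ r) := by gcongr
        _ = _ := by ring
    have h6 := mul_le_mul_of_nonneg_right h5 (sq_nonneg ‖v‖)
    linarith
  · intro J
    refine (norm_sum_le _ _).trans ((Finset.sum_le_card_nsmul _ _ c fun i _ => ?_).trans_eq
      (by simp))
    split_ifs
    · rw [norm_smul, Complex.norm_real, norm_mul, norm_pow, norm_neg, norm_one, one_pow, one_mul,
        Real.norm_of_nonneg hc0]
      exact mul_le_of_le_one_right hc0 ContinuousLinearMap.norm_id_le
    · simpa using hc0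

end BaseOperator

section BaseSolution

variable {n r : ℕ} {H : Type*} [NormedAddCommGroup H] [InnerProductSpace ℂ H] [CompleteSpace H]

/-- Bounded continuous source terms, Hölder continuous in space. -/
structure HolSrc (α M : ℝ) (g : Vec n → ℝ → H) : Prop where
  cont : Continuous fun p : Vec n × ℝ => g p.1 p.2
  bd : ∀ x t, ‖g x t‖ ≤ M
  hol : ∀ t x y, ‖g x t - g y t‖ ≤ M * ‖x - y‖ ^ α

lemma HolSrc.cont_space {α M : ℝ} {g : Vec n → ℝ → H} (hg : HolSrc α M g) (t : ℝ) :
    Continuous fun x => g x t := hg.cont.comp (by fun_prop : Continuous fun x : Vec n => (x, t))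

lemma HolSrc.nonneg {α M : ℝ} {g : Vec n → ℝ → H} (hg : HolSrc α M g) : 0 ≤ M :=
  (norm_nonneg _).trans (hg.bd 0 0)

lemma continuousAt_heatT_src (hn : 1 ≤ n) (hr : 2 ≤ r) {lam Lam : ℝ} (hlam : 0 < lam)
    (hLam : 0 ≤ Lam) {a : (Fin r → Fin n) → (H →L[ℂ] H)} (ha : EllCls lam Lam a)
    (hs : ScalarCoef a) (I : List (Fin n)) {α M : ℝ} {g : Vec n → ℝ → H} (hg : HolSrc α M g)
    (p₀ : Vec n × ℝ × ℝ) (hp₀ : 0 < p₀.2.2) :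
    ContinuousAt (fun p : Vec n × ℝ × ℝ => heatT (p.2.2 • a) I (fun y => g y p.2.1) p.1) p₀ := by
  have h := tendsto_integral_kerK hn hr (mul_pos hp₀ hlam) (mul_nonneg hp₀.le hLam)
    (ha.smul hp₀.le) ha.bd (fun ξ => (hs.commute (p₀.2.2 • a) _).symm) I
    (l := 𝓝 p₀) (τ := fun p => p.2.2 - p₀.2.2)
    (by
      have : Continuous fun p : Vec n × ℝ × ℝ => p.2.2 - p₀.2.2 := by fun_prop
      simpa using this.tendsto p₀)
    (f := fun p z => g (p.1 - z) p.2.1) (f₀ := fun z => g (p₀.1 - z) p₀.2.1) (R := M)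
    (Eventually.of_forall fun p => hg.cont.comp
      (by fun_prop : Continuous fun z : Vec n => (p.1 - z, p.2.1)))
    (Eventually.of_forall fun p z => hg.bd _ _)
    (fun z => (hg.cont.comp
      (by fun_prop : Continuous fun p : Vec n × ℝ × ℝ => (p.1 - z, p.2.1))).tendsto p₀)
  refine h.congr fun p => ?_
  have : p₀.2.2 • a + (p.2.2 - p₀.2.2) • a = p.2.2 • a := by module
  rw [this, heatT]

lemma exists_heatT_src_bound (H : Type*) [NormedAddCommGroup H] [InnerProductSpace ℂ H]
    [CompleteSpace H] (hn : 1 ≤ n) (hr : 2 ≤ r) (lam Lam α : ℝ) (hlam : 0 < lam) (hLam : 0 ≤ Lam)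
    (hα0 : 0 < α) (hα1 : α < 1) :
    ∃ C : ℝ, 0 ≤ C ∧ ∀ (a : (Fin r → Fin n) → (H →L[ℂ] H)), EllCls lam Lam a →
      ∀ (M : ℝ) (g : Vec n → ℝ → H), HolSrc α M g → ∀ I, I.length ≤ r → ∀ τ, 0 < τ → τ ≤ 1 →
        ∀ x s, ‖heatT (τ • a) I (fun y => g y s) x‖ ≤ C * M * τ ^ (α / r - 1) := by
  have hrpos : (0 : ℝ) < r := by positivity
  obtain ⟨C, hC, h⟩ := exists_uniform_list_bound (n := n) (P := fun I C => I.length ≤ r →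
    ∀ (a : (Fin r → Fin n) → (H →L[ℂ] H)), EllCls lam Lam a →
      ∀ (M : ℝ) (g : Vec n → ℝ → H), HolSrc α M g → ∀ τ, 0 < τ → τ ≤ 1 →
        ∀ x s, ‖heatT (τ • a) I (fun y => g y s) x‖ ≤ C * M * τ ^ (α / r - 1)) (fun I => by
      by_cases hI : I = []
      · obtain ⟨C, hC, h⟩ := exists_heatT_bound H hn hr lam Lam hlam hLam I
        refine ⟨C, hC, fun _ a ha M g hg τ hτ hτ1 x s => ?_⟩
        have h1 := h τ hτ _ (ha.smul hτ.le) 0 le_rfl zero_le_one (fun y => g y s) M x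
          (fun y => by simpa using hg.bd y s)
        refine h1.trans ?_
        have h2 : (1 : ℝ) ≤ τ ^ (α / r - 1) := by
          refine Real.one_le_rpow_of_pos_of_le_one_of_nonpos hτ hτ1 ?_
          have : α / r ≤ 1 := by
            rw [div_le_one hrpos]
            have : (2 : ℝ) ≤ r := by exact_mod_cast hr
            linarith
          linarith
        have h3 := mul_le_mul_of_nonneg_left h2 (mul_nonneg hC hg.nonneg)
        subst hI
        simpa using h3
      · obtain ⟨C, hC, h⟩ := exists_heatT_holder_bound H hn hr lam Lam hlam hLam I hI
        refine ⟨C, hC, fun hIr a ha M g hg τ hτ hτ1 x s => ?_⟩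
        have h1 := h τ hτ _ (ha.smul hτ.le) α hα0.le hα1.le (fun y => g y s) (hg.cont_space s) M
          (fun y => hg.bd y s) M x (fun y => hg.hol s y x)
        have h2 : τ ^ ((α - I.length) / r) ≤ τ ^ (α / r - 1) := by
          refine Real.rpow_le_rpow_of_exponent_ge hτ hτ1 ?_
          rw [sub_div]
          have : (I.length : ℝ) / r ≤ 1 := by
            rw [div_le_one hrpos]; exact_mod_cast hIr
          linarith
        have h3 := mul_le_mul_of_nonneg_left h2 (mul_nonneg hC hg.nonneg)
        linarith)
    (fun I C C' hCC h hI a ha M g hg τ hτ hτ1 x s => by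
      refine (h hI a ha M g hg τ hτ hτ1 x s).trans ?_
      have := hg.nonneg
      gcongr) r
  exact ⟨C, hC, fun a ha M g hg I hI τ hτ hτ1 x s => h I hI hI a ha M g hg τ hτ hτ1 x s⟩

/-- The jets of the solution of the constant coefficient problem (Duhamel's formula). -/
def baseU (a : (Fin r → Fin n) → (H →L[ℂ] H)) (g : Vec n → ℝ → H) (I : List (Fin n)) (x : Vec n)
    (t : ℝ) : H :=
  ∫ τ in Ioc (0 : ℝ) 1, (Iio t).indicator
    (fun τ => heatT (τ • a) I (fun y => g y (t - τ)) x) τ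

lemma integrableOn_rpow_Ioc {p : ℝ} (hp : -1 < p) : IntegrableOn (fun τ : ℝ => τ ^ p) (Ioc 0 1) := by
  have := intervalIntegral.intervalIntegrable_rpow' (a := 0) (b := 1) hp
  rwa [intervalIntegrable_iff_integrableOn_Ioc_of_le zero_le_one] at this

lemma aestronglyMeasurable_indicator_src (hn : 1 ≤ n) (hr : 2 ≤ r) {lam Lam : ℝ} (hlam : 0 < lam)
    (hLam : 0 ≤ Lam) {a : (Fin r → Fin n) → (H →L[ℂ] H)} (ha : EllCls lam Lam a)
    (hs : ScalarCoef a) (I : List (Fin n)) {α M : ℝ} {g : Vec n → ℝ → H} (hg : HolSrc α M g)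
    (x : Vec n) (t : ℝ) :
    AEStronglyMeasurable ((Iio t).indicator
      (fun τ => heatT (τ • a) I (fun y => g y (t - τ)) x)) (volume.restrict (Ioc (0 : ℝ) 1)) := by
  refine AEStronglyMeasurable.indicator ?_ measurableSet_Iio
  refine ContinuousOn.aestronglyMeasurable (fun τ hτ => ?_) measurableSet_Ioc
  have h1 := continuousAt_heatT_src hn hr hlam hLam ha hs I hg (x, t - τ, τ) hτ.1
  exact (ContinuousAt.comp (f := fun τ : ℝ => (x, t - τ, τ)) h1 (by fun_prop)).continuousWithinAt

/-- Basic properties of the Duhamel integrals. -/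
lemma exists_baseU_bound (H : Type*) [NormedAddCommGroup H] [InnerProductSpace ℂ H]
    [CompleteSpace H] (hn : 1 ≤ n) (hr : 2 ≤ r) (lam Lam α : ℝ) (hlam : 0 < lam) (hLam : 0 ≤ Lam)
    (hα0 : 0 < α) (hα1 : α < 1) :
    ∃ C : ℝ, 0 ≤ C ∧ ∀ (a : (Fin r → Fin n) → (H →L[ℂ] H)), EllCls lam Lam a → ScalarCoef a →
      ∀ (M : ℝ) (g : Vec n → ℝ → H), HolSrc α M g → ∀ I, I.length ≤ r →
        (∀ x t, IntegrableOn ((Iio t).indicator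
          (fun τ => heatT (τ • a) I (fun y => g y (t - τ)) x)) (Ioc (0 : ℝ) 1)) ∧
        (∀ x t, ‖baseU a g I x t‖ ≤ C * M) ∧
        (Continuous fun p : Vec n × ℝ => baseU a g I p.1 p.2) ∧
        (∀ i, I.length < r → ∀ x t, HasLineDerivAt ℝ (fun y => baseU a g I y t)
          (baseU a g (i :: I) x t) x (EuclideanSpace.single i (1 : ℝ))) := by
  have hrpos : (0 : ℝ) < r := by positivity
  obtain ⟨C, hC, hb⟩ := exists_heatT_src_bound H hn hr lam Lam α hlam hLam hα0 hα1
  have hintg : IntegrableOn (fun τ : ℝ => τ ^ (α / r - 1)) (Ioc 0 1) :=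
    integrableOn_rpow_Ioc (by have : 0 < α / r := by positivity
                              linarith)
  refine ⟨C * ∫ τ in Ioc (0 : ℝ) 1, τ ^ (α / r - 1), mul_nonneg hC
    (setIntegral_nonneg measurableSet_Ioc fun τ hτ => Real.rpow_nonneg hτ.1.le _), ?_⟩
  intro a ha hs M g hg I hI
  have hM := hg.nonneg
  have hbd : ∀ I, I.length ≤ r → ∀ x t, ∀ τ ∈ Ioc (0 : ℝ) 1, ‖(Iio t).indicator
      (fun τ => heatT (τ • a) I (fun y => g y (t - τ)) x) τ‖ ≤ C * M * τ ^ (α / r - 1) := by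
    intro I hI x t τ hτ
    refine (norm_indicator_le_norm_self _ _).trans (hb a ha M g hg I hI τ hτ.1 hτ.2 x _)
  have hbae : ∀ I, I.length ≤ r → ∀ x t, ∀ᵐ τ ∂(volume.restrict (Ioc (0 : ℝ) 1)), ‖(Iio t).indicator
      (fun τ => heatT (τ • a) I (fun y => g y (t - τ)) x) τ‖ ≤ C * M * τ ^ (α / r - 1) :=
    fun I hI x t => (ae_restrict_iff' measurableSet_Ioc).2 (Eventually.of_forall (hbd I hI x t))
  have hI1 : ∀ x t, IntegrableOn ((Iio t).indicator
          (fun τ => heatT (τ • a) I (fun y => g y (t - τ)) x)) (Ioc (0 : ℝ) 1) := fun x t =>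
    Integrable.mono' (hintg.const_mul (C * M))
      (aestronglyMeasurable_indicator_src hn hr hlam hLam ha hs I hg x t) (hbae I hI x t)
  refine ⟨hI1, fun x t => ?_, ?_, ?_⟩
  · refine (norm_integral_le_of_norm_le (hintg.const_mul (C * M)) (hbae I hI x t)).trans_eq ?_
    rw [integral_const_mul]; ring
  · refine continuous_iff_continuousAt.2 fun p₀ => ?_
    refine continuousAt_of_dominated (bound := fun τ => C * M * τ ^ (α / r - 1))
      (Eventually.of_forall fun p =>
        aestronglyMeasurable_indicator_src hn hr hlam hLam ha hs I hg p.1 p.2)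
      (Eventually.of_forall fun p => hbae I hI p.1 p.2) (hintg.const_mul (C * M)) ?_
    have h0 : ∀ᵐ τ ∂(volume.restrict (Ioc (0 : ℝ) 1)), τ ≠ p₀.2 :=
      ae_restrict_of_ae (measure_eq_zero_iff_ae_notMem.1 (measure_singleton p₀.2))
    filter_upwards [h0, ae_restrict_mem measurableSet_Ioc] with τ hτ hτ1
    rcases lt_or_gt_of_ne hτ with h | h
    · have h1 := continuousAt_heatT_src hn hr hlam hLam ha hs I hg (p₀.1, p₀.2 - τ, τ) hτ1.1
      have h2 := ContinuousAt.comp (f := fun p : Vec n × ℝ => (p.1, p.2 - τ, τ)) (x := p₀) h1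
        (by fun_prop)
      refine h2.congr ?_
      filter_upwards [continuous_snd.tendsto p₀ |>.eventually (lt_mem_nhds h)] with p hp
      rw [indicator_of_mem (show τ ∈ Iio p.2 from hp)]
      rfl
    · refine (continuousAt_const (y := (0 : H))).congr ?_
      filter_upwards [continuous_snd.tendsto p₀ |>.eventually (gt_mem_nhds h)] with p hp
      rw [indicator_of_notMem (show τ ∉ Iio p.2 from not_lt.2 hp.le)]
  · intro i hIr x t
    set e : Vec n := EuclideanSpace.single i (1 : ℝ)
    have hI' : (i :: I).length ≤ r := by simpa using hIr
    unfold HasLineDerivAt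
    have h := hasDerivAt_integral_of_dominated_loc_of_deriv_le (μ := volume.restrict (Ioc (0 : ℝ) 1))
      (F := fun (u : ℝ) τ => (Iio t).indicator
          (fun τ => heatT (τ • a) I (fun y => g y (t - τ)) (x + u • e)) τ)
      (F' := fun (u : ℝ) τ => (Iio t).indicator
          (fun τ => heatT (τ • a) (i :: I) (fun y => g y (t - τ)) (x + u • e)) τ)
      (x₀ := 0) (s := univ) (bound := fun τ => C * M * τ ^ (α / r - 1)) univ_mem
      (Eventually.of_forall fun u =>
        aestronglyMeasurable_indicator_src hn hr hlam hLam ha hs I hg _ t)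
      (hI1 _ t)
      (aestronglyMeasurable_indicator_src hn hr hlam hLam ha hs (i :: I) hg _ t)
      ((ae_restrict_iff' measurableSet_Ioc).2 (Eventually.of_forall fun τ hτ u _ =>
        hbd (i :: I) hI' _ t τ hτ))
      (hintg.const_mul (C * M))
      ((ae_restrict_iff' measurableSet_Ioc).2 (Eventually.of_forall fun τ hτ u _ => by
        by_cases hτt : τ ∈ Iio t
        · simp only [indicator_of_mem hτt]
          exact (heatT_hasLineDerivAt hn hr (mul_pos hτ.1 hlam) (mul_nonneg hτ.1.le hLam)
            (ha.smul hτ.1.le) I i (hg.cont_space (t - τ)) (fun y => hg.bd y _)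
            (x + u • e)).hasDerivAt_add_smul rfl
        · simp only [indicator_of_notMem hτt]
          exact hasDerivAt_const _ _))
    have h2 := h.2
    simp only [zero_smul, add_zero] at h2
    exact h2

end BaseSolution

section BaseTime

variable {n r : ℕ} {H : Type*} [NormedAddCommGroup H] [InnerProductSpace ℂ H] [CompleteSpace H]

lemma integrable_indicator_of_continuousOn {E : Type*} [NormedAddCommGroup E] {O : Set (ℝ × ℝ)}
    (hO : IsOpen O) (hO1 : O ⊆ Ioc 0 1 ×ˢ Ioc 0 1) {K : ℝ × ℝ → E} (hK : ContinuousOn K O)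
    {b : ℝ → ℝ} (hb : IntegrableOn b (Ioc 0 1)) (hb0 : ∀ σ ∈ Ioc (0 : ℝ) 1, 0 ≤ b σ)
    (hKb : ∀ p ∈ O, ‖K p‖ ≤ b p.2) :
    Integrable (O.indicator K) (volume.prod volume) := by
  have h1 : Integrable (fun p : ℝ × ℝ => (Ioc (0 : ℝ) 1).indicator (fun _ => (1 : ℝ)) p.1
      * (Ioc (0 : ℝ) 1).indicator b p.2) (volume.prod volume) := by
    refine Integrable.mul_prod (f := (Ioc (0 : ℝ) 1).indicator (fun _ => (1 : ℝ)))
      (g := (Ioc (0 : ℝ) 1).indicator b) ?_ ?_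
    · exact (integrable_indicator_iff measurableSet_Ioc).2 (by simp)
    · exact (integrable_indicator_iff measurableSet_Ioc).2 hb
  refine h1.mono' ?_ (Eventually.of_forall fun p => ?_)
  · rw [aestronglyMeasurable_indicator_iff hO.measurableSet]
    exact hK.aestronglyMeasurable hO.measurableSet
  · by_cases hp : p ∈ O
    · rw [indicator_of_mem hp, indicator_of_mem (hO1 hp).1, indicator_of_mem (hO1 hp).2, one_mul]
      exact hKb p hp
    · rw [indicator_of_notMem hp, norm_zero]
      exact mul_nonneg (indicator_nonneg (fun _ _ => zero_le_one) _) (indicator_nonneg hb0 _)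

lemma integral_triangle_shear {E : Type*} [NormedAddCommGroup E] [NormedSpace ℝ E]
    {ψ : ℝ → ℝ → E} (hψ : ContinuousOn (fun p : ℝ × ℝ => ψ p.1 p.2) {p | 0 < p.2})
    {b : ℝ → ℝ} (hb : IntegrableOn b (Ioc 0 1)) (hb0 : ∀ σ ∈ Ioc (0 : ℝ) 1, 0 ≤ b σ)
    (hψb : ∀ s, ∀ σ ∈ Ioc (0 : ℝ) 1, ‖ψ s σ‖ ≤ b σ) {t : ℝ} (ht0 : 0 ≤ t) (ht1 : t ≤ 1) :
    ∫ τ in (0 : ℝ)..t, ∫ σ in (0 : ℝ)..τ, ψ (t - τ) σ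
      = ∫ s in (0 : ℝ)..t, ∫ σ in (0 : ℝ)..s, ψ (s - σ) σ := by
  set O₁ : Set (ℝ × ℝ) := {p | 0 < p.1 ∧ 0 < p.2 ∧ p.1 + p.2 < t} with hO₁
  set O₂ : Set (ℝ × ℝ) := {p | 0 < p.1 - p.2 ∧ 0 < p.2 ∧ p.1 < t} with hO₂
  have o₁ : IsOpen O₁ := (isOpen_lt continuous_const continuous_fst).inter
    ((isOpen_lt continuous_const continuous_snd).inter
      (isOpen_lt (continuous_fst.add continuous_snd) continuous_const))
  have o₂ : IsOpen O₂ := (isOpen_lt continuous_const (continuous_fst.sub continuous_snd)).inter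
    ((isOpen_lt continuous_const continuous_snd).inter
      (isOpen_lt continuous_fst continuous_const))
  have s₁ : O₁ ⊆ Ioc 0 1 ×ˢ Ioc 0 1 := by
    rintro ⟨p, q⟩ ⟨h1, h2, h3⟩
    simp only at h1 h2 h3
    exact ⟨⟨h1, by simp only; linarith⟩, ⟨h2, by simp only; linarith⟩⟩
  have s₂ : O₂ ⊆ Ioc 0 1 ×ˢ Ioc 0 1 := by
    rintro ⟨p, q⟩ ⟨h1, h2, h3⟩
    simp only at h1 h2 h3
    exact ⟨⟨by simp only; linarith, by simp only; linarith⟩, ⟨h2, by simp only; linarith⟩⟩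
  have i₁ : Integrable (O₁.indicator fun p : ℝ × ℝ => ψ p.1 p.2) (volume.prod volume) :=
    integrable_indicator_of_continuousOn o₁ s₁ (hψ.mono fun p hp => hp.2.1) hb hb0
      fun p hp => hψb _ _ (s₁ hp).2
  have i₂ : Integrable (O₂.indicator fun p : ℝ × ℝ => ψ (p.1 - p.2) p.2) (volume.prod volume) :=
    integrable_indicator_of_continuousOn o₂ s₂
      (hψ.comp (f := fun p : ℝ × ℝ => (p.1 - p.2, p.2)) (by fun_prop) fun p hp => hp.2.1) hb hb0
      fun p hp => hψb _ _ (s₂ hp).2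
  have e₁ : ∫ s, ∫ σ, O₁.indicator (fun p : ℝ × ℝ => ψ p.1 p.2) (s, σ)
      = ∫ τ in (0 : ℝ)..t, ∫ σ in (0 : ℝ)..τ, ψ (t - τ) σ := by
    have h1 := intervalIntegral.integral_comp_sub_left (a := 0) (b := t)
      (fun s => ∫ σ in (0 : ℝ)..(t - s), ψ s σ) t
    simp only [sub_sub_cancel, sub_self, sub_zero] at h1
    rw [h1, intervalIntegral.integral_of_le ht0, integral_Ioc_eq_integral_Ioo,
      ← integral_indicator measurableSet_Ioo]
    congr 1
    ext s
    by_cases hs : s ∈ Ioo 0 t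
    · rw [indicator_of_mem hs, intervalIntegral.integral_of_le (by linarith [hs.2]),
        integral_Ioc_eq_integral_Ioo, ← integral_indicator measurableSet_Ioo]
      congr 1
      ext σ
      by_cases hσ : σ ∈ Ioo 0 (t - s)
      · rw [indicator_of_mem hσ, indicator_of_mem]
        exact ⟨hs.1, hσ.1, by simp only; linarith [hσ.2]⟩
      · rw [indicator_of_notMem hσ, indicator_of_notMem]
        rintro ⟨-, h2, h3⟩
        exact hσ ⟨h2, by simp only at h3; linarith⟩
    · rw [indicator_of_notMem hs]
      have : ∀ σ, O₁.indicator (fun p : ℝ × ℝ => ψ p.1 p.2) (s, σ) = 0 := by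
        intro σ
        refine indicator_of_notMem ?_ _
        rintro ⟨h1, h2, h3⟩
        simp only at h1 h2 h3
        exact hs ⟨h1, by linarith⟩
      simp only [this, integral_zero]
  have e₂ : ∫ s, ∫ σ, O₂.indicator (fun p : ℝ × ℝ => ψ (p.1 - p.2) p.2) (s, σ)
      = ∫ s in (0 : ℝ)..t, ∫ σ in (0 : ℝ)..s, ψ (s - σ) σ := by
    rw [intervalIntegral.integral_of_le ht0, integral_Ioc_eq_integral_Ioo,
      ← integral_indicator measurableSet_Ioo]
    congr 1
    ext s
    by_cases hs : s ∈ Ioo 0 t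
    · rw [indicator_of_mem hs, intervalIntegral.integral_of_le hs.1.le,
        integral_Ioc_eq_integral_Ioo, ← integral_indicator measurableSet_Ioo]
      congr 1
      ext σ
      by_cases hσ : σ ∈ Ioo 0 s
      · rw [indicator_of_mem hσ, indicator_of_mem]
        exact ⟨by simp only; linarith [hσ.2], hσ.1, hs.2⟩
      · rw [indicator_of_notMem hσ, indicator_of_notMem]
        rintro ⟨h1, h2, -⟩
        exact hσ ⟨h2, by simp only at h1; linarith⟩
    · rw [indicator_of_notMem hs]
      have : ∀ σ, O₂.indicator (fun p : ℝ × ℝ => ψ (p.1 - p.2) p.2) (s, σ) = 0 := by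
        intro σ
        refine indicator_of_notMem ?_ _
        rintro ⟨h1, h2, h3⟩
        simp only at h1 h2 h3
        exact hs ⟨by linarith, h3⟩
      simp only [this, integral_zero]
  rw [← e₁, ← e₂, integral_integral_swap (f := fun s σ => O₁.indicator
    (fun p : ℝ × ℝ => ψ p.1 p.2) (s, σ)) i₁, integral_integral_swap (f := fun s σ => O₂.indicator
    (fun p : ℝ × ℝ => ψ (p.1 - p.2) p.2) (s, σ)) i₂]
  congr 1
  ext σ
  rw [← integral_sub_right_eq_self (fun s => O₁.indicator (fun p : ℝ × ℝ => ψ p.1 p.2) (s, σ)) σ]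
  congr 1
  ext s
  by_cases hp : (s, σ) ∈ O₂
  · rw [indicator_of_mem hp, indicator_of_mem]
    exact ⟨hp.1, hp.2.1, by have := hp.2.2; simp only at this ⊢; linarith⟩
  · rw [indicator_of_notMem hp, indicator_of_notMem]
    rintro ⟨h1, h2, h3⟩
    exact hp ⟨h1, h2, by simp only at h3 ⊢; linarith⟩

lemma hasDerivAt_heatT_time (hn : 1 ≤ n) (hr : 2 ≤ r) {lam Lam : ℝ} (hlam : 0 < lam)
    (hLam : 0 ≤ Lam) {a : (Fin r → Fin n) → (H →L[ℂ] H)} (ha : EllCls lam Lam a)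
    (hs : ScalarCoef a) {f : Vec n → H} (hf : Continuous f) {M : ℝ} (hM : ∀ y, ‖f y‖ ≤ M)
    (x : Vec n) {σ : ℝ} (hσ : 0 < σ) :
    HasDerivAt (fun τ => heatT (τ • a) [] f x) (∑ J, a J (heatT (σ • a) (List.ofFn J) f x)) σ := by
  have hM0 : 0 ≤ M := (norm_nonneg _).trans (hM x)
  have h := hasDerivAt_heatT_param hn hr (mul_pos hσ hlam) (mul_nonneg hσ.le hLam) (s₀ := σ)
    (ha.smul hσ.le) ha.bd (fun t ξ => (hs.commute _ _).symm) [] one_pos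
    (w := fun y _ => f y) (wt := fun _ _ => 0) (R := M) (fun _ _ => hf) (fun _ _ y => hM y)
    continuous_const (fun _ _ _ => by simpa using hM0) (fun _ _ y => hasDerivAt_const _ _) x
  have e : ∀ s : ℝ, σ • a + (s - σ) • a = s • a := fun s => by module
  simp only [e, List.append_nil] at h
  have h2 : heatT (σ • a) [] (fun _ => (0 : H)) x = 0 := by simp [heatT]
  rw [h2, add_zero] at h
  refine h.congr_deriv (Finset.sum_congr rfl fun J _ => ?_)
  exact heatT_scalar _ _ (hs J) f x

lemma setIntegral_indicator_Iio_eq {E : Type*} [NormedAddCommGroup E] [NormedSpace ℝ E]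
    (f : ℝ → E) {t : ℝ} (ht0 : 0 ≤ t) (ht1 : t ≤ 1) :
    ∫ τ in Ioc (0 : ℝ) 1, (Iio t).indicator f τ = ∫ τ in (0 : ℝ)..t, f τ := by
  rw [setIntegral_indicator measurableSet_Iio, intervalIntegral.integral_of_le ht0,
    integral_Ioc_eq_integral_Ioo]
  congr 2
  ext τ
  simp only [mem_inter_iff, mem_Ioc, mem_Iio, mem_Ioo]
  exact ⟨fun h => ⟨h.1.1, h.2⟩, fun h => ⟨⟨h.1, by linarith [h.2]⟩, h.2⟩⟩

/-- The Duhamel integral solves the integrated equation. -/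
lemma baseU_nil_eq (hn : 1 ≤ n) (hr : 2 ≤ r) {lam Lam α M : ℝ} (hlam : 0 < lam)
    (hLam : 0 ≤ Lam) (hα0 : 0 < α) (hα1 : α < 1)
    {a : (Fin r → Fin n) → (H →L[ℂ] H)} (ha : EllCls lam Lam a)
    (hs : ScalarCoef a) {g : Vec n → ℝ → H} (hg : HolSrc α M g) (x : Vec n) {t : ℝ} (ht0 : 0 ≤ t)
    (ht1 : t ≤ 1) :
    baseU a g [] x t
      = ∫ s in (0 : ℝ)..t, (g x s + ∑ J, a J (baseU a g (List.ofFn J) x s)) := by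
  obtain ⟨C, hC, hb⟩ := exists_heatT_src_bound H hn hr lam Lam α hlam hLam hα0 hα1
  obtain ⟨C', hC', hU⟩ := exists_baseU_bound H hn hr lam Lam α hlam hLam hα0 hα1
  have hM := hg.nonneg
  have hrpos : (0 : ℝ) < r := by positivity
  set m : ℝ := ((Fintype.card (Fin r → Fin n) : ℕ) : ℝ) with hm
  set b : ℝ → ℝ := fun σ => m * (Lam * (C * M * σ ^ (α / r - 1))) with hbdef
  have hintg : IntegrableOn b (Ioc 0 1) :=
    (((integrableOn_rpow_Ioc (by have : 0 < α / r := by positivity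
                                 linarith)).const_mul _).const_mul _).const_mul _
  have hb0 : ∀ σ ∈ Ioc (0 : ℝ) 1, 0 ≤ b σ := fun σ hσ => by
    have := hσ.1
    positivity
  set ψ : ℝ → ℝ → H := fun s σ => ∑ J, a J (heatT (σ • a) (List.ofFn J) (fun y => g y s) x)
    with hψ
  have hψc : ContinuousOn (fun p : ℝ × ℝ => ψ p.1 p.2) {p | 0 < p.2} := by
    refine continuousOn_finsetSum _ fun J _ => (a J).continuous.comp_continuousOn fun p hp => ?_
    have h1 := continuousAt_heatT_src hn hr hlam hLam ha hs (List.ofFn J) hg (x, p.1, p.2) hp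
    exact (ContinuousAt.comp (f := fun p : ℝ × ℝ => (x, p.1, p.2)) h1
      (by fun_prop)).continuousWithinAt
  have hψb : ∀ s, ∀ σ ∈ Ioc (0 : ℝ) 1, ‖ψ s σ‖ ≤ b σ := fun s σ hσ =>
    norm_sum_clm_le _ _ hLam ha.bd fun J => hb a ha M g hg _ (by simp) σ hσ.1 hσ.2 x s
  have hψi : ∀ s, IntegrableOn (ψ s) (Ioc 0 1) := fun s => by
    refine Integrable.mono' hintg ?_ ((ae_restrict_iff' measurableSet_Ioc).2
      (Eventually.of_forall (hψb s)))
    refine ContinuousOn.aestronglyMeasurable ?_ measurableSet_Ioc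
    exact hψc.comp (f := fun σ : ℝ => (s, σ)) (by fun_prop) fun σ hσ => hσ.1
  have hftc : ∀ s, ∀ τ, 0 < τ → τ ≤ 1 →
      heatT (τ • a) [] (fun y => g y s) x = g x s + ∫ σ in (0 : ℝ)..τ, ψ s σ := by
    intro s τ hτ hτ1
    have h1 := intervalIntegral.integral_eq_sub_of_hasDerivAt_of_tendsto hτ
      (fun σ hσ => hasDerivAt_heatT_time hn hr hlam hLam ha hs (hg.cont_space s)
        (fun y => hg.bd y s) x hσ.1)
      ((intervalIntegrable_iff_integrableOn_Ioc_of_le hτ.le).2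
        ((hψi s).mono_set (Ioc_subset_Ioc_right hτ1)))
      (tendsto_heatT_nil hn hr hlam hLam ha (hg.cont_space s) (fun y => hg.bd y s) x)
      ((hasDerivAt_heatT_time hn hr hlam hLam ha hs (hg.cont_space s)
        (fun y => hg.bd y s) x hτ).continuousAt.tendsto.mono_left nhdsWithin_le_nhds)
    rw [h1]; abel
  have hUint : ∀ J : Fin r → Fin n, ∀ s ∈ Icc 0 t, IntervalIntegrable
      (fun τ => heatT (τ • a) (List.ofFn J) (fun y => g y (s - τ)) x) volume 0 s := by
    intro J s hs'
    have h1 := (hU a ha hs M g hg (List.ofFn J) (by simp)).1 x s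
    rw [intervalIntegrable_iff_integrableOn_Ioo_of_le hs'.1]
    have h2 := h1.mono_set (show Ioo 0 s ⊆ Ioc 0 1 from fun τ hτ =>
      ⟨hτ.1, by linarith [hτ.2, hs'.2]⟩)
    refine h2.congr_fun (fun τ hτ => ?_) measurableSet_Ioo
    exact indicator_of_mem (show τ ∈ Iio s from hτ.2) _
  have hrhs : ∀ s ∈ Icc 0 t, ∑ J, a J (baseU a g (List.ofFn J) x s)
      = ∫ σ in (0 : ℝ)..s, ψ (s - σ) σ := by
    intro s hs'
    rw [hψ, intervalIntegral.integral_finsetSum]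
    · refine Finset.sum_congr rfl fun J _ => ?_
      rw [baseU, setIntegral_indicator_Iio_eq _ hs'.1 (hs'.2.trans ht1)]
      exact (((a J).restrictScalars ℝ).intervalIntegral_comp_comm (hUint J s hs')).symm
    · intro J _
      exact ⟨((a J).restrictScalars ℝ).integrable_comp (hUint J s hs').1,
        ((a J).restrictScalars ℝ).integrable_comp (hUint J s hs').2⟩
  have hgc : Continuous fun s => g x s := hg.cont.comp (by fun_prop : Continuous fun s : ℝ => (x, s))
  have hWc : Continuous fun s => ∑ J, a J (baseU a g (List.ofFn J) x s) := by
    refine continuous_finsetSum _ fun J _ => (a J).continuous.comp ?_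
    exact (hU a ha hs M g hg (List.ofFn J) (by simp)).2.2.1.comp
      (by fun_prop : Continuous fun s : ℝ => (x, s))
  have hΨ : ∀ τ ∈ Ioc 0 t, heatT (τ • a) [] (fun y => g y (t - τ)) x - g x (t - τ)
      = ∫ σ in (0 : ℝ)..τ, ψ (t - τ) σ := fun τ hτ => by
    rw [hftc (t - τ) τ hτ.1 (hτ.2.trans ht1)]; abel
  have hUi : IntervalIntegrable (fun τ => heatT (τ • a) [] (fun y => g y (t - τ)) x) volume 0 t := by
    have h1 := (hU a ha hs M g hg [] (by simp)).1 x t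
    rw [intervalIntegrable_iff_integrableOn_Ioo_of_le ht0]
    have h2 := h1.mono_set (show Ioo 0 t ⊆ Ioc 0 1 from fun τ hτ => ⟨hτ.1, by linarith [hτ.2]⟩)
    refine h2.congr_fun (fun τ hτ => ?_) measurableSet_Ioo
    exact indicator_of_mem (show τ ∈ Iio t from hτ.2) _
  have hgi : IntervalIntegrable (fun τ => g x (t - τ)) volume 0 t :=
    (hgc.comp (by fun_prop : Continuous fun τ : ℝ => t - τ)).intervalIntegrable _ _
  rw [intervalIntegral.integral_add (hgc.intervalIntegrable _ _) (hWc.intervalIntegrable _ _)]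
  have e3 : ∫ s in (0 : ℝ)..t, ∑ J, a J (baseU a g (List.ofFn J) x s)
      = ∫ s in (0 : ℝ)..t, ∫ σ in (0 : ℝ)..s, ψ (s - σ) σ := by
    refine intervalIntegral.integral_congr fun s hs' => ?_
    rw [uIcc_of_le ht0] at hs'
    exact hrhs s hs'
  rw [e3, ← integral_triangle_shear hψc hintg hb0 hψb ht0 ht1, baseU,
    setIntegral_indicator_Iio_eq _ ht0 ht1]
  have e4 : ∫ τ in (0 : ℝ)..t, ∫ σ in (0 : ℝ)..τ, ψ (t - τ) σ
      = ∫ τ in (0 : ℝ)..t, (heatT (τ • a) [] (fun y => g y (t - τ)) x - g x (t - τ)) := by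
    rw [intervalIntegral.integral_of_le ht0, intervalIntegral.integral_of_le ht0]
    exact setIntegral_congr_fun measurableSet_Ioc fun τ hτ => (hΨ τ hτ).symm
  rw [e4, intervalIntegral.integral_sub hUi hgi]
  have e5 : ∫ τ in (0 : ℝ)..t, g x (t - τ) = ∫ s in (0 : ℝ)..t, g x s := by
    simp
  rw [e5]; abel

/-- The Duhamel integral is a solution of the constant coefficient problem. -/
lemma exists_baseU_linSol (H : Type*) [NormedAddCommGroup H] [InnerProductSpace ℂ H]
    [CompleteSpace H] (hn : 1 ≤ n) (hr : 2 ≤ r) (lam Lam α : ℝ) (hlam : 0 < lam) (hLam : 0 ≤ Lam)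
    (hα0 : 0 < α) (hα1 : α < 1) :
    ∃ C : ℝ, 0 ≤ C ∧ ∀ (a : (Fin r → Fin n) → (H →L[ℂ] H)), EllCls lam Lam a → ScalarCoef a →
      ∀ (M : ℝ) (g : Vec n → ℝ → H), HolSrc α M g → ∀ δ, 0 ≤ δ → δ ≤ 1 →
        LinSol δ (C * M) (fun _ => a) g (baseU a g)
          (fun x t => ∑ J, a J (baseU a g (List.ofFn J) x t) + g x t) := by
  obtain ⟨C, hC, hU⟩ := exists_baseU_bound H hn hr lam Lam α hlam hLam hα0 hα1
  set m : ℝ := ((Fintype.card (Fin r → Fin n) : ℕ) : ℝ) with hm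
  refine ⟨C + (m * (Lam * C) + 1), by positivity, fun a ha hs M g hg δ hδ hδ1 => ?_⟩
  have hM := hg.nonneg
  have hc : ∀ I, I.length ≤ r → ∀ t, Continuous fun x => baseU a g I x t := fun I hI t =>
    (hU a ha hs M g hg I hI).2.2.1.comp (by fun_prop : Continuous fun x : Vec n => (x, t))
  have hct : ∀ I, I.length ≤ r → ∀ x, Continuous fun t => baseU a g I x t := fun I hI x =>
    (hU a ha hs M g hg I hI).2.2.1.comp (by fun_prop : Continuous fun t : ℝ => (x, t))
  have hgct : ∀ x, Continuous fun s => g x s := fun x =>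
    hg.cont.comp (by fun_prop : Continuous fun s : ℝ => (x, s))
  have hnn : 0 ≤ (m * (Lam * C) + 1) * M := by positivity
  have hnn' : 0 ≤ C * M := by positivity
  refine ⟨fun t ht => ⟨fun I hI => hc I hI t, fun I hI x =>
      ((hU a ha hs M g hg I hI).2.1 x t).trans (by rw [add_mul]; linarith), fun I i hI x =>
      (hU a ha hs M g hg I hI.le).2.2.2 i hI x t⟩, fun x t ht => ?_, fun x => ?_, fun t ht =>
      (continuous_finsetSum _ fun J _ => (a J).continuous.comp (hc _ (by simp) t)).add
        (hg.cont_space t), fun t ht x => ?_, fun t ht x => rfl⟩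
  · have hW : Continuous fun s => g x s + ∑ J, a J (baseU a g (List.ofFn J) x s) :=
      (hgct x).add (continuous_finsetSum _ fun J _ => (a J).continuous.comp (hct _ (by simp) x))
    have h1 := (intervalIntegral.integral_hasDerivAt_right (a := 0) (b := t)
      (hW.intervalIntegrable _ _) hW.stronglyMeasurable.stronglyMeasurableAtFilter
      hW.continuousAt).hasDerivWithinAt (s := Icc 0 δ)
    rw [add_comm] at h1
    refine h1.congr (fun s hs' => ?_) ?_
    · exact baseU_nil_eq hn hr hlam hLam hα0 hα1 ha hs hg x hs'.1 (hs'.2.trans hδ1)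
    · exact baseU_nil_eq hn hr hlam hLam hα0 hα1 ha hs hg x ht.1 (ht.2.trans hδ1)
  · rw [baseU_nil_eq hn hr hlam hLam hα0 hα1 ha hs hg x le_rfl zero_le_one,
      intervalIntegral.integral_same]
  · have h1 := norm_sum_clm_le a (fun J => baseU a g (List.ofFn J) x t) hLam ha.bd
      fun J => (hU a ha hs M g hg (List.ofFn J) (by simp)).2.1 x t
    refine (norm_add_le _ _).trans ((add_le_add h1 (hg.bd x t)).trans ?_)
    rw [← hm]
    have : (C + (m * (Lam * C) + 1)) * M = C * M + (m * (Lam * (C * M)) + M) := by ring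
    linarith

end BaseTime

section FixedPoint

variable {n r : ℕ} {H : Type*} [NormedAddCommGroup H] [InnerProductSpace ℂ H] [CompleteSpace H]

lemma LinSol.sub {δ R R' : ℝ} {a : Vec n → (Fin r → Fin n) → (H →L[ℂ] H)} {f f' : Vec n → ℝ → H}
    {d d' : List (Fin n) → Vec n → ℝ → H} {wt wt' : Vec n → ℝ → H} (h : LinSol δ R a f d wt)
    (h' : LinSol δ R' a f' d' wt') :
    LinSol δ (R + R') a (fun x t => f x t - f' x t) (fun I x t => d I x t - d' I x t)
      (fun x t => wt x t - wt' x t) where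
  jets t ht := (h.jets t ht).sub (h'.jets t ht)
  time x t ht := (h.time x t ht).sub (h'.time x t ht)
  zero x := by rw [h.zero, h'.zero, sub_zero]
  wt_cont t ht := (h.wt_cont t ht).sub (h'.wt_cont t ht)
  wt_bd t ht x := (norm_sub_le _ _).trans (add_le_add (h.wt_bd t ht x) (h'.wt_bd t ht x))
  eq t ht x := by
    rw [h.eq t ht, h'.eq t ht]
    simp only [map_sub, Finset.sum_sub_distrib]
    abel

/-- Projection of the time axis onto `[0,δ]`. -/
def clampT (δ t : ℝ) : ℝ := max 0 (min t δ)

lemma clampT_mem {δ : ℝ} (hδ : 0 ≤ δ) (t : ℝ) : clampT δ t ∈ Icc 0 δ :=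
  ⟨le_max_left _ _, max_le hδ (min_le_right _ _)⟩

lemma clampT_of_mem {δ t : ℝ} (ht : t ∈ Icc 0 δ) : clampT δ t = t := by
  rw [clampT, min_eq_left ht.2, max_eq_right ht.1]

lemma continuous_clampT (δ : ℝ) : Continuous (clampT δ) := by
  unfold clampT; fun_prop

lemma continuous_clampT_of_holder {E : Type*} [NormedAddCommGroup E] {δ K β : ℝ} (hδ : 0 ≤ δ)
    (hβ : 0 < β) {φ : Vec n → ℝ → E} (hc : ∀ t ∈ Icc 0 δ, Continuous fun x => φ x t)
    (ht : ∀ t ∈ Icc 0 δ, ∀ s ∈ Icc 0 δ, ∀ x, ‖φ x t - φ x s‖ ≤ K * |t - s| ^ β) :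
    Continuous fun p : Vec n × ℝ => φ p.1 (clampT δ p.2) := by
  rw [continuous_iff_continuousAt]
  rintro ⟨x₀, t₀⟩
  have h1 : Tendsto (fun p : Vec n × ℝ => K * |clampT δ p.2 - clampT δ t₀| ^ β
      + ‖φ p.1 (clampT δ t₀) - φ x₀ (clampT δ t₀)‖) (𝓝 (x₀, t₀)) (𝓝 0) := by
    have c1 : Continuous fun p : Vec n × ℝ => K * |clampT δ p.2 - clampT δ t₀| ^ β
      + ‖φ p.1 (clampT δ t₀) - φ x₀ (clampT δ t₀)‖ := by
      have h2 := continuous_clampT δ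
      have h3 : Continuous fun p : Vec n × ℝ => φ p.1 (clampT δ t₀) :=
        (hc _ (clampT_mem hδ t₀)).comp continuous_fst
      have h4 : Continuous fun p : Vec n × ℝ => |clampT δ p.2 - clampT δ t₀| ^ β :=
        Continuous.rpow_const (by fun_prop) fun _ => Or.inr hβ.le
      exact (continuous_const.mul h4).add (h3.sub continuous_const).norm
    have := c1.tendsto (x₀, t₀)
    simpa [Real.zero_rpow hβ.ne'] using this
  refine tendsto_iff_norm_sub_tendsto_zero.2 (squeeze_zero (fun _ => norm_nonneg _) (fun p => ?_) h1)
  have := ht _ (clampT_mem hδ p.2) _ (clampT_mem hδ t₀) p.1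
  refine (norm_sub_le_norm_sub_add_norm_sub _ (φ p.1 (clampT δ t₀)) _).trans ?_
  exact add_le_add this le_rfl

/-- Functions with sup bound `m` and `α`-Hölder constant `M`. -/
structure HolV {E : Type*} [NormedAddCommGroup E] (α m M : ℝ) (g : Vec n → E) : Prop where
  bd : ∀ x, ‖g x‖ ≤ m
  hol : ∀ x y, ‖g x - g y‖ ≤ M * ‖x - y‖ ^ α

namespace HolV

variable {E F : Type*} [NormedAddCommGroup E] [NormedAddCommGroup F] {α m M m' M' : ℝ}

lemma mono {g : Vec n → E} (h : HolV α m M g) (h1 : m ≤ m') (h2 : M ≤ M') : HolV α m' M' g :=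
  ⟨fun x => (h.bd x).trans h1, fun x y => (h.hol x y).trans (by gcongr)⟩

lemma nonneg {g : Vec n → E} (h : HolV α m M g) : 0 ≤ m := (norm_nonneg _).trans (h.bd 0)

lemma add {g g' : Vec n → E} (h : HolV α m M g) (h' : HolV α m' M' g') :
    HolV α (m + m') (M + M') (fun x => g x + g' x) :=
  ⟨fun x => (norm_add_le _ _).trans (add_le_add (h.bd x) (h'.bd x)), fun x y => by
    rw [add_sub_add_comm, add_mul]
    exact (norm_add_le _ _).trans (add_le_add (h.hol x y) (h'.hol x y))⟩

lemma sub {g g' : Vec n → E} (h : HolV α m M g) (h' : HolV α m' M' g') :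
    HolV α (m + m') (M + M') (fun x => g x - g' x) :=
  ⟨fun x => (norm_sub_le _ _).trans (add_le_add (h.bd x) (h'.bd x)), fun x y => by
    rw [sub_sub_sub_comm, add_mul]
    exact (norm_sub_le _ _).trans (add_le_add (h.hol x y) (h'.hol x y))⟩

lemma sum {ι : Type*} [Fintype ι] {g : ι → Vec n → E} (h : ∀ j, HolV α m M (g j)) :
    HolV α (Fintype.card ι * m) (Fintype.card ι * M) (fun x => ∑ j, g j x) :=
  ⟨fun x => (norm_sum_le _ _).trans ((Finset.sum_le_card_nsmul _ _ m fun j _ => (h j).bd x).trans_eq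
    (by simp)), fun x y => by
    rw [← Finset.sum_sub_distrib]
    refine (norm_sum_le _ _).trans ((Finset.sum_le_card_nsmul _ _ (M * ‖x - y‖ ^ α)
      fun j _ => (h j).hol x y).trans_eq ?_)
    simp [mul_assoc]⟩

lemma clm_apply {𝕜 : Type*} [NontriviallyNormedField 𝕜] [NormedSpace 𝕜 E] [NormedSpace 𝕜 F]
    {A : Vec n → E →L[𝕜] F} {v : Vec n → E} (hA : HolV α m M A) (hv : HolV α m' M' v) :
    HolV α (m * m') (m * M' + M * m') (fun x => A x (v x)) :=
  ⟨fun x => ((A x).le_opNorm _).trans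
    (mul_le_mul (hA.bd x) (hv.bd x) (norm_nonneg _) hA.nonneg), fun x y => by
    have e : A x (v x) - A y (v y) = A x (v x - v y) + (A x - A y) (v y) := by
      simp
    rw [e]
    refine (norm_add_le _ _).trans ?_
    have h1 : ‖A x (v x - v y)‖ ≤ m * (M' * ‖x - y‖ ^ α) := ((A x).le_opNorm _).trans
      (mul_le_mul (hA.bd x) (hv.hol x y) (norm_nonneg _) hA.nonneg)
    have h2 : ‖(A x - A y) (v y)‖ ≤ (M * ‖x - y‖ ^ α) * m' := ((A x - A y).le_opNorm _).trans
      (mul_le_mul (hA.hol x y) (hv.bd y) (norm_nonneg _) ((norm_nonneg _).trans (hA.hol x y)))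
    linarith⟩

lemma clm_comp {𝕜 : Type*} [NontriviallyNormedField 𝕜] [NormedSpace 𝕜 E] [NormedSpace 𝕜 F]
    {A : E →L[𝕜] F} (hA : ‖A‖ ≤ 1) {v : Vec n → E} (hv : HolV α m M v) :
    HolV α m M (fun x => A (v x)) := by
  refine ⟨fun x => ?_, fun x y => ?_⟩
  · refine (A.le_opNorm _).trans ((mul_le_of_le_one_left (norm_nonneg _) hA).trans (hv.bd x))
  · rw [← map_sub]
    exact (A.le_opNorm _).trans ((mul_le_of_le_one_left (norm_nonneg _) hA).trans (hv.hol x y))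

lemma const_smul {𝕜 : Type*} [NormedField 𝕜] [NormedSpace 𝕜 E] (c : 𝕜)
    {g : Vec n → E} (h : HolV α m M g) : HolV α (‖c‖ * m) (‖c‖ * M) (fun x => c • g x) :=
  ⟨fun x => by rw [norm_smul]; gcongr; exact h.bd x, fun x y => by
    rw [← smul_sub, norm_smul, mul_assoc]; gcongr; exact h.hol x y⟩

lemma continuous (hα : 0 < α) {g : Vec n → E} (h : HolV α m M g) : Continuous g := by
  rw [continuous_iff_continuousAt]
  intro x₀
  have h1 : Tendsto (fun x : Vec n => M * ‖x - x₀‖ ^ α) (𝓝 x₀) (𝓝 0) := by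
    have c1 : Continuous fun x : Vec n => M * ‖x - x₀‖ ^ α :=
      continuous_const.mul (Continuous.rpow_const (by fun_prop) fun _ => Or.inr hα.le)
    simpa [Real.zero_rpow hα.ne'] using c1.tendsto x₀
  exact tendsto_iff_norm_sub_tendsto_zero.2
    (squeeze_zero (fun _ => norm_nonneg _) (fun x => h.hol x x₀) h1)

/-- Bounded Lipschitz functions are Hölder continuous. -/
lemma of_lipschitz (hα0 : 0 ≤ α) (hα1 : α ≤ 1) {g : Vec n → E} {L : ℝ} (hm : ∀ x, ‖g x‖ ≤ m)
    (hL0 : 0 ≤ L) (hL : ∀ x y, ‖g x - g y‖ ≤ L * ‖x - y‖) : HolV α m (L + 2 * m) g := by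
  have hm0 : 0 ≤ m := (norm_nonneg _).trans (hm 0)
  refine ⟨hm, fun x y => ?_⟩
  rcases le_total ‖x - y‖ 1 with h | h
  · have h1 : ‖x - y‖ ≤ ‖x - y‖ ^ α := by
      rcases (norm_nonneg (x - y)).eq_or_lt with h0 | h0
      · rw [← h0]; exact Real.rpow_nonneg le_rfl _
      · simpa using Real.rpow_le_rpow_of_exponent_ge h0 h hα1
    have h2 : 0 ≤ ‖x - y‖ ^ α := by positivity
    have := hL x y
    nlinarith
  · have h1 : 1 ≤ ‖x - y‖ ^ α := Real.one_le_rpow h hα0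
    have h2 := (norm_sub_le (g x) (g y)).trans (add_le_add (hm x) (hm y))
    nlinarith

end HolV

lemma HolSrc.holV {α M : ℝ} {g : Vec n → ℝ → H} (h : HolSrc α M g) (t : ℝ) :
    HolV α M M (fun x => g x t) := ⟨fun x => h.bd x t, h.hol t⟩

lemma HolSrc.of_holV {α M : ℝ} {g : Vec n → ℝ → H}
    (hc : Continuous fun p : Vec n × ℝ => g p.1 p.2) (h : ∀ t, HolV α M M (fun x => g x t)) :
    HolSrc α M g := ⟨hc, fun x t => (h t).bd x, fun t => (h t).hol⟩

lemma HolSrc.mono {α M M' : ℝ} {g : Vec n → ℝ → H} (h : HolSrc α M g) (hM : M ≤ M') :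
    HolSrc α M' g := .of_holV h.cont fun t => (h.holV t).mono hM hM

lemma HolSrc.add {α M M' : ℝ} {g g' : Vec n → ℝ → H} (h : HolSrc α M g) (h' : HolSrc α M' g') :
    HolSrc α (M + M') (fun x t => g x t + g' x t) :=
  .of_holV (h.cont.add h'.cont) fun t => (h.holV t).add (h'.holV t)

lemma HolSrc.sub {α M M' : ℝ} {g g' : Vec n → ℝ → H} (h : HolSrc α M g) (h' : HolSrc α M' g') :
    HolSrc α (M + M') (fun x t => g x t - g' x t) :=
  .of_holV (h.cont.sub h'.cont) fun t => (h.holV t).sub (h'.holV t)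

lemma HolSrc.zero {α M : ℝ} (hM : 0 ≤ M) : HolSrc α M (fun (_ : Vec n) (_ : ℝ) => (0 : H)) :=
  .of_holV continuous_const fun _ => ⟨fun _ => by simpa, fun x y => by
    rw [sub_zero, norm_zero]; positivity⟩

/-- Limits of sequences with geometrically decreasing increments. -/
lemma HolSrc.exists_limit {α K : ℝ} {g : ℕ → Vec n → ℝ → H} (hK : 0 ≤ K)
    (h0 : ∀ k, HolSrc α K (g k))
    (h : ∀ k, HolSrc α (K / 2 ^ k) (fun x t => g (k + 1) x t - g k x t)) :
    ∃ G : Vec n → ℝ → H, HolSrc α K G ∧ (∀ x t, Tendsto (fun k => g k x t) atTop (𝓝 (G x t))) ∧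
      ∀ k, HolSrc α (2 * K / 2 ^ k) (fun x t => G x t - g k x t) := by
  have hd : ∀ k j, HolSrc α (2 * K / 2 ^ k) (fun x t => g (k + j) x t - g k x t) := by
    intro k j
    have h1 : HolSrc α (2 * K / 2 ^ k - 2 * K / 2 ^ (k + j))
        (fun x t => g (k + j) x t - g k x t) := by
      induction j with
      | zero => simpa using HolSrc.zero (n := n) (H := H) (α := α) le_rfl
      | succ j ih =>
        have h2 := (h (k + j)).add ih
        convert h2 using 1
        · rw [← add_assoc, pow_succ (2 : ℝ) (k + j)]; field_simp; ring
        · funext x t; rw [add_assoc]; abel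
    exact h1.mono (by have : 0 ≤ 2 * K / 2 ^ (k + j) := by positivity
                      linarith)
  have hlim0 : Tendsto (fun k : ℕ => 2 * K / 2 ^ k) atTop (𝓝 0) := by
    have := (tendsto_pow_atTop_nhds_zero_of_lt_one (r := (1 / 2 : ℝ)) (by norm_num)
      (by norm_num)).const_mul (2 * K)
    simpa [div_eq_mul_inv] using this
  have hcau : ∀ x t, ∃ y, Tendsto (fun k => g k x t) atTop (𝓝 y) := by
    intro x t
    refine cauchySeq_tendsto_of_complete (cauchySeq_of_le_tendsto_0' _ (fun k m hkm => ?_) hlim0)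
    obtain ⟨j, rfl⟩ := Nat.exists_eq_add_of_le hkm
    rw [dist_comm, dist_eq_norm]
    exact (hd k j).bd x t
  choose G hG using hcau
  have hbd : ∀ k x t, ‖G x t - g k x t‖ ≤ 2 * K / 2 ^ k := fun k x t =>
    le_of_tendsto ((((tendsto_add_atTop_iff_nat k).2 (hG x t)).sub_const (g k x t)).norm)
      (Eventually.of_forall fun j => by
        have := (hd k j).bd x t
        rwa [add_comm k j] at this)
  have hGc : Continuous fun p : Vec n × ℝ => G p.1 p.2 := by
    refine TendstoUniformly.continuous (F := fun k (p : Vec n × ℝ) => g k p.1 p.2) (p := atTop)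
      ?_ (Frequently.of_forall fun k => (h0 k).cont)
    rw [Metric.tendstoUniformly_iff]
    intro ε hε
    filter_upwards [hlim0.eventually (gt_mem_nhds hε)] with k hk p
    rw [dist_eq_norm]
    exact (hbd k _ _).trans_lt hk
  refine ⟨G, ⟨hGc, fun x t => ?_, fun t x y => ?_⟩, hG, fun k => ⟨hGc.sub (h0 k).cont, fun x t =>
    hbd k x t, fun t x y => ?_⟩⟩
  · exact le_of_tendsto (hG x t).norm (Eventually.of_forall fun k => (h0 k).bd x t)
  · exact le_of_tendsto ((hG x t).sub (hG y t)).norm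
      (Eventually.of_forall fun k => (h0 k).hol t x y)
  · refine le_of_tendsto (((((tendsto_add_atTop_iff_nat k).2 (hG x t)).sub_const (g k x t)).sub
      (((tendsto_add_atTop_iff_nat k).2 (hG y t)).sub_const (g k y t))).norm)
      (Eventually.of_forall fun j => ?_)
    have := (hd k j).hol t x y
    rwa [add_comm k j] at this

/-- A contraction principle for Hölder continuous sources satisfying a closed condition `P`. -/
lemma HolSrc.exists_fixedPoint {α K : ℝ} (hK : 0 ≤ K) (P : (Vec n → ℝ → H) → Prop)
    (hP0 : P fun _ _ => 0)
    (hP : ∀ (g : ℕ → Vec n → ℝ → H) G, (∀ k, P (g k)) →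
      (∀ x t, Tendsto (fun k => g k x t) atTop (𝓝 (G x t))) → P G)
    (Φ : (Vec n → ℝ → H) → Vec n → ℝ → H)
    (hΦ : ∀ g, HolSrc α K g → P g → HolSrc α K (Φ g) ∧ P (Φ g))
    (hc : ∀ g g', HolSrc α K g → P g → HolSrc α K g' → P g' → ∀ M,
      HolSrc α M (fun x t => g x t - g' x t) →
      HolSrc α (M / 2) (fun x t => Φ g x t - Φ g' x t)) :
    ∃ g, HolSrc α K g ∧ P g ∧ Φ g = g := by
  set g : ℕ → Vec n → ℝ → H := fun k => Φ^[k] (fun _ _ => 0) with hg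
  have hs : ∀ k, g (k + 1) = Φ (g k) := fun k => Function.iterate_succ_apply' _ _ _
  have hin : ∀ k, HolSrc α K (g k) ∧ P (g k) := by
    intro k
    induction k with
    | zero => exact ⟨HolSrc.zero hK, hP0⟩
    | succ k ih => rw [hs]; exact hΦ _ ih.1 ih.2
  have hd : ∀ k, HolSrc α (K / 2 ^ k) (fun x t => g (k + 1) x t - g k x t) := by
    intro k
    induction k with
    | zero => simpa [hg] using (hin 1).1
    | succ k ih =>
      have := hc _ _ (hin (k + 1)).1 (hin (k + 1)).2 (hin k).1 (hin k).2 _ ih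
      rw [← hs, ← hs] at this
      rwa [pow_succ, ← div_div]
  obtain ⟨G, hG, hlim, hGd⟩ := HolSrc.exists_limit hK (fun k => (hin k).1) hd
  have hPG := hP g G (fun k => (hin k).2) hlim
  refine ⟨G, hG, hPG, ?_⟩
  funext x t
  refine tendsto_nhds_unique (?_ : Tendsto (fun k => g (k + 1) x t) atTop _)
    ((tendsto_add_atTop_iff_nat 1).2 (hlim x t))
  have hlim0 : Tendsto (fun k : ℕ => 2 * K / 2 ^ k / 2) atTop (𝓝 0) := by
    have := (tendsto_pow_atTop_nhds_zero_of_lt_one (r := (1 / 2 : ℝ)) (by norm_num)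
      (by norm_num)).const_mul K
    simpa [div_eq_mul_inv, mul_assoc, mul_comm, mul_left_comm] using this
  refine tendsto_iff_norm_sub_tendsto_zero.2 (squeeze_zero (fun _ => norm_nonneg _)
    (fun k => ?_) hlim0)
  have := (hc _ _ hG hPG (hin k).1 (hin k).2 _ (hGd k)).bd x t
  rw [hs, norm_sub_rev]
  exact this

end FixedPoint

section ContinuityMethod

variable {n r : ℕ} {H : Type*} [NormedAddCommGroup H] [InnerProductSpace ℂ H] [CompleteSpace H]

/-- The a priori bounds for jets and time derivative of a solution on `[0,δ]` whose
right-hand side is bounded by `M` in the Hölder norm. -/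
structure LinBd (r : ℕ) (α C δ M : ℝ) (d : List (Fin n) → Vec n → ℝ → H) (wt : Vec n → ℝ → H) :
    Prop where
  bd : ∀ I, I.length ≤ r → ∀ t ∈ Icc 0 δ, ∀ x, ‖d I x t‖ ≤ C * M * δ ^ (α / r)
  hol : ∀ J : Fin r → Fin n, ∀ t ∈ Icc 0 δ, ∀ x y,
    ‖d (List.ofFn J) x t - d (List.ofFn J) y t‖ ≤ C * M * ‖x - y‖ ^ α
  time : ∀ I, I.length ≤ r → ∀ t ∈ Icc 0 δ, ∀ s ∈ Icc 0 δ, ∀ x,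
    ‖d I x t - d I x s‖ ≤ C * M * |t - s| ^ (α / r)
  wt_bd : ∀ t ∈ Icc 0 δ, ∀ x, ‖wt x t‖ ≤ C * M
  wt_hol : ∀ t ∈ Icc 0 δ, ∀ x y, ‖wt x t - wt y t‖ ≤ C * M * ‖x - y‖ ^ α

/-- The coefficients `a` satisfy the a priori estimate with constant `C` up to time `δ₀`. -/
def APriori (α C δ₀ : ℝ) (a : Vec n → (Fin r → Fin n) → (H →L[ℂ] H)) : Prop :=
  ∀ (δ R : ℝ) (f : Vec n → ℝ → H) (d : List (Fin n) → Vec n → ℝ → H) (wt : Vec n → ℝ → H) (M : ℝ),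
    0 ≤ δ → δ ≤ δ₀ → LinSol δ R a f d wt → 0 ≤ M →
    (∀ t ∈ Icc 0 δ, HolV α M M fun x => f x t) → LinBd r α C δ M d wt

/-- Solvability of the linear problem on `[0,δ]` for all Hölder continuous sources. -/
def Solvable (α δ : ℝ) (a : Vec n → (Fin r → Fin n) → (H →L[ℂ] H)) : Prop :=
  ∀ (M : ℝ) (f : Vec n → ℝ → H), HolSrc α M f → ∃ R d wt, LinSol δ R a f d wt

lemma LinBd.continuous_clampT {R α C δ M : ℝ} {a : Vec n → (Fin r → Fin n) → (H →L[ℂ] H)}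
    {f : Vec n → ℝ → H} {d : List (Fin n) → Vec n → ℝ → H} {wt : Vec n → ℝ → H} (hr : 2 ≤ r)
    (hα : 0 < α) (hδ : 0 ≤ δ) (hs : LinSol δ R a f d wt) (hb : LinBd r α C δ M d wt)
    {I : List (Fin n)} (hI : I.length ≤ r) :
    Continuous fun p : Vec n × ℝ => d I p.1 (clampT δ p.2) :=
  continuous_clampT_of_holder hδ (by positivity : 0 < α / r)
    (fun t ht => (hs.jets t ht).cont I hI) (hb.time I hI)

lemma LinBd.holV_top {α C δ M : ℝ} {d : List (Fin n) → Vec n → ℝ → H} {wt : Vec n → ℝ → H}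
    (hα : 0 < α) (hM : 0 ≤ M) (hC : 0 ≤ C) (hδ : 0 ≤ δ) (hδ1 : δ ≤ 1) (hb : LinBd r α C δ M d wt)
    (J : Fin r → Fin n) {t : ℝ} (ht : t ∈ Icc 0 δ) :
    HolV α (C * M) (C * M) (fun x => d (List.ofFn J) x t) :=
  ⟨fun x => (hb.bd _ (by simp) t ht x).trans (mul_le_of_le_one_right (by positivity)
    (Real.rpow_le_one hδ hδ1 (by positivity))), hb.hol J t ht⟩

lemma LinBd.src {R α C δ M η : ℝ} {a : Vec n → (Fin r → Fin n) → (H →L[ℂ] H)}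
    {f : Vec n → ℝ → H} {d : List (Fin n) → Vec n → ℝ → H} {wt : Vec n → ℝ → H} (hr : 2 ≤ r)
    (hα : 0 < α) (hM : 0 ≤ M) (hC : 0 ≤ C) (hδ : 0 ≤ δ) (hδ1 : δ ≤ 1)
    (hs : LinSol δ R a f d wt) (hb : LinBd r α C δ M d wt)
    {A : (Fin r → Fin n) → Vec n → H →L[ℂ] H} (hA : ∀ J, HolV α η η (A J)) :
    HolSrc α (Fintype.card (Fin r → Fin n) * (2 * η * C) * M)
      (fun x t => ∑ J, A J x (d (List.ofFn J) x (clampT δ t))) := by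
  refine .of_holV (continuous_finsetSum _ fun J _ => ((hA J).continuous hα).comp continuous_fst
    |>.clm_apply (hb.continuous_clampT hr hα hδ hs (by simp))) fun t => ?_
  have h1 : ∀ J, HolV α (2 * η * C * M) (2 * η * C * M)
      (fun x => A J x (d (List.ofFn J) x (clampT δ t))) := fun J => by
    have hη := (hA J).nonneg
    have : 0 ≤ η * C * M := by positivity
    exact ((hA J).clm_apply (hb.holV_top hα hM hC hδ hδ1 J (clampT_mem hδ t))).mono
      (by linarith) (by linarith)
  exact (HolV.sum h1).mono (mul_assoc _ _ _).ge (mul_assoc _ _ _).ge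

lemma Solvable.of_close {α C δ η : ℝ} (hr : 2 ≤ r) (hα : 0 < α) (hC : 0 ≤ C) (hδ : 0 ≤ δ)
    (hδ1 : δ ≤ 1) {a a' : Vec n → (Fin r → Fin n) → (H →L[ℂ] H)} (hs : Solvable α δ a)
    (ha : APriori α C δ a) (hA : ∀ J, HolV α η η fun x => a' x J - a x J)
    (hη : Fintype.card (Fin r → Fin n) * (2 * η * C) ≤ 1 / 2) : Solvable α δ a' := by
  intro M f hf
  have hM := hf.nonneg
  have h1 : ∀ h : Vec n → ℝ → H, ∃ d wt, (∃ M, HolSrc α M h) → ∃ R, LinSol δ R a h d wt := by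
    intro h
    by_cases hh : ∃ M, HolSrc α M h
    · obtain ⟨M, hh⟩ := hh
      obtain ⟨R, d, wt, h2⟩ := hs M h hh
      exact ⟨d, wt, fun _ => ⟨R, h2⟩⟩
    · exact ⟨fun _ _ _ => 0, fun _ _ => 0, fun h => (hh h).elim⟩
  choose dd ww hdd using h1
  have key : ∀ (g : Vec n → ℝ → H) (d : List (Fin n) → Vec n → ℝ → H) wt R M', LinSol δ R a g d wt →
      HolSrc α M' g → HolSrc α (M' / 2)
        (fun x t => ∑ J, (a' x J - a x J) (d (List.ofFn J) x (clampT δ t))) := by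
    intro g d wt R M' h2 hg
    have hb := ha δ R g d wt M' hδ le_rfl h2 hg.nonneg fun t _ => hg.holV t
    refine (LinBd.src (A := fun J x => a' x J - a x J) hr hα hg.nonneg hC hδ hδ1 h2 hb hA).mono ?_
    have := mul_le_mul_of_nonneg_right hη hg.nonneg
    linarith
  obtain ⟨h, hh, -, hfix⟩ := HolSrc.exists_fixedPoint (H := H) (n := n) (α := α) (K := 2 * M)
    (by positivity) (fun _ => True) trivial (fun _ _ _ _ => trivial)
    (fun h x t => f x t + ∑ J, (a' x J - a x J) (dd h (List.ofFn J) x (clampT δ t)))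
    (fun g hg _ => ⟨by
      obtain ⟨R, h2⟩ := hdd g ⟨_, hg⟩
      exact (hf.add (key g _ _ R _ h2 hg)).mono (by linarith), trivial⟩)
    (fun g g' hg _ hg' _ M' hM' => by
      obtain ⟨R, h2⟩ := hdd g ⟨_, hg⟩
      obtain ⟨R', h2'⟩ := hdd g' ⟨_, hg'⟩
      have := key _ _ _ _ M' (h2.sub h2') hM'
      simpa only [map_sub, Finset.sum_sub_distrib, add_sub_add_left_eq_sub] using this)
  obtain ⟨R, h2⟩ := hdd h ⟨_, hh⟩
  refine ⟨R, dd h, ww h, h2.jets, h2.time, h2.zero, h2.wt_cont, h2.wt_bd, fun t ht x => ?_⟩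
  have h3 := congrFun (congrFun hfix x) t
  simp only [clampT_of_mem ht, sub_apply, Finset.sum_sub_distrib] at h3
  rw [h2.eq t ht x, ← h3]
  abel

/-- Solvability and a priori estimates for the linear problem with Hölder continuous
coefficients on short time intervals. -/
theorem exists_apriori_solvable (H : Type) [NormedAddCommGroup H] [InnerProductSpace ℂ H]
    [CompleteSpace H] (hn : 1 ≤ n) (hr : 2 ≤ r) (hrev : Even r) (lam Lam α Ha : ℝ) (hlam : 0 < lam)
    (hLam : 0 ≤ Lam) (hα0 : 0 < α) (hα1 : α < 1) (hHa : 0 ≤ Ha) :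
    ∃ δ₀ C : ℝ, 0 < δ₀ ∧ δ₀ ≤ 1 ∧ 0 ≤ C ∧ ∀ a : Vec n → (Fin r → Fin n) → (H →L[ℂ] H),
      HolCoef lam Lam α Ha a → APriori α C δ₀ a ∧ ∀ δ, 0 ≤ δ → δ ≤ δ₀ → Solvable α δ a := by
  obtain ⟨c, Lam₀, hLam₀, hbase⟩ := exists_baseCoef_ellCls (n := n) (r := r) hn hr hrev lam hlam
  set Lam₁ := max Lam Lam₀ with hLam₁
  have hL1 : 0 ≤ Lam₁ := hLam.trans (le_max_left _ _)
  set a₀ := baseCoef n r H c with ha₀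
  have ha0 : EllCls lam Lam₁ a₀ := (hbase H).mono le_rfl (le_max_right _ _)
  have hs0 : ScalarCoef a₀ := baseCoef_scalar c
  obtain ⟨δ₀, C, hδ₀, hδ₀1, hC, hest⟩ :=
    exists_linSol_estimate H hn hr lam Lam₁ α Ha hlam hL1 hα0 hα1 hHa
  obtain ⟨C₂, hC₂, hsol⟩ := exists_baseU_linSol H hn hr lam Lam₁ α hlam hL1 hα0 hα1
  have hAP : ∀ a : Vec n → (Fin r → Fin n) → (H →L[ℂ] H), HolCoef lam Lam₁ α Ha a →
      APriori α C δ₀ a := by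
    intro a ha δ R f d wt M hδ hδ' hsl hM hf
    obtain ⟨h1, h2, h3, h4, h5⟩ := hest a₀ ha0 hs0 δ R a f d wt M hδ hδ' hsl ha hM
      (fun t ht => (hf t ht).bd) (fun t ht => (hf t ht).hol)
    exact ⟨h1, h2, h3, h4, h5⟩
  refine ⟨δ₀, C, hδ₀, hδ₀1, hC, fun a ha => ?_⟩
  have ha1 : HolCoef lam Lam₁ α Ha a := ⟨fun x => (ha.cls x).mono le_rfl (le_max_left _ _), ha.hol⟩
  refine ⟨hAP a ha1, fun δ hδ hδ' => ?_⟩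
  set b : ℝ → Vec n → (Fin r → Fin n) → (H →L[ℂ] H) :=
    fun s x => (1 - s) • a₀ + s • a x with hb
  have hbc : ∀ s, 0 ≤ s → s ≤ 1 → HolCoef lam Lam₁ α Ha (b s) := by
    intro s hs hs1
    refine ⟨fun x => ?_, fun x y J => ?_⟩
    · have := (ha0.smul (sub_nonneg.2 hs1)).add ((ha1.cls x).smul hs)
      rwa [← add_mul, ← add_mul, sub_add_cancel, one_mul, one_mul] at this
    · have e : b s x J - b s y J = s • (a x J - a y J) := by
        simp [hb, smul_sub]
      rw [e, norm_smul, Real.norm_of_nonneg hs]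
      exact (mul_le_of_le_one_left (norm_nonneg _) hs1).trans (ha.hol x y J)
  have hdiff : ∀ s s' J, HolV α (|s' - s| * (2 * Lam₁ + Ha)) (|s' - s| * (2 * Lam₁ + Ha))
      fun x => b s' x J - b s x J := by
    intro s s' J
    have h1 : HolV α (2 * Lam₁ + Ha) (2 * Lam₁ + Ha) fun x => a x J - a₀ J :=
      ⟨fun x => by
        have h2 := (norm_sub_le (a x J) (a₀ J)).trans (add_le_add ((ha1.cls x).bd J) (ha0.bd J))
        linarith, fun x y => by
        rw [sub_sub_sub_cancel_right]
        refine (ha.hol x y J).trans ?_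
        gcongr
        linarith⟩
    have h2 := h1.const_smul (s' - s)
    rw [Real.norm_eq_abs] at h2
    convert h2 using 2 with x
    simp only [hb, Pi.add_apply, Pi.smul_apply, Pi.sub_apply, sub_smul, smul_sub, one_smul]
    abel
  obtain ⟨N, hN⟩ := exists_nat_gt
    (Fintype.card (Fin r → Fin n) * (2 * (2 * Lam₁ + Ha) * C) * 2)
  have hN0 : (0 : ℝ) < N := lt_of_le_of_lt (by positivity) hN
  have hstep : ∀ k : ℕ, k ≤ N → Solvable α δ (b (k / N)) := by
    intro k
    induction k with
    | zero =>
      intro _ M f hf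
      have e : b (((0 : ℕ) : ℝ) / N) = fun _ => a₀ := by
        funext x
        simp [hb]
      rw [e]
      exact ⟨_, _, _, hsol a₀ ha0 hs0 M f hf δ hδ (hδ'.trans hδ₀1)⟩
    | succ k ih =>
      intro hk
      have hk' : (k : ℝ) + 1 ≤ N := by exact_mod_cast hk
      refine Solvable.of_close (C := C) hr hα0 hC hδ (hδ'.trans hδ₀1) (ih (by omega)) ?_
        (hdiff (k / N) ((k + 1 : ℕ) / N)) ?_
      · have := hAP _ (hbc (k / N) (by positivity) ((div_le_one hN0).2 (by linarith)))
        exact fun δ R f d wt M h1 h2 => this δ R f d wt M h1 (h2.trans hδ')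
      · have e : |((k + 1 : ℕ) / N - k / N : ℝ)| = 1 / N := by
          rw [← sub_div]
          push_cast
          rw [add_sub_cancel_left, abs_of_pos (by positivity)]
        rw [e]
        have e2 : Fintype.card (Fin r → Fin n) * (2 * (1 / N * (2 * Lam₁ + Ha)) * C)
          = Fintype.card (Fin r → Fin n) * (2 * (2 * Lam₁ + Ha) * C) * 2 / N / 2 := by
          field_simp
        rw [e2]
        have := (div_lt_one hN0).2 hN
        linarith
  have := hstep N le_rfl
  rw [div_self hN0.ne'] at this
  convert this using 1
  funext x
  simp [hb]

end ContinuityMethod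

section RealJets

variable {n l r : ℕ}

lemma hasFDerivAt_of_partials {E : Type*} [NormedAddCommGroup E] [NormedSpace ℝ E] {f : Vec n → E}
    {G : Fin n → Vec n → E}
    (hf : ∀ i y, HasLineDerivAt ℝ f (G i y) y (EuclideanSpace.single i (1 : ℝ)))
    (hG : ∀ i, Continuous (G i)) (x : Vec n) :
    HasFDerivAt f (∑ i, (EuclideanSpace.proj i : Vec n →L[ℝ] ℝ).smulRight (G i x)) x := by
  rw [hasFDerivAt_iff_isLittleO_nhds_zero, Asymptotics.isLittleO_iff]
  intro c hc
  have hε : 0 < c / (n + 1) := by positivity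
  have h1 : ∀ᶠ y in 𝓝 x, ∀ i, ‖G i y - G i x‖ < c / (n + 1) := by
    refine eventually_all.2 fun i => ?_
    have := (hG i).continuousAt (x := x)
    rw [ContinuousAt, tendsto_iff_norm_sub_tendsto_zero] at this
    exact this.eventually (gt_mem_nhds hε)
  obtain ⟨ρ, hρ, h2⟩ := Metric.eventually_nhds_iff.1 h1
  filter_upwards [Metric.ball_mem_nhds (0 : Vec n) hρ] with h hh
  have h3 := norm_sub_sub_sum_partials_le hf x (fun i => G i x) (c / (n + 1)) h fun i y hy =>
    (h2 (by rw [dist_eq_norm]; exact hy.trans_lt (by simpa using hh)) i).le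
  simp only [sum_apply, ContinuousLinearMap.smulRight_apply, EuclideanSpace.coe_proj]
  refine h3.trans ?_
  gcongr
  rw [mul_div_assoc', div_le_iff₀ (by positivity)]
  nlinarith

/-- Families of continuous functions which are the iterated partial derivatives of `e []`. -/
structure RJets (r : ℕ) (e : List (Fin n) → Vec n → Vec l) : Prop where
  cont : ∀ I, I.length ≤ r → Continuous (e I)
  line : ∀ I i, I.length < r → ∀ x,
    HasLineDerivAt ℝ (e I) (e (i :: I) x) x (EuclideanSpace.single i (1 : ℝ))

lemma RJets.hasFDerivAt {e : List (Fin n) → Vec n → Vec l} (h : RJets r e) {I : List (Fin n)}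
    (hI : I.length < r) (x : Vec n) :
    HasFDerivAt (e I) (∑ i, (EuclideanSpace.proj i : Vec n →L[ℝ] ℝ).smulRight (e (i :: I) x)) x :=
  hasFDerivAt_of_partials (G := fun i => e (i :: I)) (fun i y => h.line I i hI y)
    (fun i => h.cont _ (by simpa using hI)) x

lemma RJets.contDiff {e : List (Fin n) → Vec n → Vec l} (h : RJets r e) : ContDiff ℝ r (e []) := by
  induction r generalizing e with
  | zero => exact contDiff_zero.2 (h.cont [] le_rfl)
  | succ r ih =>
    have hd : ∀ x, HasFDerivAt (e [])
        (∑ i, (EuclideanSpace.proj i : Vec n →L[ℝ] ℝ).smulRight (e [i] x)) x :=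
      h.hasFDerivAt (I := []) (by simp)
    push_cast
    refine contDiff_succ_iff_fderiv.2 ⟨fun x => (hd x).differentiableAt, fun h => by simp at h, ?_⟩
    have e1 : fderiv ℝ (e []) =
        fun x => ∑ i, (EuclideanSpace.proj i : Vec n →L[ℝ] ℝ).smulRight (e [i] x) :=
      funext fun x => (hd x).fderiv
    rw [e1]
    refine ContDiff.sum fun i _ => contDiff_const.smulRight ?_
    have h2 : RJets r fun I => e (I ++ [i]) :=
      ⟨fun I hI => h.cont _ (by simpa using hI), fun I j hI x => h.line (I ++ [i]) j (by simpa) x⟩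
    exact ih h2

lemma RJets.pderivW_eq {e : List (Fin n) → Vec n → Vec l} (h : RJets r e) (k : ℕ) (hk : k ≤ r)
    (J : Fin k → Fin n) (x : Vec n) : pderivW univ k J (e []) x = e (List.ofFn J) x := by
  induction k generalizing x with
  | zero => simp [pderivW]
  | succ k ih =>
    have hkr : k < r := hk
    have h1 : ∀ y, pderivW univ k (Fin.tail J) (e []) y = e (List.ofFn (Fin.tail J)) y :=
      fun y => ih hkr.le _ y
    rw [List.ofFn_succ]
    unfold pderivW at h1 ⊢
    simp only [iteratedFDerivWithin_univ] at h1 ⊢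
    rw [iteratedFDeriv_succ_apply_left]
    have hd : DifferentiableAt ℝ (iteratedFDeriv ℝ k (e [])) x :=
      h.contDiff.differentiable_iteratedFDeriv (by exact_mod_cast hkr) x
    have h2 := (hd.hasFDerivAt.continuousMultilinear_apply_const
      (fun j => EuclideanSpace.single (Fin.tail J j) (1 : ℝ))).hasLineDerivAt
        (EuclideanSpace.single (J 0) (1 : ℝ))
    have h3 := h.line (List.ofFn (Fin.tail J)) (J 0) (by simpa using hkr) x
    have h4 : (fun y => (iteratedFDeriv ℝ k (e []) y)
        fun j => EuclideanSpace.single (Fin.tail J j) (1 : ℝ)) = e (List.ofFn (Fin.tail J)) :=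
      funext h1
    rw [h4] at h2
    exact h2.unique h3

lemma RJets.add {e e' : List (Fin n) → Vec n → Vec l} (h : RJets r e) (h' : RJets r e') :
    RJets r (fun I x => e I x + e' I x) :=
  ⟨fun I hI => (h.cont I hI).add (h'.cont I hI), fun I i hI x => by
    have h1 := h.line I i hI x
    have h2 := h'.line I i hI x
    unfold HasLineDerivAt at *
    exact h1.add h2⟩

lemma pderivW_cast {D : Set (Vec n)} {k m : ℕ} (h : m = k) (J : Fin k → Fin n) (w : Vec n → Vec l) :
    pderivW D m (J ∘ Fin.cast h) w = pderivW D k J w := by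
  subst h; rfl

/-- Partial derivatives indexed by lists. -/
def pdL (w : Vec n → Vec l) (I : List (Fin n)) : Vec n → Vec l := pderivW univ I.length I.get w

lemma pdL_ofFn (w : Vec n → Vec l) {k : ℕ} (J : Fin k → Fin n) :
    pdL w (List.ofFn J) = pderivW univ k J w := by
  rw [← pderivW_cast (List.length_ofFn (f := J)) J w, pdL]
  congr 1
  funext i
  simp only [List.get_ofFn]
  rfl

lemma pdL_nil (w : Vec n → Vec l) : pdL w [] = w := by
  funext x
  simp [pdL, pderivW]

lemma rJets_pdL {w : Vec n → Vec l} (h : ContDiff ℝ r w) : RJets r (pdL w) where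
  cont I hI := by
    unfold pdL pderivW
    simp only [iteratedFDerivWithin_univ]
    have := h.continuous_iteratedFDeriv (m := I.length) (by exact_mod_cast hI)
    exact (ContinuousMultilinearMap.apply ℝ (fun _ : Fin I.length => Vec n) (Vec l)
      _).continuous.comp this
  line I i hI x := by
    unfold pdL pderivW
    simp only [iteratedFDerivWithin_univ]
    have hd : DifferentiableAt ℝ (iteratedFDeriv ℝ I.length w) x :=
      h.differentiable_iteratedFDeriv (by exact_mod_cast hI) x
    have h2 := (hd.hasFDerivAt.continuousMultilinear_apply_const
      (fun j => EuclideanSpace.single (I.get j) (1 : ℝ))).hasLineDerivAt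
        (EuclideanSpace.single i (1 : ℝ))
    have e1 : iteratedFDeriv ℝ (i :: I).length w x
        (fun j => EuclideanSpace.single ((i :: I).get j) (1 : ℝ)) =
        fderiv ℝ (iteratedFDeriv ℝ I.length w) x (EuclideanSpace.single i (1 : ℝ))
        (fun j => EuclideanSpace.single (I.get j) (1 : ℝ)) := by
      exact iteratedFDeriv_succ_apply_left _
    rw [e1]
    exact h2

end RealJets

section Periodic

variable {n : ℕ} {E : Type*} [NormedAddCommGroup E]

/-- Integer translation vectors. -/
def zvec (m : Fin n → ℤ) : Vec n := (EuclideanSpace.equiv (Fin n) ℝ).symm fun i => (m i : ℝ)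

lemma exists_zvec_add_norm_le (x : Vec n) : ∃ m : Fin n → ℤ, ‖x + zvec m‖ ≤ n := by
  refine ⟨fun i => -⌊x i⌋, ?_⟩
  have h1 : ∀ i, ‖(x + zvec fun i => -⌊x i⌋) i‖ ≤ 1 := by
    intro i
    have e : (x + zvec fun i => -⌊x i⌋) i = Int.fract (x i) := by
      simp [zvec, Int.fract, sub_eq_add_neg]
    rw [e, Real.norm_of_nonneg (Int.fract_nonneg _)]
    exact (Int.fract_lt_one _).le
  rw [EuclideanSpace.norm_eq]
  refine (Real.sqrt_le_sqrt (Finset.sum_le_sum fun i _ =>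
    pow_le_pow_left₀ (norm_nonneg _) (h1 i) 2)).trans ?_
  refine Real.sqrt_le_iff.2 ⟨by positivity, ?_⟩
  simp only [one_pow, Finset.sum_const, Finset.card_univ, Fintype.card_fin, nsmul_eq_mul, mul_one]
  exact_mod_cast Nat.le_self_pow two_ne_zero n

lemma PerZ.exists_bound {g : Vec n → E} (hg : PerZ g) (hc : Continuous g) :
    ∃ C, 0 ≤ C ∧ ∀ x, ‖g x‖ ≤ C := by
  obtain ⟨C, hC⟩ := (isCompact_closedBall (0 : Vec n) n).exists_bound_of_continuousOn hc.continuousOn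
  refine ⟨max C 0, le_max_right _ _, fun x => ?_⟩
  obtain ⟨m, hm⟩ := exists_zvec_add_norm_le x
  have e : g (x + zvec m) = g x := hg x m
  rw [← e]
  exact (hC _ (by simpa using hm)).trans (le_max_left _ _)

lemma exists_bound_of_perZ {δ : ℝ} {g : Vec n → ℝ → E} (hg : ∀ t ∈ Icc 0 δ, PerZ fun x => g x t)
    (hc : ContinuousOn (fun p : Vec n × ℝ => g p.1 p.2) (univ ×ˢ Icc 0 δ)) :
    ∃ C, 0 ≤ C ∧ ∀ x, ∀ t ∈ Icc 0 δ, ‖g x t‖ ≤ C := by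
  obtain ⟨C, hC⟩ := ((isCompact_closedBall (0 : Vec n) n).prod
    (isCompact_Icc (a := (0 : ℝ)) (b := δ))).exists_bound_of_continuousOn
    (hc.mono (prod_mono (subset_univ _) le_rfl))
  refine ⟨max C 0, le_max_right _ _, fun x t ht => ?_⟩
  obtain ⟨m, hm⟩ := exists_zvec_add_norm_le x
  have e : g (x + zvec m) t = g x t := hg t ht x m
  rw [← e]
  exact (hC (x + zvec m, t) ⟨by simpa using hm, ht⟩).trans (le_max_left _ _)

lemma exists_time_modulus_of_perZ {δ : ℝ} {g : Vec n → ℝ → E}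
    (hg : ∀ t ∈ Icc 0 δ, PerZ fun x => g x t)
    (hc : ContinuousOn (fun p : Vec n × ℝ => g p.1 p.2) (univ ×ˢ Icc 0 δ)) {ε : ℝ} (hε : 0 < ε) :
    ∃ h, 0 < h ∧ ∀ x, ∀ t ∈ Icc 0 δ, ∀ s ∈ Icc 0 δ, |t - s| ≤ h → ‖g x t - g x s‖ ≤ ε := by
  have hu := ((isCompact_closedBall (0 : Vec n) n).prod
    (isCompact_Icc (a := (0 : ℝ)) (b := δ))).uniformContinuousOn_of_continuous
    (hc.mono (prod_mono (subset_univ _) le_rfl))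
  obtain ⟨h, hh, h1⟩ := Metric.uniformContinuousOn_iff.1 hu ε hε
  refine ⟨h / 2, by positivity, fun x t ht s hs hts => ?_⟩
  obtain ⟨m, hm⟩ := exists_zvec_add_norm_le x
  have h2 := h1 (x + zvec m, t) ⟨by simpa using hm, ht⟩ (x + zvec m, s) ⟨by simpa using hm, hs⟩
    (by rw [Prod.dist_eq, dist_self, Real.dist_eq]; simp only [sup_lt_iff]; exact ⟨hh, by linarith⟩)
  rw [dist_eq_norm] at h2
  have e1 : g (x + zvec m) t = g x t := hg t ht x m
  have e2 : g (x + zvec m) s = g x s := hg s hs x m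
  simp only [e1, e2] at h2
  exact h2.le

end Periodic

section Tame

variable {n : ℕ} {Z W : Type*} [NormedAddCommGroup Z] [NormedSpace ℝ Z] [ProperSpace Z]
  [NormedAddCommGroup W] [NormedSpace ℝ W]

/-- Boundedness and joint Hölder/Lipschitz continuity on the tube of radius `ρ` around `j`. -/
structure TameOn (α β T ρ L : ℝ) (j : Vec n → Z) (Ψ : Vec n → ℝ → Z → W) : Prop where
  bd : ∀ x, ∀ t ∈ Icc 0 T, ∀ z, ‖z - j x‖ ≤ ρ → ‖Ψ x t z‖ ≤ L
  lip : ∀ x y, ∀ t ∈ Icc 0 T, ∀ s ∈ Icc 0 T, ∀ z w, ‖z - j x‖ ≤ ρ → ‖w - j y‖ ≤ ρ →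
    ‖Ψ x t z - Ψ y s w‖ ≤ L * (‖x - y‖ ^ α + |t - s| ^ β + ‖z - w‖)

lemma TameOn.mono {α β T ρ L L' : ℝ} {j : Vec n → Z} {Ψ : Vec n → ℝ → Z → W}
    (h : TameOn α β T ρ L j Ψ) (hL : L ≤ L') : TameOn α β T ρ L' j Ψ :=
  ⟨fun x t ht z hz => (h.bd x t ht z hz).trans hL, fun x y t ht s hs z w hz hw =>
    (h.lip x y t ht s hs z w hz hw).trans (by gcongr)⟩

lemma le_rpow_of_le_one {p α : ℝ} (hp : 0 ≤ p) (hp1 : p ≤ 1) (hα1 : α ≤ 1) : p ≤ p ^ α := by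
  rcases hp.eq_or_lt with h0 | h0
  · rw [← h0]; exact Real.rpow_nonneg le_rfl _
  · simpa using Real.rpow_le_rpow_of_exponent_ge h0 hp1 hα1

/-- The open tube around `j` over `[0,T]`. -/
def tube (T R : ℝ) (j : Vec n → Z) : Set (Vec n × ℝ × Z) :=
  {q | q.2.1 ∈ Icc (0 : ℝ) T ∧ ‖q.2.2 - j q.1‖ < R}

lemma exists_tameOn {α β T ρ R : ℝ} (hα0 : 0 ≤ α) (hα1 : α ≤ 1) (hβ0 : 0 ≤ β) (hβ1 : β ≤ 1)
    (hρ : ρ < R) {j : Vec n → Z} (hj : Continuous j) (hjp : PerZ j) {Ψ : Vec n → ℝ → Z → W}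
    (hΨ : ContDiffOn ℝ 1 (fun q : Vec n × ℝ × Z => Ψ q.1 q.2.1 q.2.2) (tube T R j))
    (hp : ∀ x m t z, Ψ (x + zvec m) t z = Ψ x t z) :
    ∃ L, 0 ≤ L ∧ TameOn α β T ρ L j Ψ := by
  obtain ⟨Cj, hCj0, hCj⟩ := hjp.exists_bound hj
  set K : Set (Vec n × ℝ × Z) :=
    {q | ‖q.1‖ ≤ n + 1 ∧ q.2.1 ∈ Icc (0 : ℝ) T ∧ ‖q.2.2 - j q.1‖ ≤ ρ} with hK
  set S : Set (Vec n × ℝ × Z) := univ ×ˢ (Icc (0 : ℝ) T ×ˢ univ) with hS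
  have hKc : IsCompact K := by
    have c1 : IsClosed {q : Vec n × ℝ × Z | ‖q.1‖ ≤ n + 1} :=
      isClosed_le (by fun_prop) continuous_const
    have c2 : IsClosed {q : Vec n × ℝ × Z | q.2.1 ∈ Icc (0 : ℝ) T} :=
      isClosed_Icc.preimage (by fun_prop : Continuous fun q : Vec n × ℝ × Z => q.2.1)
    have c3 : IsClosed {q : Vec n × ℝ × Z | ‖q.2.2 - j q.1‖ ≤ ρ} :=
      isClosed_le (by fun_prop) continuous_const
    have hcl : IsClosed K := c1.inter (c2.inter c3)
    refine ((isCompact_closedBall (0 : Vec n) (n + 1)).prod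
      ((isCompact_Icc (a := (0 : ℝ)) (b := T)).prod
        (isCompact_closedBall (0 : Z) (ρ + Cj)))).of_isClosed_subset hcl ?_
    rintro ⟨x, t, z⟩ ⟨h1, h2, h3⟩
    refine ⟨by simpa using h1, h2, ?_⟩
    simp only at h3
    have : ‖z‖ ≤ ‖z - j x‖ + ‖j x‖ := by simpa using norm_add_le (z - j x) (j x)
    rw [mem_closedBall_zero_iff]
    linarith [hCj x]
  have hKS : K ⊆ S := fun q hq => ⟨trivial, hq.2.1, trivial⟩
  have hKt : K ⊆ tube T R j := fun q hq => ⟨hq.2.1, lt_of_le_of_lt hq.2.2 hρ⟩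
  have hlip : LocallyLipschitzOn K (fun q : Vec n × ℝ × Z => Ψ q.1 q.2.1 q.2.2) := by
    intro q hq
    have h1 : tube T R j ∈ 𝓝[S] q := by
      have ho : IsOpen {q : Vec n × ℝ × Z | ‖q.2.2 - j q.1‖ < R} :=
        isOpen_lt (by fun_prop) continuous_const
      filter_upwards [self_mem_nhdsWithin, mem_nhdsWithin_of_mem_nhds (ho.mem_nhds (hKt hq).2)]
        with p hp hp'
      exact ⟨hp.2.1, hp'⟩
    obtain ⟨C, t, ht, h2⟩ := ((hΨ q (hKt hq)).mono_of_mem_nhdsWithin h1).exists_lipschitzOnWith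
      (convex_univ.prod ((convex_Icc _ _).prod convex_univ))
    exact ⟨C, t, nhdsWithin_mono _ hKS ht, h2⟩
  obtain ⟨C₁, hC₁⟩ := hlip.exists_lipschitzOnWith_of_compact hKc
  obtain ⟨C₂, hC₂⟩ := hKc.exists_bound_of_continuousOn (hΨ.continuousOn.mono hKt)
  set L := max (C₁ : ℝ) (2 * max C₂ 0) with hL
  have hL1 : (C₁ : ℝ) ≤ L := le_max_left _ _
  have hL2 : 2 * max C₂ 0 ≤ L := le_max_right _ _
  have hC20 : 0 ≤ max C₂ 0 := le_max_right _ _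
  have hL0 : 0 ≤ L := by linarith
  have hbd : ∀ x, ∀ t ∈ Icc 0 T, ∀ z, ‖z - j x‖ ≤ ρ → ‖Ψ x t z‖ ≤ max C₂ 0 := by
    intro x t ht z hz
    obtain ⟨m, hm⟩ := exists_zvec_add_norm_le x
    rw [← hp x m]
    refine (hC₂ (x + zvec m, t, z) ⟨hm.trans (by simp), ht, ?_⟩).trans (le_max_left _ _)
    have e : j (x + zvec m) = j x := hjp x m
    simpa only [e] using hz
  refine ⟨L, hL0, fun x t ht z hz => (hbd x t ht z hz).trans (by linarith),
    fun x y t ht s hs z w hz hw => ?_⟩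
  have hx0 : 0 ≤ ‖x - y‖ ^ α := by positivity
  have ht0 : 0 ≤ |t - s| ^ β := by positivity
  have hbig : 1 ≤ ‖x - y‖ ^ α + |t - s| ^ β + ‖z - w‖ →
      ‖Ψ x t z - Ψ y s w‖ ≤ L * (‖x - y‖ ^ α + |t - s| ^ β + ‖z - w‖) := fun h => by
    have := (norm_sub_le (Ψ x t z) (Ψ y s w)).trans (add_le_add (hbd x t ht z hz) (hbd y s hs w hw))
    nlinarith
  have hz0 := norm_nonneg (z - w)
  rcases le_total 1 ‖x - y‖ with h | h
  · exact hbig (by linarith [Real.one_le_rpow h hα0])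
  rcases le_total 1 |t - s| with h' | h'
  · exact hbig (by linarith [Real.one_le_rpow h' hβ0])
  obtain ⟨m, hm⟩ := exists_zvec_add_norm_le x
  have ex : j (x + zvec m) = j x := hjp x m
  have ey : j (y + zvec m) = j y := hjp y m
  have hym : ‖y + zvec m‖ ≤ n + 1 := by
    have : y + zvec m = (x + zvec m) - (x - y) := by abel
    rw [this]
    exact (norm_sub_le _ _).trans (add_le_add hm h)
  have h1 := hC₁.dist_le_mul (x + zvec m, t, z) ⟨hm.trans (by simp), ht, by simpa only [ex] using hz⟩
    (y + zvec m, s, w) ⟨hym, hs, by simpa only [ey] using hw⟩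
  simp only [hp] at h1
  rw [dist_eq_norm] at h1
  refine h1.trans ?_
  have hxx := le_rpow_of_le_one (norm_nonneg (x - y)) h hα1
  have htt := le_rpow_of_le_one (abs_nonneg (t - s)) h' hβ1
  refine mul_le_mul hL1 ?_ dist_nonneg hL0
  rw [Prod.dist_eq, Prod.dist_eq]
  simp only [dist_eq_norm, add_sub_add_right_eq_sub, Real.norm_eq_abs]
  refine max_le (by linarith) (max_le (by linarith) (by linarith))

/-- `F` and its jet derivative `G` are tame on the tube of radius `ρ`. -/
structure TameDeriv (α β T ρ L : ℝ) (j : Vec n → Z) (F : Vec n → ℝ → Z → W)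
    (G : Vec n → ℝ → Z → Z →L[ℝ] W) : Prop where
  nonneg : 0 ≤ L
  tame : TameOn α β T ρ L j F
  tame_deriv : TameOn α β T ρ L j G
  deriv : ∀ x, ∀ t ∈ Icc 0 T, ∀ z, ‖z - j x‖ ≤ ρ → HasFDerivAt (F x t) (G x t z) z

lemma exists_tameDeriv {α β T ρ R : ℝ} (hα0 : 0 ≤ α) (hα1 : α ≤ 1) (hβ0 : 0 ≤ β) (hβ1 : β ≤ 1)
    (hT : 0 < T) (hρ : ρ < R) {j : Vec n → Z} (hj : Continuous j) (hjp : PerZ j)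
    {F : Vec n → ℝ → Z → W}
    (hF : ContDiffOn ℝ 2 (fun q : Vec n × ℝ × Z => F q.1 q.2.1 q.2.2)
      {q | q.2.1 ∈ Icc (0 : ℝ) T ∧ ‖q.2.2 - j q.1‖ ≤ R})
    (hp : ∀ x m t z, F (x + zvec m) t z = F x t z) :
    ∃ L, TameDeriv α β T ρ L j F fun x t z => fderiv ℝ (F x t) z := by
  set Ft : Vec n × ℝ × Z → W := fun q => F q.1 q.2.1 q.2.2 with hFt
  have hF' : ContDiffOn ℝ 2 Ft (tube T R j) := hF.mono fun q hq => ⟨hq.1, hq.2.le⟩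
  have ho : IsOpen {q : Vec n × ℝ × Z | ‖q.2.2 - j q.1‖ < R} :=
    isOpen_lt (by fun_prop) continuous_const
  have hud : UniqueDiffOn ℝ (tube T R j) := by
    have h1 : UniqueDiffOn ℝ ((univ : Set (Vec n)) ×ˢ (Icc (0 : ℝ) T ×ˢ (univ : Set Z))) :=
      uniqueDiffOn_univ.prod ((uniqueDiffOn_Icc hT).prod uniqueDiffOn_univ)
    have h2 := h1.inter ho
    convert h2 using 1
    ext q
    simp [tube]
  have hd1 : ContDiffOn ℝ 1 (fderivWithin ℝ Ft (tube T R j)) (tube T R j) :=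
    hF'.fderivWithin hud (by norm_num)
  set inz : Z →L[ℝ] Vec n × ℝ × Z :=
    (ContinuousLinearMap.inr ℝ (Vec n) (ℝ × Z)).comp (ContinuousLinearMap.inr ℝ ℝ Z) with hinz
  have hder : ∀ q ∈ tube T R j,
      HasFDerivAt (F q.1 q.2.1) ((fderivWithin ℝ Ft (tube T R j) q).comp inz) q.2.2 := by
    rintro ⟨x, t, z⟩ hq
    have h1 : HasFDerivWithinAt Ft (fderivWithin ℝ Ft (tube T R j) (x, t, z)) (tube T R j) (x, t, z) :=
      ((hF'.differentiableOn (by norm_num)) _ hq).hasFDerivWithinAt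
    have h2 : HasFDerivAt (fun w : Z => ((x, t, w) : Vec n × ℝ × Z)) inz z := by
      have h3 : HasFDerivAt (fun w : Z => ((x, t, 0) : Vec n × ℝ × Z) + inz w) inz z :=
        inz.hasFDerivAt.const_add _
      convert h3 using 2 with w
      simp [hinz]
    have h4 : HasFDerivWithinAt (fun w : Z => Ft (x, t, w))
        ((fderivWithin ℝ Ft (tube T R j) (x, t, z)).comp inz) (Metric.ball (j x) R) z :=
      HasFDerivWithinAt.comp (g := Ft) z h1 h2.hasFDerivWithinAt fun w hw =>
        ⟨hq.1, mem_ball_iff_norm.1 hw⟩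
    exact h4.hasFDerivAt (Metric.isOpen_ball.mem_nhds (mem_ball_iff_norm.2 hq.2))
  have hG : ContDiffOn ℝ 1 (fun q : Vec n × ℝ × Z => fderiv ℝ (F q.1 q.2.1) q.2.2) (tube T R j) :=
    (hd1.clm_comp contDiffOn_const).congr fun q hq => (hder q hq).fderiv
  have hper : ∀ x m t, F (x + zvec m) t = F x t := fun x m t => funext fun z => hp x m t z
  obtain ⟨L₁, hL₁, h1⟩ := exists_tameOn hα0 hα1 hβ0 hβ1 hρ hj hjp (hF'.of_le (by norm_num)) hp
  obtain ⟨L₂, hL₂, h2⟩ := exists_tameOn (Ψ := fun x t z => fderiv ℝ (F x t) z) hα0 hα1 hβ0 hβ1 hρ hj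
    hjp hG (fun x m t z => by rw [hper])
  refine ⟨max L₁ L₂, hL₁.trans (le_max_left _ _), h1.mono (le_max_left _ _),
    h2.mono (le_max_right _ _), fun x t ht z hz => ?_⟩
  have h3 := hder (x, t, z) ⟨ht, lt_of_le_of_lt hz hρ⟩
  exact h3.differentiableAt.hasFDerivAt

end Tame

section RealComplex

variable {n l r : ℕ}

/-- Inclusion of `ℝ^l` into `ℂ^l`. -/
def inclC (l : ℕ) : Vec l →L[ℝ] EuclideanSpace ℂ (Fin l) :=
  LinearMap.mkContinuous
    { toFun := fun v => WithLp.toLp 2 fun i => ((v i : ℝ) : ℂ)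
      map_add' := fun v w => by ext i; simp
      map_smul' := fun c v => by ext i; simp } 1 fun v => by
    simp [EuclideanSpace.norm_eq]

/-- Real part of a vector in `ℂ^l`. -/
def reV (l : ℕ) : EuclideanSpace ℂ (Fin l) →L[ℝ] Vec l :=
  LinearMap.mkContinuous
    { toFun := fun v => WithLp.toLp 2 fun i => (v i).re
      map_add' := fun v w => by ext i; simp
      map_smul' := fun c v => by ext i; simp } 1 fun v => by
    rw [one_mul, EuclideanSpace.norm_eq, EuclideanSpace.norm_eq]
    refine Real.sqrt_le_sqrt (Finset.sum_le_sum fun i _ => pow_le_pow_left₀ (norm_nonneg _) ?_ 2)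
    exact Complex.abs_re_le_norm _

@[simp] lemma inclC_apply (v : Vec l) (i : Fin l) : inclC l v i = (v i : ℂ) := rfl

@[simp] lemma reV_apply (v : EuclideanSpace ℂ (Fin l)) (i : Fin l) : reV l v i = (v i).re := rfl

lemma norm_inclC_le : ‖inclC l‖ ≤ 1 := LinearMap.mkContinuous_norm_le _ zero_le_one _

lemma norm_reV_le : ‖reV l‖ ≤ 1 := LinearMap.mkContinuous_norm_le _ zero_le_one _

lemma reV_inclC (v : Vec l) : reV l (inclC l v) = v := by ext i; simp

lemma norm_inclC (v : Vec l) : ‖inclC l v‖ = ‖v‖ := by simp [EuclideanSpace.norm_eq]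

/-- Real part of a family of derivatives, as an `r`-jet. -/
def reJet (r : ℕ) (D : List (Fin n) → EuclideanSpace ℂ (Fin l)) : Jet n l r :=
  fun _ I b => (D (List.ofFn I) b).re

/-- The part of `reJet` of order less than `r`. -/
def lowJet (r : ℕ) (D : List (Fin n) → EuclideanSpace ℂ (Fin l)) : Jet n l r :=
  fun k I b => if (k : ℕ) < r then (D (List.ofFn I) b).re else 0

lemma norm_jet_le {z : Jet n l r} {S : ℝ} (hS : 0 ≤ S) (h : ∀ k I b, |z k I b| ≤ S) : ‖z‖ ≤ S :=
  (pi_norm_le_iff_of_nonneg hS).2 fun k => (pi_norm_le_iff_of_nonneg hS).2 fun I =>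
    (pi_norm_le_iff_of_nonneg hS).2 fun b => h k I b

lemma abs_jet_le (z : Jet n l r) (k I b) : |z k I b| ≤ ‖z‖ :=
  ((norm_le_pi_norm (z k I) b).trans (norm_le_pi_norm (z k) I)).trans (norm_le_pi_norm z k)

lemma abs_re_apply_le (v : EuclideanSpace ℂ (Fin l)) (b : Fin l) : |(v b).re| ≤ ‖v‖ :=
  (Complex.abs_re_le_norm _).trans (PiLp.norm_apply_le v b)

lemma norm_reJet_le {D : List (Fin n) → EuclideanSpace ℂ (Fin l)} {S : ℝ} (hS : 0 ≤ S)
    (h : ∀ I, I.length ≤ r → ‖D I‖ ≤ S) : ‖reJet r D‖ ≤ S :=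
  norm_jet_le hS fun k I b => (abs_re_apply_le _ _).trans (h _ (by simp; omega))

lemma norm_lowJet_le {D : List (Fin n) → EuclideanSpace ℂ (Fin l)} {S : ℝ} (hS : 0 ≤ S)
    (h : ∀ I, I.length < r → ‖D I‖ ≤ S) : ‖lowJet r D‖ ≤ S :=
  norm_jet_le hS fun k I b => by
    unfold lowJet
    split_ifs with hk
    · exact (abs_re_apply_le _ _).trans (h _ (by simpa))
    · simpa

lemma reJet_sub (D D' : List (Fin n) → EuclideanSpace ℂ (Fin l)) :
    reJet r (fun I => D I - D' I) = reJet r D - reJet r D' := by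
  ext k I b; simp [reJet]

lemma lowJet_sub (D D' : List (Fin n) → EuclideanSpace ℂ (Fin l)) :
    lowJet r (fun I => D I - D' I) = lowJet r D - lowJet r D' := by
  ext k I b
  simp only [lowJet, Pi.sub_apply, PiLp.sub_apply, Complex.sub_re]
  split_ifs <;> simp

lemma reJet_eq_lowJet_add (D : List (Fin n) → EuclideanSpace ℂ (Fin l)) :
    reJet r D = lowJet r D + ∑ J : Fin r → Fin n, ∑ b, (D (List.ofFn J) b).re • jetBasisG r r J b := by
  ext k I b
  simp only [reJet, lowJet, Pi.add_apply, Finset.sum_apply, Pi.smul_apply, jetBasisG, smul_eq_mul]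
  by_cases hk : (k : ℕ) = r
  · obtain ⟨k, hk'⟩ := k
    simp only at hk
    subst hk
    simp only [lt_self_iff_false, if_false, dite_true, zero_add, mul_ite, mul_one, mul_zero]
    rw [Finset.sum_eq_single I, Finset.sum_eq_single b]
    · simp
    · intro b' _ hb
      rw [if_neg]; exact fun h => hb h.2.symm
    · simp
    · intro J _ hJ
      refine Finset.sum_eq_zero fun b' _ => ?_
      rw [if_neg]; exact fun h => hJ h.1.symm
    · simp
  · have : (k : ℕ) < r := by omega
    simp [this, hk]

lemma norm_jetBasisG_le (k : ℕ) (J : Fin k → Fin n) (b : Fin l) : ‖jetBasisG r k J b‖ ≤ 1 :=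
  norm_jet_le zero_le_one fun k' I b' => by
    unfold jetBasisG
    split_ifs <;> simp

/-- The complexified leading coefficient of a linear map on jets. -/
def coefJ (G : Jet n l r →L[ℝ] Vec l) (J : Fin r → Fin n) :
    EuclideanSpace ℂ (Fin l) →L[ℂ] EuclideanSpace ℂ (Fin l) :=
  ∑ b, (EuclideanSpace.proj b : EuclideanSpace ℂ (Fin l) →L[ℂ] ℂ).smulRight
    (inclC l (G (jetBasisG r r J b)))

lemma coefJ_apply (G : Jet n l r →L[ℝ] Vec l) (J : Fin r → Fin n) (v : EuclideanSpace ℂ (Fin l)) :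
    coefJ G J v = ∑ b, v b • inclC l (G (jetBasisG r r J b)) := by
  simp [coefJ]

lemma reV_coefJ (G : Jet n l r →L[ℝ] Vec l) (J : Fin r → Fin n) (v : EuclideanSpace ℂ (Fin l)) :
    reV l (coefJ G J v) = ∑ b, (v b).re • G (jetBasisG r r J b) := by
  rw [coefJ_apply, map_sum]
  refine Finset.sum_congr rfl fun b _ => ?_
  ext i
  simp

lemma coefJ_inclC (G : Jet n l r →L[ℝ] Vec l) (J : Fin r → Fin n) (v : Vec l) :
    coefJ G J (inclC l v) = inclC l (∑ b, v b • G (jetBasisG r r J b)) := by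
  rw [coefJ_apply, map_sum]
  refine Finset.sum_congr rfl fun b _ => ?_
  ext i
  simp

lemma coefJ_sub (G G' : Jet n l r →L[ℝ] Vec l) (J : Fin r → Fin n) :
    coefJ (G - G') J = coefJ G J - coefJ G' J := by
  ext1 v
  simp only [coefJ_apply, sub_apply, map_sub, smul_sub, Finset.sum_sub_distrib]

lemma norm_coefJ_le (G : Jet n l r →L[ℝ] Vec l) (J : Fin r → Fin n) : ‖coefJ G J‖ ≤ l * ‖G‖ := by
  refine ContinuousLinearMap.opNorm_le_bound _ (by positivity) fun v => ?_
  rw [coefJ_apply]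
  refine (norm_sum_le _ _).trans ((Finset.sum_le_card_nsmul _ _ (‖G‖ * ‖v‖) fun b _ => ?_).trans_eq
    (by simp; ring))
  rw [norm_smul, norm_inclC, mul_comm]
  refine mul_le_mul ((G.le_opNorm _).trans (mul_le_of_le_one_right (norm_nonneg _)
    (norm_jetBasisG_le _ _ _))) (PiLp.norm_apply_le v b) (norm_nonneg _) (norm_nonneg _)

lemma map_reJet (G : Jet n l r →L[ℝ] Vec l) (D : List (Fin n) → EuclideanSpace ℂ (Fin l)) :
    G (reJet r D) = G (lowJet r D) + reV l (∑ J, coefJ G J (D (List.ofFn J))) := by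
  rw [reJet_eq_lowJet_add, map_add, map_sum, map_sum]
  congr 1
  refine Finset.sum_congr rfl fun J _ => ?_
  rw [reV_coefJ, map_sum]
  simp

lemma monoSym_ofFn_toC (hrev : Even r) (hr : 2 ≤ r) (J : Fin r → Fin n) (ξ : Vec n) :
    monoSym (List.ofFn J) (toC ξ) =
      ((-((2 * Real.pi) ^ r * (-1) ^ (r / 2 - 1) * ∏ j, ξ (J j)) : ℝ) : ℂ) := by
  have h1 : monoSym (List.ofFn J) (toC ξ) = (2 * (Real.pi : ℂ) * Complex.I) ^ r * ∏ j, (ξ (J j) : ℂ) := by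
    unfold monoSym
    rw [List.map_ofFn, List.prod_ofFn]
    simp [Finset.prod_mul_distrib, toC, mul_pow]
  obtain ⟨k, rfl⟩ := hrev
  obtain ⟨m, rfl⟩ : ∃ m, k = m + 1 := ⟨k - 1, by omega⟩
  have h2 : (m + 1 + (m + 1)) / 2 - 1 = m := by omega
  have h3 : Complex.I ^ (m + 1 + (m + 1)) = -(-1) ^ m := by
    rw [← two_mul, pow_mul, Complex.I_sq, pow_succ]; ring
  rw [h1, h2, mul_pow, h3]
  push_cast
  ring

lemma ellCls_coefJ (hr : 2 ≤ r) (hrev : Even r) {lam L : ℝ} {G : Jet n l r →L[ℝ] Vec l}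
    (hG : ‖G‖ ≤ L)
    (hpar : ∀ ξ : Vec n, ∀ v : Vec l, lam * ‖ξ‖ ^ r * ‖v‖ ^ 2 ≤ (-1 : ℝ) ^ (r / 2 - 1) *
      ∑ I : Fin r → Fin n, ∑ a : Fin l, ∑ b : Fin l,
        G (jetBasisG r r I b) a * (∏ j, ξ (I j)) * v a * v b) :
    EllCls ((2 * Real.pi) ^ r * lam) (l * L) (coefJ G) where
  bd J := (norm_coefJ_le G J).trans (by gcongr)
  ell ξ v := by
    set p : Vec l := reV l v with hp
    set q : Vec l := WithLp.toLp 2 fun i => (v i).im with hq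
    have hpq : ‖v‖ ^ 2 = ‖p‖ ^ 2 + ‖q‖ ^ 2 := by
      rw [EuclideanSpace.norm_sq_eq, EuclideanSpace.norm_sq_eq, EuclideanSpace.norm_sq_eq,
        ← Finset.sum_add_distrib]
      refine Finset.sum_congr rfl fun i _ => ?_
      rw [Complex.sq_norm, Complex.normSq_apply]
      simp [hp, hq, sq]
    have h1 : (inner ℂ v (opSym (coefJ G) (toC ξ) v)).re =
        -((2 * Real.pi) ^ r * ((-1 : ℝ) ^ (r / 2 - 1) *
          ∑ I : Fin r → Fin n, ∑ a : Fin l, ∑ b : Fin l,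
            G (jetBasisG r r I b) a * (∏ j, ξ (I j)) * p a * p b)) +
        -((2 * Real.pi) ^ r * ((-1 : ℝ) ^ (r / 2 - 1) *
          ∑ I : Fin r → Fin n, ∑ a : Fin l, ∑ b : Fin l,
            G (jetBasisG r r I b) a * (∏ j, ξ (I j)) * q a * q b)) := by
      simp only [opSym, sum_apply, smul_apply, inner_sum, inner_smul_right, monoSym_ofFn_toC hrev hr,
        Complex.re_sum, Complex.re_ofReal_mul, coefJ_apply, Finset.mul_sum, ← Finset.sum_neg_distrib,
        ← Finset.sum_add_distrib]
      refine Finset.sum_congr rfl fun J _ => ?_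
      rw [Finset.sum_comm]
      refine Finset.sum_congr rfl fun b _ => ?_
      rw [PiLp.inner_apply, Finset.mul_sum, Complex.re_sum, Finset.mul_sum]
      refine Finset.sum_congr rfl fun a _ => ?_
      simp [hp, hq]
      ring
    rw [h1, hpq]
    have h2 := hpar ξ p
    have h3 := hpar ξ q
    have h4 : (0 : ℝ) ≤ (2 * Real.pi) ^ r := by positivity
    nlinarith [mul_le_mul_of_nonneg_left h2 h4, mul_le_mul_of_nonneg_left h3 h4]

end RealComplex

section Averaging

variable {n : ℕ} {Z W : Type*} [NormedAddCommGroup Z] [NormedSpace ℝ Z]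
  [NormedAddCommGroup W] [NormedSpace ℝ W]

lemma TameOn.continuous_comp {α β T ρ L : ℝ} (hα : 0 < α) (hβ : 0 < β) {j : Vec n → Z}
    {Ψ : Vec n → ℝ → Z → W} (h : TameOn α β T ρ L j Ψ) {X : Type*} [TopologicalSpace X]
    {x : X → Vec n} {t : X → ℝ} {z : X → Z} (hx : Continuous x) (ht : Continuous t)
    (hz : Continuous z) (htm : ∀ p, t p ∈ Icc 0 T) (hzm : ∀ p, ‖z p - j (x p)‖ ≤ ρ) :
    Continuous fun p => Ψ (x p) (t p) (z p) := by
  rw [continuous_iff_continuousAt]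
  intro p₀
  have h1 : Continuous fun p => L * (‖x p - x p₀‖ ^ α + |t p - t p₀| ^ β + ‖z p - z p₀‖) := by
    have c1 : Continuous fun p => ‖x p - x p₀‖ ^ α :=
      Continuous.rpow_const (by fun_prop) fun _ => Or.inr hα.le
    have c2 : Continuous fun p => |t p - t p₀| ^ β :=
      Continuous.rpow_const (by fun_prop) fun _ => Or.inr hβ.le
    fun_prop
  have h2 := h1.tendsto p₀
  simp only [sub_self, norm_zero, abs_zero, Real.zero_rpow hα.ne', Real.zero_rpow hβ.ne', add_zero,
    mul_zero] at h2
  exact tendsto_iff_norm_sub_tendsto_zero.2 (squeeze_zero (fun _ => norm_nonneg _)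
    (fun p => h.lip _ _ _ (htm p) _ (htm p₀) _ _ (hzm p) (hzm p₀)) h2)

lemma TameOn.holV {α β T ρ L Hz : ℝ} (hβ : 0 < β) {j : Vec n → Z}
    {Ψ : Vec n → ℝ → Z → W} (h : TameOn α β T ρ L j Ψ) (hL : 0 ≤ L) {t : ℝ} (ht : t ∈ Icc 0 T)
    {z : Vec n → Z} (hz : ∀ x, ‖z x - j x‖ ≤ ρ) (hzH : ∀ x y, ‖z x - z y‖ ≤ Hz * ‖x - y‖ ^ α) :
    HolV α L (L * (1 + Hz)) fun x => Ψ x t (z x) :=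
  ⟨fun x => h.bd x t ht _ (hz x), fun x y => by
    refine (h.lip x y t ht t ht _ _ (hz x) (hz y)).trans ?_
    rw [sub_self, abs_zero, Real.zero_rpow hβ.ne', mul_assoc]
    gcongr
    linarith [hzH x y]⟩

lemma norm_lineMap_sub_le {z z' j : Z} {σ θ : ℝ} (hθ : θ ∈ Icc (0 : ℝ) 1) (hz : ‖z - j‖ ≤ σ)
    (hz' : ‖z' - j‖ ≤ σ) : ‖z' + θ • (z - z') - j‖ ≤ σ := by
  have e : z' + θ • (z - z') - j = (1 - θ) • (z' - j) + θ • (z - j) := by module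
  rw [e]
  refine (norm_add_le _ _).trans ?_
  rw [norm_smul, norm_smul, Real.norm_of_nonneg hθ.1, Real.norm_of_nonneg (by linarith [hθ.2])]
  nlinarith [hθ.1, hθ.2, mul_le_mul_of_nonneg_left hz hθ.1,
    mul_le_mul_of_nonneg_left hz' (sub_nonneg.2 hθ.2)]

/-- The deviation of `F` from its linearization at `j` is a linear map with small coefficients. -/
lemma TameDeriv.exists_avg [CompleteSpace W] {α β T ρ L σ Hz : ℝ} (hα : 0 < α) (hβ : 0 < β)
    (hT : 0 ≤ T)
    {j : Vec n → Z} {F : Vec n → ℝ → Z → W} {G : Vec n → ℝ → Z → Z →L[ℝ] W}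
    (h : TameDeriv α β T ρ L j F G) {t : ℝ} (ht : t ∈ Icc 0 T) (hσ : σ ≤ ρ) {z z' : Vec n → Z}
    (hz : ∀ x, ‖z x - j x‖ ≤ σ) (hz' : ∀ x, ‖z' x - j x‖ ≤ σ)
    (hjH : ∀ x y, ‖j x - j y‖ ≤ Hz * ‖x - y‖ ^ α)
    (hzH : ∀ x y, ‖z x - z y‖ ≤ Hz * ‖x - y‖ ^ α)
    (hzH' : ∀ x y, ‖z' x - z' y‖ ≤ Hz * ‖x - y‖ ^ α) :
    ∃ A : Vec n → Z →L[ℝ] W, HolV α (L * (t ^ β + σ)) (2 * L * (1 + Hz)) A ∧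
      ∀ x, F x t (z x) - F x t (z' x) - G x 0 (j x) (z x - z' x) = A x (z x - z' x) := by
  have hL := h.nonneg
  have h0T : (0 : ℝ) ∈ Icc 0 T := ⟨le_rfl, hT⟩
  have hσ0 : 0 ≤ σ := (norm_nonneg _).trans (hz 0)
  have hj0 : ∀ x, ‖j x - j x‖ ≤ ρ := fun x => by rw [sub_self, norm_zero]; linarith
  set w : Vec n → ℝ → Z := fun x θ => z' x + θ • (z x - z' x) with hw
  have hwσ : ∀ x, ∀ θ ∈ Icc (0 : ℝ) 1, ‖w x θ - j x‖ ≤ σ := fun x θ hθ =>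
    norm_lineMap_sub_le hθ (hz x) (hz' x)
  have hww : ∀ x y, ∀ θ ∈ Icc (0 : ℝ) 1, ‖w x θ - w y θ‖ ≤ Hz * ‖x - y‖ ^ α := by
    intro x y θ hθ
    have h1 : ‖(z x - z y) - 0‖ ≤ Hz * ‖x - y‖ ^ α := by simpa using hzH x y
    have h2 : ‖(z' x - z' y) - 0‖ ≤ Hz * ‖x - y‖ ^ α := by simpa using hzH' x y
    have h3 := norm_lineMap_sub_le hθ h1 h2
    have e : w x θ - w y θ = z' x - z' y + θ • (z x - z y - (z' x - z' y)) - 0 := by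
      simp only [hw]; module
    rwa [e]
  have hcG : ∀ x, ContinuousOn (fun θ => G x t (w x θ)) (Icc 0 1) := by
    intro x
    rw [continuousOn_iff_continuous_domRestrict]
    exact h.tame_deriv.continuous_comp (X := Icc (0 : ℝ) 1) (x := fun _ => x) (t := fun _ => t)
      (z := fun θ => w x θ) hα hβ continuous_const continuous_const (by simp only [hw]; fun_prop)
      (fun _ => ht) (fun θ => (hwσ x θ θ.2).trans hσ)
  have hcD : ∀ x, ContinuousOn (fun θ => G x t (w x θ) - G x 0 (j x)) (uIcc 0 1) := fun x => by
    rw [uIcc_of_le zero_le_one]; exact (hcG x).sub continuousOn_const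
  have hI : ∀ x, IntervalIntegrable (fun θ => G x t (w x θ) - G x 0 (j x)) volume 0 1 := fun x =>
    (hcD x).intervalIntegrable
  have hmem : ∀ θ ∈ uIoc (0 : ℝ) 1, θ ∈ Icc (0 : ℝ) 1 := fun θ hθ => by
    rw [uIoc_of_le zero_le_one] at hθ; exact ⟨hθ.1.le, hθ.2⟩
  refine ⟨fun x => ∫ θ in (0 : ℝ)..1, (G x t (w x θ) - G x 0 (j x)), ⟨fun x => ?_, fun x y => ?_⟩,
    fun x => ?_⟩
  · refine (intervalIntegral.norm_integral_le_of_norm_le_const (C := L * (t ^ β + σ))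
      fun θ hθ => ?_).trans_eq (by simp)
    refine (h.tame_deriv.lip x x t ht 0 h0T _ _ ((hwσ x θ (hmem θ hθ)).trans hσ) (hj0 x)).trans ?_
    rw [sub_self, norm_zero, Real.zero_rpow hα.ne', sub_zero, abs_of_nonneg ht.1, zero_add]
    gcongr
    exact hwσ x θ (hmem θ hθ)
  · rw [← intervalIntegral.integral_sub (hI x) (hI y)]
    refine (intervalIntegral.norm_integral_le_of_norm_le_const
      (C := 2 * L * (1 + Hz) * ‖x - y‖ ^ α) fun θ hθ => ?_).trans_eq (by simp)
    have h1 := h.tame_deriv.lip x y t ht t ht _ _ ((hwσ x θ (hmem θ hθ)).trans hσ)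
      ((hwσ y θ (hmem θ hθ)).trans hσ)
    have h2 := h.tame_deriv.lip x y 0 h0T 0 h0T _ _ (hj0 x) (hj0 y)
    rw [sub_self, abs_zero, Real.zero_rpow hβ.ne', add_zero] at h1 h2
    have h3 := mul_le_mul_of_nonneg_left (hww x y θ (hmem θ hθ)) hL
    have h4 := mul_le_mul_of_nonneg_left (hjH x y) hL
    rw [sub_sub_sub_comm]
    refine (norm_sub_le _ _).trans ?_
    linarith
  · have h1 : ∫ θ in (0 : ℝ)..1, G x t (w x θ) (z x - z' x) = F x t (w x 1) - F x t (w x 0) := by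
      refine intervalIntegral.integral_eq_sub_of_hasDerivAt (f := fun θ => F x t (w x θ))
        (fun θ hθ => ?_) ?_
      · rw [uIcc_of_le zero_le_one] at hθ
        have h2 : HasDerivAt (w x) (z x - z' x) θ := by
          have := ((hasDerivAt_id θ).smul_const (z x - z' x)).const_add (z' x)
          rwa [one_smul] at this
        exact (h.deriv x t ht _ ((hwσ x θ hθ).trans hσ)).comp_hasDerivAt θ h2
      · refine ContinuousOn.intervalIntegrable ?_
        rw [uIcc_of_le zero_le_one]
        exact (hcG x).clm_apply continuousOn_const
    have h2 : IntervalIntegrable (fun θ => G x t (w x θ) (z x - z' x)) volume 0 1 := by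
      refine ContinuousOn.intervalIntegrable ?_
      rw [uIcc_of_le zero_le_one]
      exact (hcG x).clm_apply continuousOn_const
    rw [ContinuousLinearMap.intervalIntegral_apply (hI x)]
    simp only [sub_apply]
    rw [intervalIntegral.integral_sub h2 intervalIntegrable_const, h1]
    simp [hw]

end Averaging

section JetEstimates

variable {n l r : ℕ}

lemma exists_ofFn_eq {I : List (Fin n)} (h : I.length = r) : ∃ J : Fin r → Fin n, List.ofFn J = I := by
  subst h
  exact ⟨I.get, by simp⟩

lemma LinBd.holV_low {H : Type*} [NormedAddCommGroup H] [InnerProductSpace ℂ H]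
    [CompleteSpace H] {α C δ M R : ℝ} {d : List (Fin n) → Vec n → ℝ → H} {wt : Vec n → ℝ → H} (hα0 : 0 ≤ α)
    (hα1 : α ≤ 1) (hC : 0 ≤ C) (hM : 0 ≤ M) (hδ : 0 ≤ δ) (hb : LinBd r α C δ M d wt)
    {t : ℝ} (ht : t ∈ Icc 0 δ) (hj : Jets r (fun I x => d I x t) R) {I : List (Fin n)}
    (hI : I.length < r) :
    HolV α (C * M * δ ^ (α / r)) ((n + 2) * (C * M * δ ^ (α / r))) fun x => d I x t := by
  have h1 := HolV.of_lipschitz (g := fun x => d I x t) hα0 hα1 (hb.bd I hI.le t ht)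
    (by positivity) (hj.norm_sub_le hI fun i x => hb.bd (i :: I) (by simpa using hI) t ht x)
  refine h1.mono le_rfl (le_of_eq (by ring))

lemma LinBd.holV_lowJet {α C δ M R : ℝ} {d : List (Fin n) → Vec n → ℝ → EuclideanSpace ℂ (Fin l)}
    {wt : Vec n → ℝ → EuclideanSpace ℂ (Fin l)} (hα0 : 0 ≤ α)
    (hα1 : α ≤ 1) (hC : 0 ≤ C) (hM : 0 ≤ M) (hδ : 0 ≤ δ) (hb : LinBd r α C δ M d wt)
    {t : ℝ} (ht : t ∈ Icc 0 δ) (hj : Jets r (fun I x => d I x t) R) :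
    HolV α (C * M * δ ^ (α / r)) ((n + 2) * (C * M * δ ^ (α / r)))
      fun x => lowJet r fun I => d I x t := by
  refine ⟨fun x => norm_lowJet_le (by positivity) fun I hI => hb.bd I hI.le t ht x, fun x y => ?_⟩
  rw [← lowJet_sub]
  exact norm_lowJet_le (by positivity) fun I hI =>
    (hb.holV_low hα0 hα1 hC hM hδ ht hj hI).hol x y

lemma LinBd.holV_reJet {α C δ M R : ℝ} {d : List (Fin n) → Vec n → ℝ → EuclideanSpace ℂ (Fin l)}
    {wt : Vec n → ℝ → EuclideanSpace ℂ (Fin l)} (hα0 : 0 ≤ α)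
    (hα1 : α ≤ 1) (hC : 0 ≤ C) (hM : 0 ≤ M) (hδ : 0 ≤ δ) (hδ1 : δ ≤ 1) (hb : LinBd r α C δ M d wt)
    {t : ℝ} (ht : t ∈ Icc 0 δ) (hj : Jets r (fun I x => d I x t) R) :
    HolV α (C * M * δ ^ (α / r)) ((n + 2) * (C * M)) fun x => reJet r fun I => d I x t := by
  refine ⟨fun x => norm_reJet_le (by positivity) fun I hI => hb.bd I hI t ht x, fun x y => ?_⟩
  rw [← reJet_sub]
  refine norm_reJet_le (by positivity) fun I hI => ?_
  have hCM : 0 ≤ C * M := by positivity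
  rcases hI.lt_or_eq with h | h
  · refine ((hb.holV_low hα0 hα1 hC hM hδ ht hj h).hol x y).trans ?_
    have : δ ^ (α / r) ≤ 1 := Real.rpow_le_one hδ hδ1 (by positivity)
    have h3 : C * M * δ ^ (α / r) ≤ C * M := mul_le_of_le_one_right hCM this
    gcongr
  · obtain ⟨J, rfl⟩ := exists_ofFn_eq h
    refine (hb.hol J t ht x y).trans ?_
    refine mul_le_mul_of_nonneg_right ?_ (by positivity)
    have : (0 : ℝ) ≤ n := by positivity
    nlinarith

/-- Size of the right-hand side of the linearized equation. -/
def srcConst (n : ℕ) (C m Ma L LG p : ℝ) : ℝ := (m * (n + 3) + (Ma + L * (n + 3) + LG) * p) * C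

lemma LinBd.holV_src {α C δ M R m Ma L LG : ℝ}
    {d : List (Fin n) → Vec n → ℝ → EuclideanSpace ℂ (Fin l)}
    {wt : Vec n → ℝ → EuclideanSpace ℂ (Fin l)} (hα0 : 0 ≤ α)
    (hα1 : α ≤ 1) (hC : 0 ≤ C) (hM : 0 ≤ M) (hδ : 0 ≤ δ) (hδ1 : δ ≤ 1) (hb : LinBd r α C δ M d wt)
    {t : ℝ} (ht : t ∈ Icc 0 δ) (hj : Jets r (fun I x => d I x t) R)
    {A G : Vec n → Jet n l r →L[ℝ] Vec l} (hA : HolV α m Ma A) (hMa : 0 ≤ Ma) (hG : HolV α L LG G)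
    (hLG : 0 ≤ LG) :
    HolV α (srcConst n C m Ma L LG (δ ^ (α / r)) * M) (srcConst n C m Ma L LG (δ ^ (α / r)) * M)
      fun x => inclC l (A x (reJet r fun I => d I x t) + G x (lowJet r fun I => d I x t)) := by
  have h1 := hA.clm_apply (hb.holV_reJet hα0 hα1 hC hM hδ hδ1 ht hj)
  have h2 := hG.clm_apply (hb.holV_lowJet hα0 hα1 hC hM hδ ht hj)
  have hm := hA.nonneg
  have hL := hG.nonneg
  set p := δ ^ (α / r)
  have hp : p ≤ 1 := Real.rpow_le_one hδ hδ1 (by positivity)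
  have hp0 : 0 ≤ p := by positivity
  have hCM : 0 ≤ C * M := by positivity
  refine ((h1.add h2).clm_comp norm_inclC_le).mono ?_ ?_
  · unfold srcConst
    have e1 : m * (C * M * p) ≤ m * (C * M) :=
      mul_le_mul_of_nonneg_left (mul_le_of_le_one_right hCM hp) hm
    have e2 : 0 ≤ m * (n + 2) * (C * M) := by positivity
    have e3 : 0 ≤ (Ma + L * (n + 2) + LG) * p * (C * M) := by positivity
    nlinarith
  · unfold srcConst
    have e1 : 0 ≤ m * (C * M) := by positivity
    have e3 : 0 ≤ L * p * (C * M) := by positivity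
    nlinarith

lemma exists_rpow_le {β : ℝ} (hβ : 0 < β) (q : ℝ) {c : ℝ} (hc : 0 < c) :
    ∃ δ₁, 0 < δ₁ ∧ ∀ δ, 0 ≤ δ → δ ≤ δ₁ → q * δ ^ β ≤ c := by
  have hq : 0 < c / (|q| + 1) := by positivity
  refine ⟨(c / (|q| + 1)) ^ β⁻¹, by positivity, fun δ h0 h => ?_⟩
  have h1 : δ ^ β ≤ c / (|q| + 1) := by
    have := Real.rpow_le_rpow h0 h hβ.le
    rwa [← Real.rpow_mul hq.le, inv_mul_cancel₀ hβ.ne', Real.rpow_one] at this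
  have h2 : 0 ≤ δ ^ β := by positivity
  calc q * δ ^ β ≤ |q| * (c / (|q| + 1)) := by
        refine (mul_le_mul_of_nonneg_right (le_abs_self q) h2).trans ?_
        gcongr
    _ ≤ c := by
        rw [mul_div_assoc', div_le_iff₀ (by positivity)]
        nlinarith [abs_nonneg q]

end JetEstimates

section NonlinearExistence

variable {n l r : ℕ}

/-- A periodic tame nonlinearity which is strongly parabolic at the jet field `j`. -/
structure ParabolicData (lam α T ρ L Hj : ℝ) (j : Vec n → Jet n l r)
    (F : Vec n → ℝ → Jet n l r → Vec l)
    (G : Vec n → ℝ → Jet n l r → Jet n l r →L[ℝ] Vec l) : Prop where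
  tame : TameDeriv α (α / r) T ρ L j F G
  hol_nonneg : 0 ≤ Hj
  hol : ∀ x y, ‖j x - j y‖ ≤ Hj * ‖x - y‖ ^ α
  per : ∀ x m, j (x + zvec m) = j x
  perF : ∀ x m t, F (x + zvec m) t = F x t
  perG : ∀ x m t, G (x + zvec m) t = G x t
  par : ∀ x, ∀ ξ : Vec n, ∀ v : Vec l, lam * ‖ξ‖ ^ r * ‖v‖ ^ 2 ≤ (-1 : ℝ) ^ (r / 2 - 1) *
      ∑ I : Fin r → Fin n, ∑ a : Fin l, ∑ b : Fin l,
        G x 0 (j x) (jetBasisG r r I b) a * (∏ j, ξ (I j)) * v a * v b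

namespace ParabolicData

variable {lam α T ρ L Hj : ℝ} {j : Vec n → Jet n l r} {F : Vec n → ℝ → Jet n l r → Vec l}
  {G : Vec n → ℝ → Jet n l r → Jet n l r →L[ℝ] Vec l}

lemma holV_lin (h : ParabolicData lam α T ρ L Hj j F G) (hr : 2 ≤ r) (hα : 0 < α) (hT : 0 ≤ T)
    (hρ : 0 ≤ ρ) : HolV α L (L * (1 + Hj)) fun x => G x 0 (j x) :=
  h.tame.tame_deriv.holV (by positivity) h.tame.nonneg ⟨le_rfl, hT⟩ (fun x => by simpa) h.hol

lemma holCoef (h : ParabolicData lam α T ρ L Hj j F G) (hr : 2 ≤ r) (hrev : Even r) (hα : 0 < α)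
    (hT : 0 ≤ T) (hρ : 0 ≤ ρ) :
    HolCoef ((2 * Real.pi) ^ r * lam) (l * L) α (l * (L * (1 + Hj)))
      (fun x => coefJ (G x 0 (j x))) where
  cls x := ellCls_coefJ hr hrev ((h.holV_lin hr hα hT hρ).bd x) (h.par x)
  hol x y J := by
    rw [← coefJ_sub, mul_assoc]
    exact (norm_coefJ_le _ _).trans
      (mul_le_mul_of_nonneg_left ((h.holV_lin hr hα hT hρ).hol x y) (by positivity))

end ParabolicData

/-- The jets of a solution with periodic source are periodic. -/
lemma LinSol.periodic {H : Type*} [NormedAddCommGroup H] [InnerProductSpace ℂ H] [CompleteSpace H]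
    {α C δ δ₀ R : ℝ} {a : Vec n → (Fin r → Fin n) → (H →L[ℂ] H)}
    {f : Vec n → ℝ → H} {d : List (Fin n) → Vec n → ℝ → H} {wt : Vec n → ℝ → H}
    (hap : APriori α C δ₀ a) (hδ : 0 ≤ δ) (hδ₀ : δ ≤ δ₀) (h : LinSol δ R a f d wt)
    (k : Vec n) (ha : ∀ x, a (x + k) = a x) (hf : ∀ x, ∀ t ∈ Icc 0 δ, f (x + k) t = f x t)
    {I : List (Fin n)} (hI : I.length ≤ r) {t : ℝ} (ht : t ∈ Icc 0 δ) (x : Vec n) :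
    d I (x + k) t = d I x t := by
  have h1 : LinSol δ R a (fun x t => f (x + k) t) (fun I x t => d I (x + k) t)
      (fun x t => wt (x + k) t) :=
    { jets := fun t ht => ⟨fun I hI => ((h.jets t ht).cont I hI).comp (by fun_prop),
        fun I hI x => (h.jets t ht).bd I hI _, fun I i hI x => by
          have := (h.jets t ht).line I i hI (x + k)
          unfold HasLineDerivAt at this ⊢
          convert this using 3
          abel⟩
      time := fun x t ht => h.time (x + k) t ht
      zero := fun x => h.zero _
      wt_cont := fun t ht => (h.wt_cont t ht).comp (by fun_prop)
      wt_bd := fun t ht x => h.wt_bd t ht _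
      eq := fun t ht x => by rw [h.eq t ht, ha] }
  have h2 := hap δ _ _ _ _ 0 hδ hδ₀ (h1.sub h) le_rfl fun t ht => ⟨fun x => by
    simp [hf x t ht], fun x y => by simp [hf x t ht, hf y t ht]⟩
  have h3 := h2.bd I hI t ht x
  rw [mul_zero, zero_mul] at h3
  exact sub_eq_zero.1 (norm_le_zero_iff.1 h3)

lemma continuous_reJet {X : Type*} [TopologicalSpace X]
    {D : X → List (Fin n) → EuclideanSpace ℂ (Fin l)}
    (h : ∀ I : List (Fin n), I.length ≤ r → Continuous fun p => D p I) :
    Continuous fun p => reJet r (D p) :=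
  continuous_pi fun k => continuous_pi fun I => continuous_pi fun b => by
    have h1 : Continuous fun p => D p (List.ofFn I) := h _ (by simp; omega)
    have h2 : Continuous fun p => D p (List.ofFn I) b :=
      (EuclideanSpace.proj b : EuclideanSpace ℂ (Fin l) →L[ℂ] ℂ).continuous.comp h1
    exact Complex.continuous_re.comp h2

lemma continuous_lowJet {X : Type*} [TopologicalSpace X]
    {D : X → List (Fin n) → EuclideanSpace ℂ (Fin l)}
    (h : ∀ I : List (Fin n), I.length ≤ r → Continuous fun p => D p I) :
    Continuous fun p => lowJet r (D p) :=
  continuous_pi fun k => continuous_pi fun I => continuous_pi fun b => by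
    unfold lowJet
    by_cases hk : (k : ℕ) < r
    · simp only [hk, if_true]
      have h1 : Continuous fun p => D p (List.ofFn I) := h _ (by simp; omega)
      have h2 : Continuous fun p => D p (List.ofFn I) b :=
        (EuclideanSpace.proj b : EuclideanSpace ℂ (Fin l) →L[ℂ] ℂ).continuous.comp h1
      exact Complex.continuous_re.comp h2
    · simp only [hk, if_false]
      exact continuous_const

/-- Right-hand side of the fixed-point formulation of the nonlinear equation. -/
def nlSrc (F : Vec n → ℝ → Jet n l r → Vec l)
    (G : Vec n → ℝ → Jet n l r → Jet n l r →L[ℝ] Vec l) (j : Vec n → Jet n l r) (x : Vec n) (t : ℝ)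
    (D : List (Fin n) → EuclideanSpace ℂ (Fin l)) : EuclideanSpace ℂ (Fin l) :=
  inclC l (F x t (j x + reJet r D) - G x 0 (j x) (reJet r D) + G x 0 (j x) (lowJet r D))

lemma LinSol.reV_eq {δ R : ℝ} {F : Vec n → ℝ → Jet n l r → Vec l}
    {G : Vec n → ℝ → Jet n l r → Jet n l r →L[ℝ] Vec l} {j : Vec n → Jet n l r}
    {f : Vec n → ℝ → EuclideanSpace ℂ (Fin l)}
    {d : List (Fin n) → Vec n → ℝ → EuclideanSpace ℂ (Fin l)}
    {wt : Vec n → ℝ → EuclideanSpace ℂ (Fin l)}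
    (h : LinSol δ R (fun x => coefJ (G x 0 (j x))) f d wt) {t : ℝ} (ht : t ∈ Icc 0 δ) (x : Vec n)
    (hf : f x t = nlSrc F G j x t fun I => d I x t) :
    reV l (wt x t) = F x t (j x + reJet r fun I => d I x t) := by
  rw [h.eq t ht x, map_add, hf, nlSrc, reV_inclC, map_reJet]
  abel

theorem ParabolicData.exists_sol (hr : 2 ≤ r) {lam α T ρ L Hj C δ₀ : ℝ}
    {j : Vec n → Jet n l r} {F : Vec n → ℝ → Jet n l r → Vec l}
    {G : Vec n → ℝ → Jet n l r → Jet n l r →L[ℝ] Vec l} (h : ParabolicData lam α T ρ L Hj j F G)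
    (hα0 : 0 < α) (hα1 : α < 1) (hT : 0 < T) (hC : 0 ≤ C) (hδ₀ : 0 < δ₀) (hδ₀1 : δ₀ ≤ 1)
    (hap : APriori α C δ₀ fun x => coefJ (G x 0 (j x)))
    (hso : ∀ δ, 0 ≤ δ → δ ≤ δ₀ → Solvable α δ fun x => coefJ (G x 0 (j x))) {ε : ℝ} (hε : 0 < ε)
    (hερ : ε ≤ ρ) :
    ∃ K δ₁, 0 ≤ K ∧ 0 < δ₁ ∧ ∀ δ, 0 < δ → δ ≤ δ₁ → δ ≤ T ∧ δ ≤ δ₀ ∧ ∃ R d wt f,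
      LinSol δ R (fun x => coefJ (G x 0 (j x))) f d wt ∧ LinBd r α C δ K d wt ∧
      (∀ I, I.length ≤ r → ∀ x m, ∀ t ∈ Icc 0 δ, d I (x + zvec m) t = d I x t) ∧
      (∀ x, ∀ t ∈ Icc 0 δ, ‖reJet r fun I => d I x t‖ ≤ ε) ∧
      ∀ x, ∀ t ∈ Icc 0 δ, reV l (wt x t) = F x t (j x + reJet r fun I => d I x t) := by
  have hL := h.tame.nonneg
  have hHj := h.hol_nonneg
  have hρ : 0 ≤ ρ := hε.le.trans hερ
  have hβ : 0 < α / r := by positivity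
  set K₀ := L * (1 + Hj) with hK₀
  have hK₀0 : 0 ≤ K₀ := by positivity
  set K := 2 * K₀ + 2 * L with hK
  have hK0 : 0 ≤ K := by positivity
  set Hz := Hj + (n + 2) * (C * K) with hHz
  have hHz0 : 0 ≤ Hz := by positivity
  set q : ℝ := (L * (1 + C * K) * (n + 3) + (2 * L * (1 + Hz) + L * (n + 3) + L * (1 + Hj))) * C
    with hq
  obtain ⟨δa, hδa, ha⟩ := exists_rpow_le hβ q (c := 1 / 2) (by norm_num)
  obtain ⟨δb, hδb, hb⟩ := exists_rpow_le hβ (C * K) hε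
  refine ⟨K, min (min δa δb) (min T δ₀), hK0, by positivity, fun δ hδ hδ' => ?_⟩
  have hδa' : δ ≤ δa := hδ'.trans ((min_le_left _ _).trans (min_le_left _ _))
  have hδb' : δ ≤ δb := hδ'.trans ((min_le_left _ _).trans (min_le_right _ _))
  have hδT : δ ≤ T := hδ'.trans ((min_le_right _ _).trans (min_le_left _ _))
  have hδδ₀ : δ ≤ δ₀ := hδ'.trans ((min_le_right _ _).trans (min_le_right _ _))
  refine ⟨hδT, hδδ₀, ?_⟩
  have hδ1 : δ ≤ 1 := hδδ₀.trans hδ₀1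
  specialize ha δ hδ.le hδa'
  specialize hb δ hδ.le hδb'
  set p := δ ^ (α / r) with hp
  have hp0 : 0 ≤ p := by positivity
  have hso := hso δ hδ.le hδδ₀
  have hcl := clampT_mem (δ := δ) hδ.le
  have hclT : ∀ t, clampT δ t ∈ Icc 0 T := fun t => ⟨(hcl t).1, (hcl t).2.trans hδT⟩
  set a : Vec n → (Fin r → Fin n) → (EuclideanSpace ℂ (Fin l) →L[ℂ] EuclideanSpace ℂ (Fin l)) :=
    fun x => coefJ (G x 0 (j x)) with haa
  have hlin := h.holV_lin hr hα0 hT.le hρ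
  have h1 : ∀ g : Vec n → ℝ → EuclideanSpace ℂ (Fin l), ∃ d wt,
      (∃ M, HolSrc α M g) → ∃ R, LinSol δ R a g d wt := by
    intro g
    by_cases hh : ∃ M, HolSrc α M g
    · obtain ⟨M, hh⟩ := hh
      obtain ⟨R, d, wt, h2⟩ := hso M g hh
      exact ⟨d, wt, fun _ => ⟨R, h2⟩⟩
    · exact ⟨fun _ _ _ => 0, fun _ _ => 0, fun h => (hh h).elim⟩
  choose dd ww hdd using h1
  have hbd : ∀ (g : Vec n → ℝ → EuclideanSpace ℂ (Fin l)) d wt R M, LinSol δ R a g d wt →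
      HolSrc α M g → LinBd r α C δ M d wt := fun g d wt R M h1 h2 =>
    hap δ R g d wt M hδ.le hδδ₀ h1 h2.nonneg fun t _ => h2.holV t
  set Φ : (Vec n → ℝ → EuclideanSpace ℂ (Fin l)) → Vec n → ℝ → EuclideanSpace ℂ (Fin l) :=
    fun g x t => nlSrc F G j x (clampT δ t) fun I => dd g I x (clampT δ t) with hΦ
  have hsm : ∀ g, HolSrc α K g → ∀ x t, ‖reJet r fun I => dd g I x (clampT δ t)‖ ≤ ε := by
    intro g hg x t
    obtain ⟨R, h2⟩ := hdd g ⟨_, hg⟩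
    refine norm_reJet_le hε.le fun I hI => ?_
    exact ((hbd g _ _ R K h2 hg).bd I hI _ (hcl t) x).trans hb
  have hΦc : ∀ g, HolSrc α K g → Continuous fun p : Vec n × ℝ => Φ g p.1 p.2 := by
    intro g hg
    obtain ⟨R, h2⟩ := hdd g ⟨_, hg⟩
    have hB := hbd g _ _ R K h2 hg
    have hdc : ∀ I : List (Fin n), I.length ≤ r →
        Continuous fun p : Vec n × ℝ => dd g I p.1 (clampT δ p.2) := fun I hI =>
      hB.continuous_clampT hr hα0 hδ.le h2 hI
    have c1 : Continuous fun p : Vec n × ℝ => reJet r fun I => dd g I p.1 (clampT δ p.2) :=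
      continuous_reJet hdc
    have c2 : Continuous fun p : Vec n × ℝ => lowJet r fun I => dd g I p.1 (clampT δ p.2) :=
      continuous_lowJet hdc
    have c3 : Continuous fun p : Vec n × ℝ => G p.1 0 (j p.1) :=
      (hlin.continuous hα0).comp continuous_fst
    have cj : Continuous j := by
      rw [continuous_iff_continuousAt]
      intro x₀
      have h6 : Tendsto (fun x : Vec n => Hj * ‖x - x₀‖ ^ α) (𝓝 x₀) (𝓝 0) := by
        have c1 : Continuous fun x : Vec n => Hj * ‖x - x₀‖ ^ α :=
          continuous_const.mul (Continuous.rpow_const (by fun_prop) fun _ => Or.inr hα0.le)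
        simpa [Real.zero_rpow hα0.ne'] using c1.tendsto x₀
      exact tendsto_iff_norm_sub_tendsto_zero.2
        (squeeze_zero (fun _ => norm_nonneg _) (fun x => h.hol x x₀) h6)
    have c4 : Continuous fun p : Vec n × ℝ =>
        F p.1 (clampT δ p.2) (j p.1 + reJet r fun I => dd g I p.1 (clampT δ p.2)) :=
      h.tame.tame.continuous_comp hα0 hβ continuous_fst ((continuous_clampT δ).comp continuous_snd)
        ((cj.comp continuous_fst).add c1) (fun p => hclT _)
        (fun p => by rw [add_sub_cancel_left]; exact (hsm g hg _ _).trans hερ)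
    exact (inclC l).continuous.comp ((c4.sub (c3.clm_apply c1)).add (c3.clm_apply c2))
  have key : ∀ g g', HolSrc α K g → HolSrc α K g' → ∀ M, HolSrc α M (fun x t => g x t - g' x t) →
      HolSrc α (M / 2) (fun x t => Φ g x t - Φ g' x t) := by
    intro g g' hg hg' M hM
    refine .of_holV ((hΦc g hg).sub (hΦc g' hg')) fun t => ?_
    obtain ⟨R, h2⟩ := hdd g ⟨_, hg⟩
    obtain ⟨R', h2'⟩ := hdd g' ⟨_, hg'⟩
    have hB := hbd g _ _ R K h2 hg
    have hB' := hbd g' _ _ R' K h2' hg'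
    have hBe := hbd _ _ _ _ M (h2.sub h2') hM
    have ht := hcl t
    have hz : ∀ (g : Vec n → ℝ → EuclideanSpace ℂ (Fin l)) R,
        LinSol δ R a g (dd g) (ww g) → LinBd r α C δ K (dd g) (ww g) → ∀ x y,
        ‖(j x + reJet r fun I => dd g I x (clampT δ t)) -
          (j y + reJet r fun I => dd g I y (clampT δ t))‖ ≤ Hz * ‖x - y‖ ^ α := by
      intro g R h3 h4 x y
      rw [add_sub_add_comm, hHz, add_mul]
      exact (norm_add_le _ _).trans (add_le_add (h.hol x y)
        ((h4.holV_reJet hα0.le hα1.le hC hK0 hδ.le hδ1 ht (h3.jets _ ht)).hol x y))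
    have hzs : ∀ (g : Vec n → ℝ → EuclideanSpace ℂ (Fin l)),
        LinBd r α C δ K (dd g) (ww g) → ∀ x,
        ‖(j x + reJet r fun I => dd g I x (clampT δ t)) - j x‖ ≤ C * K * p := by
      intro g h4 x
      rw [add_sub_cancel_left]
      exact norm_reJet_le (by positivity) fun I hI => h4.bd I hI _ ht x
    obtain ⟨A, hA, hAe⟩ := h.tame.exists_avg hα0 hβ hT.le (hclT t) (hb.trans hερ)
      (hzs g hB) (hzs g' hB') (fun x y => (h.hol x y).trans (by
        gcongr; rw [hHz]; exact le_add_of_nonneg_right (by positivity))) (hz g R h2 hB) (hz g' R' h2' hB')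
    have hA' : HolV α (L * (1 + C * K) * p) (2 * L * (1 + Hz)) A := hA.mono (by
      have : clampT δ t ^ (α / r) ≤ p := Real.rpow_le_rpow ht.1 ht.2 hβ.le
      calc L * (clampT δ t ^ (α / r) + C * K * p) ≤ L * (p + C * K * p) := by gcongr
        _ = _ := by ring) le_rfl
    have h5 := hBe.holV_src hα0.le hα1.le hC hM.nonneg hδ.le hδ1 ht ((h2.sub h2').jets _ ht) hA'
      (by positivity) hlin (by positivity)
    have h6 : srcConst n C (L * (1 + C * K) * p) (2 * L * (1 + Hz)) L (L * (1 + Hj)) p * M ≤ M / 2 := by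
      have e : srcConst n C (L * (1 + C * K) * p) (2 * L * (1 + Hz)) L (L * (1 + Hj)) p = q * p := by
        rw [srcConst, hq]; ring
      rw [e]
      have := mul_le_mul_of_nonneg_right ha hM.nonneg
      linarith
    have e : ∀ x, Φ g x t - Φ g' x t = inclC l
        (A x (reJet r fun I => dd g I x (clampT δ t) - dd g' I x (clampT δ t)) +
        G x 0 (j x) (lowJet r fun I => dd g I x (clampT δ t) - dd g' I x (clampT δ t))) := by
      intro x
      have h7 := hAe x
      rw [add_sub_add_left_eq_sub, ← reJet_sub] at h7
      rw [← h7, lowJet_sub, reJet_sub, map_sub, map_sub, hΦ]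
      simp only [nlSrc]
      rw [← map_sub]
      congr 1
      abel
    simp only [e]
    exact h5.mono h6 h6
  have hF0 : HolSrc α (K / 2) (Φ fun _ _ => 0) := by
    have hz : HolSrc α K fun (_ : Vec n) (_ : ℝ) => (0 : EuclideanSpace ℂ (Fin l)) := .zero hK0
    refine .of_holV (hΦc _ hz) fun t => ?_
    obtain ⟨R, h2⟩ := hdd _ ⟨_, hz⟩
    have hB := hbd _ _ _ R 0 h2 (.zero le_rfl)
    have h3 : ∀ x, reJet r (fun I => dd (fun _ _ => 0) I x (clampT δ t)) = 0 := fun x =>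
      norm_le_zero_iff.1 (norm_reJet_le le_rfl fun I hI => by simpa using hB.bd I hI _ (hcl t) x)
    have h4 : ∀ x, lowJet r (fun I => dd (fun _ _ => 0) I x (clampT δ t)) = 0 := fun x =>
      norm_le_zero_iff.1 (norm_lowJet_le le_rfl fun I hI => by
        simpa using hB.bd I hI.le _ (hcl t) x)
    simp only [hΦ, nlSrc, h3, h4, map_zero, sub_zero, add_zero]
    exact ((h.tame.tame.holV hβ hL (hclT t) (z := j) (fun x => by simpa) h.hol).clm_comp
      norm_inclC_le).mono (by rw [hK]; linarith) (by rw [hK]; linarith)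
  obtain ⟨g, hg, hgp, hfix⟩ := HolSrc.exists_fixedPoint (n := n) (α := α) hK0
    (fun g => ∀ x m t, g (x + zvec m) t = g x t) (fun _ _ _ => rfl)
    (fun g G' h1 h2 x m t => by
      refine tendsto_nhds_unique (h2 _ _) ?_
      simp only [h1]
      exact h2 _ _)
    Φ (fun g hg hgp => ⟨by
      have h2 := key g _ hg (.zero hK0) K (by simpa using hg)
      have h3 := h2.add hF0
      simp only [sub_add_cancel] at h3
      exact h3.mono (by linarith), fun x m t => by
      obtain ⟨R, h2⟩ := hdd g ⟨_, hg⟩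
      have h3 : ∀ I : List (Fin n), I.length ≤ r →
          dd g I (x + zvec m) (clampT δ t) = dd g I x (clampT δ t) := fun I hI =>
        h2.periodic hap hδ.le hδδ₀ (zvec m) (fun x => by simp only [haa, h.perG, h.per])
          (fun x t _ => hgp x m t) hI (hcl t) x
      have h4 : (reJet r fun I => dd g I (x + zvec m) (clampT δ t)) =
          reJet r fun I => dd g I x (clampT δ t) := by
        ext k I b
        simp only [reJet]
        rw [h3 _ (by simp; omega)]
      have h5 : (lowJet r fun I => dd g I (x + zvec m) (clampT δ t)) =
          lowJet r fun I => dd g I x (clampT δ t) := by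
        ext k I b
        simp only [lowJet]
        rw [h3 _ (by simp; omega)]
      simp only [hΦ, nlSrc, h4, h5, h.perG, h.per, h.perF]⟩)
    (fun g g' hg _ hg' _ M hM => key g g' hg hg' M hM)
  obtain ⟨R, h2⟩ := hdd g ⟨_, hg⟩
  refine ⟨R, dd g, ww g, g, h2, hbd g _ _ R K h2 hg, fun I hI x m t ht =>
    h2.periodic hap hδ.le hδδ₀ (zvec m) (fun x => by simp only [haa, h.perG, h.per])
      (fun x t _ => hgp x m t) hI ht x, fun x t ht => ?_, fun x t ht => ?_⟩
  · have := hsm g hg x t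
    rwa [clampT_of_mem ht] at this
  · refine h2.reV_eq ht x ?_
    have h3 := congrFun (congrFun hfix x) t
    simp only [hΦ, clampT_of_mem ht] at h3
    exact h3.symm

end NonlinearExistence

section NonlinearUniqueness

variable {n l r : ℕ}

/-- The jet vector of a family of partial derivatives indexed by lists. -/
def jetL (r : ℕ) (E : List (Fin n) → Vec l) : Jet n l r := fun _ I b => E (List.ofFn I) b

lemma jetL_sub (E E' : List (Fin n) → Vec l) :
    jetL r (fun I => E I - E' I) = jetL r E - jetL r E' := by
  ext k I b; simp [jetL]

lemma jetL_add (E E' : List (Fin n) → Vec l) :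
    jetL r (fun I => E I + E' I) = jetL r E + jetL r E' := by
  ext k I b; simp [jetL]

lemma reJet_inclC (E : List (Fin n) → Vec l) : (reJet r fun I => inclC l (E I)) = jetL r E := by
  ext k I b; simp [jetL, reJet]

lemma jetL_reV (D : List (Fin n) → EuclideanSpace ℂ (Fin l)) :
    (jetL r fun I => reV l (D I)) = reJet r D := by
  ext k I b; simp [jetL, reJet]

lemma norm_lowJet_le_norm_reJet (D : List (Fin n) → EuclideanSpace ℂ (Fin l)) :
    ‖lowJet r D‖ ≤ ‖reJet r D‖ :=
  norm_jet_le (norm_nonneg _) fun k I b => by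
    unfold lowJet
    split_ifs
    · exact abs_jet_le (reJet r D) k I b
    · simp

lemma norm_jetL_le {E : List (Fin n) → Vec l} {S : ℝ} (hS : 0 ≤ S)
    (h : ∀ I, I.length ≤ r → ‖E I‖ ≤ S) : ‖jetL r E‖ ≤ S :=
  norm_jet_le hS fun k I b =>
    (PiLp.norm_apply_le (E (List.ofFn I)) b).trans (h _ (by simp; omega))

lemma RJets.jetOf_eq {e : List (Fin n) → Vec n → Vec l} (h : RJets r e) (x : Vec n) :
    jetOf univ r (e []) x = jetL r fun I => e I x := by
  ext k I b
  simp only [jetOf, jetL]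
  rw [h.pderivW_eq k (by omega)]

/-- The jets of a solution on `[0,δ]` of the nonlinear equation with bounded, Hölder continuous
jets which are uniformly continuous in time. -/
structure RSol (r : ℕ) (α δ R Hz : ℝ) (F : Vec n → ℝ → Jet n l r → Vec l)
    (e : List (Fin n) → Vec n → ℝ → Vec l) : Prop where
  jets : ∀ t ∈ Icc 0 δ, RJets r fun I x => e I x t
  bd : ∀ I, I.length ≤ r → ∀ x, ∀ t ∈ Icc 0 δ, ‖e I x t‖ ≤ R
  time : ∀ x, ∀ t ∈ Icc 0 δ,
    HasDerivWithinAt (e [] x) (F x t (jetL r fun I => e I x t)) (Icc 0 δ) t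
  hol : ∀ t ∈ Icc 0 δ, ∀ x y,
    ‖(jetL r fun I => e I x t) - jetL r fun I => e I y t‖ ≤ Hz * ‖x - y‖ ^ α
  modulus : ∀ ε > 0, ∃ h > 0, ∀ x, ∀ t ∈ Icc 0 δ, ∀ s ∈ Icc 0 δ, |t - s| ≤ h →
    ‖(jetL r fun I => e I x t) - jetL r fun I => e I x s‖ ≤ ε

lemma eq_zero_of_holV_halving {α C δ M : ℝ}
    {f : Vec n → ℝ → EuclideanSpace ℂ (Fin l)}
    {d : List (Fin n) → Vec n → ℝ → EuclideanSpace ℂ (Fin l)}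
    {wt : Vec n → ℝ → EuclideanSpace ℂ (Fin l)} (hM : 0 ≤ M)
    (hb : ∀ M, 0 ≤ M → (∀ t ∈ Icc 0 δ, HolV α M M fun x => f x t) → LinBd r α C δ M d wt)
    (hf : ∀ t ∈ Icc 0 δ, HolV α M M fun x => f x t)
    (hs : ∀ M, 0 ≤ M → LinBd r α C δ M d wt →
      ∀ t ∈ Icc 0 δ, HolV α (M / 2) (M / 2) fun x => f x t)
    {I : List (Fin n)} (hI : I.length ≤ r) {t : ℝ} (ht : t ∈ Icc 0 δ) (x : Vec n) :
    d I x t = 0 := by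
  have h1 : ∀ N : ℕ, ∀ t ∈ Icc 0 δ, HolV α (M * (1 / 2) ^ N) (M * (1 / 2) ^ N) fun x => f x t := by
    intro N
    induction N with
    | zero => simpa using hf
    | succ N ih =>
      have h0 : 0 ≤ M * (1 / 2) ^ N := by positivity
      have := hs _ h0 (hb _ h0 ih)
      rw [pow_succ, ← mul_assoc]
      simpa [div_eq_mul_inv] using this
  have h2 : Tendsto (fun N : ℕ => C * (M * (1 / 2) ^ N) * δ ^ (α / r)) atTop (𝓝 0) := by
    have := (((tendsto_pow_atTop_nhds_zero_of_lt_one (r := (1 / 2 : ℝ)) (by norm_num)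
      (by norm_num)).const_mul M).const_mul C).mul_const (δ ^ (α / r))
    simpa using this
  exact norm_le_zero_iff.1 (ge_of_tendsto' h2 fun N =>
    (hb _ (by positivity) (h1 N)).bd I hI t ht x)

lemma ParabolicData.eq_of_eq_start (hr : 2 ≤ r) {lam α T ρ L Hj C δ₀ : ℝ}
    {j : Vec n → Jet n l r} {F : Vec n → ℝ → Jet n l r → Vec l}
    {G : Vec n → ℝ → Jet n l r → Jet n l r →L[ℝ] Vec l} (h : ParabolicData lam α T ρ L Hj j F G)
    (hα0 : 0 < α) (hα1 : α < 1) (hT : 0 < T) (hC : 0 ≤ C) (hδ₀1 : δ₀ ≤ 1)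
    (hap : APriori α C δ₀ fun x => coefJ (G x 0 (j x))) {δ R Hz σ s k : ℝ}
    {e e' : List (Fin n) → Vec n → ℝ → Vec l} (he : RSol r α δ R Hz F e)
    (he' : RSol r α δ R Hz F e') (hδT : δ ≤ T) (hs : 0 ≤ s) (hk : 0 ≤ k) (hsk : s + k ≤ δ)
    (hkδ₀ : k ≤ δ₀) (hσ : σ ≤ ρ)
    (hz : ∀ x, ∀ t ∈ Icc s (s + k), ‖(jetL r fun I => e I x t) - j x‖ ≤ σ)
    (hz' : ∀ x, ∀ t ∈ Icc s (s + k), ‖(jetL r fun I => e' I x t) - j x‖ ≤ σ)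
    (hjH : Hj ≤ Hz)
    (hq : srcConst n C (L * (δ ^ (α / r) + σ)) (2 * L * (1 + Hz)) L (L * (1 + Hj))
      (k ^ (α / r)) ≤ 1 / 2)
    (heq : ∀ x, e [] x s = e' [] x s) (x : Vec n) {t : ℝ} (ht : t ∈ Icc s (s + k)) :
    e [] x t = e' [] x t := by
  have hL := h.tame.nonneg
  have hHj := h.hol_nonneg
  have hHz : 0 ≤ Hz := hHj.trans hjH
  have hβ : 0 < α / r := by positivity
  have hσ0 : 0 ≤ σ := (norm_nonneg _).trans (hz 0 s ⟨le_rfl, by linarith⟩)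
  have hρ : 0 ≤ ρ := hσ0.trans hσ
  have hδ0 : 0 ≤ δ := by linarith
  have hR : 0 ≤ R := (norm_nonneg _).trans (he.bd [] (by simp) 0 0 ⟨le_rfl, hδ0⟩)
  have hmem : ∀ τ ∈ Icc 0 k, s + τ ∈ Icc 0 δ := fun τ hτ =>
    ⟨by linarith [hτ.1], by linarith [hτ.2]⟩
  have hmem' : ∀ τ ∈ Icc 0 k, s + τ ∈ Icc s (s + k) := fun τ hτ =>
    ⟨by linarith [hτ.1], by linarith [hτ.2]⟩
  have hmemT : ∀ τ ∈ Icc 0 k, s + τ ∈ Icc 0 T := fun τ hτ =>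
    ⟨(hmem τ hτ).1, (hmem τ hτ).2.trans hδT⟩
  set z : Vec n → ℝ → Jet n l r := fun x t => jetL r fun I => e I x t with hzd
  set z' : Vec n → ℝ → Jet n l r := fun x t => jetL r fun I => e' I x t with hzd'
  set d : List (Fin n) → Vec n → ℝ → EuclideanSpace ℂ (Fin l) :=
    fun I x τ => inclC l (e I x (s + τ) - e' I x (s + τ)) with hd
  set wt : Vec n → ℝ → EuclideanSpace ℂ (Fin l) :=
    fun x τ => inclC l (F x (s + τ) (z x (s + τ)) - F x (s + τ) (z' x (s + τ))) with hwt
  set f : Vec n → ℝ → EuclideanSpace ℂ (Fin l) :=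
    fun x τ => wt x τ - ∑ J, coefJ (G x 0 (j x)) J (d (List.ofFn J) x τ) with hf
  have hFh : ∀ τ ∈ Icc 0 k, ∀ w : Vec n → ℝ → Jet n l r, (∀ x, ‖w x (s + τ) - j x‖ ≤ σ) →
      (∀ x y, ‖w x (s + τ) - w y (s + τ)‖ ≤ Hz * ‖x - y‖ ^ α) →
      HolV α L (L * (1 + Hz)) fun x => F x (s + τ) (w x (s + τ)) := fun τ hτ w h1 h2 =>
    h.tame.tame.holV hβ hL (hmemT τ hτ) (fun x => (h1 x).trans hσ) h2
  have hw : ∀ τ ∈ Icc 0 k, HolV α (L + L) (L * (1 + Hz) + L * (1 + Hz)) fun x => wt x τ :=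
    fun τ hτ => ((hFh τ hτ z (fun x => hz x _ (hmem' τ hτ)) (he.hol _ (hmem τ hτ))).sub
      (hFh τ hτ z' (fun x => hz' x _ (hmem' τ hτ)) (he'.hol _ (hmem τ hτ)))).clm_comp norm_inclC_le
  have hre : ∀ x τ, (reJet r fun I => d I x τ) = z x (s + τ) - z' x (s + τ) := fun x τ => by
    simp only [hd, hzd, hzd']
    rw [reJet_inclC, jetL_sub]
  have hsol : LinSol k (max (2 * R) (L + L)) (fun x => coefJ (G x 0 (j x))) f d wt :=
    { jets := fun τ hτ => by
        have j1 := he.jets _ (hmem τ hτ)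
        have j2 := he'.jets _ (hmem τ hτ)
        refine ⟨fun I hI => (inclC l).continuous.comp ((j1.cont I hI).sub (j2.cont I hI)),
          fun I hI x => ?_, fun I i hI x => ?_⟩
        · rw [hd, norm_inclC]
          refine (norm_sub_le _ _).trans (le_max_of_le_left ?_)
          linarith [he.bd I hI x _ (hmem τ hτ), he'.bd I hI x _ (hmem τ hτ)]
        · have l1 := j1.line I i hI x
          have l2 := j2.line I i hI x
          unfold HasLineDerivAt at l1 l2 ⊢
          exact (inclC l).hasFDerivAt.comp_hasDerivAt 0 (l1.sub l2)
      time := fun x τ hτ => by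
        have l1 := (he.time x _ (hmem τ hτ)).sub (he'.time x _ (hmem τ hτ))
        have l2 : HasDerivWithinAt (fun τ => s + τ) 1 (Icc 0 k) τ :=
          ((hasDerivAt_id τ).const_add s).hasDerivWithinAt
        have l3 := l1.scomp τ l2 fun τ hτ => hmem τ hτ
        rw [one_smul] at l3
        exact (inclC l).hasFDerivAt.comp_hasDerivWithinAt τ l3
      zero := fun x => by simp [hd, heq]
      wt_cont := fun τ hτ => (hw τ hτ).continuous hα0
      wt_bd := fun τ hτ x => ((hw τ hτ).bd x).trans (le_max_right _ _)
      eq := fun τ hτ x => by simp [hf] }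
  have hfe : ∀ τ ∈ Icc 0 k, ∃ A : Vec n → Jet n l r →L[ℝ] Vec l,
      HolV α (L * (δ ^ (α / r) + σ)) (2 * L * (1 + Hz)) A ∧ ∀ x, f x τ =
        inclC l (A x (reJet r fun I => d I x τ) + G x 0 (j x) (lowJet r fun I => d I x τ)) := by
    intro τ hτ
    obtain ⟨A, hA, hAe⟩ := h.tame.exists_avg hα0 hβ hT.le (hmemT τ hτ) hσ
      (fun x => hz x _ (hmem' τ hτ)) (fun x => hz' x _ (hmem' τ hτ))
      (fun x y => (h.hol x y).trans (by gcongr)) (he.hol _ (hmem τ hτ)) (he'.hol _ (hmem τ hτ))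
    refine ⟨A, hA.mono (by have := (hmem τ hτ).1; have := (hmem τ hτ).2; gcongr) le_rfl,
      fun x => ?_⟩
    have e1 : ∑ J, coefJ (G x 0 (j x)) J (d (List.ofFn J) x τ) =
        inclC l (reV l (∑ J, coefJ (G x 0 (j x)) J (d (List.ofFn J) x τ))) := by
      simp only [hd, coefJ_inclC]
      rw [← map_sum, reV_inclC]
    have e2 := map_reJet (G x 0 (j x)) fun I => d I x τ
    rw [hre x τ] at e2 ⊢
    rw [← hAe x]
    simp only [hf]
    rw [e1, hwt, ← map_sub]
    congr 1
    have e3 : reV l (∑ J, coefJ (G x 0 (j x)) J (d (List.ofFn J) x τ)) =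
        G x 0 (j x) (z x (s + τ) - z' x (s + τ)) - G x 0 (j x) (lowJet r fun I => d I x τ) := by
      rw [e2]; abel
    rw [e3]
    abel
  have hlin := h.holV_lin hr hα0 hT.le hρ
  have hζ : ∀ τ ∈ Icc 0 k, HolV α (R + R) (Hz + Hz) fun x => reJet r fun I => d I x τ := by
    intro τ hτ
    simp only [hre]
    have b1 : ∀ e : List (Fin n) → Vec n → ℝ → Vec l, RSol r α δ R Hz F e →
        HolV α R Hz fun x => jetL r fun I => e I x (s + τ) := fun e he =>
      ⟨fun x => norm_jetL_le hR fun I hI => he.bd I hI x _ (hmem τ hτ), he.hol _ (hmem τ hτ)⟩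
    exact (b1 e he).sub (b1 e' he')
  have hζl : ∀ τ ∈ Icc 0 k, HolV α (R + R) (Hz + Hz) fun x => lowJet r fun I => d I x τ :=
    fun τ hτ => ⟨fun x => (norm_lowJet_le_norm_reJet _).trans ((hζ τ hτ).bd x), fun x y => by
      rw [← lowJet_sub]
      refine (norm_lowJet_le_norm_reJet _).trans ?_
      rw [reJet_sub]
      exact (hζ τ hτ).hol x y⟩
  obtain ⟨M, hM0, hM⟩ : ∃ M, 0 ≤ M ∧ ∀ τ ∈ Icc 0 k, HolV α M M fun x => f x τ := by
    have b : ∀ τ ∈ Icc 0 k, HolV α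
        (L * (δ ^ (α / r) + σ) * (R + R) + L * (R + R))
        ((2 * L * (1 + Hz) * (R + R) + L * (δ ^ (α / r) + σ) * (Hz + Hz)) +
          (L * (1 + Hj) * (R + R) + L * (Hz + Hz))) fun x => f x τ := by
      intro τ hτ
      obtain ⟨A, hA, hAe⟩ := hfe τ hτ
      simp only [hAe]
      refine (((hA.clm_apply (hζ τ hτ)).add (hlin.clm_apply (hζl τ hτ))).clm_comp
        norm_inclC_le).mono (le_of_eq ?_) (le_of_eq ?_) <;> ring
    exact ⟨max _ _, le_max_of_le_left (b 0 ⟨le_rfl, hk⟩).nonneg, fun τ hτ =>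
      (b τ hτ).mono (le_max_left _ _) (le_max_right _ _)⟩
  have hτ : t - s ∈ Icc 0 k := ⟨by linarith [ht.1], by linarith [ht.2]⟩
  have hfin := eq_zero_of_holV_halving (C := C) hM0
    (fun M h1 h2 => hap k _ f d wt M hk hkδ₀ hsol h1 h2) hM
    (fun M h1 h2 τ hτ => by
      obtain ⟨A, hA, hAe⟩ := hfe τ hτ
      have h3 := h2.holV_src hα0.le hα1.le hC h1 hk (hkδ₀.trans hδ₀1) hτ (hsol.jets τ hτ) hA
        (by positivity) hlin (by positivity)
      simp only [hAe]
      have h4 := mul_le_mul_of_nonneg_right hq h1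
      exact h3.mono (by linarith) (by linarith)) (I := []) (by simp) hτ x
  have h5 := congrArg norm hfin
  rw [hd] at h5
  simp only [norm_inclC, norm_zero, add_sub_cancel] at h5
  exact sub_eq_zero.1 (norm_eq_zero.1 h5)

theorem ParabolicData.unique (hr : 2 ≤ r) {lam α T ρ L Hj C δ₀ : ℝ}
    {j : Vec n → Jet n l r} {F : Vec n → ℝ → Jet n l r → Vec l}
    {G : Vec n → ℝ → Jet n l r → Jet n l r →L[ℝ] Vec l} (h : ParabolicData lam α T ρ L Hj j F G)
    (hα0 : 0 < α) (hα1 : α < 1) (hT : 0 < T) (hC : 0 ≤ C) (hδ₀ : 0 < δ₀) (hδ₀1 : δ₀ ≤ 1)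
    (hap : APriori α C δ₀ fun x => coefJ (G x 0 (j x))) {δ R Hz ε : ℝ}
    {e e' : List (Fin n) → Vec n → ℝ → Vec l} (he : RSol r α δ R Hz F e)
    (he' : RSol r α δ R Hz F e') (hδT : δ ≤ T) (hε : 0 < ε) (hερ : 2 * ε ≤ ρ)
    (hsm : L * (δ ^ (α / r) + 2 * ε) * (n + 3) * C ≤ 1 / 4)
    (hz : ∀ x, ∀ t ∈ Icc 0 δ, ‖(jetL r fun I => e I x t) - j x‖ ≤ ε)
    (hjH : Hj ≤ Hz)
    (heq : ∀ x, e [] x 0 = e' [] x 0) (x : Vec n) {t : ℝ} (ht : t ∈ Icc 0 δ) :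
    e [] x t = e' [] x t := by
  have hβ : 0 < α / r := by positivity
  obtain ⟨k₁, hk₁, hk₁'⟩ := exists_rpow_le hβ
    ((2 * L * (1 + Hz) + L * (n + 3) + L * (1 + Hj)) * C) (c := 1 / 4) (by norm_num)
  obtain ⟨k₂, hk₂, hk₂'⟩ := he'.modulus ε hε
  set k := min (min k₁ k₂) δ₀ with hkd
  have hk : 0 < k := by positivity
  have key : ∀ N : ℕ, ∀ t ∈ Icc 0 δ, t ≤ N * k → ∀ x, e [] x t = e' [] x t := by
    intro N
    induction N with
    | zero =>
      intro t ht ht' x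
      have : t = 0 := le_antisymm (by simpa using ht') ht.1
      rw [this, heq]
    | succ N ih =>
      intro t ht ht' x
      push_cast at ht'
      rcases le_total t (N * k) with h1 | h1
      · exact ih t ht h1 x
      set s : ℝ := N * k with hs
      have hs0 : 0 ≤ s := by positivity
      have hsδ : s ∈ Icc 0 δ := ⟨hs0, h1.trans ht.2⟩
      set k' := t - s with hk'
      have hk'0 : 0 ≤ k' := by linarith
      have hk'k : k' ≤ k := by linarith
      have hse := ih s hsδ le_rfl
      have hjet : ∀ x, (jetL r fun I => e I x s) = jetL r fun I => e' I x s := fun x => by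
        rw [← (he.jets s hsδ).jetOf_eq x, ← (he'.jets s hsδ).jetOf_eq x]
        congr 1
        exact funext hse
      have hsub : ∀ τ ∈ Icc s (s + k'), τ ∈ Icc 0 δ := fun τ hτ =>
        ⟨hs0.trans hτ.1, hτ.2.trans (by linarith [ht.2])⟩
      refine h.eq_of_eq_start hr hα0 hα1 hT hC hδ₀1 hap he he' hδT hs0 hk'0
        (by linarith [ht.2]) (hk'k.trans (min_le_right _ _)) hερ
        (fun x τ hτ => (hz x τ (hsub τ hτ)).trans (by linarith)) (fun x τ hτ => ?_) hjH ?_ hse x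
        ⟨h1, by linarith⟩
      · have b1 := hk₂' x τ (hsub τ hτ) s hsδ (by
          rw [abs_of_nonneg (by linarith [hτ.1])]
          linarith [hτ.2, (min_le_left (min k₁ k₂) δ₀).trans (min_le_right _ _)])
        have b2 := hz x s hsδ
        rw [hjet x] at b2
        have b3 := norm_sub_le_norm_sub_add_norm_sub (jetL r fun I => e' I x τ)
          (jetL r fun I => e' I x s) (j x)
        linarith
      · have b1 := hk₁' k' hk'0 (hk'k.trans ((min_le_left _ _).trans (min_le_left _ _)))
        rw [srcConst]
        nlinarith
  obtain ⟨N, hN⟩ := exists_nat_ge (t / k)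
  exact key N t ht ((div_le_iff₀ hk).1 hN) x

end NonlinearUniqueness

section ParabolicHolderSpace

variable {n l r : ℕ}

lemma RJets.holV_jetL {α R H : ℝ} {e : List (Fin n) → Vec n → Vec l} (h : RJets r e) (hα0 : 0 ≤ α)
    (hα1 : α ≤ 1) (hH : 0 ≤ H) (hb : ∀ I, I.length ≤ r → ∀ x, ‖e I x‖ ≤ R)
    (htop : ∀ (J : Fin r → Fin n) x y,
      ‖e (List.ofFn J) x - e (List.ofFn J) y‖ ≤ H * ‖x - y‖ ^ α) :
    HolV α R (H + (n * R + 2 * R)) fun x => jetL r fun I => e I x := by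
  have hR : 0 ≤ R := (norm_nonneg _).trans (hb [] (by simp) 0)
  refine ⟨fun x => norm_jetL_le hR fun I hI => hb I hI x, fun x y => ?_⟩
  rw [← jetL_sub]
  refine norm_jetL_le (by positivity) fun I hI => ?_
  have hp : 0 ≤ ‖x - y‖ ^ α := by positivity
  have hnR : 0 ≤ n * R + 2 * R := by positivity
  rcases hI.lt_or_eq with h1 | h1
  · have h2 : ∀ x y, ‖e I x - e I y‖ ≤ n * R * ‖x - y‖ := fun x y => by
      have := norm_sub_sub_sum_partials_le (G := fun i => e (i :: I))
        (fun i x => h.line I i h1 x) y 0 R (x - y)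
        (fun i z _ => by simpa using hb (i :: I) (by simpa using h1) z)
      simpa using this
    refine ((HolV.of_lipschitz hα0 hα1 (hb I hI) (by positivity) h2).hol x y).trans ?_
    exact mul_le_mul_of_nonneg_right (by linarith) hp
  · obtain ⟨J, rfl⟩ := exists_ofFn_eq h1
    exact (htop J x y).trans (mul_le_mul_of_nonneg_right (by linarith) hp)

lemma PerZ.pderivW {w : Vec n → Vec l} (hw : PerZ w) (k : ℕ) (J : Fin k → Fin n) :
    PerZ (pderivW univ k J w) := by
  intro x m
  have e : (fun y => w (y + zvec m)) = w := funext fun y => hw y m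
  have h1 := iteratedFDeriv_comp_add_right (𝕜 := ℝ) (f := w) k (zvec m) x
  rw [e] at h1
  unfold _root_.pderivW
  simp only [iteratedFDerivWithin_univ]
  rw [h1]
  rfl

lemma jetOf_eq_jetL (w : Vec n → Vec l) (x : Vec n) :
    jetOf univ r w x = jetL r fun I => pdL w I x := by
  ext k I b
  simp only [jetOf, jetL, pdL_ofFn]

lemma PerZ.jetOf {w : Vec n → Vec l} (hw : PerZ w) : PerZ (jetOf univ r w) := by
  intro x m
  ext k I b
  have h1 := hw.pderivW k I x m
  simp only [_root_.jetOf, h1]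

lemma continuous_jetOf {w : Vec n → Vec l} (hw : ContDiff ℝ r w) : Continuous (jetOf univ r w) :=
  continuous_pi fun k => continuous_pi fun I => continuous_pi fun b => by
    have h1 : Continuous (pderivW univ k I w) := by
      rw [← pdL_ofFn]
      exact (rJets_pdL hw).cont _ (by simp; omega)
    exact (EuclideanSpace.proj b : Vec l →L[ℝ] ℝ).continuous.comp h1

lemma norm_pdL_le {w : Vec n → Vec l} {S : ℝ} {x : Vec n} (h : ‖jetOf univ r w x‖ ≤ S)
    {I : List (Fin n)} (hI : I.length ≤ r) : ‖pdL w I x‖ ≤ l * S := by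
  have h1 : ∀ b, ‖pdL w I x b‖ ≤ S := fun b =>
    (abs_jet_le (jetOf univ r w x) ⟨I.length, by omega⟩ I.get b).trans h
  calc ‖pdL w I x‖ = ‖∑ b, EuclideanSpace.single b (pdL w I x b)‖ := by
        congr 1
        ext b
        simp [Finset.sum_apply, Pi.single_apply]
    _ ≤ ∑ b : Fin l, ‖EuclideanSpace.single b (pdL w I x b)‖ := norm_sum_le _ _
    _ ≤ ∑ _b : Fin l, S := Finset.sum_le_sum fun b _ => by simpa using h1 b
    _ = l * S := by simp

lemma MemSp.exists_holder {α : ℝ} {w : Vec n → Vec l} (h : MemSp r α univ w) :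
    ∃ H, 0 ≤ H ∧ ∀ (J : Fin r → Fin n) x y,
      ‖pderivW univ r J w x - pderivW univ r J w y‖ ≤ H * ‖x - y‖ ^ α := by
  choose b hb using fun J => h.2 J
  refine ⟨∑ J, |b J|, by positivity, fun J x y => ?_⟩
  rcases eq_or_ne x y with rfl | hxy
  · rw [sub_self, norm_zero]; positivity
  have hp : 0 < ‖x - y‖ ^ α := Real.rpow_pos_of_pos (norm_pos_iff.2 (sub_ne_zero.2 hxy)) _
  have h1 := hb J ⟨x, mem_univ _, y, mem_univ _, hxy, rfl⟩
  rw [div_le_iff₀ hp] at h1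
  refine h1.trans (mul_le_mul_of_nonneg_right ((le_abs_self _).trans ?_) hp.le)
  exact Finset.single_le_sum (f := fun J => |b J|) (fun _ _ => abs_nonneg _) (Finset.mem_univ J)

lemma norm_sub_le_of_mem_upperBounds_holQuot {α c : ℝ} {J : Set ℝ}
    {w : Vec n → ℝ → Vec l} (hc : c ∈ upperBounds (holQuot r α (univ ×ˢ J) w)) (hβ : α / r ≠ 0)
    {t : ℝ} (ht : t ∈ J) (x y : Vec n) : ‖w x t - w y t‖ ≤ |c| * ‖x - y‖ ^ α := by
  rcases eq_or_ne x y with rfl | hxy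
  · rw [sub_self, norm_zero]; positivity
  have hp : 0 < ‖x - y‖ ^ α := Real.rpow_pos_of_pos (norm_pos_iff.2 (sub_ne_zero.2 hxy)) _
  have h1 := hc ⟨(x, t), ⟨mem_univ _, ht⟩, (y, t), ⟨mem_univ _, ht⟩,
    fun h => hxy (congrArg Prod.fst h), rfl⟩
  simp only [sub_self, abs_zero, Real.zero_rpow hβ, add_zero] at h1
  rw [div_le_iff₀ hp] at h1
  exact h1.trans (mul_le_mul_of_nonneg_right (le_abs_self _) hp.le)

lemma bddAbove_holQuot {α K : ℝ} (hK : 0 ≤ K) {J : Set ℝ} {w : Vec n → ℝ → Vec l}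
    (h : ∀ x y, ∀ t ∈ J, ∀ s ∈ J,
      ‖w x t - w y s‖ ≤ K * (‖x - y‖ ^ α + |t - s| ^ (α / r))) :
    BddAbove (holQuot r α (univ ×ˢ J) w) := by
  refine ⟨K, ?_⟩
  rintro _ ⟨p, hp, q, hq, -, rfl⟩
  exact div_le_of_le_mul₀ (by positivity) hK (h _ _ _ hp.2 _ hq.2)

lemma MemPar.exists_rSol (hr : 2 ≤ r) {α δ : ℝ} (hα0 : 0 < α) (hα1 : α < 1) {u : Vec n → ℝ → Vec l}
    {F : Vec n → ℝ → Jet n l r → Vec l} (h : MemPar r α univ (Icc 0 δ) u) (hp : PerZ u)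
    (hF : ∀ x, ∀ t ∈ Icc 0 δ, tDerivW (Icc 0 δ) u x t = F x t (jetOf univ r (fun y => u y t) x)) :
    ∃ C, ∀ R Hz, C ≤ R → C ≤ Hz → RSol r α δ R Hz F fun I x t => pdL (fun y => u y t) I x := by
  obtain ⟨-, hcd, hdf, hc, -, htop, -⟩ := h
  have hβ : α / r ≠ 0 := by positivity
  have hcd' : ∀ t ∈ Icc 0 δ, ContDiff ℝ r fun y => u y t := fun t ht => contDiffOn_univ.1 (hcd t ht)
  have hper : ∀ t, PerZ fun y => u y t := fun t x m => by
    have h1 : u (x + zvec m) = u x := hp x m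
    exact congrFun h1 t
  have hjc : ContinuousOn (fun p : Vec n × ℝ => jetOf univ r (fun y => u y p.2) p.1)
      (univ ×ˢ Icc 0 δ) :=
    continuousOn_pi.2 fun k => continuousOn_pi.2 fun I => continuousOn_pi.2 fun b =>
      (EuclideanSpace.proj b : Vec l →L[ℝ] ℝ).continuous.comp_continuousOn (hc k (by omega) I)
  have hjp : ∀ t ∈ Icc 0 δ, PerZ fun x => jetOf univ r (fun y => u y t) x :=
    fun t _ => (hper t).jetOf
  obtain ⟨S, hS, hSb⟩ := exists_bound_of_perZ
    (g := fun x t => jetOf univ r (fun y => u y t) x) hjp hjc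
  choose c hc' using htop
  have hbd : ∀ I : List (Fin n), I.length ≤ r → ∀ x, ∀ t ∈ Icc 0 δ,
      ‖pdL (fun y => u y t) I x‖ ≤ l * S := fun I hI x t ht => norm_pdL_le (hSb x t ht) hI
  have hhol : ∀ t ∈ Icc 0 δ, HolV α (l * S) (∑ J, |c J| + (n * (l * S) + 2 * (l * S)))
      fun x => jetL r fun I => pdL (fun y => u y t) I x := fun t ht =>
    (rJets_pdL (hcd' t ht)).holV_jetL hα0.le hα1.le (by positivity)
      (fun I hI x => hbd I hI x t ht) fun J x y => by
        rw [pdL_ofFn]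
        refine (norm_sub_le_of_mem_upperBounds_holQuot (hc' J) hβ ht x y).trans
          (mul_le_mul_of_nonneg_right ?_ (by positivity))
        exact Finset.single_le_sum (f := fun J => |c J|) (fun _ _ => abs_nonneg _)
          (Finset.mem_univ J)
  refine ⟨max (l * S) (∑ J, |c J| + (n * (l * S) + 2 * (l * S))), fun R Hz hR hHz =>
    { jets := fun t ht => rJets_pdL (hcd' t ht)
      bd := fun I hI x t ht => (hbd I hI x t ht).trans ((le_max_left _ _).trans hR)
      time := fun x t ht => ?_
      hol := fun t ht => ((hhol t ht).mono le_rfl ((le_max_right _ _).trans hHz)).hol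
      modulus := fun ε hε => ?_ }⟩
  · have h1 := (hdf x (mem_univ _) t ht).hasDerivWithinAt
    have h2 := hF x t ht
    rw [tDerivW] at h2
    rw [h2, jetOf_eq_jetL] at h1
    simpa only [pdL_nil] using h1
  · simp only [← jetOf_eq_jetL]
    exact exists_time_modulus_of_perZ (g := fun x t => jetOf univ r (fun y => u y t) x) hjp hjc hε

end ParabolicHolderSpace

section ShortTimeExistence

variable {n l r : ℕ}

lemma Jets.rJets {D : List (Fin n) → Vec n → EuclideanSpace ℂ (Fin l)} {R : ℝ} (h : Jets r D R) :
    RJets r fun I x => reV l (D I x) where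
  cont I hI := (reV l).continuous.comp (h.cont I hI)
  line I i hI x := by
    have h1 := h.line I i hI x
    unfold HasLineDerivAt at h1 ⊢
    exact (reV l).hasFDerivAt.comp_hasDerivAt 0 h1

lemma norm_reV_apply_le (v : EuclideanSpace ℂ (Fin l)) : ‖reV l v‖ ≤ ‖v‖ :=
  ((reV l).le_opNorm v).trans (mul_le_of_le_one_left (norm_nonneg _) norm_reV_le)

lemma MemSp.exists_parabolicData {α T R₀ ρ lam : ℝ} (hr : 2 ≤ r) (hα0 : 0 < α) (hα1 : α < 1)
    (hT : 0 < T) (hρ0 : 0 ≤ ρ) (hρ : ρ < R₀) {u₀ : Vec n → Vec l} (hu₀ : MemSp r α univ u₀)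
    (hu₀per : PerZ u₀) {F : Vec n → ℝ → Jet n l r → Vec l}
    (hF : ContDiffOn ℝ 2 (fun q : Vec n × ℝ × Jet n l r => F q.1 q.2.1 q.2.2)
      {q | q.2.1 ∈ Icc (0 : ℝ) T ∧ ‖q.2.2 - jetOf univ r u₀ q.1‖ ≤ R₀})
    (hFper : ∀ x m t z, F (x + zvec m) t z = F x t z)
    (hpar : ∀ x : Vec n, ∀ ξ : Vec n, ∀ v : Vec l,
      lam * ‖ξ‖ ^ r * ‖v‖ ^ 2 ≤ (-1 : ℝ) ^ (r / 2 - 1) *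
        ∑ I : Fin r → Fin n, ∑ a : Fin l, ∑ b : Fin l,
          (fderivWithin ℝ (fun z => F x 0 z a) (Metric.closedBall (jetOf univ r u₀ x) R₀)
            (jetOf univ r u₀ x) (jetBasisG r r I b)) * (∏ j, ξ (I j)) * v a * v b) :
    ∃ L Hj, ParabolicData lam α T ρ L Hj (jetOf univ r u₀) F fun x t z => fderiv ℝ (F x t) z := by
  have hcd : ContDiff ℝ r u₀ := contDiffOn_univ.1 hu₀.1
  have hβ1 : α / r ≤ 1 := by
    have : (2 : ℝ) ≤ r := by exact_mod_cast hr
    rw [div_le_one (by linarith)]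
    linarith
  obtain ⟨L, hL⟩ := exists_tameDeriv (β := α / r) hα0.le hα1.le (by positivity) hβ1 hT hρ
    (continuous_jetOf hcd) hu₀per.jetOf hF hFper
  obtain ⟨H, hH, hHb⟩ := hu₀.exists_holder
  obtain ⟨S, hS, hSb⟩ := hu₀per.jetOf.exists_bound (continuous_jetOf (r := r) hcd)
  have hhol := (rJets_pdL hcd).holV_jetL hα0.le hα1.le hH
    (fun I hI x => norm_pdL_le (hSb x) hI) fun J x y => by rw [pdL_ofFn]; exact hHb J x y
  refine ⟨L, H + (n * (l * S) + 2 * (l * S)), hL, ?_, fun x y => ?_, fun x m => hu₀per.jetOf x m,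
    fun x m t => funext fun z => hFper x m t z, fun x m t => ?_, fun x ξ v => ?_⟩
  rotate_left
  · rw [jetOf_eq_jetL, jetOf_eq_jetL]
    exact hhol.hol x y
  · have h1 : F (x + zvec m) t = F x t := funext fun z => hFper x m t z
    funext z
    rw [h1]
  · have hR₀ : 0 < R₀ := hρ0.trans_lt hρ
    have h1 := hL.deriv x 0 ⟨le_rfl, hT.le⟩ (jetOf univ r u₀ x) (by simpa using hρ0)
    have h2 : ∀ a, fderivWithin ℝ (fun z => F x 0 z a) (Metric.closedBall (jetOf univ r u₀ x) R₀)
        (jetOf univ r u₀ x) =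
        (EuclideanSpace.proj a : Vec l →L[ℝ] ℝ).comp (fderiv ℝ (F x 0) (jetOf univ r u₀ x)) := by
      intro a
      rw [fderivWithin_of_mem_nhds (Metric.closedBall_mem_nhds _ hR₀)]
      exact ((EuclideanSpace.proj a : Vec l →L[ℝ] ℝ).hasFDerivAt.comp _ h1).fderiv
    have h3 := hpar x ξ v
    simp only [h2] at h3
    exact h3
  · positivity

lemma memPar_of_linSol (hr : 2 ≤ r) {α T ρ L Hj C δ K R H lam : ℝ} (hα0 : 0 < α) (hα1 : α < 1)
    (hC : 0 ≤ C) (hK : 0 ≤ K) (hδ : 0 < δ) (hδT : δ ≤ T) (hδ1 : δ ≤ 1) {u₀ : Vec n → Vec l}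
    (hcd : ContDiff ℝ r u₀) (hH : 0 ≤ H)
    (hHb : ∀ (J : Fin r → Fin n) x y,
      ‖pderivW univ r J u₀ x - pderivW univ r J u₀ y‖ ≤ H * ‖x - y‖ ^ α)
    {F : Vec n → ℝ → Jet n l r → Vec l} {G : Vec n → ℝ → Jet n l r → Jet n l r →L[ℝ] Vec l}
    (h : ParabolicData lam α T ρ L Hj (jetOf univ r u₀) F G)
    {f : Vec n → ℝ → EuclideanSpace ℂ (Fin l)}
    {d : List (Fin n) → Vec n → ℝ → EuclideanSpace ℂ (Fin l)}
    {wt : Vec n → ℝ → EuclideanSpace ℂ (Fin l)}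
    (hs : LinSol δ R (fun x => coefJ (G x 0 (jetOf univ r u₀ x))) f d wt)
    (hb : LinBd r α C δ K d wt)
    (hsm : ∀ x, ∀ t ∈ Icc 0 δ, ‖reJet r fun I => d I x t‖ ≤ ρ)
    (heq : ∀ x, ∀ t ∈ Icc 0 δ,
      reV l (wt x t) = F x t (jetOf univ r u₀ x + reJet r fun I => d I x t))
    {u : Vec n → ℝ → Vec l} (hu : ∀ x t, u x t = u₀ x + reV l (d [] x (clampT δ t))) :
    MemPar r α univ (Icc 0 δ) u ∧
      (∀ x, ∀ t ∈ Icc 0 δ, jetOf univ r (fun y => u y t) x =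
        jetOf univ r u₀ x + reJet r fun I => d I x t) ∧
      ∀ x, ∀ t ∈ Icc 0 δ,
        tDerivW (Icc 0 δ) u x t = F x t (jetOf univ r u₀ x + reJet r fun I => d I x t) := by
  have hβ : 0 < α / r := by positivity
  have hL := h.tame.nonneg
  have hHj := h.hol_nonneg
  have hju : ∀ t ∈ Icc 0 δ, RJets r fun I x => pdL u₀ I x + reV l (d I x t) := fun t ht =>
    (rJets_pdL hcd).add (hs.jets t ht).rJets
  have hut : ∀ t ∈ Icc 0 δ, (fun y => u y t) = fun x => pdL u₀ [] x + reV l (d [] x t) :=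
    fun t ht => funext fun x => by rw [hu, clampT_of_mem ht, pdL_nil]
  have hsp : ∀ k, k ≤ r → ∀ I : Fin k → Fin n, ∀ x, ∀ t ∈ Icc 0 δ,
      spDerivW univ k I u x t = pderivW univ k I u₀ x + reV l (d (List.ofFn I) x t) := by
    intro k hk I x t ht
    rw [spDerivW, hut t ht]
    refine ((hju t ht).pderivW_eq k hk I x).trans ?_
    rw [pdL_ofFn]
  have htd : ∀ x, ∀ t ∈ Icc 0 δ, HasDerivWithinAt (fun s => u x s) (reV l (wt x t)) (Icc 0 δ) t := by
    intro x t ht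
    have h1 := ((reV l).hasFDerivAt.comp_hasDerivWithinAt t (hs.time x t ht)).const_add (u₀ x)
    have h2 : ∀ s ∈ Icc 0 δ, u x s = u₀ x + reV l (d [] x s) := fun s hs => by
      rw [hu, clampT_of_mem hs]
    exact h1.congr h2 (h2 t ht)
  have htd' : ∀ x, ∀ t ∈ Icc 0 δ,
      tDerivW (Icc 0 δ) u x t = F x t (jetOf univ r u₀ x + reJet r fun I => d I x t) := by
    intro x t ht
    rw [← heq x t ht]
    exact (htd x t ht).derivWithin (uniqueDiffOn_Icc hδ t ht)
  have hcl := clampT_mem hδ.le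
  have hdc : ∀ I : List (Fin n), I.length ≤ r →
      Continuous fun p : Vec n × ℝ => d I p.1 (clampT δ p.2) := fun I hI =>
    hb.continuous_clampT hr hα0 hδ.le hs hI
  have hj0 : ∀ x, ∀ t ∈ Icc 0 δ,
      ‖(jetOf univ r u₀ x + reJet r fun I => d I x t) - jetOf univ r u₀ x‖ ≤ ρ := fun x t ht => by
    rw [add_sub_cancel_left]; exact hsm x t ht
  refine ⟨⟨?_, fun t ht => ?_, fun x _ t ht => (htd x t ht).differentiableWithinAt,
    fun k hk I => ?_, ?_, fun I => ?_, ?_⟩, fun x t ht => ?_, htd'⟩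
  · have e : (fun p : Vec n × ℝ => u p.1 p.2) =
        fun p => u₀ p.1 + reV l (d [] p.1 (clampT δ p.2)) := funext fun p => hu _ _
    rw [e]
    exact ((hcd.continuous.comp continuous_fst).add
      ((reV l).continuous.comp (hdc [] (by simp)))).continuousOn
  · rw [hut t ht, contDiffOn_univ]
    exact (hju t ht).contDiff
  · have c1 : Continuous (pderivW univ k I u₀) := by
      rw [← pdL_ofFn]
      exact (rJets_pdL hcd).cont _ (by simpa using hk)
    have c2 : Continuous fun p : Vec n × ℝ =>
        pderivW univ k I u₀ p.1 + reV l (d (List.ofFn I) p.1 (clampT δ p.2)) :=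
      (c1.comp continuous_fst).add ((reV l).continuous.comp (hdc _ (by simpa using hk)))
    refine c2.continuousOn.congr fun p hp => ?_
    simp only [hsp k hk I p.1 p.2 hp.2, clampT_of_mem hp.2]
  · have c1 : Continuous fun p : Vec n × ℝ =>
        F p.1 (clampT δ p.2) (jetOf univ r u₀ p.1 + reJet r fun I => d I p.1 (clampT δ p.2)) :=
      h.tame.tame.continuous_comp hα0 hβ continuous_fst ((continuous_clampT δ).comp continuous_snd)
        (((continuous_jetOf hcd).comp continuous_fst).add (continuous_reJet hdc))
        (fun p => ⟨(hcl _).1, (hcl _).2.trans hδT⟩) fun p => hj0 _ _ (hcl _)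
    refine c1.continuousOn.congr fun p hp => ?_
    simp only [htd' p.1 p.2 hp.2, clampT_of_mem hp.2]
  · refine bddAbove_holQuot (K := H + C * K) (by positivity) fun x y t ht s hs' => ?_
    rw [hsp r le_rfl I x t ht, hsp r le_rfl I y s hs', add_sub_add_comm, ← map_sub]
    have h1 := hHb I x y
    have h2 := hb.hol I t ht x y
    have h3 := hb.time (List.ofFn I) (by simp) t ht s hs' y
    have h4 := norm_reV_apply_le (d (List.ofFn I) x t - d (List.ofFn I) y s)
    have h5 := norm_sub_le_norm_sub_add_norm_sub (d (List.ofFn I) x t) (d (List.ofFn I) y t)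
      (d (List.ofFn I) y s)
    have h6 : 0 ≤ H * |t - s| ^ (α / r) := by positivity
    refine (norm_add_le _ _).trans ?_
    linarith
  · have hHz := fun t (ht : t ∈ Icc 0 δ) =>
      hb.holV_reJet hα0.le hα1.le hC hK hδ.le hδ1 ht (hs.jets t ht)
    refine bddAbove_holQuot (K := L * (1 + (Hj + ((n + 2) * (C * K) + C * K)))) (by positivity)
      fun x y t ht s hs' => ?_
    rw [htd' x t ht, htd' y s hs']
    refine (h.tame.tame.lip x y t ⟨ht.1, ht.2.trans hδT⟩ s ⟨hs'.1, hs'.2.trans hδT⟩ _ _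
      (hj0 x t ht) (hj0 y s hs')).trans ?_
    rw [mul_assoc]
    refine mul_le_mul_of_nonneg_left ?_ hL
    have h1 := h.hol x y
    have h2 := (hHz t ht).hol x y
    have h3 : ‖(reJet r fun I => d I y t) - reJet r fun I => d I y s‖ ≤
        C * K * |t - s| ^ (α / r) := by
      rw [← reJet_sub]
      exact norm_reJet_le (by positivity) fun I hI => hb.time I hI t ht s hs' y
    have h5 := norm_sub_le_norm_sub_add_norm_sub (reJet r fun I => d I x t)
      (reJet r fun I => d I y t) (reJet r fun I => d I y s)
    rw [add_sub_add_comm]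
    have h6 := norm_add_le (jetOf univ r u₀ x - jetOf univ r u₀ y)
      ((reJet r fun I => d I x t) - reJet r fun I => d I y s)
    have h7 : 0 ≤ (Hj + (n + 2) * (C * K)) * |t - s| ^ (α / r) := by positivity
    have h8 : 0 ≤ C * K * ‖x - y‖ ^ α := by positivity
    linarith
  · rw [hut t ht, (hju t ht).jetOf_eq, jetL_add, jetOf_eq_jetL, jetL_reV]

end ShortTimeExistence

end ParabolicSystems

/-- **Short-time existence and uniqueness for fully nonlinear parabolic systems in
parabolic Hölder spaces on the torus** (Theorem 1.2 for `M = 𝕋^n` with the trivial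
bundle): for `u₀ ∈ C^{r+α}` periodic, `F` of class `C²` on
`B = {(x,t,z) : t ∈ [0,T], |z − j_r u₀(x)| ≤ R₀}`, periodic in `x`, with the equation
strongly parabolic at `u₀`, there exists `δ ∈ (0,T]` such that
`∂u/∂t = F(x,t,j_r u)`, `u(⋅,0) = u₀` has one and only one periodic solution
`u ∈ C^{r+α,1+α/r}(ℝ^n × [0,δ], ℝ^l)` with jet staying in `B`. -/
theorem fully_nonlinear_short_time_existence_holder_torus
    (n l r : ℕ) (hn : 1 ≤ n) (hl : 1 ≤ l) (hr : 2 ≤ r) (hrev : Even r)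
    (α : ℝ) (hα0 : 0 < α) (hα1 : α < 1)
    (T : ℝ) (hT : 0 < T) (R₀ : ℝ) (hR₀ : 0 < R₀)
    (u₀ : Vec n → Vec l) (hu₀ : MemSp r α Set.univ u₀) (hu₀per : PerZ u₀)
    (F : Vec n → ℝ → Jet n l r → Vec l)
    (hF : ContDiffOn ℝ 2 (fun q : Vec n × ℝ × Jet n l r => F q.1 q.2.1 q.2.2)
      {q : Vec n × ℝ × Jet n l r |
        q.2.1 ∈ Set.Icc (0 : ℝ) T ∧ ‖q.2.2 - jetOf Set.univ r u₀ q.1‖ ≤ R₀})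
    (hFper : ∀ (x : Vec n) (m : Fin n → ℤ) (t : ℝ) (z : Jet n l r),
      F (x + (EuclideanSpace.equiv (Fin n) ℝ).symm fun i => (m i : ℝ)) t z = F x t z)
    (lam : ℝ) (hlam : 0 < lam)
    (hpar : ∀ x : Vec n, ∀ ξ : Vec n, ∀ v : Vec l,
      lam * ‖ξ‖ ^ r * ‖v‖ ^ 2 ≤
        (-1 : ℝ) ^ (r / 2 - 1) *
          ∑ I : Fin r → Fin n, ∑ a : Fin l, ∑ b : Fin l,
            (fderivWithin ℝ (fun z => F x 0 z a)
                (Metric.closedBall (jetOf Set.univ r u₀ x) R₀)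
                (jetOf Set.univ r u₀ x) (jetBasisG r r I b))
              * (∏ j, ξ (I j)) * v a * v b) :
    ∃ δ : ℝ, 0 < δ ∧ δ ≤ T ∧
      ∃ u : Vec n → ℝ → Vec l,
        (MemPar r α Set.univ (Set.Icc 0 δ) u ∧ PerZ u ∧
          (∀ x : Vec n, ∀ t ∈ Set.Icc (0 : ℝ) δ,
            ‖jetOf Set.univ r (fun y => u y t) x - jetOf Set.univ r u₀ x‖ ≤ R₀) ∧
          (∀ x : Vec n, ∀ t ∈ Set.Icc (0 : ℝ) δ,
            tDerivW (Set.Icc 0 δ) u x t = F x t (jetOf Set.univ r (fun y => u y t) x)) ∧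
          (∀ x : Vec n, u x 0 = u₀ x)) ∧
        ∀ u' : Vec n → ℝ → Vec l,
          (MemPar r α Set.univ (Set.Icc 0 δ) u' ∧ PerZ u' ∧
            (∀ x : Vec n, ∀ t ∈ Set.Icc (0 : ℝ) δ,
              ‖jetOf Set.univ r (fun y => u' y t) x - jetOf Set.univ r u₀ x‖ ≤ R₀) ∧
            (∀ x : Vec n, ∀ t ∈ Set.Icc (0 : ℝ) δ,
              tDerivW (Set.Icc 0 δ) u' x t
                = F x t (jetOf Set.univ r (fun y => u' y t) x)) ∧
            (∀ x : Vec n, u' x 0 = u₀ x)) →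
          ∀ x : Vec n, ∀ t ∈ Set.Icc (0 : ℝ) δ, u' x t = u x t := by
  have hα0' : 0 < (2 * Real.pi) ^ r * lam := by positivity
  have hρ : R₀ / 2 < R₀ := by linarith
  obtain ⟨L, Hj, h⟩ := hu₀.exists_parabolicData hr hα0 hα1 hT (by linarith) hρ hu₀per hF hFper hpar
  have hL := h.tame.nonneg
  have hHj := h.hol_nonneg
  obtain ⟨δ₀, C, hδ₀, hδ₀1, hC, hlin⟩ := exists_apriori_solvable (EuclideanSpace ℂ (Fin l)) hn hr
    hrev ((2 * Real.pi) ^ r * lam) (l * L) α (l * (L * (1 + Hj))) hα0' (by positivity) hα0 hα1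
    (by positivity)
  obtain ⟨hap, hso⟩ := hlin _ (h.holCoef hr hrev hα0 hT.le (by linarith))
  set B := L * (n + 3) * C with hB
  have hB0 : 0 ≤ B := by positivity
  obtain ⟨ε, hε, hε1, hε2⟩ : ∃ ε : ℝ, 0 < ε ∧ 2 * ε ≤ R₀ / 2 ∧ B * (2 * ε) ≤ 1 / 8 := by
    refine ⟨min (R₀ / 4) (1 / (16 * (B + 1))), by positivity, ?_, ?_⟩
    · linarith [min_le_left (R₀ / 4) (1 / (16 * (B + 1)))]
    · have h1 := min_le_right (R₀ / 4) (1 / (16 * (B + 1)))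
      have h2 : (B + 1) * (1 / (16 * (B + 1))) = 1 / 16 := by field_simp
      have h3 : 0 < 1 / (16 * (B + 1)) := by positivity
      have h4 := mul_le_mul_of_nonneg_left h1 hB0
      linarith
  obtain ⟨K, δ₁, hK, hδ₁, hsol⟩ := h.exists_sol hr hα0 hα1 hT hC hδ₀ hδ₀1 hap hso hε
    (by linarith)
  have hβ : 0 < α / r := by positivity
  obtain ⟨δ₂, hδ₂, hδ₂'⟩ := exists_rpow_le hβ B (c := 1 / 8) (by norm_num)
  set δ := min δ₁ δ₂ with hδd
  have hδ : 0 < δ := by positivity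
  obtain ⟨hδT, hδδ₀, R, d, wt, f, hs, hb, hper, hsm, heq⟩ := hsol δ hδ (min_le_left _ _)
  obtain ⟨H, hH, hHb⟩ := hu₀.exists_holder
  set u : Vec n → ℝ → Vec l := fun x t => u₀ x + reV l (d [] x (clampT δ t)) with hu
  obtain ⟨hmem, hjet, htime⟩ := memPar_of_linSol hr hα0 hα1 hC hK hδ hδT (hδδ₀.trans hδ₀1)
    (contDiffOn_univ.1 hu₀.1) hH hHb h hs hb (fun x t ht => (hsm x t ht).trans (by linarith)) heq
    (u := u) fun _ _ => rfl
  have hup : PerZ u := by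
    intro x m
    funext t
    have e1 : u₀ (x + zvec m) = u₀ x := hu₀per x m
    have e2 := hper [] (by simp) x m _ (clampT_mem hδ.le t)
    change u₀ (x + zvec m) + reV l (d [] (x + zvec m) (clampT δ t)) = _
    rw [e1, e2]
  have hut : ∀ x, ∀ t ∈ Set.Icc (0 : ℝ) δ,
      tDerivW (Set.Icc 0 δ) u x t = F x t (jetOf Set.univ r (fun y => u y t) x) := fun x t ht => by
    rw [htime x t ht, hjet x t ht]
  have h0 : (0 : ℝ) ∈ Set.Icc 0 δ := ⟨le_rfl, hδ.le⟩
  have hu0 : ∀ x, u x 0 = u₀ x := fun x => by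
    simp only [hu]
    rw [clampT_of_mem h0, hs.zero, map_zero, add_zero]
  have hclose : ∀ x, ∀ t ∈ Set.Icc (0 : ℝ) δ,
      ‖jetOf Set.univ r (fun y => u y t) x - jetOf Set.univ r u₀ x‖ ≤ ε := fun x t ht => by
    rw [hjet x t ht, add_sub_cancel_left]
    exact hsm x t ht
  refine ⟨δ, hδ, hδT, u, ⟨hmem, hup, fun x t ht => (hclose x t ht).trans (by linarith), hut, hu0⟩,
    fun u' ⟨hmem', hup', _, hut', hu0'⟩ x t ht => ?_⟩
  obtain ⟨C₁, hC₁⟩ := hmem.exists_rSol hr hα0 hα1 hup hut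
  obtain ⟨C₂, hC₂⟩ := hmem'.exists_rSol hr hα0 hα1 hup' hut'
  set M := max (max C₁ C₂) Hj with hM
  have hM1 : C₁ ≤ M := (le_max_left _ _).trans (le_max_left _ _)
  have hM2 : C₂ ≤ M := (le_max_right _ _).trans (le_max_left _ _)
  have hsmall : L * (δ ^ (α / r) + 2 * ε) * (n + 3) * C ≤ 1 / 4 := by
    have h1 := hδ₂' δ hδ.le (min_le_right _ _)
    have h2 : L * (δ ^ (α / r) + 2 * ε) * (n + 3) * C = B * δ ^ (α / r) + B * (2 * ε) := by
      rw [hB]; ring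
    linarith
  have key := h.unique hr hα0 hα1 hT hC hδ₀ hδ₀1 hap (hC₁ M M hM1 hM1) (hC₂ M M hM2 hM2) hδT hε
    hε1 hsmall (fun x t ht => by rw [← jetOf_eq_jetL]; exact hclose x t ht) (le_max_right _ _)
    (fun x => by simp only [pdL_nil, hu0, hu0']) x ht
  simpa only [pdL_nil] using key.symm
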